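/- There exists a constant η > 0 such that for all sufficiently large integers q the following holds. Suppose some Dirichlet L-function modulo q has an η-Siegel zero ρ₁ = 1 − λ₁/log q (with 0 < λ₁ ≤ η). Let x be real with q^{6.18} ≤ x and log x ≤ q^{1/3000}, and set T = q(log x)³/λ₁. Then ∑_{χ mod q} ∑_ρ |x^ρ/ρ| ≤ 3λ₁·x, where the inner sum runs over all zeros ρ of L(s,χ) with 0 < Re ρ < 1 and |Im ρ| < T, excluding the zero ρ₁ itself (for the character possessing it), counted with multiplicity. -/

import Mathlib

open scoped Classical

/-- The multiplicity of `z` as a zero of `f` (the analytic order, truncated to `ℕ`). -/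
noncomputable def zeroMult (f : ℂ → ℂ) (z : ℂ) : ℕ :=
  if h : AnalyticAt ℂ f z then (analyticOrderAt f z).toNat else 0

namespace SiegelSum

section
open Complex Filter MeasureTheory Asymptotics Topology

section PartialSums

variable {c : ℕ → ℂ} {κ : ℂ} {B θ : ℝ}

/-- The tail integral `∫_N^∞ (C(u) - κ u) u^{-s-1} du`, with `C` the summatory function of `c`. -/
noncomputable def tailIntegral (c : ℕ → ℂ) (κ : ℂ) (N : ℝ) (s : ℂ) : ℂ :=
  ∫ u in Set.Ioi N, (∑ n ∈ Finset.Icc 1 ⌊u⌋₊, c n - κ * u) * (u : ℂ) ^ (-s - 1)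

lemma locallyIntegrableOn_tail (c : ℕ → ℂ) (κ : ℂ) :
    LocallyIntegrableOn (fun u : ℝ => ∑ n ∈ Finset.Icc 1 ⌊u⌋₊, c n - κ * u) (Set.Ici 0) := by
  have h1 : LocallyIntegrableOn (fun u : ℝ => ∑ n ∈ Finset.Icc 1 ⌊u⌋₊, c n) (Set.Ici 0) := by
    have := locallyIntegrableOn_mul_sum_Icc c (m := 1) (le_refl (0 : ℝ)) (g := fun _ => (1 : ℂ))
      (by exact (continuous_const.locallyIntegrable).locallyIntegrableOn _)
    simpa using this
  exact h1.sub (by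
    exact (Continuous.locallyIntegrable (by fun_prop)).locallyIntegrableOn _)

lemma tail_isBigO_top (hD : ∀ u : ℝ, 1 ≤ u → ‖∑ n ∈ Finset.Icc 1 ⌊u⌋₊, c n - κ * u‖ ≤ B * u ^ θ)
    {N : ℝ} :
    (Set.indicator (Set.Ioi N) fun u : ℝ => ∑ n ∈ Finset.Icc 1 ⌊u⌋₊, c n - κ * u)
      =O[atTop] fun u : ℝ => u ^ (-(-θ)) := by
  refine IsBigO.of_bound B ?_
  filter_upwards [eventually_ge_atTop 1] with u hu
  have h0 : (0:ℝ) ≤ u ^ θ := by positivity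
  have h1 := hD u hu
  rw [neg_neg, Real.norm_of_nonneg h0]
  exact (norm_indicator_le_norm_self _ _).trans h1

lemma tail_isBigO_zero {N b : ℝ} (hN : 1 ≤ N) :
    (Set.indicator (Set.Ioi N) fun u : ℝ => ∑ n ∈ Finset.Icc 1 ⌊u⌋₊, c n - κ * u)
      =O[𝓝[>] 0] fun u : ℝ => u ^ (-b) := by
  refine IsBigO.of_bound 0 ?_
  have : Set.Iio N ∈ 𝓝[>] (0:ℝ) := mem_nhdsWithin_of_mem_nhds (Iio_mem_nhds (by linarith))
  filter_upwards [this] with u hu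
  rw [Set.indicator_of_notMem (by simpa using le_of_lt hu)]
  simp

lemma tailIntegral_eq_mellin {N : ℝ} (hN : 1 ≤ N) (s : ℂ) :
    tailIntegral c κ N s = mellin (Set.indicator (Set.Ioi N)
      fun u : ℝ => ∑ n ∈ Finset.Icc 1 ⌊u⌋₊, c n - κ * u) (-s) := by
  rw [tailIntegral, mellin]
  have : ∀ u : ℝ, (u : ℂ) ^ (-s - 1) • (Set.indicator (Set.Ioi N)
      fun u : ℝ => ∑ n ∈ Finset.Icc 1 ⌊u⌋₊, c n - κ * u) u = (Set.indicator (Set.Ioi N)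
      fun u : ℝ => (∑ n ∈ Finset.Icc 1 ⌊u⌋₊, c n - κ * u) * (u : ℂ) ^ (-s - 1)) u := by
    intro u
    by_cases hu : u ∈ Set.Ioi N
    · simp only [Set.indicator_of_mem hu, smul_eq_mul]; ring
    · simp only [Set.indicator_of_notMem hu, smul_zero]
  simp_rw [this]
  rw [setIntegral_indicator measurableSet_Ioi]
  congr 2
  ext u
  simp only [Set.mem_Ioi, Set.mem_inter_iff]
  constructor
  · intro h; exact ⟨by linarith, h⟩
  · exact fun h => h.2

lemma tail_locallyIntegrable {N : ℝ} :
    LocallyIntegrableOn (Set.indicator (Set.Ioi N)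
      fun u : ℝ => ∑ n ∈ Finset.Icc 1 ⌊u⌋₊, c n - κ * u) (Set.Ioi 0) := by
  have h := (locallyIntegrableOn_tail c κ).mono_set (Set.Ioi_subset_Ici_self)
  rw [locallyIntegrableOn_iff (isOpen_Ioi.isLocallyClosed)] at h ⊢
  intro k hk hkc
  exact (h k hk hkc).indicator measurableSet_Ioi

lemma tailIntegral_differentiableAt
    (hD : ∀ u : ℝ, 1 ≤ u → ‖∑ n ∈ Finset.Icc 1 ⌊u⌋₊, c n - κ * u‖ ≤ B * u ^ θ)
    {N : ℝ} (hN : 1 ≤ N) {s : ℂ} (hs : θ < s.re) :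
    DifferentiableAt ℂ (tailIntegral c κ N) s := by
  have h : DifferentiableAt ℂ (mellin (Set.indicator (Set.Ioi N)
      fun u : ℝ => ∑ n ∈ Finset.Icc 1 ⌊u⌋₊, c n - κ * u)) (-s) :=
    mellin_differentiableAt_of_isBigO_rpow (a := -θ) (b := -s.re - 1) tail_locallyIntegrable
      (tail_isBigO_top hD) (by simpa using hs) (tail_isBigO_zero hN) (by simp)
  have : tailIntegral c κ N = fun s => mellin (Set.indicator (Set.Ioi N)
      fun u : ℝ => ∑ n ∈ Finset.Icc 1 ⌊u⌋₊, c n - κ * u) (-s) := by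
    ext s; exact tailIntegral_eq_mellin hN s
  rw [this]
  exact DifferentiableAt.fun_comp' s h (by fun_prop)

lemma tailIntegrand_integrableOn
    (hD : ∀ u : ℝ, 1 ≤ u → ‖∑ n ∈ Finset.Icc 1 ⌊u⌋₊, c n - κ * u‖ ≤ B * u ^ θ)
    {N : ℝ} (hN : 1 ≤ N) {s : ℂ} (hs : θ < s.re) :
    IntegrableOn (fun u : ℝ => (∑ n ∈ Finset.Icc 1 ⌊u⌋₊, c n - κ * u) * (u : ℂ) ^ (-s - 1))
      (Set.Ioi N) := by
  have h : MellinConvergent (Set.indicator (Set.Ioi N)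
      fun u : ℝ => ∑ n ∈ Finset.Icc 1 ⌊u⌋₊, c n - κ * u) (-s) :=
    mellinConvergent_of_isBigO_rpow (a := -θ) (b := -s.re - 1) tail_locallyIntegrable
      (tail_isBigO_top hD) (by simpa using hs) (tail_isBigO_zero hN) (by simp)
  have h2 := h.mono_set (Set.Ioi_subset_Ioi (show (0:ℝ) ≤ N by linarith))
  refine h2.congr_fun (fun u hu => ?_) measurableSet_Ioi
  simp only [Set.indicator_of_mem hu, smul_eq_mul]; ring

lemma norm_tailIntegral_le
    (hD : ∀ u : ℝ, 1 ≤ u → ‖∑ n ∈ Finset.Icc 1 ⌊u⌋₊, c n - κ * u‖ ≤ B * u ^ θ)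
    {N : ℝ} (hN : 1 ≤ N) {s : ℂ} (hs : θ < s.re) :
    ‖tailIntegral c κ N s‖ ≤ B * N ^ (θ - s.re) / (s.re - θ) := by
  have hN0 : 0 < N := by linarith
  have h1 : ‖tailIntegral c κ N s‖ ≤ ∫ u in Set.Ioi N, B * u ^ (θ - s.re - 1) := by
    refine norm_integral_le_of_norm_le ?_ ?_
    · exact (integrableOn_Ioi_rpow_of_lt (by linarith) hN0).const_mul B
    · refine (ae_restrict_iff' measurableSet_Ioi).2 (Eventually.of_forall fun u hu => ?_)
      have hu0 : 0 < u := hN0.trans hu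
      rw [norm_mul, norm_cpow_eq_rpow_re_of_pos hu0]
      have : (-s - 1).re = -s.re - 1 := by simp
      rw [this, show θ - s.re - 1 = θ + (-s.re - 1) by ring, Real.rpow_add hu0, ← mul_assoc]
      exact mul_le_mul_of_nonneg_right (hD u (hN.trans (le_of_lt hu))) (by positivity)
  rw [integral_const_mul, integral_Ioi_rpow_of_lt (by linarith) hN0] at h1
  refine h1.trans_eq ?_
  have : θ - s.re ≠ 0 := by linarith
  have h3 : s.re - θ ≠ 0 := by linarith
  rw [show θ - s.re - 1 + 1 = θ - s.re by ring]
  field_simp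
  ring

lemma sum_eq_integral (c : ℕ → ℂ) {N : ℝ} (hN : 1 ≤ N) (s : ℂ) (hs : s ≠ 0) :
    ∑ n ∈ Finset.Icc 1 ⌊N⌋₊, c n * (n : ℂ) ^ (-s) = (∑ n ∈ Finset.Icc 1 ⌊N⌋₊, c n) * (N : ℂ) ^ (-s)
      + s * ∫ u in Set.Ioc 1 N, (∑ n ∈ Finset.Icc 1 ⌊u⌋₊, c n) * (u : ℂ) ^ (-s - 1) := by
  set c' : ℕ → ℂ := fun n => if n = 0 then 0 else c n with hc'
  have hsum : ∀ m : ℕ, ∑ n ∈ Finset.Icc 0 m, c' n = ∑ n ∈ Finset.Icc 1 m, c n := by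
    intro m
    rw [Finset.Icc_eq_cons_Ioc (Nat.zero_le _), Finset.sum_cons]
    simp only [hc', if_true, zero_add]
    refine Finset.sum_congr (by ext; simp [Nat.lt_iff_add_one_le]) fun n hn => ?_
    rw [if_neg (by have := (Finset.mem_Icc.1 hn).1; omega)]
  have hd : ∀ t : ℝ, 0 < t → HasDerivAt (fun u : ℝ => (u : ℂ) ^ (-s)) (-s * (t : ℂ) ^ (-s - 1)) t :=
    fun t ht => hasDerivAt_ofReal_cpow_const ht.ne' (neg_ne_zero.2 hs)
  have hint : IntegrableOn (deriv fun u : ℝ => (u : ℂ) ^ (-s)) (Set.Icc 1 N) := by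
    refine ContinuousOn.integrableOn_Icc ?_
    have : ContinuousOn (fun t : ℝ => -s * (t : ℂ) ^ (-s - 1)) (Set.Icc 1 N) := by
      refine continuousOn_const.mul ?_
      refine ContinuousOn.cpow_const (by fun_prop) fun t ht => ?_
      left; simpa using lt_of_lt_of_le one_pos ht.1
    exact this.congr fun t ht => (hd t (lt_of_lt_of_le one_pos ht.1)).deriv
  have h := sum_mul_eq_sub_integral_mul₀ (f := fun u : ℝ => (u : ℂ) ^ (-s)) c' (by simp [hc']) N
    (fun t ht => (hd t (lt_of_lt_of_le one_pos ht.1)).differentiableAt) hint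
  have hl : ∑ k ∈ Finset.Icc 0 ⌊N⌋₊, ((k : ℝ) : ℂ) ^ (-s) * c' k =
      ∑ n ∈ Finset.Icc 1 ⌊N⌋₊, c n * (n : ℂ) ^ (-s) := by
    rw [Finset.Icc_eq_cons_Ioc (Nat.zero_le _), Finset.sum_cons]
    simp only [hc', if_true, mul_zero, zero_add]
    refine Finset.sum_congr (by ext; simp [Nat.lt_iff_add_one_le]) fun n hn => ?_
    rw [if_neg (by have := (Finset.mem_Icc.1 hn).1; omega)]
    push_cast; ring
  rw [hl] at h
  rw [h, hsum, ← integral_const_mul, sub_eq_add_neg, ← integral_neg, mul_comm]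
  congr 1
  refine setIntegral_congr_fun measurableSet_Ioc fun t ht => ?_
  rw [(hd t (lt_trans one_pos ht.1)).deriv, hsum]
  ring

lemma LSeries_eq_partialSum_add
    (hD : ∀ u : ℝ, 1 ≤ u → ‖∑ n ∈ Finset.Icc 1 ⌊u⌋₊, c n - κ * u‖ ≤ B * u ^ θ)
    (hθ : θ < 1) (hc : ∀ s : ℂ, 1 < s.re → LSeriesSummable c s)
    {N : ℝ} (hN : 1 ≤ N) {s : ℂ} (hs : 1 < s.re) :
    (s - 1) * LSeries c s = (s - 1) * (∑ n ∈ Finset.Icc 1 ⌊N⌋₊, c n * (n : ℂ) ^ (-s)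
      - (∑ n ∈ Finset.Icc 1 ⌊N⌋₊, c n - κ * N) * (N : ℂ) ^ (-s) + s * tailIntegral c κ N s)
      + κ * (N : ℂ) ^ (1 - s) := by
  have hs0 : s ≠ 0 := fun h => by simp [h] at hs; linarith
  have hs1 : s - 1 ≠ 0 := fun h => by rw [sub_eq_zero] at h; simp [h] at hs
  have hN0 : 0 < N := by linarith
  have hO : (fun n : ℕ => ∑ k ∈ Finset.Icc 1 n, c k) =O[atTop] fun n : ℕ => (n : ℝ) ^ (1 : ℝ) := by
    refine IsBigO.of_bound (|B| + ‖κ‖) ?_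
    filter_upwards [eventually_ge_atTop 1] with n hn
    have hn' : (1 : ℝ) ≤ n := by exact_mod_cast hn
    have h1 := hD n hn'
    rw [Nat.floor_natCast] at h1
    have h2 : (n : ℝ) ^ θ ≤ n := by
      simpa using Real.rpow_le_rpow_of_exponent_le hn' hθ.le
    have h3 : ‖∑ k ∈ Finset.Icc 1 n, c k‖ ≤ B * (n : ℝ) ^ θ + ‖κ‖ * n := by
      have h4 : ‖∑ k ∈ Finset.Icc 1 n, c k‖ ≤
          ‖∑ k ∈ Finset.Icc 1 n, c k - κ * ((n : ℝ) : ℂ)‖ + ‖κ * ((n : ℝ) : ℂ)‖ := by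
        simpa using norm_add_le (∑ k ∈ Finset.Icc 1 n, c k - κ * ((n : ℝ) : ℂ)) (κ * ((n : ℝ) : ℂ))
      have h5 : ‖κ * ((n : ℝ) : ℂ)‖ = ‖κ‖ * n := by simp
      linarith
    have h4 : B * (n : ℝ) ^ θ ≤ |B| * n :=
      mul_le_mul (le_abs_self B) h2 (by positivity) (abs_nonneg B)
    rw [Real.rpow_one, Real.norm_of_nonneg (by positivity)]
    linarith
  have hL := LSeries_eq_mul_integral c zero_le_one hs (hc s hs) hO
  have hI : IntegrableOn (fun u : ℝ => (∑ n ∈ Finset.Icc 1 ⌊u⌋₊, c n - κ * u) * (u : ℂ) ^ (-s - 1))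
      (Set.Ioi N) := tailIntegrand_integrableOn hD hN (hθ.trans hs)
  have hJ : IntegrableOn (fun u : ℝ => (u : ℂ) ^ (-s)) (Set.Ioi N) :=
    integrableOn_Ioi_cpow_of_lt (by simpa using hs) hN0
  have hcongr : ∀ u ∈ Set.Ioi N, (∑ n ∈ Finset.Icc 1 ⌊u⌋₊, c n) * (u : ℂ) ^ (-s - 1) =
      (∑ n ∈ Finset.Icc 1 ⌊u⌋₊, c n - κ * u) * (u : ℂ) ^ (-s - 1) + κ * (u : ℂ) ^ (-s) := by
    intro u hu
    have hu0 : (u : ℂ) ≠ 0 := by exact_mod_cast (hN0.trans hu).ne'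
    have : (u : ℂ) ^ (-s) = u * (u : ℂ) ^ (-s - 1) := by
      rw [cpow_sub _ _ hu0, cpow_one]; field_simp
    rw [this]; ring
  have hsplit : ∫ u in Set.Ioi (1:ℝ), (∑ n ∈ Finset.Icc 1 ⌊u⌋₊, c n) * (u : ℂ) ^ (-(s + 1)) =
      (∫ u in Set.Ioc 1 N, (∑ n ∈ Finset.Icc 1 ⌊u⌋₊, c n) * (u : ℂ) ^ (-s - 1)) +
      (tailIntegral c κ N s + κ * (N ^ (1 - s) / (s - 1))) := by
    have e : ∫ u in Set.Ioi N, (∑ n ∈ Finset.Icc 1 ⌊u⌋₊, c n) * (u : ℂ) ^ (-s - 1) =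
        tailIntegral c κ N s + κ * ((N : ℂ) ^ (1 - s) / (s - 1)) := by
      rw [setIntegral_congr_fun measurableSet_Ioi hcongr, integral_add hI (hJ.const_mul κ),
        integral_const_mul, integral_Ioi_cpow_of_lt (by simpa using hs) hN0, tailIntegral]
      rw [show -s + 1 = -(s - 1) by ring, show (1:ℂ) - s = -(s - 1) by ring]
      field_simp
    rw [← e, ← setIntegral_union (Set.Ioc_disjoint_Ioi le_rfl) measurableSet_Ioi ?_ ?_,
      Set.Ioc_union_Ioi_eq_Ioi hN]
    · simp_rw [show -(s + 1) = -s - 1 by ring]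
    · have := integrableOn_mul_sum_Icc c (m := 1) zero_le_one (b := N)
        (g := fun u : ℝ => (u : ℂ) ^ (-s - 1)) (by
          refine ContinuousOn.integrableOn_Icc (ContinuousOn.cpow_const (by fun_prop) fun t ht => ?_)
          left; simpa using lt_of_lt_of_le one_pos ht.1)
      refine (this.mono_set Set.Ioc_subset_Icc_self).congr_fun (fun u _ => ?_) measurableSet_Ioc
      simp only; ring
    · exact IntegrableOn.congr_fun (hI.add (hJ.const_mul κ)) (fun u hu => (hcongr u hu).symm)
        measurableSet_Ioi
  rw [hL, hsplit, sum_eq_integral c hN s hs0]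
  have hNs : (N : ℂ) ^ (1 - s) = N * (N : ℂ) ^ (-s) := by
    have hN1 : (N : ℂ) ≠ 0 := by exact_mod_cast hN0.ne'
    rw [show (1:ℂ) - s = 1 + -s by ring, cpow_add _ _ hN1, cpow_one]
  rw [hNs]
  field_simp
  ring

/-- Partial sums of a Dirichlet series approximate its analytic continuation. -/
theorem norm_partialSum_sub_le
    (hD : ∀ u : ℝ, 1 ≤ u → ‖∑ n ∈ Finset.Icc 1 ⌊u⌋₊, c n - κ * u‖ ≤ B * u ^ θ)
    (hθ : θ < 1) (hc : ∀ s : ℂ, 1 < s.re → LSeriesSummable c s) {g : ℂ → ℂ}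
    (hg : DifferentiableOn ℂ g {s | θ < s.re}) (hgL : ∀ s : ℂ, 1 < s.re → g s = (s - 1) * LSeries c s)
    {N : ℝ} (hN : 1 ≤ N) {s : ℂ} (hs : θ < s.re) :
    ‖(s - 1) * ∑ n ∈ Finset.Icc 1 ⌊N⌋₊, c n * (n : ℂ) ^ (-s) + κ * (N : ℂ) ^ (1 - s) - g s‖ ≤
      ‖s - 1‖ * (B * N ^ (θ - s.re) * (1 + ‖s‖ / (s.re - θ))) := by
  have hN0 : 0 < N := by linarith
  have hN1 : (N : ℂ) ≠ 0 := by exact_mod_cast hN0.ne'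
  set H : ℂ → ℂ := fun s => (s - 1) * (∑ n ∈ Finset.Icc 1 ⌊N⌋₊, c n * (n : ℂ) ^ (-s)
      - (∑ n ∈ Finset.Icc 1 ⌊N⌋₊, c n - κ * N) * (N : ℂ) ^ (-s) + s * tailIntegral c κ N s)
      + κ * (N : ℂ) ^ (1 - s) with hH
  have hopen : IsOpen {s : ℂ | θ < s.re} := isOpen_lt continuous_const continuous_re
  have hHd : DifferentiableOn ℂ H {s | θ < s.re} := by
    intro z hz
    refine DifferentiableAt.differentiableWithinAt ?_
    have h1 := tailIntegral_differentiableAt hD hN hz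
    have h2 : DifferentiableAt ℂ (fun s : ℂ => ∑ n ∈ Finset.Icc 1 ⌊N⌋₊, c n * (n : ℂ) ^ (-s)) z := by
      refine DifferentiableAt.fun_sum fun n hn => ?_
      have : (n : ℂ) ≠ 0 := by
        have := (Finset.mem_Icc.1 hn).1
        exact_mod_cast (by omega : n ≠ 0)
      exact (DifferentiableAt.const_cpow (by fun_prop) (Or.inl this)).const_mul _
    have h3 : DifferentiableAt ℂ (fun s : ℂ => (N : ℂ) ^ (-s)) z :=
      DifferentiableAt.const_cpow (by fun_prop) (Or.inl hN1)
    have h4 : DifferentiableAt ℂ (fun s : ℂ => (N : ℂ) ^ (1 - s)) z :=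
      DifferentiableAt.const_cpow (by fun_prop) (Or.inl hN1)
    fun_prop
  have hpc : IsPreconnected {s : ℂ | θ < s.re} :=
    (convex_halfSpace_re_gt θ).isPreconnected
  have heq : Set.EqOn g H {s | θ < s.re} := by
    have h2 : (2 : ℂ) ∈ {s : ℂ | θ < s.re} := by simp; linarith
    refine (hg.analyticOnNhd hopen).eqOn_of_preconnected_of_eventuallyEq
      (hHd.analyticOnNhd hopen) hpc h2 ?_
    have : {s : ℂ | 1 < s.re} ∈ 𝓝 (2 : ℂ) :=
      (isOpen_lt continuous_const continuous_re).mem_nhds (by simp)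
    filter_upwards [this] with z hz
    rw [hgL z hz, LSeries_eq_partialSum_add hD hθ hc hN hz]
  rw [heq hs]
  have e : (s - 1) * ∑ n ∈ Finset.Icc 1 ⌊N⌋₊, c n * (n : ℂ) ^ (-s) + κ * (N : ℂ) ^ (1 - s) - H s =
      (s - 1) * ((∑ n ∈ Finset.Icc 1 ⌊N⌋₊, c n - κ * N) * (N : ℂ) ^ (-s)
        - s * tailIntegral c κ N s) := by
    simp only [hH]; ring
  rw [e, norm_mul]
  refine mul_le_mul_of_nonneg_left ?_ (norm_nonneg _)
  refine (norm_sub_le _ _).trans ?_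
  rw [norm_mul, norm_mul, norm_cpow_eq_rpow_re_of_pos hN0]
  have h1 : ‖∑ n ∈ Finset.Icc 1 ⌊N⌋₊, c n - κ * N‖ * N ^ (-s).re ≤ B * N ^ (θ - s.re) := by
    rw [show θ - s.re = θ + (-s).re by simp; ring, Real.rpow_add hN0, ← mul_assoc]
    exact mul_le_mul_of_nonneg_right (hD N hN) (by positivity)
  have h2 := mul_le_mul_of_nonneg_left (norm_tailIntegral_le hD hN hs) (norm_nonneg s)
  calc _ ≤ B * N ^ (θ - s.re) + ‖s‖ * (B * N ^ (θ - s.re) / (s.re - θ)) := add_le_add h1 h2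
    _ = _ := by ring

end PartialSums

end

section
open Complex ZMod

section PolyaVinogradov

variable {N : ℕ} [NeZero N]

lemma char_eq_sum_of_isPrimitive {χ : DirichletCharacter ℂ N} (hχ : χ.IsPrimitive) (j : ZMod N) :
    (N : ℂ) * χ j = gaussSum χ stdAddChar * ∑ k : ZMod N, stdAddChar (k * j) * χ⁻¹ (-k) := by
  have h := congrFun (dft_dft (E := ℂ) (fun j ↦ χ j)) (-j)
  simp only [smul_eq_mul, neg_neg] at h
  rw [← h, dft_apply, Finset.mul_sum]
  refine Finset.sum_congr rfl fun k _ ↦ ?_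
  rw [show (ZMod.dft fun j ↦ χ j) k = _ from hχ.fourierTransform_eq_inv_mul_gaussSum k, smul_eq_mul]
  rw [show -(k * -j) = k * j by ring]
  ring

lemma norm_gaussSum_sq {χ : DirichletCharacter ℂ N} (hχ : χ.IsPrimitive) :
    ‖gaussSum χ stdAddChar‖ ^ 2 = N := by
  have h := char_eq_sum_of_isPrimitive hχ 1
  have h2 : ∑ k : ZMod N, stdAddChar (k * 1) * χ⁻¹ (-k) = star (gaussSum χ stdAddChar) := by
    rw [star_gaussSum_eq, gaussSum, ← Equiv.sum_comp (Equiv.neg (ZMod N))]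
    refine Finset.sum_congr rfl fun k _ ↦ ?_
    simp [AddChar.inv_apply, mul_comm]
  rw [h2, map_one, mul_one, RCLike.star_def, Complex.mul_conj, Complex.normSq_eq_norm_sq] at h
  exact_mod_cast h.symm

lemma norm_stdAddChar_sub_one (a : ℕ) :
    ‖(stdAddChar (a : ZMod N) : ℂ) - 1‖ = 2 * |Real.sin (Real.pi * a / N)| := by
  have h := stdAddChar_coe (N := N) (a : ℤ)
  rw [Int.cast_natCast] at h
  rw [h]
  have := Complex.norm_exp_I_mul_ofReal_sub_one (2 * (Real.pi * a / N))
  rw [show (2 * (Real.pi * a / N) / 2 : ℝ) = Real.pi * a / N by ring, norm_mul] at this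
  simp only [Real.norm_eq_abs, abs_two] at this
  rw [← this]
  congr 3
  push_cast
  ring

omit [NeZero N] in
lemma two_mul_div_le_sin {a : ℕ} (h1 : 1 ≤ a) (h2 : a < N) :
    2 * (1 / ((1 / (a : ℝ)) + 1 / ((N : ℝ) - a))) / N ≤ |Real.sin (Real.pi * a / N)| := by
  have hN : (0 : ℝ) < N := by exact_mod_cast (by lia : 0 < N)
  have ha : (0 : ℝ) < a := by exact_mod_cast h1
  have hb : (0 : ℝ) < (N : ℝ) - a := by
    have : (a : ℝ) < N := by exact_mod_cast h2
    linarith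
  have hmin : 1 / ((1 / (a : ℝ)) + 1 / ((N : ℝ) - a)) ≤ min (a : ℝ) (N - a) := by
    rw [le_min_iff]
    constructor
    · rw [div_le_iff₀ (by positivity)]
      have : 0 ≤ (a : ℝ) * (1 / ((N : ℝ) - a)) := by positivity
      have h3 : (a : ℝ) * (1 / a) = 1 := by field_simp
      nlinarith
    · rw [div_le_iff₀ (by positivity)]
      have : 0 ≤ ((N : ℝ) - a) * (1 / (a : ℝ)) := by positivity
      have h3 : ((N : ℝ) - a) * (1 / ((N : ℝ) - a)) = 1 := by field_simp
      nlinarith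
  rcases le_total (a : ℝ) (N - a) with h | h
  · rw [min_eq_left h] at hmin
    have h5 := Real.mul_le_sin (x := Real.pi * a / N) (by positivity) (by
      rw [div_le_div_iff₀ hN two_pos]; nlinarith [Real.pi_pos])
    have h6 : 2 / Real.pi * (Real.pi * a / N) = 2 * a / N := by field_simp
    rw [h6] at h5
    refine le_trans ?_ (h5.trans (le_abs_self _))
    gcongr
  · rw [min_eq_right h] at hmin
    have h5 := Real.mul_le_sin (x := Real.pi * (N - a) / N) (by positivity) (by
      rw [div_le_div_iff₀ hN two_pos]; nlinarith [Real.pi_pos])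
    have h6 : 2 / Real.pi * (Real.pi * (N - a) / N) = 2 * (N - a) / N := by field_simp
    have h7 : Real.pi * (N - a) / N = Real.pi - Real.pi * a / N := by field_simp
    rw [h6, h7, Real.sin_pi_sub] at h5
    refine le_trans ?_ (h5.trans (le_abs_self _))
    gcongr

lemma norm_geom_le {a : ℕ} (h1 : 1 ≤ a) (h2 : a < N) (M : ℕ) :
    ‖∑ n ∈ Finset.Icc 1 M, (stdAddChar ((a : ZMod N) * (n : ZMod N)) : ℂ)‖ ≤
      N / 2 * (1 / (a : ℝ) + 1 / ((N : ℝ) - a)) := by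
  have hN : (0 : ℝ) < N := by exact_mod_cast (by lia : 0 < N)
  have ha : (0 : ℝ) < a := by exact_mod_cast h1
  have hb : (0 : ℝ) < (N : ℝ) - a := by
    have : (a : ℝ) < N := by exact_mod_cast h2
    linarith
  have hs := two_mul_div_le_sin h1 h2
  have hpos : 0 < 2 * (1 / ((1 / (a : ℝ)) + 1 / ((N : ℝ) - a))) / N := by positivity
  have hz := norm_stdAddChar_sub_one (N := N) a
  set z : ℂ := stdAddChar (a : ZMod N) with hzdef
  have hz1 : z ≠ 1 := by
    intro h
    rw [h] at hz
    simp only [sub_self, norm_zero] at hz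
    linarith
  have hsum : ∑ n ∈ Finset.Icc 1 M, (stdAddChar ((a : ZMod N) * (n : ZMod N)) : ℂ)
      = ∑ n ∈ Finset.Icc 1 M, z ^ n := by
    refine Finset.sum_congr rfl fun n _ ↦ ?_
    rw [hzdef, ← AddChar.map_nsmul_eq_pow, nsmul_eq_mul, mul_comm]
  have hzn : ‖z‖ = 1 := by rw [hzdef]; exact AddChar.norm_apply _ _
  have hg : ∑ n ∈ Finset.Icc 1 M, z ^ n = (z ^ (M + 1) - z) / (z - 1) := by
    have : Finset.Icc 1 M = Finset.Ico 1 (M + 1) := by ext; simp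
    rw [this, geom_sum_Ico hz1 (by lia)]
    simp
  rw [hsum, hg, norm_div, hz]
  have h2' : ‖z ^ (M + 1) - z‖ ≤ 2 := by
    refine (norm_sub_le _ _).trans ?_
    rw [norm_pow, hzn]; norm_num
  calc ‖z ^ (M + 1) - z‖ / (2 * |Real.sin (Real.pi * a / N)|)
      ≤ 2 / (2 * (2 * (1 / ((1 / (a : ℝ)) + 1 / ((N : ℝ) - a))) / N)) := by gcongr
    _ = _ := by field_simp

/-- **Pólya–Vinogradov** for primitive characters. -/
lemma norm_sum_char_le_of_isPrimitive {χ : DirichletCharacter ℂ N} (hχ : χ.IsPrimitive)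
    (hN : 1 < N) (M : ℕ) :
    ‖∑ n ∈ Finset.Icc 1 M, χ (n : ZMod N)‖ ≤ √N * (1 + Real.log N) := by
  have hN0 : (0 : ℝ) < N := by exact_mod_cast (by lia : 0 < N)
  have hτ : ‖gaussSum χ stdAddChar‖ = √N := by
    rw [← norm_gaussSum_sq hχ, Real.sqrt_sq (norm_nonneg _)]
  have key : (N : ℂ) * ∑ n ∈ Finset.Icc 1 M, χ (n : ZMod N) = gaussSum χ stdAddChar *
      ∑ k : ZMod N, χ⁻¹ (-k) * ∑ n ∈ Finset.Icc 1 M, (stdAddChar (k * (n : ZMod N)) : ℂ) := by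
    simp_rw [Finset.mul_sum]
    rw [Finset.sum_comm]
    refine Finset.sum_congr rfl fun n _ ↦ ?_
    rw [char_eq_sum_of_isPrimitive hχ, Finset.mul_sum]
    refine Finset.sum_congr rfl fun k _ ↦ by ring
  have hbij : ∀ F : ZMod N → ℝ, ∑ k : ZMod N, F k = ∑ a ∈ Finset.range N, F (a : ZMod N) := by
    intro F
    obtain ⟨m, rfl⟩ : ∃ m, N = m + 1 := ⟨N - 1, by lia⟩
    rw [Finset.sum_range]
    refine Finset.sum_congr rfl fun k _ ↦ ?_
    congr 1
    exact (ZMod.natCast_zmod_val (n := m + 1) k).symm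
  have hbd : ∑ k : ZMod N, ‖χ⁻¹ (-k) * ∑ n ∈ Finset.Icc 1 M, (stdAddChar (k * (n : ZMod N)) : ℂ)‖ ≤
      N * (1 + Real.log N) := by
    rw [hbij, ← Finset.sum_sdiff (s₁ := {0}) (by simp; lia)]
    have : Nontrivial (ZMod N) := ZMod.nontrivial_iff.2 (by lia)
    simp only [Finset.sum_singleton, Nat.cast_zero, neg_zero]
    rw [MulChar.map_zero, zero_mul, norm_zero, add_zero]
    have hset : Finset.range N \ {0} = Finset.Icc 1 (N - 1) := by ext; simp; lia
    rw [hset]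
    calc _ ≤ ∑ a ∈ Finset.Icc 1 (N - 1), (N : ℝ) / 2 * (1 / (a : ℝ) + 1 / ((N : ℝ) - a)) := by
          refine Finset.sum_le_sum fun a ha ↦ ?_
          rw [Finset.mem_Icc] at ha
          rw [norm_mul]
          refine (mul_le_of_le_one_left (norm_nonneg _) (DirichletCharacter.norm_le_one _ _)).trans ?_
          exact norm_geom_le ha.1 (by lia) M
      _ = N * ∑ a ∈ Finset.Icc 1 (N - 1), 1 / (a : ℝ) := by
          rw [← Finset.mul_sum, Finset.sum_add_distrib]
          have : ∑ a ∈ Finset.Icc 1 (N - 1), 1 / ((N : ℝ) - a) =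
              ∑ a ∈ Finset.Icc 1 (N - 1), 1 / (a : ℝ) := by
            refine Finset.sum_nbij' (fun a ↦ N - a) (fun a ↦ N - a) ?_ ?_ ?_ ?_ ?_
            · intro a ha; simp at ha ⊢; lia
            · intro a ha; simp at ha ⊢; lia
            · intro a ha; simp at ha ⊢; lia
            · intro a ha; simp at ha ⊢; lia
            · intro a ha
              rw [Finset.mem_Icc] at ha
              rw [Nat.cast_sub (by lia)]
          rw [this]; ring
      _ ≤ N * (1 + Real.log N) := by
          gcongr
          have h := harmonic_le_one_add_log (N - 1)
          rw [harmonic_eq_sum_Icc] at h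
          push_cast at h
          simp_rw [one_div]
          refine h.trans ?_
          have : Real.log ((N - 1 : ℕ) : ℝ) ≤ Real.log N := by
            apply Real.log_le_log
            · exact_mod_cast (by lia : 0 < N - 1)
            · exact_mod_cast (by lia : N - 1 ≤ N)
          linarith
  have h1 : (N : ℝ) * ‖∑ n ∈ Finset.Icc 1 M, χ (n : ZMod N)‖ ≤ √N * (N * (1 + Real.log N)) := by
    have := congrArg norm key
    rw [norm_mul, norm_mul, hτ, Complex.norm_natCast] at this
    rw [this]
    gcongr
    exact (norm_sum_le _ _).trans hbd
  have : (N : ℝ) * ‖∑ n ∈ Finset.Icc 1 M, χ (n : ZMod N)‖ ≤ N * (√N * (1 + Real.log N)) := by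
    linarith
  exact le_of_mul_le_mul_left this hN0

/-- The number of divisors is at most `2√n`. -/
lemma card_divisors_le_two_mul_sqrt (n : ℕ) : (n.divisors.card : ℝ) ≤ 2 * √n := by
  rcases Nat.eq_zero_or_pos n with rfl | hn
  · simp
  have h : n.divisors ⊆ (Finset.Icc 1 n.sqrt) ∪ (Finset.Icc 1 n.sqrt).image (fun d ↦ n / d) := by
    intro d hd
    rw [Nat.mem_divisors] at hd
    obtain ⟨⟨e, rfl⟩, h0⟩ := hd
    have hd0 : 0 < d := Nat.pos_of_ne_zero (by rintro rfl; simp at h0)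
    have he0 : 0 < e := Nat.pos_of_ne_zero (by rintro rfl; simp at h0)
    rw [Finset.mem_union, Finset.mem_image]
    rcases le_total d e with hde | hde
    · left
      rw [Finset.mem_Icc]
      exact ⟨hd0, Nat.le_sqrt.2 (Nat.mul_le_mul_left d hde)⟩
    · right
      refine ⟨e, ?_, Nat.mul_div_cancel _ he0⟩
      rw [Finset.mem_Icc]
      exact ⟨he0, Nat.le_sqrt.2 (Nat.mul_le_mul_right e hde)⟩
  have h1 := (Finset.card_le_card h).trans (Finset.card_union_le _ _)
  have h2 := Finset.card_image_le (s := Finset.Icc 1 n.sqrt) (f := fun d ↦ n / d)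
  rw [Nat.card_Icc] at h1 h2
  have h3 : n.divisors.card ≤ 2 * n.sqrt := by lia
  calc (n.divisors.card : ℝ) ≤ 2 * (n.sqrt : ℝ) := by exact_mod_cast h3
    _ ≤ 2 * √n := by gcongr; exact Real.nat_sqrt_le_real_sqrt

lemma moebius_sum_gcd (m n : ℕ) (hm : m ≠ 0) :
    ∑ d ∈ m.divisors, (if d ∣ n then (ArithmeticFunction.moebius d : ℂ) else 0) =
      if Nat.Coprime n m then 1 else 0 := by
  rw [← Finset.sum_filter]
  have : m.divisors.filter (· ∣ n) = (Nat.gcd n m).divisors := by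
    ext d
    simp only [Finset.mem_filter, Nat.mem_divisors, Nat.dvd_gcd_iff]
    constructor
    · rintro ⟨⟨h1, h2⟩, h3⟩
      exact ⟨⟨h3, h1⟩, Nat.gcd_ne_zero_right hm⟩
    · rintro ⟨⟨h1, h2⟩, h3⟩
      exact ⟨⟨h2, hm⟩, h1⟩
  rw [this]
  have h := congrArg (fun f ↦ f (Nat.gcd n m))
    (ArithmeticFunction.coe_moebius_mul_coe_zeta (R := ℂ))
  simp only [ArithmeticFunction.one_apply] at h
  rw [ArithmeticFunction.coe_mul_zeta_apply] at h
  simpa using h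

/-- **Pólya–Vinogradov** inequality for all nonprincipal characters. -/
theorem norm_sum_char_le {χ : DirichletCharacter ℂ N} (hχ : χ ≠ 1) (M : ℕ) :
    ‖∑ n ∈ Finset.Icc 1 M, χ (n : ZMod N)‖ ≤ 2 * √N * (1 + Real.log N) := by
  set f := χ.conductor with hf
  have hN0 : 0 < N := Nat.pos_of_ne_zero (NeZero.ne N)
  obtain ⟨m, hm⟩ : f ∣ N := χ.conductor_dvd_level
  have hf0 : f ≠ 0 := by rintro h; rw [h, zero_mul] at hm; lia
  have hm0 : m ≠ 0 := by rintro h; rw [h, mul_zero] at hm; lia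
  have : NeZero f := ⟨hf0⟩
  have hf1 : 1 < f := by
    rcases Nat.lt_or_ge 1 f with h | h
    · exact h
    · exact absurd ((DirichletCharacter.eq_one_iff_conductor_eq_one).2 (by lia)) hχ
  set ψ : DirichletCharacter ℂ f := χ.primitiveCharacter
  have hψ : ψ.IsPrimitive := χ.primitiveCharacter_isPrimitive
  have hval : ∀ n : ℕ, χ (n : ZMod N) = ∑ d ∈ m.divisors,
      (if d ∣ n then (ArithmeticFunction.moebius d : ℂ) else 0) * ψ (n : ZMod f) := by
    intro n
    rw [← Finset.sum_mul, moebius_sum_gcd m n hm0]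
    have hcl : χ = DirichletCharacter.changeLevel χ.conductor_dvd_level ψ :=
      (DirichletCharacter.changeLevel_primitiveCharacter χ).symm
    by_cases hc : Nat.Coprime n N
    · rw [if_pos (Nat.Coprime.coprime_dvd_right ⟨f, by rw [hm, mul_comm]⟩ hc), one_mul]
      conv_lhs => rw [hcl]
      have := DirichletCharacter.changeLevel_eq_cast_of_dvd' ψ χ.conductor_dvd_level
        (a := (n : ℤ)) (Nat.isCoprime_iff_coprime.2 hc)
      simpa using this
    · rw [MulChar.map_nonunit _ (by rwa [ZMod.isUnit_iff_coprime])]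
      split_ifs with h
      · rw [MulChar.map_nonunit ψ, mul_zero]
        rw [ZMod.isUnit_iff_coprime]
        intro h'
        exact hc (by rw [hm]; exact Nat.Coprime.mul_right h' h)
      · rw [zero_mul]
  simp_rw [hval]
  rw [Finset.sum_comm]
  have hbound : ∀ d ∈ m.divisors, ‖∑ n ∈ Finset.Icc 1 M,
      (if d ∣ n then (ArithmeticFunction.moebius d : ℂ) else 0) * ψ (n : ZMod f)‖ ≤
      √f * (1 + Real.log f) := by
    intro d hd
    have hd0 : 0 < d := Nat.pos_of_mem_divisors hd
    have : ∑ n ∈ Finset.Icc 1 M,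
      (if d ∣ n then (ArithmeticFunction.moebius d : ℂ) else 0) * ψ (n : ZMod f) =
      ArithmeticFunction.moebius d * ψ (d : ZMod f) *
        ∑ n ∈ Finset.Icc 1 (M / d), ψ (n : ZMod f) := by
      simp_rw [ite_mul, zero_mul]
      rw [← Finset.sum_filter, Finset.mul_sum]
      symm
      refine Finset.sum_nbij' (fun k ↦ d * k) (fun n ↦ n / d) ?_ ?_ ?_ ?_ ?_
      · intro k hk
        simp only [Finset.mem_Icc, Finset.mem_filter] at hk ⊢
        refine ⟨⟨Nat.mul_pos hd0 hk.1, ?_⟩, dvd_mul_right _ _⟩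
        rw [mul_comm]; exact (Nat.le_div_iff_mul_le hd0).1 hk.2
      · intro n hn
        simp only [Finset.mem_Icc, Finset.mem_filter] at hn ⊢
        exact ⟨Nat.div_pos (Nat.le_of_dvd hn.1.1 hn.2) hd0, Nat.div_le_div_right hn.1.2⟩
      · intro k _
        exact Nat.mul_div_cancel_left k hd0
      · intro n hn
        exact Nat.mul_div_cancel' (Finset.mem_filter.1 hn).2
      · intro k _
        push_cast
        rw [map_mul]; ring
    rw [this, norm_mul]
    refine (mul_le_of_le_one_left (norm_nonneg _) ?_).trans
      (norm_sum_char_le_of_isPrimitive hψ hf1 _)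
    rw [norm_mul]
    refine mul_le_one₀ ?_ (norm_nonneg _) (DirichletCharacter.norm_le_one _ _)
    rw [Complex.norm_intCast]
    exact_mod_cast ArithmeticFunction.abs_moebius_le_one
  have hfN : (f : ℝ) ≤ N := by exact_mod_cast Nat.le_of_dvd hN0 ⟨m, hm⟩
  have hf1' : (1 : ℝ) < f := by exact_mod_cast hf1
  calc _ ≤ ∑ d ∈ m.divisors, √f * (1 + Real.log f) :=
        (norm_sum_le _ _).trans (Finset.sum_le_sum hbound)
    _ = m.divisors.card * (√f * (1 + Real.log f)) := by rw [Finset.sum_const, nsmul_eq_mul]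
    _ ≤ (2 * √m) * (√f * (1 + Real.log N)) := by
        have h1 := Real.log_nonneg hf1'.le
        gcongr
        exact card_divisors_le_two_mul_sqrt m
    _ = 2 * √N * (1 + Real.log N) := by
        have : √(N : ℝ) = √f * √m := by rw [hm]; push_cast; rw [Real.sqrt_mul (by positivity)]
        rw [this]; ring

end PolyaVinogradov

end

section
open Finset BoundingSieve

lemma sum_moebius_multiples {l k : ℕ} (hk : Squarefree k) :
    ∑ d ∈ k.divisors, (if l ∣ d then (ArithmeticFunction.moebius d : ℝ) else 0) =
      if l = k then (ArithmeticFunction.moebius l : ℝ) else 0 := by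
  have hk0 : k ≠ 0 := hk.ne_zero
  by_cases hl : l ∣ k
  · obtain ⟨m, rfl⟩ := hl
    have hl0 : l ≠ 0 := left_ne_zero_of_mul hk0
    have hm0 : m ≠ 0 := right_ne_zero_of_mul hk0
    have h1 : ∑ d ∈ (l * m).divisors, (if l ∣ d then (ArithmeticFunction.moebius d : ℝ) else 0) =
        ∑ e ∈ m.divisors, (ArithmeticFunction.moebius l : ℝ) * ArithmeticFunction.moebius e := by
      rw [← sum_filter]
      symm
      refine sum_nbij' (fun e ↦ l * e) (fun d ↦ d / l) ?_ ?_ ?_ ?_ ?_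
      · intro e he
        simp only [mem_filter, Nat.mem_divisors] at he ⊢
        exact ⟨⟨Nat.mul_dvd_mul_left l he.1, hk0⟩, dvd_mul_right _ _⟩
      · intro d hd
        simp only [mem_filter, Nat.mem_divisors] at hd ⊢
        refine ⟨?_, hm0⟩
        obtain ⟨e, rfl⟩ := hd.2
        rw [Nat.mul_div_cancel_left e (Nat.pos_of_ne_zero hl0)]
        exact Nat.dvd_of_mul_dvd_mul_left (Nat.pos_of_ne_zero hl0) hd.1.1
      · intro e _
        exact Nat.mul_div_cancel_left e (Nat.pos_of_ne_zero hl0)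
      · intro d hd
        exact Nat.mul_div_cancel' (mem_filter.1 hd).2
      · intro e he
        have hc : Nat.Coprime l e :=
          (Nat.coprime_of_squarefree_mul hk).coprime_dvd_right (Nat.dvd_of_mem_divisors he)
        rw [ArithmeticFunction.isMultiplicative_moebius.map_mul_of_coprime hc]
        push_cast; rfl
    have h2 : ∑ e ∈ m.divisors, (ArithmeticFunction.moebius e : ℝ) = if m = 1 then 1 else 0 := by
      have h := congrArg (fun f ↦ f m) (ArithmeticFunction.coe_moebius_mul_coe_zeta (R := ℝ))
      simp only [ArithmeticFunction.one_apply] at h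
      rw [ArithmeticFunction.coe_mul_zeta_apply] at h
      simpa using h
    rw [h1, ← mul_sum, h2]
    by_cases hm : m = 1
    · subst hm; simp
    · rw [if_neg hm, if_neg, mul_zero]
      intro h
      exact hm (by simpa [hl0] using h.symm)
  · rw [if_neg (by rintro rfl; exact hl dvd_rfl)]
    refine sum_eq_zero fun d hd ↦ if_neg fun h ↦ hl (h.trans (Nat.dvd_of_mem_divisors hd))

/-- The normalising sum of the Selberg sieve of level `R`. -/
noncomputable def selbergSum (s : BoundingSieve) (R : ℕ) : ℝ :=
  ∑ l ∈ s.prodPrimes.divisors.filter (· ≤ R), s.selbergTerms l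

lemma selbergSum_ge_one (s : BoundingSieve) {R : ℕ} (hR : 1 ≤ R) : 1 ≤ selbergSum s R := by
  unfold selbergSum
  have h1 : (1 : ℕ) ∈ s.prodPrimes.divisors.filter (· ≤ R) := by
    simp [hR, s.prodPrimes_squarefree.ne_zero]
  have := single_le_sum (f := fun l ↦ s.selbergTerms l) (fun l hl ↦
    (selbergTerms_pos (s := s) (Nat.dvd_of_mem_divisors (mem_filter.1 hl).1)).le) h1
  refine le_trans (le_of_eq ?_) this
  exact selbergTerms_isMultiplicative.map_one.symm

lemma inv_nu_mul_sum_le (s : BoundingSieve) (R : ℕ) {d : ℕ} (hd : d ∣ s.prodPrimes) :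
    (s.nu d)⁻¹ * ∑ k ∈ (s.prodPrimes.divisors.filter (· ≤ R)).filter (d ∣ ·), s.selbergTerms k ≤
      selbergSum s R := by
  set D := s.prodPrimes.divisors.filter (· ≤ R) with hD
  have hP0 : s.prodPrimes ≠ 0 := s.prodPrimes_squarefree.ne_zero
  have hd0 : d ≠ 0 := ne_zero_of_dvd_ne_zero hP0 hd
  have hcop : ∀ k ∈ D.filter (d ∣ ·), ∃ m, k = d * m ∧ Nat.Coprime d m := by
    intro k hk
    simp only [hD, mem_filter, Nat.mem_divisors] at hk
    obtain ⟨m, rfl⟩ := hk.2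
    exact ⟨m, rfl, Nat.coprime_of_squarefree_mul
      (s.prodPrimes_squarefree.squarefree_of_dvd hk.1.1.1)⟩
  have hmul := selbergTerms_isMultiplicative (s := s)
  have h1 : (s.nu d)⁻¹ * ∑ k ∈ D.filter (d ∣ ·), s.selbergTerms k =
      ∑ x ∈ d.divisors ×ˢ D.filter (d ∣ ·), s.selbergTerms (x.1 * (x.2 / d)) := by
    rw [sum_product_right, mul_sum]
    refine sum_congr rfl fun k hk ↦ ?_
    obtain ⟨m, rfl, hc⟩ := hcop k hk
    simp only
    rw [Nat.mul_div_cancel_left m (Nat.pos_of_ne_zero hd0), hmul.map_mul_of_coprime hc]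
    have h2 := sum_divisors_selbergTerms_eq_selbergTerms_mul_nu_inv (s := s) hd
    rw [← sum_filter, Nat.divisors_filter_dvd_of_dvd hP0 hd] at h2
    have h3 : ∑ l ∈ d.divisors, s.selbergTerms (l * m) =
        (∑ l ∈ d.divisors, s.selbergTerms l) * s.selbergTerms m := by
      rw [sum_mul]
      exact sum_congr rfl fun l hl ↦
        hmul.map_mul_of_coprime (hc.coprime_dvd_left (Nat.dvd_of_mem_divisors hl))
    rw [h3, h2]; ring
  rw [h1]
  unfold selbergSum
  have hinj : Set.InjOn (fun x : ℕ × ℕ ↦ x.1 * (x.2 / d))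
      (d.divisors ×ˢ D.filter (d ∣ ·) : Finset (ℕ × ℕ)) := by
    rintro ⟨l, k⟩ hx ⟨l', k'⟩ hx' h
    rw [mem_coe, mem_product] at hx hx'
    obtain ⟨m, hm, hc⟩ := hcop k hx.2
    obtain ⟨m', hm', hc'⟩ := hcop k' hx'.2
    simp only at hm hm' h hx hx'
    subst hm hm'
    rw [Nat.mul_div_cancel_left _ (Nat.pos_of_ne_zero hd0),
      Nat.mul_div_cancel_left _ (Nat.pos_of_ne_zero hd0)] at h
    have hl : Nat.gcd (l * m) d = l := by
      rw [Nat.Coprime.gcd_mul_right_cancel _ hc.symm]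
      exact Nat.gcd_eq_left (Nat.dvd_of_mem_divisors hx.1)
    have hl' : Nat.gcd (l' * m') d = l' := by
      rw [Nat.Coprime.gcd_mul_right_cancel _ hc'.symm]
      exact Nat.gcd_eq_left (Nat.dvd_of_mem_divisors hx'.1)
    have hll : l = l' := by rw [← hl, ← hl', h]
    subst hll
    have hl0 : 0 < l := Nat.pos_of_mem_divisors hx.1
    rw [Nat.eq_of_mul_eq_mul_left hl0 h]
  rw [← sum_image (f := fun n ↦ s.selbergTerms n) hinj]
  refine sum_le_sum_of_subset_of_nonneg ?_ fun l hl _ ↦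
    (selbergTerms_pos (s := s) (Nat.dvd_of_mem_divisors (mem_filter.1 hl).1)).le
  intro n hn
  rw [mem_image] at hn
  obtain ⟨⟨l, k⟩, hx, rfl⟩ := hn
  rw [mem_product] at hx
  obtain ⟨m, hm, hc⟩ := hcop k hx.2
  simp only at hm hx ⊢
  subst hm
  rw [Nat.mul_div_cancel_left _ (Nat.pos_of_ne_zero hd0)]
  have h5 := hx.2
  simp only [hD, mem_filter, Nat.mem_divisors] at h5 ⊢
  have h6 : l * m ∣ d * m := Nat.mul_dvd_mul_right (Nat.dvd_of_mem_divisors hx.1) m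
  refine ⟨⟨h6.trans h5.1.1.1, hP0⟩, (Nat.le_of_dvd ?_ h6).trans h5.1.2⟩
  exact Nat.pos_of_ne_zero (ne_zero_of_dvd_ne_zero hP0 h5.1.1.1)

/-- The optimal Selberg weights of level `R`. -/
theorem exists_selberg_weights (s : BoundingSieve) {R : ℕ} (hR : 1 ≤ R) :
    ∃ w : ℕ → ℝ, w 1 = 1 ∧ (∀ d, |w d| ≤ 1) ∧ (∀ d, w d ≠ 0 → d ∣ s.prodPrimes ∧ d ≤ R) ∧
      ∑ d ∈ s.prodPrimes.divisors, ∑ e ∈ s.prodPrimes.divisors,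
        w d * w e * s.nu (d.lcm e) = (selbergSum s R)⁻¹ := by
  set S := selbergSum s R with hS
  have hS1 : 1 ≤ S := selbergSum_ge_one s hR
  have hP0 : s.prodPrimes ≠ 0 := s.prodPrimes_squarefree.ne_zero
  set D := s.prodPrimes.divisors.filter (· ≤ R) with hD
  have hDdiv : ∀ d ∈ D, d ∣ s.prodPrimes := fun d hd ↦ Nat.dvd_of_mem_divisors (mem_filter.1 hd).1
  let w : ℕ → ℝ := fun d ↦ if d ∈ D then
    ArithmeticFunction.moebius d * ((s.nu d)⁻¹ * ∑ k ∈ D.filter (d ∣ ·), s.selbergTerms k) * S⁻¹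
    else 0
  have hnn : ∀ d, 0 ≤ ∑ k ∈ D.filter (d ∣ ·), s.selbergTerms k := fun d ↦
    sum_nonneg fun k hk ↦ (selbergTerms_pos (hDdiv k (mem_filter.1 hk).1)).le
  have h1D : 1 ∈ D := by simp [hD, hR, hP0]
  refine ⟨w, ?_, ?_, ?_, ?_⟩
  · simp only [w, if_pos h1D]
    have : D.filter (1 ∣ ·) = D := filter_true_of_mem fun k _ ↦ one_dvd k
    rw [this, s.nu_mult.map_one, ArithmeticFunction.moebius_apply_one]
    have : ∑ k ∈ D, s.selbergTerms k = S := rfl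
    rw [this]
    field_simp
    simp
  · intro d
    simp only [w]
    split_ifs with h
    · have h2 := inv_nu_mul_sum_le s R (hDdiv d h)
      have h3 : 0 ≤ (s.nu d)⁻¹ * ∑ k ∈ D.filter (d ∣ ·), s.selbergTerms k :=
        mul_nonneg (inv_nonneg.2 (nu_pos_of_dvd_prodPrimes (hDdiv d h)).le) (hnn d)
      rw [abs_mul, abs_mul, abs_of_nonneg h3, abs_of_nonneg (by positivity : 0 ≤ S⁻¹)]
      have h4 : |(ArithmeticFunction.moebius d : ℝ)| ≤ 1 := by
        exact_mod_cast ArithmeticFunction.abs_moebius_le_one (n := d)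
      calc _ ≤ 1 * S * S⁻¹ := by gcongr
        _ = 1 := by field_simp
    · simp
  · intro d hd
    have hdD : d ∈ D := by by_contra h; exact hd (if_neg h)
    exact ⟨hDdiv d hdD, (mem_filter.1 hdD).2⟩
  · have hquad : ∑ d ∈ s.prodPrimes.divisors, ∑ e ∈ s.prodPrimes.divisors,
        w d * w e * s.nu (d.lcm e) = s.mainSum (lambdaSquared w) := by
      rw [mainSum_lambdaSquared_eq_sum_sum_mul]
      refine sum_congr rfl fun d hd ↦ sum_congr rfl fun e _ ↦ ?_
      rw [s.nu_mult.map_lcm]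
      · ring
      · exact (nu_pos_of_dvd_prodPrimes ((Nat.gcd_dvd_left d e).trans
          (Nat.dvd_of_mem_divisors hd))).ne'
    rw [hquad, mainSum_lambdaSquared_eq_sum_mul_sum_sq]
    have hy : ∀ l ∈ s.prodPrimes.divisors,
        (∑ d ∈ s.prodPrimes.divisors, if l ∣ d then s.nu d * w d else 0) =
          if l ∈ D then S⁻¹ * s.selbergTerms l * ArithmeticFunction.moebius l else 0 := by
      intro l hl
      have e1 : ∀ d ∈ s.prodPrimes.divisors, (if l ∣ d then s.nu d * w d else 0) =
          ∑ k ∈ D, S⁻¹ * s.selbergTerms k *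
            (if d ∣ k then (if l ∣ d then (ArithmeticFunction.moebius d : ℝ) else 0) else 0) := by
        intro d hd
        by_cases hld : l ∣ d
        · simp only [if_pos hld]
          by_cases hdD : d ∈ D
          · have hnu : s.nu d ≠ 0 := (nu_pos_of_dvd_prodPrimes (hDdiv d hdD)).ne'
            simp only [w, if_pos hdD]
            rw [sum_filter]
            simp_rw [mul_sum, sum_mul, mul_sum]
            refine sum_congr rfl fun k _ ↦ ?_
            split_ifs
            · field_simp
            · simp
          · simp only [w, if_neg hdD, mul_zero]
            symm
            refine sum_eq_zero fun k hk ↦ ?_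
            rw [if_neg, mul_zero]
            intro hdk
            refine hdD (mem_filter.2 ⟨hd, (Nat.le_of_dvd ?_ hdk).trans (mem_filter.1 hk).2⟩)
            exact Nat.pos_of_mem_divisors (mem_filter.1 hk).1
        · simp [hld]
      rw [sum_congr rfl e1, sum_comm]
      simp_rw [← mul_sum, ← sum_filter (fun d ↦ d ∣ _)]
      have e2 : ∀ k ∈ D, S⁻¹ * s.selbergTerms k * ∑ d ∈ s.prodPrimes.divisors.filter (· ∣ k),
          (if l ∣ d then (ArithmeticFunction.moebius d : ℝ) else 0) =
          if l = k then S⁻¹ * s.selbergTerms l * ArithmeticFunction.moebius l else 0 := by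
        intro k hk
        rw [Nat.divisors_filter_dvd_of_dvd hP0 (hDdiv k hk),
          sum_moebius_multiples (s.prodPrimes_squarefree.squarefree_of_dvd (hDdiv k hk))]
        split_ifs with h
        · rw [h]
        · rw [mul_zero]
      rw [sum_congr rfl e2, sum_ite_eq]
    rw [sum_congr rfl fun l hl ↦ by rw [hy l hl]]
    have e3 : ∀ l ∈ s.prodPrimes.divisors, (s.selbergTerms l)⁻¹ *
        (if l ∈ D then S⁻¹ * s.selbergTerms l * (ArithmeticFunction.moebius l : ℝ) else 0) ^ 2 =
        if l ≤ R then S⁻¹ ^ 2 * s.selbergTerms l else 0 := by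
      intro l hl
      have hlD : l ∈ D ↔ l ≤ R := by simp only [hD, mem_filter, hl, true_and]
      have hpos := selbergTerms_pos (s := s) (Nat.dvd_of_mem_divisors hl)
      have hmu : (ArithmeticFunction.moebius l : ℝ) ^ 2 = 1 := by
        exact_mod_cast ArithmeticFunction.moebius_sq_eq_one_of_squarefree
          (s.prodPrimes_squarefree.squarefree_of_dvd (Nat.dvd_of_mem_divisors hl))
      by_cases h : l ≤ R
      · rw [if_pos (hlD.2 h), if_pos h]
        rw [mul_pow, mul_pow, hmu]
        field_simp
      · rw [if_neg (mt hlD.1 h), if_neg h]; simp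
    rw [sum_congr rfl e3, ← sum_filter, ← mul_sum]
    have : ∑ k ∈ s.prodPrimes.divisors.filter (· ≤ R), s.selbergTerms k = S := rfl
    rw [this]
    field_simp

/-- A finite Euler product upper bound for sums of nonnegative multiplicative functions. -/
theorem sum_le_prod_sum_primePow {b : ArithmeticFunction ℝ} (hb : b.IsMultiplicative)
    (hb0 : ∀ n, 0 ≤ b n) (I : Finset ℕ) (s : Finset ℕ) (E : ℕ → Finset ℕ)
    (hI0 : ∀ n ∈ I, n ≠ 0) (hI : ∀ n ∈ I, n.primeFactors ⊆ s)
    (hE : ∀ n ∈ I, ∀ p ∈ s, n.factorization p ∈ E p) :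
    ∑ n ∈ I, b n ≤ ∏ p ∈ s, ∑ k ∈ E p, b (p ^ k) := by
  rw [prod_sum]
  let φ : ℕ → ((p : ℕ) → p ∈ s → ℕ) := fun n p _ ↦ n.factorization p
  have hinj : Set.InjOn φ I := by
    intro n hn m hm h
    refine Nat.factorization_inj (hI0 n hn) (hI0 m hm) ?_
    ext p
    by_cases hp : p ∈ s
    · exact congrFun (congrFun h p) hp
    · rw [Finsupp.notMem_support_iff.1, Finsupp.notMem_support_iff.1]
      · exact fun h' ↦ hp (hI m hm h')
      · exact fun h' ↦ hp (hI n hn h')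
  have hval : ∀ n ∈ I, b n = ∏ x ∈ s.attach, b (x.1 ^ (φ n x.1 x.2)) := by
    intro n hn
    rw [hb.multiplicative_factorization b (hI0 n hn), Finsupp.prod]
    rw [prod_attach s (fun p ↦ b (p ^ n.factorization p))]
    refine prod_subset (hI n hn) fun p _ hp ↦ ?_
    rw [Finsupp.notMem_support_iff.1 hp, pow_zero, hb.map_one]
  rw [sum_congr rfl hval,
    ← sum_image (f := fun e : (p : ℕ) → p ∈ s → ℕ ↦ ∏ x ∈ s.attach, b (x.1 ^ (e x.1 x.2))) hinj]
  refine sum_le_sum_of_subset_of_nonneg ?_ fun e _ _ ↦ prod_nonneg fun x _ ↦ hb0 _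
  intro e he
  obtain ⟨n, hn, rfl⟩ := mem_image.1 he
  exact mem_pi.2 fun p hp ↦ hE n hn p hp

lemma factorization_mem_range {n X p : ℕ} (hn : n ≤ X) : n.factorization p ∈ range (X + 1) := by
  rw [mem_range]
  rcases Nat.eq_zero_or_pos n with rfl | h0
  · simp
  · exact (Nat.factorization_lt p h0.ne').trans_le (by lia)

/-- The arithmetic function `n ↦ 1/n`. -/
noncomputable def invArith : ArithmeticFunction ℝ := ⟨fun n ↦ (n : ℝ)⁻¹, by simp⟩

@[simp] lemma invArith_apply (n : ℕ) : invArith n = (n : ℝ)⁻¹ := rfl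

lemma invArith_mult : invArith.IsMultiplicative :=
  ⟨by simp, fun _ ↦ by simp [mul_comm]⟩

lemma sum_inv_pow_le {p : ℕ} (hp : p.Prime) (K : ℕ) :
    ∑ k ∈ range K, ((p ^ k : ℕ) : ℝ)⁻¹ ≤ (p : ℝ) / (p - 1) := by
  have h1 : (1 : ℝ) < p := by exact_mod_cast hp.one_lt
  have hlt : (p : ℝ)⁻¹ < 1 := inv_lt_one_of_one_lt₀ h1
  have h2 : ∑ k ∈ range K, ((p ^ k : ℕ) : ℝ)⁻¹ = ∑ k ∈ range K, ((p : ℝ)⁻¹) ^ k :=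
    sum_congr rfl fun k _ ↦ by push_cast; rw [inv_pow]
  rw [h2]
  refine ((summable_geometric_of_lt_one (by positivity) hlt).sum_le_tsum _
    (fun k _ ↦ by positivity)).trans ?_
  rw [tsum_geometric_of_lt_one (by positivity) hlt]
  apply le_of_eq
  have : (p : ℝ) - 1 ≠ 0 := by linarith
  field_simp

lemma sum_inv_pow_Icc_le {p : ℕ} (hp : p.Prime) (K : ℕ) :
    ∑ k ∈ Icc 1 K, ((p ^ k : ℕ) : ℝ)⁻¹ ≤ 1 / ((p : ℝ) - 1) := by
  have h1 : (1 : ℝ) < p := by exact_mod_cast hp.one_lt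
  have h := sum_inv_pow_le hp (K + 1)
  rw [sum_range_succ'] at h
  have h3 : ∑ k ∈ Icc 1 K, ((p ^ k : ℕ) : ℝ)⁻¹ = ∑ k ∈ range K, ((p ^ (k + 1) : ℕ) : ℝ)⁻¹ := by
    rw [range_eq_Ico, sum_Ico_add' (fun k ↦ ((p ^ k : ℕ) : ℝ)⁻¹)]
    rfl
  rw [h3]
  simp only [pow_zero, Nat.cast_one, inv_one] at h
  have : (p : ℝ) / (p - 1) = 1 + 1 / (p - 1) := by
    have : (p : ℝ) - 1 ≠ 0 := by linarith
    field_simp; ring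
  linarith

lemma div_totient_eq_prod {k : ℕ} (hk : k ≠ 0) :
    (k : ℝ) / k.totient = ∏ p ∈ k.primeFactors, ((p : ℝ) / (p - 1)) := by
  have h := Nat.totient_mul_prod_primeFactors k
  have h' : (k.totient : ℝ) * ∏ p ∈ k.primeFactors, (p : ℝ) =
      k * ∏ p ∈ k.primeFactors, ((p : ℝ) - 1) := by
    have := congrArg (Nat.cast : ℕ → ℝ) h
    push_cast at this
    rw [this]
    congr 1
    refine prod_congr rfl fun p hp ↦ ?_
    rw [Nat.cast_sub (Nat.prime_of_mem_primeFactors hp).one_le]; simp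
  rw [prod_div_distrib, div_eq_div_iff]
  · linarith
  · exact_mod_cast (Nat.totient_pos.2 (Nat.pos_of_ne_zero hk)).ne'
  · refine prod_ne_zero_iff.2 fun p hp ↦ ?_
    have : (1 : ℝ) < p := by exact_mod_cast (Nat.prime_of_mem_primeFactors hp).one_lt
    linarith

lemma sum_inv_smooth_le {k : ℕ} (hk : k ≠ 0) (X : ℕ) :
    ∑ n ∈ (Icc 1 X).filter (fun n ↦ n.primeFactors ⊆ k.primeFactors), (n : ℝ)⁻¹ ≤
      k / k.totient := by
  rw [div_totient_eq_prod hk]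
  refine (sum_le_prod_sum_primePow invArith_mult (fun n ↦ by simp) _ k.primeFactors
    (fun _ ↦ range (X + 1)) ?_ ?_ ?_).trans ?_
  · intro n hn; have := (mem_Icc.1 (mem_filter.1 hn).1).1; lia
  · intro n hn; exact (mem_filter.1 hn).2
  · intro n hn p _; exact factorization_mem_range (mem_Icc.1 (mem_filter.1 hn).1).2
  · refine prod_le_prod (fun p _ ↦ sum_nonneg fun k _ ↦ by simp) fun p hp ↦ ?_
    exact sum_inv_pow_le (Nat.prime_of_mem_primeFactors hp) _

/-- Sieve of density `1/d`, by the primes up to `R` not dividing `q`. -/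
noncomputable def coprimeSieve (q R : ℕ) : BoundingSieve where
  support := ∅
  prodPrimes := ∏ p ∈ (Icc 1 R).filter (fun p ↦ p.Prime ∧ ¬ p ∣ q), p
  prodPrimes_squarefree := by
    refine Finset.squarefree_prod_of_pairwise_isCoprime ?_ ?_
    · intro p hp p' hp' h
      have hp1 := (mem_filter.1 (Finset.mem_coe.1 hp)).2.1
      have hp2 := (mem_filter.1 (Finset.mem_coe.1 hp')).2.1
      exact Nat.coprime_iff_isRelPrime.1 ((Nat.coprime_primes hp1 hp2).2 h)
    · intro p hp
      exact (mem_filter.1 hp).2.1.squarefree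
  weights := 0
  weights_nonneg := fun _ ↦ le_rfl
  totalMass := 0
  nu := invArith
  nu_mult := invArith_mult
  nu_pos_of_prime := fun p hp _ ↦ by
    rw [invArith_apply]; have := hp.pos; positivity
  nu_lt_one_of_prime := fun p hp _ ↦ by
    rw [invArith_apply]; exact inv_lt_one_of_one_lt₀ (by exact_mod_cast hp.one_lt)

lemma selbergTerms_eq_prod (s : BoundingSieve) {l : ℕ} (hl : l ∣ s.prodPrimes) :
    s.selbergTerms l = ∏ p ∈ l.primeFactors, s.nu p * (1 - s.nu p)⁻¹ := by
  rw [selbergTerms_apply, prod_mul_distrib]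
  congr 1
  have hsq := s.prodPrimes_squarefree.squarefree_of_dvd hl
  conv_lhs => rw [← Nat.prod_primeFactors_of_squarefree hsq]
  exact s.nu_mult.map_prod_of_prime _ fun p hp ↦ Nat.prime_of_mem_primeFactors hp

/-- Lower bound for the Selberg sum by a sum of a multiplicative function. -/
theorem sum_le_prod_mul_selbergSum (s : BoundingSieve) (R : ℕ) (Q : Finset ℕ) (G : ℕ → ℝ)
    {b : ArithmeticFunction ℝ} (hb : b.IsMultiplicative) (hb0 : ∀ n, 0 ≤ b n)
    (hcov : ∀ p, p.Prime → p ≤ R → p ∉ Q → p ∣ s.prodPrimes)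
    (hQ : ∀ p ∈ Q, ¬ p ∣ s.prodPrimes)
    (hP : ∀ p, p.Prime → p ∣ s.prodPrimes → ∀ K,
      ∑ k ∈ Icc 1 K, b (p ^ k) ≤ s.nu p * (1 - s.nu p)⁻¹)
    (hG : ∀ p ∈ Q, ∀ K, ∑ k ∈ range K, b (p ^ k) ≤ G p) :
    ∑ n ∈ Icc 1 R, b n ≤ (∏ p ∈ Q, G p) * selbergSum s R := by
  have hP0 : s.prodPrimes ≠ 0 := s.prodPrimes_squarefree.ne_zero
  let lf : ℕ → ℕ := fun n ↦ ∏ p ∈ n.primeFactors ∩ s.prodPrimes.primeFactors, p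
  have hlf : ∀ n, (lf n).primeFactors = n.primeFactors ∩ s.prodPrimes.primeFactors := fun n ↦
    Nat.primeFactors_prod fun p hp ↦ Nat.prime_of_mem_primeFactors (mem_inter.1 hp).1
  have hmaps : ∀ n ∈ Icc 1 R, lf n ∈ s.prodPrimes.divisors.filter (· ≤ R) := by
    intro n hn
    obtain ⟨hn1, hnR⟩ := mem_Icc.1 hn
    refine mem_filter.2 ⟨Nat.mem_divisors.2 ⟨?_, hP0⟩, ?_⟩
    · exact (prod_dvd_prod_of_subset _ _ _ inter_subset_right).trans (Nat.prod_primeFactors_dvd _)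
    · refine (Nat.le_of_dvd hn1 ?_).trans hnR
      exact (prod_dvd_prod_of_subset _ _ _ inter_subset_left).trans (Nat.prod_primeFactors_dvd _)
  rw [← sum_fiberwise_of_maps_to hmaps, selbergSum, mul_sum]
  refine sum_le_sum fun l hl ↦ ?_
  obtain ⟨hl1, -⟩ := mem_filter.1 hl
  have hlP := Nat.dvd_of_mem_divisors hl1
  have hdisj : Disjoint l.primeFactors Q := by
    rw [Finset.disjoint_left]
    exact fun p hp hpQ ↦ hQ p hpQ ((Nat.dvd_of_mem_primeFactors hp).trans hlP)
  refine (sum_le_prod_sum_primePow hb hb0 _ (l.primeFactors ∪ Q)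
    (fun p ↦ if p ∈ Q then range (R + 1) else Icc 1 R) ?_ ?_ ?_).trans ?_
  · intro n hn; have := (mem_Icc.1 (mem_filter.1 hn).1).1; lia
  · intro n hn p hp
    obtain ⟨hn1, rfl⟩ := mem_filter.1 hn
    rw [mem_union, hlf]
    by_cases hpQ : p ∈ Q
    · exact Or.inr hpQ
    · have hpp := Nat.prime_of_mem_primeFactors hp
      have : p ≤ R := (Nat.le_of_mem_primeFactors hp).trans (mem_Icc.1 hn1).2
      exact Or.inl (mem_inter.2 ⟨hp, Nat.mem_primeFactors.2 ⟨hpp, hcov p hpp this hpQ, hP0⟩⟩)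
  · intro n hn p hp
    obtain ⟨hn1, rfl⟩ := mem_filter.1 hn
    have hr := factorization_mem_range (p := p) (mem_Icc.1 hn1).2
    split_ifs with hpQ
    · exact hr
    · have hp' : p ∈ n.primeFactors := by
        have := (mem_union.1 hp).resolve_right hpQ
        rw [hlf] at this
        exact (mem_inter.1 this).1
      have := (Nat.prime_of_mem_primeFactors hp').factorization_pos_of_dvd
        (Nat.mem_primeFactors.1 hp').2.2 (Nat.dvd_of_mem_primeFactors hp')
      rw [mem_range] at hr
      exact mem_Icc.2 ⟨this, by lia⟩
  · rw [prod_union hdisj, mul_comm, selbergTerms_eq_prod s hlP]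
    refine mul_le_mul ?_ ?_ (prod_nonneg fun p _ ↦ sum_nonneg fun k _ ↦ hb0 _)
      (prod_nonneg fun p hp ↦ ?_)
    · refine prod_le_prod (fun p _ ↦ sum_nonneg fun k _ ↦ hb0 _) fun p hp ↦ ?_
      rw [if_pos hp]; exact hG p hp _
    · refine prod_le_prod (fun p _ ↦ sum_nonneg fun k _ ↦ hb0 _) fun p hp ↦ ?_
      rw [if_neg (Finset.disjoint_left.1 hdisj hp)]
      exact hP p (Nat.prime_of_mem_primeFactors hp)
        ((Nat.dvd_of_mem_primeFactors hp).trans hlP) _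
    · have := hG p hp 0
      simpa using this

lemma dvd_coprimeSieve_prodPrimes {q R p : ℕ} (hp : p.Prime) :
    p ∣ (coprimeSieve q R).prodPrimes ↔ p ≤ R ∧ ¬ p ∣ q := by
  change p ∣ ∏ p ∈ (Icc 1 R).filter (fun p ↦ p.Prime ∧ ¬ p ∣ q), p ↔ _
  rw [hp.prime.dvd_finset_prod_iff]
  constructor
  · rintro ⟨r, hr, hpr⟩
    simp only [mem_filter, mem_Icc] at hr
    rw [(Nat.prime_dvd_prime_iff_eq hp hr.2.1).1 hpr]
    exact ⟨hr.1.2, hr.2.2⟩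
  · rintro ⟨h1, h2⟩
    exact ⟨p, by simp [hp, h1, h2, hp.one_lt.le], dvd_rfl⟩

lemma coprime_of_dvd_coprimeSieve {q R d : ℕ} (hd : d ∣ (coprimeSieve q R).prodPrimes) :
    Nat.Coprime d q := by
  refine Nat.coprime_of_dvd fun p hp hpd hpq ↦ ?_
  exact ((dvd_coprimeSieve_prodPrimes hp).1 (hpd.trans hd)).2 hpq

/-- The Selberg sum for sifting integers coprime to `q` is at least `(φ(q)/q) log R`. -/
theorem totient_div_mul_log_le_selbergSum {q : ℕ} (hq : q ≠ 0) (R : ℕ) :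
    (q.totient : ℝ) / q * Real.log R ≤ selbergSum (coprimeSieve q R) R := by
  have hφ : (0 : ℝ) < q.totient := by exact_mod_cast Nat.totient_pos.2 (Nat.pos_of_ne_zero hq)
  have hq0 : (0 : ℝ) < q := by exact_mod_cast Nat.pos_of_ne_zero hq
  have h := sum_le_prod_mul_selbergSum (coprimeSieve q R) R q.primeFactors
    (fun p ↦ (p : ℝ) / (p - 1)) invArith_mult (fun n ↦ by simp) ?_ ?_ ?_ ?_
  · have hlog : Real.log R ≤ ∑ n ∈ Icc 1 R, invArith n := by
      have := log_add_one_le_harmonic R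
      rw [harmonic_eq_sum_Icc] at this
      push_cast at this
      rcases Nat.eq_zero_or_pos R with rfl | hR
      · simp
      refine le_trans (Real.log_le_log (by exact_mod_cast hR) (by linarith)) (this.trans (by simp))
    rw [← div_totient_eq_prod hq] at h
    calc (q.totient : ℝ) / q * Real.log R
        ≤ (q.totient : ℝ) / q * (q / q.totient * selbergSum (coprimeSieve q R) R) := by
          gcongr; exact hlog.trans h
      _ = _ := by field_simp
  · intro p hp hpR hpq
    refine (dvd_coprimeSieve_prodPrimes hp).2 ⟨hpR, fun h ↦ hpq ?_⟩
    exact Nat.mem_primeFactors.2 ⟨hp, h, hq⟩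
  · intro p hp h
    exact ((dvd_coprimeSieve_prodPrimes (Nat.prime_of_mem_primeFactors hp)).1 h).2
      (Nat.dvd_of_mem_primeFactors hp)
  · intro p hp _ K
    have h1 : (1 : ℝ) < p := by exact_mod_cast hp.one_lt
    refine (sum_inv_pow_Icc_le hp K).trans ?_
    change _ ≤ (p : ℝ)⁻¹ * (1 - (p : ℝ)⁻¹)⁻¹
    rw [← mul_inv, mul_sub, mul_one, mul_inv_cancel₀ (by positivity)]
    simp
  · intro p hp K
    exact sum_inv_pow_le (Nat.prime_of_mem_primeFactors hp) K

end

section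
open Finset ArithmeticFunction
open scoped ArithmeticFunction.Moebius

/-- The indicator of integers coprime to `k`. -/
noncomputable def copInd (k : ℕ) : ArithmeticFunction ℝ :=
  ⟨fun n ↦ if n ≠ 0 ∧ Nat.Coprime n k then 1 else 0, by simp⟩

lemma copInd_apply {k n : ℕ} (hn : n ≠ 0) : copInd k n = if Nat.Coprime n k then 1 else 0 := by
  simp [copInd, hn]

lemma copInd_mult (k : ℕ) : (copInd k).IsMultiplicative := by
  refine IsMultiplicative.iff_ne_zero.2 ⟨by simp [copInd], fun {m n} hm hn _ ↦ ?_⟩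
  rw [copInd_apply hm, copInd_apply hn, copInd_apply (mul_ne_zero hm hn)]
  simp only [Nat.coprime_mul_iff_left]
  split_ifs <;> simp_all

lemma sum_moebius_copInd {k n : ℕ} (hn : n ≠ 0) (hk : k ≠ 0) :
    ∑ d ∈ n.divisors, (μ d : ℝ) * copInd k d =
      if n.primeFactors ⊆ k.primeFactors then 1 else 0 := by
  set r := ∏ p ∈ n.primeFactors, p with hr
  have hrn : r ∣ n := Nat.prod_primeFactors_dvd n
  have hrpf : r.primeFactors = n.primeFactors := Nat.primeFactors_prod fun p hp ↦
    Nat.prime_of_mem_primeFactors hp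
  have hrsq : Squarefree r := Finset.squarefree_prod_of_pairwise_isCoprime
    (fun p hp p' hp' h ↦ Nat.coprime_iff_isRelPrime.1 ((Nat.coprime_primes
      (Nat.prime_of_mem_primeFactors hp) (Nat.prime_of_mem_primeFactors hp')).2 h))
    fun p hp ↦ (Nat.prime_of_mem_primeFactors hp).prime.squarefree
  have h1 : ∑ d ∈ n.divisors, (μ d : ℝ) * copInd k d =
      ∑ d ∈ r.divisors, (μ d : ℝ) * copInd k d := by
    symm
    refine sum_subset (Nat.divisors_subset_of_dvd hn hrn) fun d hd hdr ↦ ?_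
    rw [ArithmeticFunction.moebius_eq_zero_of_not_squarefree, Int.cast_zero, zero_mul]
    intro hsq
    refine hdr (Nat.mem_divisors.2 ⟨?_, hrsq.ne_zero⟩)
    rw [← Nat.prod_primeFactors_of_squarefree hsq]
    exact prod_dvd_prod_of_subset _ _ _ (Nat.primeFactors_mono (Nat.dvd_of_mem_divisors hd) hn)
  rw [h1, ← (copInd_mult k).prodPrimeFactors_one_sub_of_squarefree _ hrsq, hrpf]
  have hp1 : ∀ p ∈ n.primeFactors, 1 - copInd k p = if p ∈ k.primeFactors then 1 else 0 := by
    intro p hp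
    have hpp := Nat.prime_of_mem_primeFactors hp
    rw [copInd_apply hpp.ne_zero]
    simp only [hpp.coprime_iff_not_dvd]
    by_cases h : p ∣ k <;> simp [h, hpp, hk]
  rw [prod_congr rfl hp1]
  split_ifs with h
  · exact prod_eq_one fun p hp ↦ if_pos (h hp)
  · obtain ⟨p, hp, hpk⟩ := Finset.not_subset.1 h
    exact prod_eq_zero hp (if_neg hpk)

lemma sum_moebius_coprime_conv {k : ℕ} (hk : k ≠ 0) (g : ℕ → ℝ) (X : ℕ)
    (hg : ∀ m n, g (m * n) = g m * g n) :
    ∑ m ∈ Icc 1 X, (μ m : ℝ) * copInd k m * g m * ∑ n ∈ Icc 1 (X / m), g n =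
      ∑ n ∈ (Icc 1 X).filter (fun n ↦ n.primeFactors ⊆ k.primeFactors), g n := by
  let f1 : ArithmeticFunction ℝ := ⟨fun m ↦ (μ m : ℝ) * copInd k m * g m, by simp⟩
  let g1 : ArithmeticFunction ℝ := ⟨fun m ↦ if m = 0 then 0 else g m, by simp⟩
  have h := sum_Ioc_mul_eq_sum_sum f1 g1 X
  have hI : ∀ n, Ioc 0 n = Icc 1 n := fun n ↦ by ext; simp [Nat.succ_le_iff]
  rw [hI] at h
  have h2 : ∀ m ∈ Icc 1 X, f1 m * ∑ n ∈ Ioc 0 (X / m), g1 n =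
      (μ m : ℝ) * copInd k m * g m * ∑ n ∈ Icc 1 (X / m), g n := by
    intro m _
    rw [hI]
    congr 1
    refine sum_congr rfl fun n hn ↦ ?_
    have := (mem_Icc.1 hn).1
    simp only [g1, coe_mk]
    rw [if_neg (by lia)]
  rw [← sum_congr rfl h2, ← h, sum_filter]
  refine sum_congr rfl fun n hn ↦ ?_
  have hn0 : n ≠ 0 := by have := (mem_Icc.1 hn).1; lia
  rw [mul_apply, Nat.sum_divisorsAntidiagonal (fun d e ↦ f1 d * g1 e)]
  have h3 : ∀ d ∈ n.divisors, f1 d * g1 (n / d) = ((μ d : ℝ) * copInd k d) * g n := by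
    intro d hd
    have hdn := Nat.dvd_of_mem_divisors hd
    have : n / d ≠ 0 := (Nat.div_pos (Nat.le_of_dvd (Nat.pos_of_ne_zero hn0) hdn)
      (Nat.pos_of_mem_divisors hd)).ne'
    simp only [f1, g1, coe_mk]
    rw [if_neg this, mul_assoc, ← hg, Nat.mul_div_cancel' hdn]
  rw [sum_congr rfl h3, ← sum_mul, sum_moebius_copInd hn0 hk]
  split_ifs <;> simp

lemma abs_moebius_le_one (m : ℕ) : |(μ m : ℝ)| ≤ 1 := by
  exact_mod_cast ArithmeticFunction.abs_moebius_le_one (n := m)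

lemma copInd_nonneg (k m : ℕ) : 0 ≤ copInd k m := by
  simp only [copInd, coe_mk]; split_ifs <;> simp

lemma copInd_le_one (k m : ℕ) : copInd k m ≤ 1 := by
  simp only [copInd, coe_mk]; split_ifs <;> simp

lemma abs_moebius_copInd_le (k m : ℕ) : |(μ m : ℝ) * copInd k m| ≤ 1 := by
  rw [abs_mul, abs_of_nonneg (copInd_nonneg k m)]
  exact mul_le_one₀ (abs_moebius_le_one m) (copInd_nonneg k m) (copInd_le_one k m)

lemma abs_sum_moebius_coprime_div_le {k : ℕ} (hk : k ≠ 0) (X : ℕ) :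
    |∑ m ∈ Icc 1 X, (μ m : ℝ) * copInd k m / m| ≤ 2 := by
  rcases Nat.eq_zero_or_pos X with rfl | hX
  · simp
  have hXr : (0 : ℝ) < X := by exact_mod_cast hX
  have h := sum_moebius_coprime_conv hk (fun _ ↦ 1) X (by simp)
  have h2 : |∑ m ∈ Icc 1 X, ((μ m : ℝ) * copInd k m * 1 * ∑ n ∈ Icc 1 (X / m), (1 : ℝ))| ≤ X := by
    rw [h, sum_const, nsmul_eq_mul, mul_one, abs_of_nonneg (by positivity)]
    exact_mod_cast (card_filter_le _ _).trans (by simp)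
  have h3 : |X * ∑ m ∈ Icc 1 X, (μ m : ℝ) * copInd k m / m -
      ∑ m ∈ Icc 1 X, ((μ m : ℝ) * copInd k m * 1 * ∑ n ∈ Icc 1 (X / m), (1 : ℝ))| ≤ X := by
    rw [mul_sum, ← sum_sub_distrib]
    refine (abs_sum_le_sum_abs _ _).trans ?_
    calc _ ≤ ∑ m ∈ Icc 1 X, (1 : ℝ) := by
          refine sum_le_sum fun m hm ↦ ?_
          have hm1 : (0 : ℝ) < m := by exact_mod_cast (mem_Icc.1 hm).1
          have : (X : ℝ) * ((μ m : ℝ) * copInd k m / m) -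
              (μ m : ℝ) * copInd k m * 1 * ∑ n ∈ Icc 1 (X / m), (1 : ℝ) =
              ((μ m : ℝ) * copInd k m) * ((X : ℝ) / m - (X / m : ℕ)) := by
            simp; ring
          rw [this, abs_mul]
          refine mul_le_one₀ (abs_moebius_copInd_le k m) (abs_nonneg _) ?_
          rw [← Nat.floor_div_eq_div (K := ℝ), abs_of_nonneg]
          · linarith [Nat.lt_floor_add_one ((X : ℝ) / m)]
          · linarith [Nat.floor_le (show (0 : ℝ) ≤ (X : ℝ) / m by positivity)]
      _ = X := by simp
  have h4 : |(X : ℝ) * ∑ m ∈ Icc 1 X, (μ m : ℝ) * copInd k m / m| ≤ X * 2 := by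
    have := abs_sub_abs_le_abs_sub (X * ∑ m ∈ Icc 1 X, (μ m : ℝ) * copInd k m / m)
      (∑ m ∈ Icc 1 X, ((μ m : ℝ) * copInd k m * 1 * ∑ n ∈ Icc 1 (X / m), (1 : ℝ)))
    linarith
  rw [abs_mul, abs_of_pos hXr] at h4
  exact le_of_mul_le_mul_left h4 hXr

lemma abs_harmonic_sub_log_le {t : ℝ} (ht : 1 ≤ t) :
    |∑ n ∈ Icc 1 ⌊t⌋₊, (n : ℝ)⁻¹ - Real.log t - Real.eulerMascheroniConstant| ≤ 2 / t := by
  set n := ⌊t⌋₊ with hn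
  have hn1 : 1 ≤ n := (Nat.one_le_floor_iff t).2 ht
  have hnr : (1 : ℝ) ≤ n := by exact_mod_cast hn1
  have e1 : (harmonic n : ℝ) = ∑ n ∈ Icc 1 n, (n : ℝ)⁻¹ := by
    rw [harmonic_eq_sum_Icc]; push_cast; rfl
  have l1 := Real.eulerMascheroniSeq_lt_eulerMascheroniConstant n
  have l2 := Real.eulerMascheroniConstant_lt_eulerMascheroniSeq' n
  rw [Real.eulerMascheroniSeq, e1] at l1
  rw [Real.eulerMascheroniSeq', if_neg (by lia), e1] at l2
  have a1 : (n : ℝ) ≤ t := Nat.floor_le (by linarith)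
  have a2 : t < n + 1 := Nat.lt_floor_add_one t
  have b1 := Real.log_le_log (by linarith) a1
  have b2 := Real.log_le_log (by linarith) a2.le
  have b3 : Real.log (n + 1) - Real.log n ≤ 1 / n := by
    rw [← Real.log_div (by linarith) (by linarith)]
    have := Real.log_le_sub_one_of_pos (show (0 : ℝ) < ((n : ℝ) + 1) / n by positivity)
    refine this.trans (le_of_eq ?_)
    field_simp; ring
  have b4 : (1 : ℝ) / n ≤ 2 / t := by
    rw [div_le_div_iff₀ (by linarith) (by linarith)]; linarith
  rw [abs_le]
  constructor <;> linarith

lemma one_le_div_totient {k : ℕ} (hk : k ≠ 0) : (1 : ℝ) ≤ k / k.totient := by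
  rw [one_le_div (by exact_mod_cast Nat.totient_pos.2 (Nat.pos_of_ne_zero hk))]
  exact_mod_cast Nat.totient_le k

lemma abs_sum_moebius_coprime_log_le {k : ℕ} (hk : k ≠ 0) {x : ℝ} (hx : 1 ≤ x) :
    |∑ m ∈ Icc 1 ⌊x⌋₊, (μ m : ℝ) * copInd k m / m * Real.log (x / m)| ≤
      6 * (k / k.totient) := by
  set X := ⌊x⌋₊ with hX
  have hXx : (X : ℝ) ≤ x := Nat.floor_le (by linarith)
  have h := sum_moebius_coprime_conv hk (fun n ↦ (n : ℝ)⁻¹) X (by simp [mul_comm])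
  have h0 := sum_inv_smooth_le hk X
  have hM := abs_sum_moebius_coprime_div_le hk X
  have h1 := one_le_div_totient hk
  set γ := Real.eulerMascheroniConstant with hγ
  have hγ1 : |γ| ≤ 1 := by
    have := Real.one_half_lt_eulerMascheroniConstant
    have := Real.eulerMascheroniConstant_lt_two_thirds
    rw [abs_le]; constructor <;> linarith
  set S := ∑ n ∈ (Icc 1 X).filter (fun n ↦ n.primeFactors ⊆ k.primeFactors), (n : ℝ)⁻¹ with hS
  have hS0 : 0 ≤ S := sum_nonneg fun _ _ ↦ by positivity
  have h2 : |∑ m ∈ Icc 1 X, (μ m : ℝ) * copInd k m / m * Real.log (x / m) +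
      γ * (∑ m ∈ Icc 1 X, (μ m : ℝ) * copInd k m / m) - S| ≤ 2 := by
    rw [← h, mul_sum, ← sum_add_distrib, ← sum_sub_distrib]
    refine (abs_sum_le_sum_abs _ _).trans ?_
    calc _ ≤ ∑ m ∈ Icc 1 X, 2 / x := by
          refine sum_le_sum fun m hm ↦ ?_
          have hm1 : (1 : ℝ) ≤ m := by exact_mod_cast (mem_Icc.1 hm).1
          have hmX : (m : ℝ) ≤ x := le_trans (by exact_mod_cast (mem_Icc.1 hm).2) hXx
          have hxm : 1 ≤ x / m := (one_le_div (by linarith)).2 hmX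
          have hH := abs_harmonic_sub_log_le hxm
          have hfl : ⌊x / (m : ℝ)⌋₊ = X / m := Nat.floor_div_natCast x m
          rw [hfl] at hH
          have : (μ m : ℝ) * copInd k m / m * Real.log (x / m) +
              γ * ((μ m : ℝ) * copInd k m / m) -
              (μ m : ℝ) * copInd k m * (m : ℝ)⁻¹ * ∑ n ∈ Icc 1 (X / m), (n : ℝ)⁻¹ =
              -(((μ m : ℝ) * copInd k m) * ((m : ℝ)⁻¹ * (∑ n ∈ Icc 1 (X / m), (n : ℝ)⁻¹ -
                Real.log (x / m) - γ))) := by ring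
          rw [this, abs_neg, abs_mul _ ((m : ℝ)⁻¹ * _), abs_mul (m : ℝ)⁻¹, abs_of_pos (show (0 : ℝ) < (m : ℝ)⁻¹ by positivity)]
          calc _ ≤ 1 * ((m : ℝ)⁻¹ * (2 / (x / m))) := by
                gcongr
                exact abs_moebius_copInd_le k m
            _ = 2 / x := by field_simp
      _ ≤ 2 := by
          rw [sum_const, nsmul_eq_mul]
          simp only [Nat.card_Icc, Nat.add_sub_cancel]
          rw [← mul_div_assoc, div_le_iff₀ (by linarith)]
          linarith
  have h3 : |γ * (∑ m ∈ Icc 1 X, (μ m : ℝ) * copInd k m / m)| ≤ 2 := by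
    rw [abs_mul]; nlinarith [abs_nonneg γ]
  rw [abs_le] at h2 h3 ⊢
  constructor <;> linarith [h2.1, h2.2, h3.1, h3.2]

lemma integral_max_sub_mul_exp {δ X t : ℝ} (ht0 : 0 ≤ t) (htX : t ≤ X) :
    ∫ v in (0 : ℝ)..X, max (t - v) 0 * ((2 * δ + δ ^ 2 * v) * Real.exp (δ * v)) =
      t * Real.exp (δ * t) - t := by
  have hc : Continuous fun v : ℝ ↦
      max (t - v) 0 * ((2 * δ + δ ^ 2 * v) * Real.exp (δ * v)) := by fun_prop
  rw [← intervalIntegral.integral_add_adjacent_intervals (b := t)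
    (hc.intervalIntegrable _ _) (hc.intervalIntegrable _ _)]
  have h2 : ∫ v in t..X, max (t - v) 0 * ((2 * δ + δ ^ 2 * v) * Real.exp (δ * v)) = 0 := by
    rw [intervalIntegral.integral_congr (g := fun _ ↦ 0), intervalIntegral.integral_zero]
    intro v hv
    rw [Set.uIcc_of_le htX] at hv
    beta_reduce
    rw [max_eq_right (by linarith [hv.1]), zero_mul]
  have h1 : ∫ v in (0 : ℝ)..t, max (t - v) 0 * ((2 * δ + δ ^ 2 * v) * Real.exp (δ * v)) =
      ∫ v in (0 : ℝ)..t, (t - v) * ((2 * δ + δ ^ 2 * v) * Real.exp (δ * v)) := by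
    refine intervalIntegral.integral_congr fun v hv ↦ ?_
    rw [Set.uIcc_of_le ht0] at hv
    rw [max_eq_left (by linarith [hv.2])]
  rw [h2, h1, add_zero]
  have hd : ∀ v ∈ Set.uIcc 0 t, HasDerivAt
      (fun v ↦ (t - v) * ((1 + δ * v) * Real.exp (δ * v)) + v * Real.exp (δ * v))
      ((t - v) * ((2 * δ + δ ^ 2 * v) * Real.exp (δ * v))) v := by
    intro v _
    have he : HasDerivAt (fun v ↦ Real.exp (δ * v)) (Real.exp (δ * v) * (δ * 1)) v :=
      ((hasDerivAt_id v).const_mul δ).exp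
    have h1 : HasDerivAt (fun v : ℝ ↦ t - v) (-1) v := (hasDerivAt_id v).const_sub t
    have h3 : HasDerivAt (fun v : ℝ ↦ 1 + δ * v) (δ * 1) v :=
      ((hasDerivAt_id v).const_mul δ).const_add 1
    refine ((h1.mul (h3.mul he)).add ((hasDerivAt_id v).mul he)).congr_deriv ?_
    simp only [id, Pi.mul_apply]
    ring
  rw [intervalIntegral.integral_eq_sub_of_hasDerivAt hd
    (Continuous.intervalIntegrable (by fun_prop) _ _)]
  simp

lemma abs_sum_mul_exp_le {ι : Type*} (I : Finset ι) (c t : ι → ℝ) {δ X C : ℝ} (hδ : 0 ≤ δ)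
    (hX : 0 ≤ X) (hδX : δ * X ≤ 1) (ht : ∀ i ∈ I, 0 ≤ t i ∧ t i ≤ X)
    (hB : ∀ v, 0 ≤ v → v ≤ X → |∑ i ∈ I, c i * max (t i - v) 0| ≤ C) :
    |∑ i ∈ I, c i * (t i * Real.exp (δ * t i))| ≤ 10 * C := by
  have hC : 0 ≤ C := (abs_nonneg _).trans (hB 0 le_rfl hX)
  have h1 : ∑ i ∈ I, c i * (t i * Real.exp (δ * t i)) = ∑ i ∈ I, c i * max (t i - 0) 0 +
      ∫ v in (0 : ℝ)..X, (∑ i ∈ I, c i * max (t i - v) 0) *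
        ((2 * δ + δ ^ 2 * v) * Real.exp (δ * v)) := by
    have : ∀ v : ℝ, (∑ i ∈ I, c i * max (t i - v) 0) *
        ((2 * δ + δ ^ 2 * v) * Real.exp (δ * v)) =
        ∑ i ∈ I, c i * (max (t i - v) 0 * ((2 * δ + δ ^ 2 * v) * Real.exp (δ * v))) := by
      intro v; rw [sum_mul]; exact sum_congr rfl fun _ _ ↦ by ring
    simp_rw [this]
    rw [intervalIntegral.integral_finsetSum fun i _ ↦
      Continuous.intervalIntegrable (by fun_prop) _ _, ← sum_add_distrib]
    refine sum_congr rfl fun i hi ↦ ?_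
    rw [intervalIntegral.integral_const_mul, integral_max_sub_mul_exp (ht i hi).1 (ht i hi).2,
      sub_zero, max_eq_left (ht i hi).1]
    ring
  rw [h1]
  have h2 : ‖∫ v in (0 : ℝ)..X, (∑ i ∈ I, c i * max (t i - v) 0) *
      ((2 * δ + δ ^ 2 * v) * Real.exp (δ * v))‖ ≤ (C * (3 * δ * Real.exp 1)) * |X - 0| := by
    refine intervalIntegral.norm_integral_le_of_norm_le_const fun v hv ↦ ?_
    rw [Set.uIoc_of_le hX] at hv
    have hδv : δ * v ≤ 1 := (mul_le_mul_of_nonneg_left hv.2 hδ).trans hδX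
    rw [norm_mul, Real.norm_eq_abs, Real.norm_eq_abs]
    have hv0 := hv.1.le
    refine mul_le_mul (hB v hv0 hv.2) ?_ (abs_nonneg _) hC
    rw [abs_of_nonneg (by positivity)]
    refine mul_le_mul ?_ (Real.exp_le_exp.2 hδv) (by positivity) (by positivity)
    nlinarith
  have h3 := hB 0 le_rfl hX
  have he := Real.exp_one_lt_d9
  rw [Real.norm_eq_abs, sub_zero, abs_of_nonneg hX] at h2
  have h4 : (C * (3 * δ * Real.exp 1)) * X ≤ 9 * C := by
    have : (C * (3 * δ * Real.exp 1)) * X = (C * (3 * Real.exp 1)) * (δ * X) := by ring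
    rw [this]
    calc _ ≤ (C * (3 * Real.exp 1)) * 1 := by gcongr
      _ ≤ _ := by nlinarith
  refine (abs_add_le _ _).trans ?_
  linarith

lemma abs_sum_moebius_coprime_log_rpow_le {k : ℕ} (hk : k ≠ 0) {x δ : ℝ} (hx : 1 ≤ x)
    (hδ : 0 ≤ δ) (hδx : δ * Real.log x ≤ 1) :
    |∑ m ∈ Icc 1 ⌊x⌋₊, (μ m : ℝ) * copInd k m * (m : ℝ) ^ (-(1 + δ)) * Real.log (x / m)| ≤
      60 * (k / k.totient) := by
  have hX : 0 ≤ Real.log x := Real.log_nonneg hx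
  have hx0 : 0 < x := by linarith
  have hm : ∀ m ∈ Icc 1 ⌊x⌋₊, (1 : ℝ) ≤ m ∧ (m : ℝ) ≤ x := fun m hm ↦
    ⟨by exact_mod_cast (mem_Icc.1 hm).1, (Nat.le_floor_iff hx0.le).1 (mem_Icc.1 hm).2⟩
  have h := abs_sum_mul_exp_le (Icc 1 ⌊x⌋₊) (fun m ↦ (μ m : ℝ) * copInd k m / m)
    (fun m ↦ Real.log (x / m)) (C := 6 * (k / k.totient)) hδ hX hδx ?_ ?_
  · have e : ∑ m ∈ Icc 1 ⌊x⌋₊, (μ m : ℝ) * copInd k m * (m : ℝ) ^ (-(1 + δ)) * Real.log (x / m) =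
        x ^ (-δ) * ∑ m ∈ Icc 1 ⌊x⌋₊, (μ m : ℝ) * copInd k m / m *
          (Real.log (x / m) * Real.exp (δ * Real.log (x / m))) := by
      rw [mul_sum]
      refine sum_congr rfl fun m hm' ↦ ?_
      have hm1 : (0 : ℝ) < m := by linarith [(hm m hm').1]
      rw [mul_comm δ, ← Real.rpow_def_of_pos (by positivity), Real.div_rpow hx0.le hm1.le, neg_add,
        Real.rpow_add hm1, Real.rpow_neg hx0.le, Real.rpow_neg hm1.le δ, Real.rpow_neg_one]
      have := (Real.rpow_pos_of_pos hx0 δ).ne'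
      field_simp
    have hle : x ^ (-δ) ≤ 1 := Real.rpow_le_one_of_one_le_of_nonpos hx (by linarith)
    rw [e, abs_mul, abs_of_nonneg (by positivity)]
    calc _ ≤ 1 * (10 * (6 * ((k : ℝ) / k.totient))) := by gcongr
      _ = _ := by ring
  · intro m hm'
    obtain ⟨h1, h2⟩ := hm m hm'
    refine ⟨Real.log_nonneg ((one_le_div (by linarith)).2 h2), ?_⟩
    exact Real.log_le_log (by positivity) (div_le_self hx0.le h1)
  · intro v hv0 hvX
    have hy : 1 ≤ x * Real.exp (-v) := by
      rw [Real.exp_neg, ← div_eq_mul_inv, one_le_div (Real.exp_pos _)]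
      exact (Real.le_log_iff_exp_le hx0).1 hvX
    have hyx : x * Real.exp (-v) ≤ x :=
      mul_le_of_le_one_right hx0.le (Real.exp_le_one_iff.2 (by linarith))
    have := abs_sum_moebius_coprime_log_le hk hy
    convert this using 2
    symm
    rw [← sum_subset (Icc_subset_Icc_right (Nat.floor_le_floor hyx))]
    · refine sum_congr rfl fun m hm' ↦ ?_
      have hm1 : (0 : ℝ) < m := by exact_mod_cast (mem_Icc.1 hm').1
      have hmy : (m : ℝ) ≤ x * Real.exp (-v) :=
        (Nat.le_floor_iff (by positivity)).1 (mem_Icc.1 hm').2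
      have : Real.log (x / m) - v = Real.log (x * Real.exp (-v) / m) := by
        rw [mul_div_right_comm, Real.log_mul (by positivity) (by positivity), Real.log_exp]; ring
      rw [this, max_eq_left]
      exact Real.log_nonneg ((one_le_div hm1).2 hmy)
    · intro m hm' hm''
      have hm1 : (0 : ℝ) < m := by linarith [(hm m hm').1]
      have hmy : x * Real.exp (-v) < m := by
        by_contra hcon
        exact hm'' (mem_Icc.2 ⟨(mem_Icc.1 hm').1, Nat.le_floor (not_lt.1 hcon)⟩)
      have : Real.log (x / m) - v = Real.log (x * Real.exp (-v) / m) := by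
        rw [mul_div_right_comm, Real.log_mul (by positivity) (by positivity), Real.log_exp]; ring
      rw [this, max_eq_right, mul_zero]
      exact Real.log_nonpos (by positivity) ((div_le_one hm1).2 hmy.le)

/-- `(l/φ(l))²` is bounded by a divisor sum. -/
lemma div_totient_sq_le {l : ℕ} (hl : Squarefree l) :
    ((l : ℝ) / l.totient) ^ 2 ≤ 15 * ∑ d ∈ l.divisors, (d : ℝ) ^ (-(1 / 2) : ℝ) := by
  let f : ArithmeticFunction ℝ := ⟨fun n ↦ (n : ℝ) ^ (-(1 / 2) : ℝ), by
    simp only [Nat.cast_zero]; exact Real.zero_rpow (by norm_num)⟩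
  have hf : f.IsMultiplicative := IsMultiplicative.iff_ne_zero.2
    ⟨by simp [f], fun {m n} _ _ _ ↦ by
      simp only [f, coe_mk]; push_cast; exact Real.mul_rpow (by positivity) (by positivity)⟩
  have h1 := hf.prodPrimeFactors_one_add_of_squarefree hl
  have e : ∑ d ∈ l.divisors, (d : ℝ) ^ (-(1 / 2) : ℝ) = ∏ p ∈ l.primeFactors, (1 + f p) := by
    rw [h1]; rfl
  have hf0 : ∀ p, 0 ≤ f p := fun p ↦ by simp only [f, coe_mk]; positivity
  rw [e, div_totient_eq_prod hl.ne_zero, ← prod_pow]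
  let c : ℕ → ℝ := fun p ↦ if p ≤ 5 then ((p : ℝ) / (p - 1)) ^ 2 else 1
  have hc1 : ∀ p, p.Prime → 1 ≤ c p := by
    intro p hp
    simp only [c]
    split_ifs
    · have : (1 : ℝ) < p := by exact_mod_cast hp.one_lt
      refine one_le_pow₀ ?_
      rw [one_le_div (by linarith)]; linarith
    · exact le_rfl
  have key : ∀ p ∈ l.primeFactors, ((p : ℝ) / (p - 1)) ^ 2 ≤ c p * (1 + f p) := by
    intro p hp
    have hpp := Nat.prime_of_mem_primeFactors hp
    have hp1 : (1 : ℝ) < p := by exact_mod_cast hpp.one_lt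
    simp only [c]
    split_ifs with h5
    · nlinarith [hf0 p, sq_nonneg ((p : ℝ) / (p - 1))]
    · have h7 : (7 : ℝ) ≤ p := by
        have : p ≠ 6 := by rintro rfl; revert hpp; decide
        exact_mod_cast (show 7 ≤ p by lia)
      have hs : f p = (√(p : ℝ))⁻¹ := by
        simp only [f, coe_mk]; rw [Real.rpow_neg (by positivity), Real.sqrt_eq_rpow]
      rw [hs, one_mul, div_pow, div_le_iff₀ (by nlinarith)]
      set r := √(p : ℝ) with hr
      have hrp : r ^ 2 = p := Real.sq_sqrt (by linarith)
      have hr2 : 2.64 ≤ r := Real.le_sqrt_of_sq_le (by norm_num; linarith)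
      rw [← hrp]
      have : r ^ 2 * r⁻¹ = r := by field_simp
      have h3 : (2 * r ^ 2 - 1) * r ≤ (r ^ 2 - 1) ^ 2 := by
        have := mul_nonneg (sub_nonneg.2 hr2) (sq_nonneg r)
        have := mul_nonneg (mul_nonneg (sub_nonneg.2 hr2) (sq_nonneg r)) (by linarith : 0 ≤ r)
        nlinarith [mul_nonneg (sub_nonneg.2 hr2) (by linarith : 0 ≤ r)]
      have hr0 : 0 < r := by linarith
      have h4 : (2 * r ^ 2 - 1) ≤ (r ^ 2 - 1) ^ 2 * r⁻¹ := by
        rw [le_mul_inv_iff₀ hr0]; exact h3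
      nlinarith
  calc ∏ p ∈ l.primeFactors, ((p : ℝ) / (p - 1)) ^ 2
      ≤ ∏ p ∈ l.primeFactors, (c p * (1 + f p)) :=
        prod_le_prod (fun p _ ↦ sq_nonneg _) key
    _ = (∏ p ∈ l.primeFactors, c p) * ∏ p ∈ l.primeFactors, (1 + f p) := prod_mul_distrib
    _ ≤ 15 * ∏ p ∈ l.primeFactors, (1 + f p) := by
        refine mul_le_mul_of_nonneg_right ?_ (prod_nonneg fun p _ ↦ by linarith [hf0 p])
        have h2 : ∏ p ∈ l.primeFactors, c p ≤ ∏ p ∈ ({2, 3, 5} : Finset ℕ), c p := by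
          calc ∏ p ∈ l.primeFactors, c p = ∏ p ∈ l.primeFactors ∩ {2, 3, 5}, c p := by
                symm
                refine prod_subset inter_subset_left fun p hp hp' ↦ ?_
                have hpp := Nat.prime_of_mem_primeFactors hp
                simp only [c]
                rw [if_neg]
                intro h5
                apply hp'
                rw [mem_inter]
                refine ⟨hp, ?_⟩
                interval_cases p <;> revert hpp <;> decide
            _ ≤ _ := by
                rw [← prod_sdiff (inter_subset_right (s₁ := l.primeFactors) (s₂ := {2, 3, 5}))]
                refine le_mul_of_one_le_left (prod_nonneg fun p hp ↦ ?_)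
                  (one_le_prod fun p hp ↦ hc1 p ?_)
                · have := hc1 p (Nat.prime_of_mem_primeFactors (mem_inter.1 hp).1)
                  linarith
                · have hp := (mem_sdiff.1 hp).1
                  simp only [mem_insert, mem_singleton] at hp
                  rcases hp with rfl | rfl | rfl <;> norm_num
        refine h2.trans ?_
        rw [prod_insert (by decide), prod_insert (by decide), prod_singleton]
        norm_num [c]

end

section
open Finset ArithmeticFunction BoundingSieve
open scoped ArithmeticFunction.Moebius

lemma sum_rpow_neg_le {δ : ℝ} (hδ : 0 < δ) (X : ℕ) :
    ∑ n ∈ Icc 1 X, (n : ℝ) ^ (-(1 + δ)) ≤ 1 + 1 / δ := by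
  rcases Nat.eq_zero_or_pos X with rfl | hX
  · simp; positivity
  have key : ∑ n ∈ Icc 1 X, (n : ℝ) ^ (-(1 + δ)) ≤ 1 + 1 / δ - (X : ℝ) ^ (-δ) / δ := by
    induction X, hX using Nat.le_induction with
    | base => simp
    | succ n hn ih =>
      rw [sum_Icc_succ_top (by lia)]
      have hn0 : (0 : ℝ) < n := by exact_mod_cast hn
      have h1 : (0 : ℝ) < n + 1 := by linarith
      have hl : 1 / ((n : ℝ) + 1) ≤ Real.log (((n : ℝ) + 1) / n) := by
        refine le_trans (le_of_eq ?_) (Real.one_sub_inv_le_log_of_pos (by positivity))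
        field_simp; ring
      have h2 : 1 + δ / (n + 1) ≤ (((n : ℝ) + 1) / n) ^ δ := by
        rw [Real.rpow_def_of_pos (by positivity)]
        have := Real.add_one_le_exp (Real.log (((n : ℝ) + 1) / n) * δ)
        have h3 := mul_le_mul_of_nonneg_left hl hδ.le
        rw [mul_one_div] at h3
        linarith
      rw [Real.div_rpow h1.le hn0.le, le_div_iff₀ (by positivity)] at h2
      have e1 : ((n + 1 : ℕ) : ℝ) ^ (-(1 + δ)) = ((n : ℝ) + 1)⁻¹ * (((n : ℝ) + 1) ^ δ)⁻¹ := by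
        push_cast
        rw [neg_add, Real.rpow_add h1, Real.rpow_neg_one, Real.rpow_neg h1.le]
      have e2 : ((n + 1 : ℕ) : ℝ) ^ (-δ) = (((n : ℝ) + 1) ^ δ)⁻¹ := by
        push_cast; rw [Real.rpow_neg h1.le]
      rw [Real.rpow_neg hn0.le] at ih
      rw [e1, e2]
      have hA := Real.rpow_pos_of_pos hn0 δ
      have hB := Real.rpow_pos_of_pos h1 δ
      set A := (n : ℝ) ^ δ
      set B := ((n : ℝ) + 1) ^ δ
      have h4 : ((n : ℝ) + 1)⁻¹ * B⁻¹ ≤ A⁻¹ / δ - B⁻¹ / δ := by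
        have : A⁻¹ / δ - B⁻¹ / δ - ((n : ℝ) + 1)⁻¹ * B⁻¹ =
            (B - (1 + δ / (n + 1)) * A) / (A * B * δ) := by
          field_simp; ring
        have h5 : 0 ≤ (B - (1 + δ / (n + 1)) * A) / (A * B * δ) :=
          div_nonneg (by linarith) (by positivity)
        linarith
      linarith
  have : 0 ≤ (X : ℝ) ^ (-δ) / δ := by positivity
  linarith

lemma sum_inv_le_one_add_log (X : ℕ) : ∑ n ∈ Icc 1 X, (n : ℝ)⁻¹ ≤ 1 + Real.log X := by
  have := harmonic_le_one_add_log X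
  rw [harmonic_eq_sum_Icc] at this
  push_cast at this
  exact this

lemma sum_div_totient_sq_le (X : ℕ) :
    ∑ l ∈ (Icc 1 X).filter Squarefree, (l : ℝ)⁻¹ * ((l : ℝ) / l.totient) ^ 2 ≤
      45 * (1 + Real.log X) := by
  let f : ArithmeticFunction ℝ := ⟨fun n ↦ (n : ℝ)⁻¹ * (n : ℝ) ^ (-(1 / 2) : ℝ), by simp⟩
  have h := sum_Ioc_mul_eq_sum_sum f invArith X
  have hI : ∀ n, Ioc 0 n = Icc 1 n := fun n ↦ by ext; simp [Nat.succ_le_iff]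
  rw [hI] at h
  have hlog : ∀ n ∈ Icc 1 X, ∑ m ∈ Ioc 0 (X / n), invArith m ≤ 1 + Real.log X := by
    intro n hn
    rw [hI]
    calc ∑ m ∈ Icc 1 (X / n), invArith m ≤ ∑ m ∈ Icc 1 X, (m : ℝ)⁻¹ :=
          sum_le_sum_of_subset_of_nonneg (Icc_subset_Icc_right (Nat.div_le_self _ _))
            fun m _ _ ↦ (inv_nonneg.2 (Nat.cast_nonneg m) : (0 : ℝ) ≤ (m : ℝ)⁻¹)
      _ ≤ _ := sum_inv_le_one_add_log X
  have hX0 : 0 ≤ Real.log X := Real.log_natCast_nonneg X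
  have hf0 : ∀ n, 0 ≤ f n := fun n ↦ mul_nonneg (by positivity) (by positivity)
  have h1 : ∑ n ∈ Icc 1 X, (f * invArith) n ≤ 3 * (1 + Real.log X) := by
    rw [h]
    calc _ ≤ ∑ n ∈ Icc 1 X, f n * (1 + Real.log X) := by
          exact sum_le_sum fun n hn ↦ mul_le_mul_of_nonneg_left (hlog n hn) (hf0 n)
      _ = (∑ n ∈ Icc 1 X, (n : ℝ) ^ (-(1 + 1 / 2) : ℝ)) * (1 + Real.log X) := by
          rw [sum_mul]
          refine sum_congr rfl fun n hn ↦ ?_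
          have hn0 : (0 : ℝ) < n := by exact_mod_cast (mem_Icc.1 hn).1
          simp only [f, coe_mk]
          rw [neg_add, Real.rpow_add hn0, Real.rpow_neg_one]
      _ ≤ 3 * (1 + Real.log X) := by
          gcongr
          have := sum_rpow_neg_le (show (0 : ℝ) < 1 / 2 by norm_num) X
          norm_num at this ⊢
          exact this
  calc _ ≤ ∑ l ∈ (Icc 1 X).filter Squarefree, 15 * (f * invArith) l := by
        refine sum_le_sum fun l hl ↦ ?_
        have hl2 := (mem_filter.1 hl).2
        have hl0 : l ≠ 0 := hl2.ne_zero
        have e : (f * invArith) l = (l : ℝ)⁻¹ * ∑ d ∈ l.divisors, (d : ℝ) ^ (-(1 / 2) : ℝ) := by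
          rw [mul_apply, Nat.sum_divisorsAntidiagonal (fun d e ↦ f d * invArith e), mul_sum]
          refine sum_congr rfl fun d hd ↦ ?_
          have hdl := Nat.dvd_of_mem_divisors hd
          have hd0 : (d : ℝ) ≠ 0 := by exact_mod_cast (Nat.pos_of_mem_divisors hd).ne'
          have hl0' : (l : ℝ) ≠ 0 := by exact_mod_cast hl0
          simp only [f, coe_mk, invArith_apply]
          rw [Nat.cast_div hdl hd0]
          field_simp
        rw [e]
        have := div_totient_sq_le hl2
        have h0 : (0 : ℝ) ≤ (l : ℝ)⁻¹ := by positivity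
        nlinarith [mul_le_mul_of_nonneg_left this h0]
    _ ≤ ∑ l ∈ Icc 1 X, 15 * (f * invArith) l := by
        refine sum_le_sum_of_subset_of_nonneg (filter_subset _ _) fun l _ _ ↦ ?_
        have : 0 ≤ (f * invArith) l := by
          rw [mul_apply]
          refine sum_nonneg fun x _ ↦ mul_nonneg ?_ (by simp)
          simp only [f, coe_mk]; positivity
        positivity
    _ ≤ _ := by rw [← mul_sum]; linarith

/-- The linear Barban–Vehov weights `μ(d) log(y/d)`, `d ≤ y`. -/
noncomputable def bvWeight (y : ℝ) (d : ℕ) : ℝ :=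
  if (d : ℝ) ≤ y then (μ d : ℝ) * Real.log (y / d) else 0

/-- `∑_{d ∣ n, d ≤ y} μ(d) log(y/d)`. -/
noncomputable def bvSum (y : ℝ) (n : ℕ) : ℝ := ∑ d ∈ n.divisors, bvWeight y d

/-- Sieve of density `d^{-1-δ}`. -/
noncomputable def rpowSieve (δ : ℝ) (hδ : 0 ≤ δ) (Y : ℕ) : BoundingSieve where
  support := ∅
  prodPrimes := (coprimeSieve 1 Y).prodPrimes
  prodPrimes_squarefree := (coprimeSieve 1 Y).prodPrimes_squarefree
  weights := 0
  weights_nonneg := fun _ ↦ le_rfl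
  totalMass := 0
  nu := ⟨fun n ↦ (n : ℝ) ^ (-(1 + δ)), by
    simp only [Nat.cast_zero]; exact Real.zero_rpow (by linarith)⟩
  nu_mult := IsMultiplicative.iff_ne_zero.2
    ⟨by simp, fun {m n} _ _ _ ↦ by
      simp only [coe_mk]; push_cast; exact Real.mul_rpow (by positivity) (by positivity)⟩
  nu_pos_of_prime := fun p hp _ ↦ by
    have : (0 : ℝ) < p := by exact_mod_cast hp.pos
    simp only [coe_mk]; positivity
  nu_lt_one_of_prime := fun p hp _ ↦ by
    simp only [coe_mk]
    exact Real.rpow_lt_one_of_one_lt_of_neg (by exact_mod_cast hp.one_lt) (by linarith)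

@[simp] lemma rpowSieve_nu (δ : ℝ) (hδ : 0 ≤ δ) (Y d : ℕ) :
    (rpowSieve δ hδ Y).nu d = (d : ℝ) ^ (-(1 + δ)) := rfl

lemma dvd_prodPrimes_of_squarefree {Y d : ℕ} (hd : Squarefree d) (hdY : d ≤ Y) :
    d ∣ (coprimeSieve 1 Y).prodPrimes := by
  rw [← Nat.prod_primeFactors_of_squarefree hd]
  simp only [coprimeSieve]
  refine Finset.prod_dvd_prod_of_subset _ _ (fun p : ℕ ↦ p) fun p hp ↦ ?_
  have hpp := Nat.prime_of_mem_primeFactors hp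
  exact mem_filter.2 ⟨mem_Icc.2 ⟨hpp.one_lt.le, (Nat.le_of_mem_primeFactors hp).trans hdY⟩, hpp,
    hpp.one_lt.ne' ∘ Nat.dvd_one.1⟩

lemma bvWeight_eq_zero {y : ℝ} {d : ℕ}
    (h : ¬ d ∣ (coprimeSieve 1 ⌊y⌋₊).prodPrimes) : bvWeight y d = 0 := by
  rw [bvWeight]
  split_ifs with hd
  · rw [moebius_eq_zero_of_not_squarefree, Int.cast_zero, zero_mul]
    exact fun hsq ↦ h (dvd_prodPrimes_of_squarefree hsq (Nat.le_floor hd))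
  · rfl

lemma moebius_mul_copInd {l m : ℕ} (hm : m ≠ 0) :
    (μ (l * m) : ℝ) = μ l * (μ m * copInd l m) := by
  rw [copInd_apply hm]
  split_ifs with h
  · rw [mul_one]
    exact_mod_cast isMultiplicative_moebius.map_mul_of_coprime h.symm
  · rw [moebius_eq_zero_of_not_squarefree]
    · simp
    · exact fun hsq ↦ h (Nat.coprime_of_squarefree_mul hsq).symm

lemma abs_sum_multiples_bvWeight_le {δ y : ℝ} (hδ : 0 ≤ δ)
    (hδy : δ * Real.log y ≤ 1) {l : ℕ} (hl : l ≠ 0) (P : ℕ) (hP : P = (coprimeSieve 1 ⌊y⌋₊).prodPrimes) :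
    |∑ d ∈ P.divisors, if l ∣ d then (d : ℝ) ^ (-(1 + δ)) * bvWeight y d else 0| ≤
      if l ≤ ⌊y⌋₊ then (l : ℝ) ^ (-(1 + δ)) * (60 * (l / l.totient)) else 0 := by
  have hP0 : P ≠ 0 := hP ▸ (coprimeSieve 1 ⌊y⌋₊).prodPrimes_squarefree.ne_zero
  have hl0 : (0 : ℝ) < l := by exact_mod_cast Nat.pos_of_ne_zero hl
  have e1 : ∑ d ∈ P.divisors, (if l ∣ d then (d : ℝ) ^ (-(1 + δ)) * bvWeight y d else 0) =
      ∑ m ∈ Icc 1 ⌊y / l⌋₊, ((l * m : ℕ) : ℝ) ^ (-(1 + δ)) * bvWeight y (l * m) := by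
    rw [← sum_filter]
    have : ∑ m ∈ Icc 1 ⌊y / l⌋₊, ((l * m : ℕ) : ℝ) ^ (-(1 + δ)) * bvWeight y (l * m) =
        ∑ d ∈ (Icc 1 ⌊y / l⌋₊).image (l * ·), (d : ℝ) ^ (-(1 + δ)) * bvWeight y d := by
      rw [sum_image]
      intro a _ b _ h
      exact Nat.eq_of_mul_eq_mul_left (Nat.pos_of_ne_zero hl) h
    rw [this]
    have hz : ∀ d, d ∉ P.divisors.filter (l ∣ ·) ∩ (Icc 1 ⌊y / l⌋₊).image (l * ·) →
        l ∣ d → d ≠ 0 → (d : ℝ) ^ (-(1 + δ)) * bvWeight y d = 0 := by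
      intro d hd hld hd0
      obtain ⟨m, rfl⟩ := hld
      rw [mem_inter, mem_filter, mem_image, Nat.mem_divisors, not_and_or] at hd
      rcases hd with hd | hd
      · rw [bvWeight_eq_zero, mul_zero]
        rw [← hP]
        exact fun h ↦ hd ⟨⟨h, hP0⟩, dvd_mul_right _ _⟩
      · rw [bvWeight, if_neg, mul_zero]
        intro hle
        refine hd ⟨m, mem_Icc.2 ⟨?_, Nat.le_floor ?_⟩, rfl⟩
        · exact Nat.one_le_iff_ne_zero.2 (right_ne_zero_of_mul hd0)
        · rw [le_div_iff₀ hl0]; push_cast at hle; linarith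
    trans ∑ d ∈ P.divisors.filter (l ∣ ·) ∩ (Icc 1 ⌊y / l⌋₊).image (l * ·),
      (d : ℝ) ^ (-(1 + δ)) * bvWeight y d
    · symm
      refine sum_subset inter_subset_left fun d hd hd' ↦ hz d hd' (mem_filter.1 hd).2 ?_
      exact (Nat.pos_of_mem_divisors (mem_filter.1 hd).1).ne'
    · refine sum_subset inter_subset_right fun d hd hd' ↦ ?_
      obtain ⟨m, hm, rfl⟩ := mem_image.1 hd
      have := (mem_Icc.1 hm).1
      exact hz _ hd' (dvd_mul_right _ _) (mul_ne_zero hl (by lia))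
  rw [e1]
  split_ifs with hly
  · have hly' : (l : ℝ) ≤ y := (Nat.le_floor_iff' hl).1 hly
    have hx : 1 ≤ y / l := (one_le_div hl0).2 hly'
    have e2 : ∑ m ∈ Icc 1 ⌊y / l⌋₊, ((l * m : ℕ) : ℝ) ^ (-(1 + δ)) * bvWeight y (l * m) =
        (μ l : ℝ) * ((l : ℝ) ^ (-(1 + δ)) * ∑ m ∈ Icc 1 ⌊y / l⌋₊,
          (μ m : ℝ) * copInd l m * (m : ℝ) ^ (-(1 + δ)) * Real.log (y / l / m)) := by
      rw [mul_sum, mul_sum]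
      refine sum_congr rfl fun m hm ↦ ?_
      have hm1 := (mem_Icc.1 hm).1
      have hm2 : (m : ℝ) ≤ y / l := (Nat.le_floor_iff (by positivity)).1 (mem_Icc.1 hm).2
      rw [bvWeight, if_pos, moebius_mul_copInd (by lia), Nat.cast_mul,
        Real.mul_rpow (by positivity) (by positivity), div_div]
      · ring
      · push_cast; rw [le_div_iff₀ hl0] at hm2; linarith
    rw [e2, abs_mul, abs_mul, abs_of_nonneg (show 0 ≤ (l : ℝ) ^ (-(1 + δ)) by positivity)]
    have hlog : δ * Real.log (y / l) ≤ 1 := by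
      refine le_trans (mul_le_mul_of_nonneg_left (Real.log_le_log (by positivity) ?_) hδ) hδy
      exact div_le_self (by linarith) (by exact_mod_cast Nat.pos_of_ne_zero hl)
    have h3 := abs_sum_moebius_coprime_log_rpow_le hl hx hδ hlog
    calc _ ≤ 1 * ((l : ℝ) ^ (-(1 + δ)) * (60 * (l / l.totient))) := by
          gcongr
          exact abs_moebius_le_one l
      _ = _ := one_mul _
  · rw [Nat.floor_eq_zero.2, Icc_eq_empty (by simp), sum_empty, abs_zero]
    rw [div_lt_one hl0]
    exact Nat.lt_of_floor_lt (not_le.1 hly)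

lemma hasSum_multiples {f : ℕ → ℝ} {D : ℕ} (hD : D ≠ 0) {a : ℝ} (h : HasSum (fun m ↦ f (D * m)) a) :
    HasSum (fun n ↦ if D ∣ n then f n else 0) a := by
  have hinj : Function.Injective (fun m : ℕ ↦ D * m) :=
    fun a b h ↦ Nat.eq_of_mul_eq_mul_left (Nat.pos_of_ne_zero hD) h
  refine (hinj.hasSum_iff ?_).1 ?_
  · intro n hn
    rw [if_neg]
    rintro ⟨m, rfl⟩
    exact hn ⟨m, rfl⟩
  · convert h using 2
    simp

lemma sum_divisors_eq_of_support {P : ℕ} (hP : P ≠ 0) {w : ℕ → ℝ} (hw : ∀ d, ¬ d ∣ P → w d = 0) {n : ℕ}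
    (hn : n ≠ 0) :
    ∑ d ∈ n.divisors, w d = ∑ d ∈ P.divisors, if d ∣ n then w d else 0 := by
  rw [← sum_filter]
  trans ∑ d ∈ P.divisors.filter (· ∣ n) ∩ n.divisors, w d
  · symm
    refine sum_subset inter_subset_right fun d hd hd' ↦ hw d fun h ↦ hd' ?_
    simp only [mem_inter, mem_filter, Nat.mem_divisors] at hd ⊢
    exact ⟨⟨⟨h, hP⟩, hd.1⟩, hd⟩
  · refine sum_subset inter_subset_left fun d hd hd' ↦ ?_
    simp only [mem_inter, mem_filter, Nat.mem_divisors] at hd hd'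
    exact absurd ⟨hd, hd.2, hn⟩ hd'

/-- Quadratic form bound on `[1, ∞)` for sieve weights. -/
lemma sum_sq_mul_rpow_le (δ : ℝ) (hδ : 0 < δ) (Y : ℕ) (w : ℕ → ℝ)
    (hw : ∀ d, ¬ d ∣ (coprimeSieve 1 Y).prodPrimes → w d = 0) (X : ℕ) :
    ∑ n ∈ Icc 1 X, (∑ d ∈ n.divisors, w d) ^ 2 * (n : ℝ) ^ (-(1 + δ)) ≤
      (1 + 1 / δ) * (rpowSieve δ hδ.le Y).mainSum (lambdaSquared w) := by
  set s := rpowSieve δ hδ.le Y with hs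
  set P := (coprimeSieve 1 Y).prodPrimes with hP
  have hP' : s.prodPrimes = P := rfl
  have hP0 : P ≠ 0 := (coprimeSieve 1 Y).prodPrimes_squarefree.ne_zero
  have hsum : Summable fun n : ℕ ↦ (n : ℝ) ^ (-(1 + δ)) :=
    Real.summable_nat_rpow.2 (by linarith)
  set Z := ∑' n : ℕ, (n : ℝ) ^ (-(1 + δ)) with hZ
  have hZle : Z ≤ 1 + 1 / δ := by
    refine Real.tsum_le_of_sum_range_le (fun n ↦ by positivity) fun n ↦ ?_
    rcases n with _ | n
    · simp; positivity
    rw [range_eq_Ico, sum_eq_sum_Ico_succ_bot (by simp)]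
    simp only [Nat.cast_zero, zero_add]
    rw [Real.zero_rpow (by linarith), zero_add]
    exact sum_rpow_neg_le hδ n
  have hF : HasSum (fun n : ℕ ↦ ∑ d ∈ P.divisors, ∑ e ∈ P.divisors,
      w d * w e * (if d.lcm e ∣ n then (n : ℝ) ^ (-(1 + δ)) else 0))
      (∑ d ∈ P.divisors, ∑ e ∈ P.divisors, w d * w e * ((d.lcm e : ℕ) : ℝ) ^ (-(1 + δ)) * Z) := by
    refine hasSum_sum fun d hd ↦ hasSum_sum fun e he ↦ ?_
    simp only [mul_assoc]
    refine HasSum.mul_left _ (HasSum.mul_left _ ?_)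
    refine hasSum_multiples (Nat.lcm_ne_zero (Nat.pos_of_mem_divisors hd).ne'
      (Nat.pos_of_mem_divisors he).ne') ?_
    simp_rw [Nat.cast_mul, Real.mul_rpow (Nat.cast_nonneg _) (Nat.cast_nonneg _)]
    exact hsum.hasSum.mul_left _
  have hFn : ∀ n : ℕ, ∑ d ∈ P.divisors, ∑ e ∈ P.divisors,
      w d * w e * (if d.lcm e ∣ n then (n : ℝ) ^ (-(1 + δ)) else 0) =
      (∑ d ∈ P.divisors, if d ∣ n then w d else 0) ^ 2 * (n : ℝ) ^ (-(1 + δ)) := by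
    intro n
    rw [sq, sum_mul_sum, sum_mul]
    refine sum_congr rfl fun d _ ↦ ?_
    rw [sum_mul]
    refine sum_congr rfl fun e _ ↦ ?_
    simp only [Nat.lcm_dvd_iff]
    split_ifs <;> simp_all
  have hmain : ∑ d ∈ P.divisors, ∑ e ∈ P.divisors, w d * w e * ((d.lcm e : ℕ) : ℝ) ^ (-(1 + δ)) * Z
      = Z * s.mainSum (lambdaSquared w) := by
    rw [mainSum_lambdaSquared_eq_sum_sum_mul, mul_sum, hP']
    refine sum_congr rfl fun d hd ↦ ?_
    rw [mul_sum]
    refine sum_congr rfl fun e _ ↦ ?_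
    rw [← rpowSieve_nu δ hδ.le Y, ← hs, s.nu_mult.map_lcm]
    · ring
    · exact (nu_pos_of_dvd_prodPrimes (((Nat.gcd_dvd_left d e).trans
          (Nat.dvd_of_mem_divisors hd) : d.gcd e ∣ s.prodPrimes))).ne'
  rw [hmain] at hF
  simp_rw [hFn] at hF
  have hpos : 0 ≤ s.mainSum (lambdaSquared w) := by
    rw [mainSum_lambdaSquared_eq_sum_mul_sum_sq]
    exact sum_nonneg fun l hl ↦ mul_nonneg (inv_nonneg.2 (selbergTerms_pos (Nat.dvd_of_mem_divisors hl)).le) (sq_nonneg _)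
  calc ∑ n ∈ Icc 1 X, (∑ d ∈ n.divisors, w d) ^ 2 * (n : ℝ) ^ (-(1 + δ))
      = ∑ n ∈ Icc 1 X, (∑ d ∈ P.divisors, if d ∣ n then w d else 0) ^ 2 * (n : ℝ) ^ (-(1 + δ)) := by
        refine sum_congr rfl fun n hn ↦ ?_
        rw [sum_divisors_eq_of_support hP0 hw (by have := (mem_Icc.1 hn).1; lia)]
    _ ≤ Z * s.mainSum (lambdaSquared w) :=
        sum_le_hasSum _ (fun n _ ↦ by positivity) hF
    _ ≤ _ := mul_le_mul_of_nonneg_right hZle hpos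

theorem sum_bvSum_sq_mul_rpow_le {δ y : ℝ} (hδ : 0 < δ) (hy : 1 ≤ y)
    (hδy : δ * Real.log y ≤ 1) (X : ℕ) :
    ∑ n ∈ Icc 1 X, bvSum y n ^ 2 * (n : ℝ) ^ (-(1 + δ)) ≤
      (1 + 1 / δ) * (162000 * (1 + Real.log y)) := by
  refine (sum_sq_mul_rpow_le δ hδ ⌊y⌋₊ (bvWeight y) (fun d hd ↦ bvWeight_eq_zero hd) X).trans ?_
  refine mul_le_mul_of_nonneg_left ?_ (by positivity)
  set s := rpowSieve δ hδ.le ⌊y⌋₊ with hs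
  rw [mainSum_lambdaSquared_eq_sum_mul_sum_sq]
  have hP' : s.prodPrimes = (coprimeSieve 1 ⌊y⌋₊).prodPrimes := rfl
  calc _ ≤ ∑ l ∈ s.prodPrimes.divisors, if l ≤ ⌊y⌋₊ then 3600 * ((l : ℝ)⁻¹ * ((l : ℝ) / l.totient) ^ 2) else 0 := by
        refine sum_le_sum fun l hl ↦ ?_
        have hl0 : (0 : ℝ) < l := by exact_mod_cast Nat.pos_of_mem_divisors hl
        have hl1 : (1 : ℝ) ≤ l := by exact_mod_cast Nat.pos_of_mem_divisors hl
        have hld := Nat.dvd_of_mem_divisors hl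
        have h1 := abs_sum_multiples_bvWeight_le hδ.le hδy (Nat.pos_of_mem_divisors hl).ne' s.prodPrimes hP'
        have hg : (l : ℝ) ^ (-(1 + δ)) ≤ s.selbergTerms l := by
          rw [selbergTerms_apply, ← rpowSieve_nu δ hδ.le ⌊y⌋₊, ← hs]
          refine le_mul_of_one_le_right (nu_pos_of_dvd_prodPrimes hld).le ?_
          refine (prod_const_one (s := l.primeFactors)).symm.le.trans
            (prod_le_prod (fun _ _ ↦ zero_le_one) fun p hp ↦ ?_)
          have hp1 := Nat.prime_of_mem_primeFactors hp
          have hp2 := (Nat.dvd_of_mem_primeFactors hp).trans hld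
          have := s.nu_pos_of_prime p hp1 hp2
          have := s.nu_lt_one_of_prime p hp1 hp2
          exact (one_le_inv₀ (by linarith)).2 (by linarith)
        have hpos := selbergTerms_pos hld
        rw [inv_mul_le_iff₀ hpos]
        simp only [hs, rpowSieve_nu] at h1 ⊢
        rw [← sq_abs]
        split_ifs at h1 ⊢ with hly
        · refine (pow_le_pow_left₀ (abs_nonneg _) h1 2).trans ?_
          have e : ((l : ℝ) ^ (-(1 + δ)) * (60 * (l / l.totient))) ^ 2 =
            (l : ℝ) ^ (-(1 + δ)) * (3600 * ((l : ℝ) ^ (-(1 + δ)) * ((l : ℝ) / l.totient) ^ 2)) := by ring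
          rw [e]
          refine mul_le_mul hg ?_ (by positivity) hpos.le
          gcongr
          rw [← Real.rpow_neg_one]
          exact Real.rpow_le_rpow_of_exponent_le hl1 (by linarith)
        · have : |(_ : ℝ)| = 0 := le_antisymm h1 (abs_nonneg _)
          rw [this]; simp
    _ ≤ ∑ l ∈ (Icc 1 ⌊y⌋₊).filter Squarefree, 3600 * ((l : ℝ)⁻¹ * ((l : ℝ) / l.totient) ^ 2) := by
        rw [← sum_filter]
        refine sum_le_sum_of_subset_of_nonneg (fun l hl ↦ ?_) fun _ _ _ ↦ by positivity
        have h := mem_filter.1 hl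
        exact mem_filter.2 ⟨mem_Icc.2 ⟨Nat.pos_of_mem_divisors h.1, h.2⟩,
          s.prodPrimes_squarefree.squarefree_of_dvd (Nat.dvd_of_mem_divisors h.1)⟩
    _ ≤ 3600 * (45 * (1 + Real.log ⌊y⌋₊)) := by
        rw [← mul_sum]
        gcongr
        exact sum_div_totient_sq_le _
    _ ≤ _ := by
        have : Real.log ⌊y⌋₊ ≤ Real.log y :=
          Real.log_le_log (by exact_mod_cast Nat.floor_pos.2 hy) (Nat.floor_le (by linarith))
        linarith

end

section
open Finset ArithmeticFunction BoundingSieve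

lemma abs_card_modEq_sub_le {A B : ℕ} (hAB : A ≤ B) {r : ℕ} (hr : 0 < r) (v : ℕ) :
    |(((Ioc A B).filter (fun x ↦ x ≡ v [MOD r])).card : ℝ) - (B - A) / r| ≤ 1 := by
  have h := Nat.Ioc_filter_modEq_card A B hr v
  have hr' : (0 : ℚ) < r := by exact_mod_cast hr
  have hmono : ⌊((A : ℚ) - v) / r⌋ ≤ ⌊((B : ℚ) - v) / r⌋ := by
    refine Int.floor_le_floor (div_le_div_of_nonneg_right ?_ hr'.le)
    have : (A : ℚ) ≤ B := by exact_mod_cast hAB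
    linarith
  rw [max_eq_left (by linarith)] at h
  have h1 := Int.floor_le (((A : ℚ) - v) / r)
  have h2 := Int.lt_floor_add_one (((A : ℚ) - v) / r)
  have h3 := Int.floor_le (((B : ℚ) - v) / r)
  have h4 := Int.lt_floor_add_one (((B : ℚ) - v) / r)
  have e : ((B : ℚ) - v) / r - ((A : ℚ) - v) / r = (B - A) / r := by ring
  have hc : ((((Ioc A B).filter (fun x ↦ x ≡ v [MOD r])).card : ℕ) : ℚ) =
      (⌊((B : ℚ) - v) / r⌋ : ℚ) - ⌊((A : ℚ) - v) / r⌋ := by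
    have := congrArg (Int.cast : ℤ → ℚ) h
    push_cast at this
    convert this using 2
  have h5 : |((((Ioc A B).filter (fun x ↦ x ≡ v [MOD r])).card : ℕ) : ℚ) - (B - A) / r| ≤ 1 := by
    rw [hc, abs_le]; constructor <;> linarith
  have h6 := (Rat.cast_le (K := ℝ)).2 h5
  push_cast at h6
  exact h6

lemma abs_card_dvd_modEq_sub_le {A B : ℕ} (hAB : A ≤ B) {q D : ℕ} (hq : 0 < q) (hD : 0 < D)
    (hcop : Nat.Coprime D q) (v : ℕ) :
    |(((Ioc A B).filter (fun x ↦ x ≡ v [MOD q] ∧ D ∣ x)).card : ℝ) - (B - A) / (q * D)| ≤ 1 := by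
  obtain ⟨k, hk1, hk2⟩ := Nat.chineseRemainder hcop.symm v 0
  have := abs_card_modEq_sub_le hAB (Nat.mul_pos hq hD) k
  have e : (Ioc A B).filter (fun x ↦ x ≡ v [MOD q] ∧ D ∣ x) =
      (Ioc A B).filter (fun x ↦ x ≡ k [MOD q * D]) := by
    refine filter_congr fun x _ ↦ ?_
    rw [← Nat.modEq_and_modEq_iff_modEq_mul hcop.symm]
    refine and_congr ⟨fun h ↦ h.trans hk1.symm, fun h ↦ h.trans hk1⟩ ?_
    rw [← Nat.modEq_zero_iff_dvd]
    exact ⟨fun h ↦ h.trans hk2.symm, fun h ↦ h.trans hk2⟩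
  rw [e]
  push_cast at this
  exact this

/-- Properties of the optimal Selberg weights of level `R` for primes not dividing `q`. -/
structure IsSelbergWeight (q R : ℕ) (w : ℕ → ℝ) : Prop where
  one : w 1 = 1
  abs_le_one : ∀ d, |w d| ≤ 1
  dvd : ∀ d, w d ≠ 0 → d ∣ (coprimeSieve q R).prodPrimes
  le : ∀ d, w d ≠ 0 → d ≤ R
  quad : ∑ d ∈ (coprimeSieve q R).prodPrimes.divisors, ∑ e ∈ (coprimeSieve q R).prodPrimes.divisors,
    w d * w e * ((d.lcm e : ℕ) : ℝ)⁻¹ = (selbergSum (coprimeSieve q R) R)⁻¹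

lemma exists_isSelbergWeight (q : ℕ) {R : ℕ} (hR : 1 ≤ R) : ∃ w, IsSelbergWeight q R w := by
  obtain ⟨w, h1, h2, h3, h4⟩ := exists_selberg_weights (coprimeSieve q R) hR
  refine ⟨w, h1, h2, fun d hd ↦ (h3 d hd).1, fun d hd ↦ (h3 d hd).2, ?_⟩
  rw [← h4]
  refine sum_congr rfl fun d _ ↦ sum_congr rfl fun e _ ↦ ?_
  congr 1

lemma IsSelbergWeight.sum_abs_le {q R : ℕ} {w : ℕ → ℝ} (hw : IsSelbergWeight q R w) :
    ∑ d ∈ (coprimeSieve q R).prodPrimes.divisors, |w d| ≤ R := by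
  calc ∑ d ∈ (coprimeSieve q R).prodPrimes.divisors, |w d| ≤ ∑ d ∈ Icc 1 R, 1 := by
        rw [← sum_filter_ne_zero]
        refine (sum_le_sum_of_subset_of_nonneg ?_ fun _ _ _ ↦ abs_nonneg _).trans
          (sum_le_sum fun d _ ↦ hw.abs_le_one d)
        intro d hd
        have h := mem_filter.1 hd
        exact mem_Icc.2 ⟨Nat.pos_of_mem_divisors h.1, hw.le d fun h0 ↦ h.2 (by simp [h0])⟩
    _ = R := by simp

lemma sum_selberg_sq_modEq_le {q R : ℕ} (hq : 0 < q) {w : ℕ → ℝ} (hw : IsSelbergWeight q R w)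
    {A B : ℕ} (hAB : A ≤ B) (v : ℕ) :
    ∑ m ∈ (Ioc A B).filter (fun x ↦ x ≡ v [MOD q]), (∑ d ∈ m.divisors, w d) ^ 2 ≤
      (B - A) / q * (selbergSum (coprimeSieve q R) R)⁻¹ + R ^ 2 := by
  set P := (coprimeSieve q R).prodPrimes with hP
  have hP0 : P ≠ 0 := (coprimeSieve q R).prodPrimes_squarefree.ne_zero
  have hw0 : ∀ d, ¬ d ∣ P → w d = 0 := fun d hd ↦ by
    by_contra h; exact hd (hw.dvd d h)
  have e1 : ∑ m ∈ (Ioc A B).filter (fun x ↦ x ≡ v [MOD q]), (∑ d ∈ m.divisors, w d) ^ 2 =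
      ∑ d ∈ P.divisors, ∑ e ∈ P.divisors, w d * w e *
        (((Ioc A B).filter (fun x ↦ x ≡ v [MOD q] ∧ d.lcm e ∣ x)).card : ℝ) := by
    have : ∀ m ∈ (Ioc A B).filter (fun x ↦ x ≡ v [MOD q]), (∑ d ∈ m.divisors, w d) ^ 2 =
        ∑ d ∈ P.divisors, ∑ e ∈ P.divisors, w d * w e * (if d.lcm e ∣ m then 1 else 0) := by
      intro m hm
      have hm0 : m ≠ 0 := by have := (mem_Ioc.1 (mem_filter.1 hm).1).1; lia
      rw [sum_divisors_eq_of_support hP0 hw0 hm0, sq, sum_mul_sum]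
      refine sum_congr rfl fun d _ ↦ sum_congr rfl fun e _ ↦ ?_
      simp only [Nat.lcm_dvd_iff]
      split_ifs <;> simp_all
    rw [sum_congr rfl this, sum_comm]
    refine sum_congr rfl fun d _ ↦ ?_
    rw [sum_comm]
    refine sum_congr rfl fun e _ ↦ ?_
    rw [← mul_sum, sum_boole, filter_filter]
  rw [e1]
  have key : ∀ d ∈ P.divisors, ∀ e ∈ P.divisors, w d * w e *
        (((Ioc A B).filter (fun x ↦ x ≡ v [MOD q] ∧ d.lcm e ∣ x)).card : ℝ) ≤
        (B - A) / q * (w d * w e * ((d.lcm e : ℕ) : ℝ)⁻¹) + |w d| * |w e| := by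
    intro d hd e he
    have hD : 0 < d.lcm e := Nat.lcm_pos (Nat.pos_of_mem_divisors hd) (Nat.pos_of_mem_divisors he)
    have hcop : Nat.Coprime (d.lcm e) q :=
      coprime_of_dvd_coprimeSieve (Nat.lcm_dvd (Nat.dvd_of_mem_divisors hd) (Nat.dvd_of_mem_divisors he))
    have h := abs_card_dvd_modEq_sub_le hAB hq hD hcop v
    set N := (((Ioc A B).filter (fun x ↦ x ≡ v [MOD q] ∧ d.lcm e ∣ x)).card : ℝ)
    have e2 : w d * w e * N = (B - A) / q * (w d * w e * ((d.lcm e : ℕ) : ℝ)⁻¹) +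
        w d * w e * (N - (B - A) / (q * (d.lcm e : ℕ))) := by
      field_simp
      ring
    rw [e2]
    refine add_le_add le_rfl ?_
    calc _ ≤ |w d * w e * (N - (B - A) / (q * (d.lcm e : ℕ)))| := le_abs_self _
      _ = |w d| * |w e| * |N - (B - A) / (q * (d.lcm e : ℕ))| := by rw [abs_mul, abs_mul]
      _ ≤ |w d| * |w e| * 1 := by gcongr
      _ = _ := mul_one _
  refine (sum_le_sum fun d hd ↦ sum_le_sum fun e he ↦ key d hd e he).trans ?_
  simp_rw [sum_add_distrib, ← mul_sum]
  have hquad := hw.quad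
  simp_rw [mul_assoc, ← mul_sum] at hquad ⊢
  rw [hquad]
  gcongr
  rw [← sum_mul, sq]
  have := hw.sum_abs_le
  have h0 : 0 ≤ ∑ d ∈ P.divisors, |w d| := sum_nonneg fun _ _ ↦ abs_nonneg _
  exact mul_le_mul this this h0 (by positivity)

lemma sum_exp_neg_sq_mul_le (J : ℕ) :
    ∑ j ∈ Icc 1 J, Real.exp (-((j : ℝ) - 1) ^ 2 / 4) * (2 * j * Real.exp j) ≤ 2 * Real.exp 13 := by
  have h : ∀ j ∈ Icc 1 J, Real.exp (-((j : ℝ) - 1) ^ 2 / 4) * (2 * j * Real.exp j) ≤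
      2 * Real.exp 13 * (1 / 2) ^ j := by
    intro j _
    have h1 : (j : ℝ) ≤ Real.exp j := by linarith [Real.add_one_le_exp (j : ℝ)]
    have h2 : Real.exp (-(j : ℝ)) ≤ (1 / 2) ^ j := by
      rw [Real.exp_neg, one_div, inv_pow]
      refine inv_anti₀ (by positivity) ?_
      have := Real.add_one_le_exp (1 : ℝ)
      calc (2 : ℝ) ^ j ≤ (Real.exp 1) ^ j := by gcongr; linarith
        _ = Real.exp j := by rw [← Real.exp_nat_mul, mul_one]
    calc _ ≤ Real.exp (-((j : ℝ) - 1) ^ 2 / 4) * (2 * Real.exp j * Real.exp j) := by gcongr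
      _ = 2 * Real.exp (-((j : ℝ) - 1) ^ 2 / 4 + j + j) := by rw [Real.exp_add, Real.exp_add]; ring
      _ ≤ 2 * Real.exp (13 + -(j : ℝ)) := by
          refine mul_le_mul_of_nonneg_left (Real.exp_le_exp.2 ?_) (by norm_num)
          nlinarith [sq_nonneg ((j : ℝ) - 7)]
      _ = 2 * Real.exp 13 * Real.exp (-(j : ℝ)) := by rw [Real.exp_add]; ring
      _ ≤ _ := by gcongr
  refine (sum_le_sum h).trans ?_
  rw [← mul_sum]
  refine mul_le_of_le_one_right (by positivity) ?_
  have : ∀ J : ℕ, ∑ j ∈ Icc 1 J, (1 / 2 : ℝ) ^ j = 1 - (1 / 2) ^ J := by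
    intro J
    induction J with
    | zero => simp
    | succ J ih => rw [sum_Icc_succ_top (by lia), ih, pow_succ]; ring
  rw [this]
  have : (0 : ℝ) ≤ (1 / 2) ^ J := by positivity
  linarith

lemma exp_neg_sq_le_sum (u : ℝ) {J : ℕ} (hJ : 1 ≤ J) (hu : |u| ≤ J) :
    Real.exp (-u ^ 2 / 4) ≤
      ∑ j ∈ Icc 1 J, if |u| ≤ j then Real.exp (-((j : ℝ) - 1) ^ 2 / 4) else 0 := by
  set j₀ := max 1 ⌈|u|⌉₊ with hj
  have h1 : j₀ ∈ Icc 1 J := mem_Icc.2 ⟨le_max_left _ _, max_le hJ (Nat.ceil_le.2 hu)⟩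
  have h2 : |u| ≤ j₀ := (Nat.le_ceil _).trans (by exact_mod_cast le_max_right _ _)
  have h3 : 0 ≤ (j₀ : ℝ) - 1 := by
    have : (1 : ℝ) ≤ j₀ := by exact_mod_cast le_max_left 1 ⌈|u|⌉₊
    linarith
  have h4 : (j₀ : ℝ) - 1 ≤ |u| := by
    rcases le_total ⌈|u|⌉₊ 1 with h | h
    · rw [hj, max_eq_left h]; simp
    · rw [hj, max_eq_right h]
      linarith [Nat.ceil_lt_add_one (abs_nonneg u)]
  refine le_trans ?_ (single_le_sum (f := fun j : ℕ ↦ if |u| ≤ j then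
    Real.exp (-((j : ℝ) - 1) ^ 2 / 4) else 0) (fun j _ ↦ ?_) h1)
  · rw [if_pos h2]
    refine Real.exp_le_exp.2 ?_
    have := pow_le_pow_left₀ h3 h4 2
    rw [sq_abs] at this
    linarith
  · split_ifs <;> positivity

lemma sum_selberg_sq_log_le {q R : ℕ} (hq : 0 < q) (hR : 1 ≤ R) {w : ℕ → ℝ}
    (hw : IsSelbergWeight q R w) (s : Finset ℕ) (hs : ∀ m ∈ s, 0 < m) {T : ℝ} (hT : 1 ≤ T) {n : ℕ}
    (hn : 0 < n) {j : ℕ} (hj : 1 ≤ j) :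
    ∑ m ∈ s.filter (fun m ↦ m ≡ n [MOD q]), (if |T * Real.log (n / m)| ≤ j then
        (∑ d ∈ m.divisors, w d) ^ 2 else 0) ≤
      2 * j * Real.exp j * (n / (T * q) * (selbergSum (coprimeSieve q R) R)⁻¹ + R ^ 2) := by
  set S := selbergSum (coprimeSieve q R) R
  have hS : 1 ≤ S := selbergSum_ge_one _ hR
  have hn0 : (0 : ℝ) < n := by exact_mod_cast hn
  have hj1 : (1 : ℝ) ≤ j := by exact_mod_cast hj
  have hq1 : (1 : ℝ) ≤ q := by exact_mod_cast hq
  have hR1 : (1 : ℝ) ≤ R := by exact_mod_cast hR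
  have hT0 : 0 < T := by linarith
  set A := ⌈n * Real.exp (-(j / T))⌉₊ - 1 with hA
  set B := ⌊n * Real.exp (j / T)⌋₊ with hB
  have hAn : A ≤ n := by
    have : ⌈n * Real.exp (-(j / T))⌉₊ ≤ n := by
      refine Nat.ceil_le.2 (mul_le_of_le_one_right hn0.le (Real.exp_le_one_iff.2 ?_))
      have : 0 ≤ (j : ℝ) / T := by positivity
      linarith
    lia
  have hnB : n ≤ B := Nat.le_floor (le_mul_of_one_le_right hn0.le (Real.one_le_exp (by positivity)))
  have hsub : ∀ m ∈ s, |T * Real.log (n / m)| ≤ j → m ∈ Ioc A B := by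
    intro m hm h
    have hm0 : (0 : ℝ) < m := by exact_mod_cast hs m hm
    rw [abs_le, Real.log_div hn0.ne' hm0.ne'] at h
    have h1 : Real.log n - Real.log m ≤ j / T := by rw [le_div_iff₀ hT0]; linarith [h.2]
    have h2 : -(j / T) ≤ Real.log n - Real.log m := by
      rw [← neg_div, div_le_iff₀ hT0]; linarith [h.1]
    have h3 : n * Real.exp (-(j / T)) ≤ m := by
      rw [← Real.exp_log hn0, ← Real.exp_add, ← Real.exp_log hm0]
      exact Real.exp_le_exp.2 (by linarith)
    have h4 : m ≤ n * Real.exp (j / T) := by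
      rw [← Real.exp_log hn0, ← Real.exp_add, ← Real.exp_log hm0]
      exact Real.exp_le_exp.2 (by linarith)
    have h5 := Nat.ceil_le.2 h3
    have h6 : 0 < ⌈n * Real.exp (-(j / T))⌉₊ := Nat.ceil_pos.2 (by positivity)
    exact mem_Ioc.2 ⟨by lia, Nat.le_floor h4⟩
  have hlen : (B : ℝ) - A ≤ n / T * (2 * j * Real.exp j) + 1 := by
    have h6 : 0 < ⌈n * Real.exp (-(j / T))⌉₊ := Nat.ceil_pos.2 (by positivity)
    have hA' : n * Real.exp (-(j / T)) - 1 ≤ A := by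
      rw [hA, Nat.cast_sub (by lia)]
      push_cast
      linarith [Nat.le_ceil (n * Real.exp (-(j / T)))]
    have hB' : (B : ℝ) ≤ n * Real.exp (j / T) := Nat.floor_le (by positivity)
    have hx : (j : ℝ) / T ≤ j := div_le_self (by linarith) hT
    have hx0 : 0 ≤ (j : ℝ) / T := by positivity
    have h7 : Real.exp (j / T) - Real.exp (-(j / T)) ≤ 2 * (j / T) * Real.exp j := by
      have e1 := Real.add_one_le_exp (-(2 * (j / T)) : ℝ)
      have e2 : Real.exp (-(j / T)) = Real.exp (j / T) * Real.exp (-(2 * (j / T))) := by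
        rw [← Real.exp_add]; ring_nf
      have e3 := Real.exp_le_exp.2 hx
      have e4 := Real.exp_pos (j / T)
      rw [e2]
      nlinarith [mul_le_mul_of_nonneg_left e1 e4.le, mul_le_mul_of_nonneg_left e3 hx0]
    have h8 := mul_le_mul_of_nonneg_left h7 hn0.le
    have e : n * (2 * (j / T) * Real.exp j) = n / T * (2 * j * Real.exp j) := by ring
    linarith
  have h := sum_selberg_sq_modEq_le hq hw (hAn.trans hnB) n
  have h10 : ∑ m ∈ s.filter (fun m ↦ m ≡ n [MOD q]), (if |T * Real.log (n / m)| ≤ j then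
        (∑ d ∈ m.divisors, w d) ^ 2 else 0) ≤
      ∑ m ∈ (Ioc A B).filter (fun x ↦ x ≡ n [MOD q]), (∑ d ∈ m.divisors, w d) ^ 2 := by
    rw [← sum_filter]
    refine sum_le_sum_of_subset_of_nonneg ?_ fun _ _ _ ↦ sq_nonneg _
    intro m hm
    simp only [mem_filter] at hm ⊢
    exact ⟨hsub m hm.1.1 hm.2, hm.1.2⟩
  refine h10.trans (h.trans ?_)
  have hSi : S⁻¹ ≤ 1 := inv_le_one_of_one_le₀ hS
  have hSi0 : 0 < S⁻¹ := by positivity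
  have h11 : ((B : ℝ) - A) / q * S⁻¹ ≤ (n / T * (2 * j * Real.exp j) + 1) / q * S⁻¹ := by gcongr
  have h12 : (n / T * (2 * j * Real.exp j) + 1) / q * S⁻¹ =
      2 * j * Real.exp j * (n / (T * q) * S⁻¹) + 1 / q * S⁻¹ := by field_simp
  have h13 : 1 / (q : ℝ) * S⁻¹ ≤ 1 := by
    have : 1 / (q : ℝ) ≤ 1 := by rw [div_le_one (by linarith)]; exact hq1
    exact mul_le_one₀ this hSi0.le hSi
  have h14 : 2 ≤ 2 * j * Real.exp j := by
    nlinarith [Real.one_le_exp (show (0 : ℝ) ≤ j by linarith)]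
  have h15 : (1 : ℝ) ≤ R ^ 2 := one_le_pow₀ hR1
  nlinarith [mul_le_mul_of_nonneg_right h14 (show (0 : ℝ) ≤ R ^ 2 by positivity)]

lemma sum_selberg_sq_gaussian_le {q R : ℕ} (hq : 0 < q) (hR : 1 ≤ R) {w : ℕ → ℝ}
    (hw : IsSelbergWeight q R w) (s : Finset ℕ) (hs : ∀ m ∈ s, 0 < m) {T : ℝ} (hT : 1 ≤ T) {n : ℕ}
    (hn : 0 < n) :
    ∑ m ∈ s.filter (fun m ↦ m ≡ n [MOD q]), (∑ d ∈ m.divisors, w d) ^ 2 *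
        Real.exp (-(T * Real.log (n / m)) ^ 2 / 4) ≤
      2 * Real.exp 13 * (n / (T * q) * (selbergSum (coprimeSieve q R) R)⁻¹ + R ^ 2) := by
  set J := max 1 (s.sup fun m ↦ ⌈|T * Real.log (n / m)|⌉₊) with hJ
  have hJm : ∀ m ∈ s, |T * Real.log (n / m)| ≤ J := fun m hm ↦ by
    refine (Nat.le_ceil _).trans ?_
    exact_mod_cast (le_sup (f := fun m : ℕ ↦ ⌈|T * Real.log (n / m)|⌉₊) hm).trans (le_max_right _ _)
  have hS : 1 ≤ selbergSum (coprimeSieve q R) R := selbergSum_ge_one _ hR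
  calc _ ≤ ∑ m ∈ s.filter (fun m ↦ m ≡ n [MOD q]), ∑ j ∈ Icc 1 J,
        Real.exp (-((j : ℝ) - 1) ^ 2 / 4) * (if |T * Real.log (n / m)| ≤ j then
        (∑ d ∈ m.divisors, w d) ^ 2 else 0) := by
        refine sum_le_sum fun m hm ↦ ?_
        refine (mul_le_mul_of_nonneg_left (exp_neg_sq_le_sum _ (le_max_left _ _)
          (hJm m (mem_filter.1 hm).1)) (sq_nonneg _)).trans (le_of_eq ?_)
        rw [mul_sum]
        refine sum_congr rfl fun j _ ↦ ?_
        split_ifs <;> ring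
    _ ≤ ∑ j ∈ Icc 1 J, Real.exp (-((j : ℝ) - 1) ^ 2 / 4) * (2 * j * Real.exp j *
          (n / (T * q) * (selbergSum (coprimeSieve q R) R)⁻¹ + R ^ 2)) := by
        rw [sum_comm]
        refine sum_le_sum fun j hj ↦ ?_
        rw [← mul_sum]
        exact mul_le_mul_of_nonneg_left
          (sum_selberg_sq_log_le hq hR hw s hs hT hn (mem_Icc.1 hj).1) (by positivity)
    _ ≤ _ := by
        simp_rw [← mul_assoc]
        rw [← sum_mul]
        refine mul_le_mul_of_nonneg_right ?_ (by positivity)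
        simpa only [mul_assoc] using sum_exp_neg_sq_mul_le J

end

section
open Finset

lemma sum_char_mul_conj {q : ℕ} [NeZero q] (a b : ZMod q) :
    ∑ χ : DirichletCharacter ℂ q, χ a * (starRingEnd ℂ) (χ b) =
      if IsUnit b ∧ b = a then (q.totient : ℂ) else 0 := by
  by_cases hb : IsUnit b
  · have h := DirichletCharacter.sum_char_inv_mul_char_eq ℂ hb a
    simp only [hb, true_and]
    rw [← h]
    refine sum_congr rfl fun χ _ ↦ ?_
    rw [mul_comm]
    congr 1
    have h1 : (starRingEnd ℂ) (χ b) = χ⁻¹ b := MulChar.star_apply' χ b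
    rw [h1, MulChar.inv_apply]
    obtain ⟨u, rfl⟩ := hb
    rw [Ring.inverse_unit, ZMod.inv_coe_unit]
  · simp [MulChar.map_nonunit _ hb, hb]

lemma sum_char_norm_sq {q : ℕ} [NeZero q] (s : Finset ℕ) (b : ℕ → ℂ) :
    ((∑ χ : DirichletCharacter ℂ q, ‖∑ n ∈ s, b n * χ (n : ZMod q)‖ ^ 2 : ℝ) : ℂ) =
      q.totient * ∑ n ∈ s, ∑ m ∈ s, if IsUnit (m : ZMod q) ∧ m ≡ n [MOD q] then
        b n * (starRingEnd ℂ) (b m) else 0 := by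
  push_cast
  have h : ∀ χ : DirichletCharacter ℂ q, ((‖∑ n ∈ s, b n * χ (n : ZMod q)‖ : ℝ) : ℂ) ^ 2 =
      ∑ n ∈ s, ∑ m ∈ s, b n * (starRingEnd ℂ) (b m) *
        (χ (n : ZMod q) * (starRingEnd ℂ) (χ (m : ZMod q))) := by
    intro χ
    rw [← Complex.mul_conj', map_sum, sum_mul_sum]
    refine sum_congr rfl fun n _ ↦ sum_congr rfl fun m _ ↦ ?_
    rw [map_mul]; ring
  simp_rw [h]
  rw [sum_comm, mul_sum]
  refine sum_congr rfl fun n _ ↦ ?_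
  rw [sum_comm, mul_sum]
  refine sum_congr rfl fun m _ ↦ ?_
  rw [← mul_sum, sum_char_mul_conj]
  simp only [ZMod.natCast_eq_natCast_iff]
  split_ifs
  · ring
  · ring

lemma integral_exp_mul_gaussian {T : ℝ} (hT : 0 < T) (u : ℝ) :
    ∫ t : ℝ, Complex.exp (Complex.I * u * t) * Complex.exp (-(1 / T ^ 2 : ℝ) * t ^ 2) =
      ((Real.sqrt Real.pi * T * Real.exp (-(T * u) ^ 2 / 4) : ℝ) : ℂ) := by
  have h := fourierIntegral_gaussian (b := ((1 / T ^ 2 : ℝ) : ℂ))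
    (by rw [Complex.ofReal_re]; positivity) u
  rw [h]
  have hT' : (T : ℂ) ≠ 0 := by exact_mod_cast hT.ne'
  rw [Complex.ofReal_mul, Complex.ofReal_exp]
  congr 1
  · have e : ((Real.pi : ℂ) / ((1 / T ^ 2 : ℝ) : ℂ)) = ((Real.pi * T ^ 2 : ℝ) : ℂ) := by
      push_cast; field_simp
    rw [e, show (1 / 2 : ℂ) = ((1 / 2 : ℝ) : ℂ) by push_cast; rfl,
      ← Complex.ofReal_cpow (by positivity), ← Real.sqrt_eq_rpow, Real.sqrt_mul Real.pi_pos.le,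
      Real.sqrt_sq hT.le]
  · congr 1
    push_cast
    field_simp

lemma integrable_exp_mul_gaussian {T : ℝ} (hT : 0 < T) (u : ℝ) :
    MeasureTheory.Integrable fun t : ℝ ↦
      Complex.exp (Complex.I * u * t) * Complex.exp (-(1 / T ^ 2 : ℝ) * t ^ 2) := by
  have h := integrable_cexp_quadratic (b := ((1 / T ^ 2 : ℝ) : ℂ))
    (by rw [Complex.ofReal_re]; positivity) (Complex.I * u) 0
  refine h.congr (Filter.Eventually.of_forall fun t ↦ ?_)
  simp only
  rw [← Complex.exp_add]
  congr 1
  ring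

theorem sum_char_integral_sq_le {q : ℕ} [NeZero q] (s : Finset ℕ) (hs : ∀ n ∈ s, 0 < n)
    (a : ℕ → ℝ) (σ : ℝ) {T : ℝ} (hT : 0 < T) :
    ∑ χ : DirichletCharacter ℂ q, ∫ t in (-T)..T,
        ‖∑ n ∈ s, (a n : ℂ) * (n : ℂ) ^ (-(σ + t * Complex.I)) * χ (n : ZMod q)‖ ^ 2 ≤
      Real.exp 1 * (Real.sqrt Real.pi * T * (q.totient * ∑ n ∈ s, ∑ m ∈ s, if m ≡ n [MOD q] then
        |a n| * |a m| * ((n : ℝ) ^ (-σ) * (m : ℝ) ^ (-σ)) *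
          Real.exp (-(T * Real.log (n / m)) ^ 2 / 4) else 0)) := by
  set G : ℝ → ℝ := fun t ↦ ∑ χ : DirichletCharacter ℂ q,
    ‖∑ n ∈ s, (a n : ℂ) * (n : ℂ) ^ (-(σ + t * Complex.I)) * χ (n : ZMod q)‖ ^ 2 with hG
  set g : ℝ → ℝ := fun t ↦ Real.exp (-(1 / T ^ 2) * t ^ 2) with hg
  have hcont : ∀ χ : DirichletCharacter ℂ q, Continuous fun t : ℝ ↦
      ‖∑ n ∈ s, (a n : ℂ) * (n : ℂ) ^ (-(σ + t * Complex.I)) * χ (n : ZMod q)‖ ^ 2 := by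
    intro χ
    refine Continuous.pow (Continuous.norm (continuous_finset_sum _ fun n hn ↦ ?_)) 2
    refine (continuous_const.mul ?_).mul continuous_const
    refine Continuous.const_cpow (by fun_prop) (Or.inl ?_)
    exact_mod_cast (hs n hn).ne'
  have hG0 : ∀ t, 0 ≤ G t := fun t ↦ sum_nonneg fun _ _ ↦ by positivity
  have hGc : Continuous G := continuous_finset_sum _ fun χ _ ↦ hcont χ
  have hgc : Continuous g := by fun_prop
  have hGg : ∀ t, ((G t * g t : ℝ) : ℂ) = q.totient * ∑ n ∈ s, ∑ m ∈ s,
      if IsUnit (m : ZMod q) ∧ m ≡ n [MOD q] then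
        ((a n * a m * ((n : ℝ) ^ (-σ) * (m : ℝ) ^ (-σ)) : ℝ) : ℂ) *
        (Complex.exp (Complex.I * (Real.log (m / n) : ℝ) * t) *
          Complex.exp (-(1 / T ^ 2 : ℝ) * t ^ 2)) else 0 := by
    intro t
    rw [Complex.ofReal_mul, hG]
    dsimp only
    rw [sum_char_norm_sq, mul_assoc, sum_mul]
    congr 1
    refine sum_congr rfl fun n hn ↦ ?_
    rw [sum_mul]
    refine sum_congr rfl fun m hm ↦ ?_
    have hn0 : (0 : ℝ) < n := by exact_mod_cast hs n hn
    have hm0 : (0 : ℝ) < m := by exact_mod_cast hs m hm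
    have hcp : ∀ k : ℕ, (0 : ℝ) < k → (k : ℂ) ^ (-(σ + t * Complex.I)) =
        ((k : ℝ) ^ (-σ) : ℝ) * Complex.exp (-(Complex.I * (Real.log k : ℝ) * t)) := by
      intro k hk
      rw [neg_add, Complex.cpow_add _ _ (by exact_mod_cast hk.ne'), Complex.ofReal_cpow hk.le]
      congr 1
      · push_cast; rfl
      · rw [Complex.cpow_def_of_ne_zero (by exact_mod_cast hk.ne'), Complex.ofReal_log hk.le]
        congr 1; push_cast; ring
    split_ifs with hc
    · rw [hcp n hn0, hcp m hm0, hg]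
      simp only [map_mul, Complex.conj_ofReal, ← Complex.exp_conj, map_neg, Complex.conj_I]
      rw [Real.log_div hm0.ne' hn0.ne']
      push_cast
      rw [show Complex.I * (Complex.log m - Complex.log n) * t =
        -(Complex.I * Complex.log n * t) + -(-Complex.I * Complex.log m * t) by ring,
        Complex.exp_add]
      ring
    · simp
  have hint : ∀ n m : ℕ, MeasureTheory.Integrable fun t : ℝ ↦
      if IsUnit (m : ZMod q) ∧ m ≡ n [MOD q] then
        ((a n * a m * ((n : ℝ) ^ (-σ) * (m : ℝ) ^ (-σ)) : ℝ) : ℂ) *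
        (Complex.exp (Complex.I * (Real.log (m / n) : ℝ) * t) *
          Complex.exp (-(1 / T ^ 2 : ℝ) * t ^ 2)) else 0 := by
    intro n m
    split_ifs
    · exact (integrable_exp_mul_gaussian hT _).const_mul _
    · exact MeasureTheory.integrable_zero _ _ _
  have hintC : MeasureTheory.Integrable fun t ↦ ((G t * g t : ℝ) : ℂ) := by
    simp_rw [hGg]
    exact (MeasureTheory.integrable_finsetSum _ fun n _ ↦
      MeasureTheory.integrable_finsetSum _ fun m _ ↦ hint n m).const_mul _
  have hintR : MeasureTheory.Integrable fun t ↦ G t * g t := by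
    have := hintC.re
    simpa using this
  have hval : ∫ t, G t * g t = q.totient * ∑ n ∈ s, ∑ m ∈ s,
      if IsUnit (m : ZMod q) ∧ m ≡ n [MOD q] then
        (a n * a m * ((n : ℝ) ^ (-σ) * (m : ℝ) ^ (-σ))) *
        (Real.sqrt Real.pi * T * Real.exp (-(T * Real.log (m / n)) ^ 2 / 4)) else 0 := by
    have : ((∫ t, G t * g t : ℝ) : ℂ) = _ := (integral_ofReal (f := fun t ↦ G t * g t)).symm
    apply Complex.ofReal_injective
    rw [this]
    refine (MeasureTheory.integral_congr_ae (.of_forall hGg)).trans ?_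
    rw [MeasureTheory.integral_const_mul, MeasureTheory.integral_finsetSum _ fun n _ ↦
      MeasureTheory.integrable_finsetSum _ fun m _ ↦ hint n m]
    rw [Complex.ofReal_mul, Complex.ofReal_natCast, Complex.ofReal_sum]
    congr 1
    refine sum_congr rfl fun n _ ↦ ?_
    rw [MeasureTheory.integral_finsetSum _ fun m _ ↦ hint n m, Complex.ofReal_sum]
    refine sum_congr rfl fun m _ ↦ ?_
    split_ifs
    · rw [MeasureTheory.integral_const_mul, integral_exp_mul_gaussian hT, ← Complex.ofReal_mul]
    · simp
  calc _ = ∫ t in (-T)..T, G t := by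
        rw [hG, intervalIntegral.integral_finsetSum]
        exact fun χ _ ↦ (hcont χ).intervalIntegrable _ _
    _ ≤ ∫ t in (-T)..T, Real.exp 1 * (G t * g t) := by
        refine intervalIntegral.integral_mono_on (by linarith) (hGc.intervalIntegrable _ _)
          ((continuous_const.mul (hGc.mul hgc)).intervalIntegrable _ _) fun t ht ↦ ?_
        have h1 : 1 ≤ Real.exp 1 * g t := by
          rw [hg, ← Real.exp_add]
          refine Real.one_le_exp ?_
          have : t ^ 2 ≤ T ^ 2 := sq_le_sq' ht.1 ht.2
          have : t ^ 2 / T ^ 2 ≤ 1 := (div_le_one (by positivity)).2 this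
          have e : -(1 / T ^ 2) * t ^ 2 = -(t ^ 2 / T ^ 2) := by ring
          rw [e]; linarith
        nlinarith [mul_le_mul_of_nonneg_left h1 (hG0 t)]
    _ = Real.exp 1 * ∫ t in (-T)..T, G t * g t := intervalIntegral.integral_const_mul _ _
    _ ≤ Real.exp 1 * ∫ t, G t * g t := by
        refine mul_le_mul_of_nonneg_left ?_ (Real.exp_pos _).le
        rw [intervalIntegral.integral_of_le (by linarith)]
        exact MeasureTheory.setIntegral_le_integral hintR
          (Filter.Eventually.of_forall fun t ↦ mul_nonneg (hG0 t) (Real.exp_pos _).le)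
    _ ≤ _ := by
        refine mul_le_mul_of_nonneg_left ?_ (Real.exp_pos _).le
        rw [hval, mul_left_comm]
        refine mul_le_mul_of_nonneg_left ?_ (Nat.cast_nonneg _)
        rw [mul_sum]
        refine sum_le_sum fun n hn ↦ ?_
        rw [mul_sum]
        refine sum_le_sum fun m hm ↦ ?_
        have hn0 : (0 : ℝ) < n := by exact_mod_cast hs n hn
        have hm0 : (0 : ℝ) < m := by exact_mod_cast hs m hm
        have e : -(T * Real.log ((m : ℝ) / n)) ^ 2 / 4 = -(T * Real.log (n / m)) ^ 2 / 4 := by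
          rw [Real.log_div hm0.ne' hn0.ne', Real.log_div hn0.ne' hm0.ne']; ring
        have h2 : a n * a m ≤ |a n| * |a m| := (le_abs_self _).trans (abs_mul _ _).le
        have h3 : a n * a m * ((n : ℝ) ^ (-σ) * (m : ℝ) ^ (-σ)) *
          (Real.sqrt Real.pi * T * Real.exp (-(T * Real.log (n / m)) ^ 2 / 4)) ≤
          Real.sqrt Real.pi * T * (|a n| * |a m| * ((n : ℝ) ^ (-σ) * (m : ℝ) ^ (-σ)) *
          Real.exp (-(T * Real.log (n / m)) ^ 2 / 4)) := by
          have := mul_le_mul_of_nonneg_right h2 (show 0 ≤ ((n : ℝ) ^ (-σ) * (m : ℝ) ^ (-σ)) *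
            (Real.sqrt Real.pi * T * Real.exp (-(T * Real.log (n / m)) ^ 2 / 4)) by positivity)
          linarith
        rw [e]
        split_ifs with h4 h5
        · exact h3
        · exact absurd h4.2 h5
        · positivity
        · simp

/-- Mean value estimate for products of arbitrary weights with Selberg weights. -/
theorem sum_char_integral_selberg_le {q R : ℕ} [NeZero q] (hR : 1 ≤ R) {w : ℕ → ℝ}
    (hw : IsSelbergWeight q R w) (s : Finset ℕ) (hs : ∀ n ∈ s, 0 < n) (α : ℕ → ℝ) (σ : ℝ) {T : ℝ}
    (hT : 1 ≤ T) :
    ∑ χ : DirichletCharacter ℂ q, ∫ t in (-T)..T, ‖∑ n ∈ s,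
        ((α n * ∑ d ∈ n.divisors, w d : ℝ) : ℂ) * (n : ℂ) ^ (-(σ + t * Complex.I)) *
          χ (n : ZMod q)‖ ^ 2 ≤
      2 * Real.exp 14 * Real.sqrt Real.pi * ∑ n ∈ s, α n ^ 2 * (n : ℝ) ^ (-(2 * σ)) *
        (n * (q.totient / q) * (selbergSum (coprimeSieve q R) R)⁻¹ + T * q.totient * R ^ 2) := by
  set θ : ℕ → ℝ := fun n ↦ ∑ d ∈ n.divisors, w d with hθ
  have hq : 0 < q := Nat.pos_of_ne_zero (NeZero.ne q)
  have hq0 : (0 : ℝ) < q := by exact_mod_cast hq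
  refine (sum_char_integral_sq_le s hs (fun n ↦ α n * θ n) σ (by linarith)).trans ?_
  set E : ℕ → ℕ → ℝ := fun n m ↦ Real.exp (-(T * Real.log (n / m)) ^ 2 / 4) with hE
  have hEs : ∀ n ∈ s, ∀ m ∈ s, E n m = E m n := by
    intro n hn m hm
    have hn0 : (0 : ℝ) < n := by exact_mod_cast hs n hn
    have hm0 : (0 : ℝ) < m := by exact_mod_cast hs m hm
    simp only [hE]
    rw [Real.log_div hm0.ne' hn0.ne', Real.log_div hn0.ne' hm0.ne']
    congr 1; ring
  set D : ℝ := ∑ n ∈ s, ∑ m ∈ s, if m ≡ n [MOD q] then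
    α n ^ 2 * (n : ℝ) ^ (-(2 * σ)) * (θ m ^ 2 * E n m) else 0 with hD
  have hD' : D = ∑ n ∈ s, ∑ m ∈ s, if m ≡ n [MOD q] then
    α m ^ 2 * (m : ℝ) ^ (-(2 * σ)) * (θ n ^ 2 * E n m) else 0 := by
    rw [hD, sum_comm]
    refine sum_congr rfl fun n hn ↦ sum_congr rfl fun m hm ↦ ?_
    rw [hEs n hn m hm]
    exact if_congr ⟨fun h ↦ h.symm, fun h ↦ h.symm⟩ rfl rfl
  have hpair : ∑ n ∈ s, ∑ m ∈ s, (if m ≡ n [MOD q] then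
        |α n * θ n| * |α m * θ m| * ((n : ℝ) ^ (-σ) * (m : ℝ) ^ (-σ)) * E n m else 0) ≤ D := by
    have h2 : 2 * D = D + D := by ring
    suffices 2 * ∑ n ∈ s, ∑ m ∈ s, (if m ≡ n [MOD q] then
        |α n * θ n| * |α m * θ m| * ((n : ℝ) ^ (-σ) * (m : ℝ) ^ (-σ)) * E n m else 0) ≤ D + D by
      linarith
    nth_rewrite 2 [hD']
    rw [hD, mul_sum, ← sum_add_distrib]
    refine sum_le_sum fun n hn ↦ ?_
    rw [mul_sum, ← sum_add_distrib]
    refine sum_le_sum fun m hm ↦ ?_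
    split_ifs
    · have hpw : ∀ k : ℕ, (k : ℝ) ^ (-(2 * σ)) = ((k : ℝ) ^ (-σ)) ^ 2 := fun k ↦ by
        rw [← Real.rpow_natCast, ← Real.rpow_mul (Nat.cast_nonneg k)]; congr 1; push_cast; ring
      rw [hpw, hpw, abs_mul, abs_mul, ← sq_abs (α n), ← sq_abs (α m), ← sq_abs (θ n),
        ← sq_abs (θ m)]
      have hE0 : 0 ≤ E n m := (Real.exp_pos _).le
      nlinarith [mul_nonneg (sq_nonneg (|α n| * (n : ℝ) ^ (-σ) * |θ m| -
        |α m| * (m : ℝ) ^ (-σ) * |θ n|)) hE0]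
    · simp
  have hDle : D ≤ ∑ n ∈ s, α n ^ 2 * (n : ℝ) ^ (-(2 * σ)) * (2 * Real.exp 13 *
      (n / (T * q) * (selbergSum (coprimeSieve q R) R)⁻¹ + R ^ 2)) := by
    refine sum_le_sum fun n hn ↦ ?_
    rw [← sum_filter, ← mul_sum]
    exact mul_le_mul_of_nonneg_left (sum_selberg_sq_gaussian_le hq hR hw s hs hT (hs n hn))
      (by positivity)
  have hfin := mul_le_mul_of_nonneg_left (hpair.trans hDle)
    (show 0 ≤ Real.exp 1 * (Real.sqrt Real.pi * T * q.totient) by positivity)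
  refine le_trans (le_of_eq ?_) (hfin.trans (le_of_eq ?_))
  · ring
  · rw [mul_sum, mul_sum]
    refine sum_congr rfl fun n _ ↦ ?_
    rw [show (14 : ℝ) = 1 + 13 by norm_num, Real.exp_add]
    have : T ≠ 0 := by linarith
    field_simp

/-- The coefficients of the Dirichlet series `(∑ i ∈ I, β i * (k i) ^ (-s)) * LSeries f s`. -/
noncomputable def dilate {ι : Type*} (I : Finset ι) (β : ι → ℂ) (k : ι → ℕ) (f : ℕ → ℂ) (n : ℕ) :
    ℂ :=
  ∑ i ∈ I, if k i ∣ n then β i * f (n / k i) else 0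

theorem sum_Icc_ite_dvd {k : ℕ} (hk : 0 < k) (F : ℕ → ℂ) (u : ℝ) :
    ∑ n ∈ Icc 1 ⌊u⌋₊, (if k ∣ n then F (n / k) else 0) = ∑ m ∈ Icc 1 ⌊u / k⌋₊, F m := by
  rw [← sum_filter]
  symm
  refine sum_bij (fun m _ ↦ k * m) ?_ ?_ ?_ ?_
  · intro m hm
    rw [mem_Icc] at hm
    rw [mem_filter, mem_Icc]
    refine ⟨⟨Nat.mul_pos hk hm.1, ?_⟩, dvd_mul_right _ _⟩
    rw [Nat.floor_div_natCast] at hm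
    exact (Nat.mul_le_mul_left k hm.2).trans (Nat.mul_div_le _ _)
  · intro a _ b _ h
    exact Nat.eq_of_mul_eq_mul_left hk h
  · intro n hn
    rw [mem_filter, mem_Icc] at hn
    obtain ⟨m, rfl⟩ := hn.2
    refine ⟨m, ?_, rfl⟩
    rw [mem_Icc, Nat.floor_div_natCast]
    exact ⟨Nat.pos_of_mul_pos_left hn.1.1, (Nat.le_div_iff_mul_le hk).2 (by
      rw [mul_comm]; exact hn.1.2)⟩
  · intro m _
    rw [Nat.mul_div_cancel_left _ hk]

theorem hasSum_term_ite_dvd {k : ℕ} (hk : 0 < k) (b : ℂ) (f : ℕ → ℂ) {s : ℂ}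
    (hs : LSeriesSummable f s) :
    HasSum (LSeries.term (fun n ↦ if k ∣ n then b * f (n / k) else 0) s)
      (b * (k : ℂ) ^ (-s) * LSeries f s) := by
  have hinj : Function.Injective (fun m : ℕ ↦ k * m) := fun a b h ↦ Nat.eq_of_mul_eq_mul_left hk h
  rw [← hinj.hasSum_iff]
  · have h := hs.hasSum.mul_left (b * (k : ℂ) ^ (-s))
    have e : (fun i ↦ b * (k : ℂ) ^ (-s) * LSeries.term f s i) =
      LSeries.term (fun n ↦ if k ∣ n then b * f (n / k) else 0) s ∘ fun m ↦ k * m := by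
      funext m
      simp only [Function.comp_apply]
      rcases Nat.eq_zero_or_pos m with rfl | hm
      · simp
      · rw [LSeries.term_of_ne_zero (Nat.mul_pos hk hm).ne', LSeries.term_of_ne_zero hm.ne']
        simp only [dvd_mul_right, if_true, Nat.mul_div_cancel_left _ hk]
        rw [Nat.cast_mul, Complex.natCast_mul_natCast_cpow, Complex.cpow_neg]
        field_simp
    rw [← e]
    exact h
  · intro n hn
    rw [LSeries.term_def]
    split_ifs with h0 hd
    · rfl
    · exact absurd ⟨n / k, Nat.mul_div_cancel' hd⟩ hn
    · simp

theorem hasSum_term_dilate {ι : Type*} (I : Finset ι) (β : ι → ℂ) {k : ι → ℕ}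
    (hk : ∀ i ∈ I, 0 < k i) (f : ℕ → ℂ) {s : ℂ} (hs : LSeriesSummable f s) :
    HasSum (LSeries.term (dilate I β k f) s)
      ((∑ i ∈ I, β i * (k i : ℂ) ^ (-s)) * LSeries f s) := by
  rw [sum_mul]
  have h := hasSum_sum (s := I) fun i hi ↦ hasSum_term_ite_dvd (hk i hi) (β i) f hs
  convert h using 1
  funext n
  rcases eq_or_ne n 0 with rfl | hn
  · simp
  · simp only [LSeries.term_of_ne_zero hn, dilate, sum_div]

theorem norm_sum_dilate_sub_le {ι : Type*} (I : Finset ι) (β : ι → ℂ) {k : ι → ℕ}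
    (hk : ∀ i ∈ I, 0 < k i) {f : ℕ → ℂ} {κ : ℂ} {B θ : ℝ}
    (hF : ∀ u : ℝ, 0 < u → ‖∑ n ∈ Icc 1 ⌊u⌋₊, f n - κ * u‖ ≤ B * u ^ θ) {u : ℝ} (hu : 0 < u) :
    ‖∑ n ∈ Icc 1 ⌊u⌋₊, dilate I β k f n - (κ * ∑ i ∈ I, β i / k i) * u‖ ≤
      (B * ∑ i ∈ I, ‖β i‖ * (k i : ℝ) ^ (-θ)) * u ^ θ := by
  have e : ∑ n ∈ Icc 1 ⌊u⌋₊, dilate I β k f n - (κ * ∑ i ∈ I, β i / k i) * u =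
      ∑ i ∈ I, β i * (∑ m ∈ Icc 1 ⌊u / k i⌋₊, f m - κ * (u / k i : ℝ)) := by
    simp only [dilate]
    rw [sum_comm, mul_sum, sum_mul, ← sum_sub_distrib]
    refine sum_congr rfl fun i hi ↦ ?_
    have := hk i hi
    rw [sum_Icc_ite_dvd this (fun m ↦ β i * f m), ← mul_sum]
    push_cast
    ring
  rw [e, mul_sum, sum_mul]
  refine norm_sum_le_of_le _ fun i hi ↦ ?_
  have hk0 : (0 : ℝ) < k i := by exact_mod_cast hk i hi
  rw [norm_mul]
  refine (mul_le_mul_of_nonneg_left (hF _ (div_pos hu hk0)) (norm_nonneg _)).trans_eq ?_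
  rw [Real.div_rpow hu.le hk0.le, Real.rpow_neg hk0.le]
  ring

/-- Approximation of the product of a Dirichlet polynomial and an `L`-series by a partial sum. -/
theorem norm_partialSum_dilate_sub_le {ι : Type*} (I : Finset ι) (β : ι → ℂ) {k : ι → ℕ}
    (hk : ∀ i ∈ I, 0 < k i) {f : ℕ → ℂ} {κ : ℂ} {B θ : ℝ}
    (hF : ∀ u : ℝ, 0 < u → ‖∑ n ∈ Icc 1 ⌊u⌋₊, f n - κ * u‖ ≤ B * u ^ θ) (hθ : θ < 1)
    (hf : ∀ s : ℂ, 1 < s.re → LSeriesSummable f s) {g : ℂ → ℂ}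
    (hg : DifferentiableOn ℂ g {s | θ < s.re})
    (hgL : ∀ s : ℂ, 1 < s.re → g s = (s - 1) * LSeries f s)
    {N : ℝ} (hN : 1 ≤ N) {s : ℂ} (hs : θ < s.re) :
    ‖(s - 1) * ∑ n ∈ Icc 1 ⌊N⌋₊, dilate I β k f n * (n : ℂ) ^ (-s) +
        (κ * ∑ i ∈ I, β i / k i) * (N : ℂ) ^ (1 - s) -
        g s * ∑ i ∈ I, β i * (k i : ℂ) ^ (-s)‖ ≤
      ‖s - 1‖ * ((B * ∑ i ∈ I, ‖β i‖ * (k i : ℝ) ^ (-θ)) * N ^ (θ - s.re) *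
        (1 + ‖s‖ / (s.re - θ))) := by
  refine norm_partialSum_sub_le (c := dilate I β k f) (g := fun s ↦ g s * ∑ i ∈ I, β i *
    (k i : ℂ) ^ (-s)) (fun u hu ↦ norm_sum_dilate_sub_le I β hk hF (by linarith)) hθ
    (fun s hs ↦ (hasSum_term_dilate I β hk f (hf s hs)).summable) ?_ ?_ hN hs
  · refine hg.mul (Differentiable.differentiableOn ?_)
    refine Differentiable.fun_sum fun i hi ↦ (differentiable_const _).mul ?_
    have : (k i : ℂ) ≠ 0 := by exact_mod_cast (hk i hi).ne'
    exact differentiable_id.neg.const_cpow (Or.inl this)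
  · intro s hs
    have h : LSeries (dilate I β k f) s = _ := (hasSum_term_dilate I β hk f (hf s hs)).tsum_eq
    rw [h]
    rw [hgL s hs]; ring

end

section
open Finset MeromorphicOn Real Metric

theorem zeroMult_eq {f : ℂ → ℂ} {z : ℂ} (hf : AnalyticAt ℂ f z) :
    zeroMult f z = (analyticOrderAt f z).toNat := by simp [zeroMult, hf]

/-- Jensen's inequality for a finite set of zeros. -/
theorem sum_zeroMult_mul_log_le {f : ℂ → ℂ} {c : ℂ} {r : ℝ} (hr : 0 < r)
    (hf : AnalyticOnNhd ℂ f (closedBall c r)) (hc : f c ≠ 0) (S : Finset ℂ)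
    (hS : ∀ z ∈ S, z ∈ closedBall c r) :
    ∑ z ∈ S, zeroMult f z * log (r / ‖c - z‖) ≤ circleAverage (log ‖f ·‖) c r - log ‖f c‖ := by
  have habs : |r| = r := abs_of_pos hr
  have h := AnalyticOnNhd.circleAverage_log_norm (c := c) hr.ne' (f := f) (by rwa [habs]) hc
  rw [habs] at h
  set D := divisor f (closedBall c r) with hD
  have hfin : D.support.Finite := D.finiteSupport (isCompact_closedBall c r)
  have hlog : ∀ u ∈ closedBall c r, 0 ≤ log (r * ‖c - u‖⁻¹) := by
    intro u hu
    rw [mem_closedBall, dist_comm, dist_eq_norm] at hu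
    rcases eq_or_ne (c - u) 0 with h0 | h0
    · simp [h0]
    · refine log_nonneg ?_
      rw [← div_eq_mul_inv, one_le_div (norm_pos_iff.2 h0)]
      exact hu
  have hDv : ∀ u ∈ closedBall c r, (D u : ℝ) = zeroMult f u := by
    intro u hu
    rw [hD, AnalyticOnNhd.divisor_apply hf hu, zeroMult_eq (hf u hu)]
    induction analyticOrderAt f u using ENat.recTopCoe <;> rfl
  have hsupp : (Function.support fun u ↦ (D u : ℝ) * log (r * ‖c - u‖⁻¹)) ⊆
      (hfin.toFinset ∪ S : Finset ℂ) := by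
    intro u hu
    simp only [Function.mem_support, ne_eq, mul_eq_zero, not_or, Int.cast_eq_zero] at hu
    simp [hu.1]
  rw [finsum_eq_sum_of_support_subset _ hsupp] at h
  have h2 : ∑ z ∈ S, zeroMult f z * log (r / ‖c - z‖) ≤
      ∑ u ∈ hfin.toFinset ∪ S, (D u : ℝ) * log (r * ‖c - u‖⁻¹) := by
    have : ∀ z ∈ S, zeroMult f z * log (r / ‖c - z‖) = (D z : ℝ) * log (r * ‖c - z‖⁻¹) :=
      fun z hz ↦ by rw [hDv z (hS z hz), div_eq_mul_inv]
    rw [sum_congr rfl this]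
    refine sum_le_sum_of_subset_of_nonneg subset_union_right fun u _ _ ↦ ?_
    by_cases hu : u ∈ closedBall c r
    · rw [hDv u hu]
      exact mul_nonneg (Nat.cast_nonneg _) (hlog u hu)
    · have : D u = 0 := D.apply_eq_zero_of_notMem hu
      simp [this]
  linarith

theorem zeroMult_le_of_mul {f g h : ℂ → ℂ} {U : Set ℂ} (hU : IsPreconnected U) {z c : ℂ}
    (hz : z ∈ U) (hc : c ∈ U) (hh : AnalyticOnNhd ℂ h U) (hhc : h c ≠ 0) (hf : AnalyticAt ℂ f z)
    (hg : AnalyticAt ℂ g z) (hfg : ∀ s, h s = f s * g s) : zeroMult f z ≤ zeroMult h z := by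
  rw [zeroMult_eq hf, zeroMult_eq (hh z hz)]
  have e : h = f * g := funext hfg
  have htop : analyticOrderAt h z ≠ ⊤ := by
    intro ht
    have := hh.eqOn_zero_of_preconnected_of_eventuallyEq_zero hU hz (analyticOrderAt_eq_top.1 ht)
    exact hhc (this hc)
  rw [e, analyticOrderAt_mul hf hg] at htop ⊢
  refine ENat.toNat_le_toNat le_self_add htop

theorem div_le_log_div {η σ d r : ℝ} (hη : 0 < η) (hη1 : η ≤ 1) (hσ : 1 / 2 ≤ σ - η) (hσ1 : σ ≤ 1)
    (hr : r = 3 - σ + η) (hd0 : 0 < d) (hd : d ^ 2 ≤ (3 - σ) ^ 2 + η) : η / 8 ≤ log (r / d) := by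
  have hr0 : 0 < r := by linarith
  have h1 : 1 + 3 * η / 8 ≤ r ^ 2 / d ^ 2 := by
    rw [le_div_iff₀ (by positivity), hr]
    have hd2 : (3 - σ) ^ 2 + η ≤ 29 / 4 := by nlinarith
    have h8 : η * d ^ 2 ≤ η * (29 / 4) := mul_le_mul_of_nonneg_left (hd.trans hd2) hη.le
    nlinarith
  have h2 : log (r ^ 2 / d ^ 2) = 2 * log (r / d) := by
    rw [← div_pow, log_pow]; norm_num
  have h3 : log (1 + 3 * η / 8) ≤ log (r ^ 2 / d ^ 2) := log_le_log (by positivity) h1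
  have h4 := one_sub_inv_le_log_of_pos (show 0 < 1 + 3 * η / 8 by positivity)
  have h5 : 1 - (1 + 3 * η / 8)⁻¹ = (3 * η / 8) / (1 + 3 * η / 8) := by field_simp; ring
  have h6 : 3 * η / 11 ≤ (3 * η / 8) / (1 + 3 * η / 8) := by
    rw [le_div_iff₀ (by positivity)]; nlinarith
  linarith

theorem circleMap_three (t r θ : ℝ) : circleMap (3 + t * Complex.I) r θ =
    ((3 + r * cos θ : ℝ) : ℂ) + ((t + r * sin θ : ℝ) : ℂ) * Complex.I := by
  rw [circleMap, Complex.exp_mul_I]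
  push_cast; ring

section
variable {f D P : ℂ → ℂ} {σ η T₀ T₁ E : ℝ}

/-- Pointwise form of the zero detection inequality. -/
theorem sum_zeroMult_le_circleAverage (hη : 0 < η) (hη1 : η ≤ 1) (hσ : 1 / 2 ≤ σ - η)
    (hσ1 : σ ≤ 1)
    (hf : ∀ s : ℂ, σ - η ≤ s.re → T₀ - 3 ≤ s.im → s.im ≤ T₁ + 3 → AnalyticAt ℂ f s)
    (hD : Differentiable ℂ D) (hP : Continuous P)
    (hE : ∀ s : ℂ, σ - η ≤ s.re → s.re ≤ 6 → T₀ - 3 ≤ s.im → s.im ≤ T₁ + 3 →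
      ‖1 - f s * D s + P s‖ ≤ E)
    {t : ℝ} (ht0 : T₀ ≤ t) (ht1 : t ≤ T₁) (hw : ‖P (3 + t * Complex.I)‖ + E ≤ 1 / 2)
    (Z : Finset ℂ) (hZ : ∀ ρ ∈ Z, σ ≤ ρ.re ∧ ρ.re ≤ 1) :
    ∑ ρ ∈ Z, (if |t - ρ.im| ≤ √η then (zeroMult f ρ : ℝ) * (η / 8) else 0) ≤
      circleAverage (fun s ↦ 2 * ‖P s‖ ^ 2 + 2 * E ^ 2) (3 + t * Complex.I) (3 - σ + η) +
        2 * (2 * ‖P (3 + t * Complex.I)‖ ^ 2 + 2 * E ^ 2) := by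
  set c : ℂ := 3 + t * Complex.I with hc
  set r : ℝ := 3 - σ + η with hr
  have hr0 : 0 < r := by linarith
  have hr3 : r ≤ 5 / 2 := by linarith
  have hcre : c.re = 3 := by simp [hc]
  have hcim : c.im = t := by simp [hc]
  set h : ℂ → ℂ := fun s ↦ 1 - (1 - f s * D s) ^ 2 with hh
  have hball : ∀ s ∈ closedBall c r, σ - η ≤ s.re ∧ s.re ≤ 6 ∧ T₀ - 3 ≤ s.im ∧ s.im ≤ T₁ + 3 := by
    intro s hs
    rw [mem_closedBall, dist_eq_norm] at hs
    have h1 := (abs_le.1 ((Complex.abs_re_le_norm (s - c)).trans hs))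
    have h2 := (abs_le.1 ((Complex.abs_im_le_norm (s - c)).trans hs))
    rw [Complex.sub_re, hcre] at h1
    rw [Complex.sub_im, hcim] at h2
    refine ⟨?_, ?_, ?_, ?_⟩ <;> linarith [h1.1, h1.2, h2.1, h2.2]
  have hfa : ∀ s ∈ closedBall c r, AnalyticAt ℂ f s := fun s hs ↦
    hf s (hball s hs).1 (hball s hs).2.2.1 (hball s hs).2.2.2
  have hDa : ∀ s, AnalyticAt ℂ D s := fun s ↦ hD.analyticAt s
  have hha : AnalyticOnNhd ℂ h (closedBall c r) := fun s hs ↦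
    analyticAt_const.sub ((analyticAt_const.sub ((hfa s hs).mul (hDa s))).pow 2)
  have hwE : ∀ s ∈ closedBall c r, ‖1 - f s * D s‖ ≤ ‖P s‖ + E := by
    intro s hs
    have := hE s (hball s hs).1 (hball s hs).2.1 (hball s hs).2.2.1 (hball s hs).2.2.2
    have e : 1 - f s * D s = (1 - f s * D s + P s) - P s := by ring
    rw [e]
    exact (norm_sub_le _ _).trans (by linarith)
  have hE0 : 0 ≤ E := (norm_nonneg _).trans (hE c (by rw [hcre]; linarith) (by rw [hcre]; norm_num)
    (by rw [hcim]; linarith) (by rw [hcim]; linarith))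
  have hw2 : ∀ s ∈ closedBall c r, ‖1 - f s * D s‖ ^ 2 ≤ 2 * ‖P s‖ ^ 2 + 2 * E ^ 2 := by
    intro s hs
    have h1 := hwE s hs
    have h2 := norm_nonneg (1 - f s * D s)
    nlinarith [sq_nonneg (‖P s‖ - E)]
  have hcb : c ∈ closedBall c r := mem_closedBall_self hr0.le
  have hwc : ‖1 - f c * D c‖ ≤ 1 / 2 := (hwE c hcb).trans hw
  have hhc1 : 1 - ‖1 - f c * D c‖ ^ 2 ≤ ‖h c‖ := by
    rw [hh, ← norm_pow]
    have := norm_sub_norm_le (1 : ℂ) ((1 - f c * D c) ^ 2)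
    rwa [norm_one] at this
  have hx : ‖1 - f c * D c‖ ^ 2 ≤ 1 / 4 := by nlinarith [norm_nonneg (1 - f c * D c)]
  have hhc : h c ≠ 0 := by
    rw [← norm_pos_iff]; linarith
  have hlogc : -log ‖h c‖ ≤ 2 * ‖1 - f c * D c‖ ^ 2 := by
    set x := ‖1 - f c * D c‖ ^ 2
    have hx0 : 0 ≤ x := by positivity
    have h1 := one_sub_inv_le_log_of_pos (show 0 < 1 - x by linarith)
    have h2 := log_le_log (show 0 < 1 - x by linarith) hhc1
    have h3 : (1 - x)⁻¹ ≤ 1 + 2 * x := by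
      rw [inv_le_iff_one_le_mul₀ (by linarith)]; nlinarith
    linarith
  have hcirc : circleAverage (log ‖h ·‖) c r ≤
      circleAverage (fun s ↦ 2 * ‖P s‖ ^ 2 + 2 * E ^ 2) c r := by
    refine circleAverage_mono ?_ ?_ ?_
    · refine MeromorphicOn.circleIntegrable_log_norm fun s hs ↦ ?_
      rw [abs_of_pos hr0] at hs
      exact (hha s (sphere_subset_closedBall hs)).meromorphicAt
    · exact ContinuousOn.circleIntegrable hr0.le (by fun_prop)
    · intro s hs
      rw [abs_of_pos hr0] at hs
      refine le_trans ?_ (hw2 s (sphere_subset_closedBall hs))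
      rcases eq_or_ne (h s) 0 with h0 | h0
      · simp [h0]
      · have h1 : ‖h s‖ ≤ 1 + ‖1 - f s * D s‖ ^ 2 := by
          rw [hh, ← norm_pow]
          exact (norm_sub_le _ _).trans (by rw [norm_one])
        have := log_le_sub_one_of_pos (norm_pos_iff.2 h0)
        linarith
  have hmem : ∀ ρ ∈ Z.filter fun ρ ↦ |t - ρ.im| ≤ √η, ρ ∈ closedBall c r ∧
      η / 8 ≤ log (r / ‖c - ρ‖) := by
    intro ρ hρ
    rw [mem_filter] at hρ
    obtain ⟨hρ, him⟩ := hρ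
    obtain ⟨h1, h2⟩ := hZ ρ hρ
    have him2 : (t - ρ.im) ^ 2 ≤ η := by
      rw [← sq_abs, ← Real.sq_sqrt hη.le]
      exact pow_le_pow_left₀ (abs_nonneg _) him 2
    have hn : ‖c - ρ‖ ^ 2 = (3 - ρ.re) ^ 2 + (t - ρ.im) ^ 2 := by
      rw [← Complex.normSq_eq_norm_sq, Complex.normSq_apply]
      simp [hcre, hcim]; ring
    have hd : ‖c - ρ‖ ^ 2 ≤ (3 - σ) ^ 2 + η := by rw [hn]; nlinarith
    have hd0 : 0 < ‖c - ρ‖ := by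
      rw [norm_pos_iff]
      intro h0
      rw [h0] at hn
      simp at hn
      nlinarith [sq_nonneg (t - ρ.im)]
    have hlog := div_le_log_div hη hη1 hσ hσ1 hr hd0 hd
    refine ⟨?_, hlog⟩
    rw [mem_closedBall, dist_comm, dist_eq_norm]
    refine le_of_sq_le_sq ?_ hr0.le
    rw [hr]; nlinarith
  have hJ := sum_zeroMult_mul_log_le hr0 hha hhc (Z.filter fun ρ ↦ |t - ρ.im| ≤ √η)
    fun z hz ↦ (hmem z hz).1
  calc _ = ∑ ρ ∈ Z.filter fun ρ ↦ |t - ρ.im| ≤ √η, (zeroMult f ρ : ℝ) * (η / 8) :=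
        (sum_filter _ _).symm
    _ ≤ ∑ ρ ∈ Z.filter fun ρ ↦ |t - ρ.im| ≤ √η, zeroMult h ρ * log (r / ‖c - ρ‖) := by
        refine sum_le_sum fun ρ hρ ↦ ?_
        obtain ⟨h1, h2⟩ := hmem ρ hρ
        have h3 : zeroMult f ρ ≤ zeroMult h ρ := by
          refine zeroMult_le_of_mul (convex_closedBall c r).isPreconnected h1 hcb hha hhc
            (hfa ρ h1) (g := fun s ↦ D s * (2 - f s * D s))
            ((hDa ρ).mul (analyticAt_const.sub ((hfa ρ h1).mul (hDa ρ)))) fun s ↦ ?_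
          simp only [hh]; ring
        have h4 : (zeroMult f ρ : ℝ) ≤ zeroMult h ρ := by exact_mod_cast h3
        exact mul_le_mul h4 h2 (by linarith) (Nat.cast_nonneg _)
    _ ≤ _ := by linarith [hw2 c hcb]

end

end

section
open Finset MeromorphicOn Real Metric MeasureTheory

theorem intervalIntegral_ite_abs_sub_le {a b c w : ℝ} (hw : 0 ≤ w) (h1 : a ≤ c - w) (h2 : c + w ≤ b)
    (m : ℝ) : ∫ t in a..b, (if |t - c| ≤ w then m else 0) = 2 * w * m := by
  have e : (fun t ↦ if |t - c| ≤ w then m else 0) =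
      Set.indicator (Set.Icc (c - w) (c + w)) fun _ ↦ m := by
    funext t
    simp only [Set.indicator, Set.mem_Icc, abs_le]
    congr 1
    exact propext ⟨fun h ↦ ⟨by linarith [h.1], by linarith [h.2]⟩,
      fun h ↦ ⟨by linarith [h.1], by linarith [h.2]⟩⟩
  rw [e, intervalIntegral.integral_of_le (by linarith), ← integral_Icc_eq_integral_Ioc,
    setIntegral_indicator measurableSet_Icc, setIntegral_const,
    Set.inter_eq_self_of_subset_right (Set.Icc_subset_Icc h1 h2)]
  simp only [measureReal_def, Real.volume_Icc, smul_eq_mul]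
  rw [ENNReal.toReal_ofReal (by linarith)]
  ring

theorem intervalIntegrable_ite_abs_sub_le {a b c w : ℝ} (m : ℝ) :
    IntervalIntegrable (fun t ↦ if |t - c| ≤ w then m else 0) volume a b := by
  have e : (fun t ↦ if |t - c| ≤ w then m else 0) =
      Set.indicator (Set.Icc (c - w) (c + w)) fun _ ↦ m := by
    funext t
    simp only [Set.indicator, Set.mem_Icc, abs_le]
    congr 1
    exact propext ⟨fun h ↦ ⟨by linarith [h.1], by linarith [h.2]⟩,
      fun h ↦ ⟨by linarith [h.1], by linarith [h.2]⟩⟩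
  rw [e]
  have h : IntervalIntegrable (fun _ : ℝ ↦ m) volume a b := intervalIntegrable_const
  exact ⟨h.1.indicator measurableSet_Icc, h.2.indicator measurableSet_Icc⟩

section
variable {f D P : ℂ → ℂ} {σ η T₀ T₁ E : ℝ}

/-- Zero detection: the number of zeros in a rectangle is bounded by mean squares of `P`. -/
theorem sum_zeroMult_le_integral (hη : 0 < η) (hη1 : η ≤ 1) (hσ : 1 / 2 ≤ σ - η)
    (hσ1 : σ ≤ 1) (hT : T₀ ≤ T₁)
    (hf : ∀ s : ℂ, σ - η ≤ s.re → T₀ - 3 ≤ s.im → s.im ≤ T₁ + 3 → AnalyticAt ℂ f s)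
    (hD : Differentiable ℂ D) (hP : Continuous P)
    (hE : ∀ s : ℂ, σ - η ≤ s.re → s.re ≤ 6 → T₀ - 3 ≤ s.im → s.im ≤ T₁ + 3 →
      ‖1 - f s * D s + P s‖ ≤ E)
    (hw : ∀ t : ℝ, T₀ ≤ t → t ≤ T₁ → ‖P (3 + t * Complex.I)‖ + E ≤ 1 / 2)
    (Z : Finset ℂ) (hZ : ∀ ρ ∈ Z, σ ≤ ρ.re ∧ ρ.re ≤ 1 ∧ T₀ + √η ≤ ρ.im ∧ ρ.im ≤ T₁ - √η) :
    (∑ ρ ∈ Z, (zeroMult f ρ : ℝ)) * (η * √η / 4) ≤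
      (2 * π)⁻¹ * (∫ θ in (0 : ℝ)..2 * π, ∫ v in (T₀ - 3)..(T₁ + 3),
        2 * ‖P (((3 + (3 - σ + η) * cos θ : ℝ) : ℂ) + (v : ℂ) * Complex.I)‖ ^ 2) +
        4 * (∫ v in (T₀ - 3)..(T₁ + 3), ‖P (((3 : ℝ) : ℂ) + (v : ℂ) * Complex.I)‖ ^ 2) +
        6 * E ^ 2 * (T₁ - T₀) := by
  set r : ℝ := 3 - σ + η with hr
  have hr0 : 0 < r := by linarith
  have hr3 : r ≤ 5 / 2 := by linarith
  have hpi : 0 < 2 * π := by positivity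
  set Q : ℝ → ℝ → ℝ := fun t θ ↦ ‖P (((3 + r * cos θ : ℝ) : ℂ) + ((t : ℝ) : ℂ) * Complex.I)‖ ^ 2
    with hQ
  have hQc : Continuous fun p : ℝ × ℝ ↦ Q p.1 p.2 := by
    simp only [hQ]; fun_prop
  have hQs : Continuous fun p : ℝ × ℝ ↦ Q (p.1 + r * sin p.2) p.2 := by
    simp only [hQ]; fun_prop
  have hQs2 : Continuous fun p : ℝ × ℝ ↦ 2 * Q (p.2 + r * sin p.1) p.1 := by
    simp only [hQ]; fun_prop
  have hQc2 : Continuous fun p : ℝ × ℝ ↦ 2 * Q p.2 p.1 := by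
    simp only [hQ]; fun_prop
  have hca : ∀ t : ℝ, circleAverage (fun s ↦ 2 * ‖P s‖ ^ 2 + 2 * E ^ 2) (3 + t * Complex.I) r =
      (2 * π)⁻¹ * (∫ θ in (0 : ℝ)..2 * π, 2 * Q (t + r * sin θ) θ) + 2 * E ^ 2 := by
    intro t
    rw [circleAverage, smul_eq_mul]
    simp_rw [circleMap_three]
    rw [intervalIntegral.integral_add (Continuous.intervalIntegrable (by fun_prop) _ _)
      intervalIntegrable_const, intervalIntegral.integral_const, smul_eq_mul, mul_add]
    congr 1
    field_simp; ring
  have hI : Continuous fun t : ℝ ↦ ∫ θ in (0 : ℝ)..2 * π, 2 * Q (t + r * sin θ) θ := by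
    refine intervalIntegral.continuous_parametric_intervalIntegral_of_continuous' ?_ _ _
    exact continuous_const.mul hQs
  have hP3 : Continuous fun t : ℝ ↦ ‖P (3 + t * Complex.I)‖ ^ 2 := by fun_prop
  have hpt : ∀ t ∈ Set.Icc T₀ T₁,
      ∑ ρ ∈ Z, (if |t - ρ.im| ≤ √η then (zeroMult f ρ : ℝ) * (η / 8) else 0) ≤
      (2 * π)⁻¹ * (∫ θ in (0 : ℝ)..2 * π, 2 * Q (t + r * sin θ) θ) +
        4 * ‖P (3 + t * Complex.I)‖ ^ 2 + 6 * E ^ 2 := by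
    intro t ht
    have := sum_zeroMult_le_circleAverage hη hη1 hσ hσ1 hf hD hP hE ht.1 ht.2 (hw t ht.1 ht.2) Z
      fun ρ hρ ↦ ⟨(hZ ρ hρ).1, (hZ ρ hρ).2.1⟩
    rw [hca] at this
    linarith
  set S : ℝ → ℝ := fun t ↦
    ∑ ρ ∈ Z, (if |t - ρ.im| ≤ √η then (zeroMult f ρ : ℝ) * (η / 8) else 0) with hS
  have i1 : IntervalIntegrable (fun t : ℝ ↦ (2 * π)⁻¹ *
      (∫ θ in (0 : ℝ)..2 * π, 2 * Q (t + r * sin θ) θ)) volume T₀ T₁ :=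
    (continuous_const.mul hI).intervalIntegrable _ _
  have i2 : IntervalIntegrable (fun t : ℝ ↦ 4 * ‖P (3 + t * Complex.I)‖ ^ 2) volume T₀ T₁ :=
    (continuous_const.mul hP3).intervalIntegrable _ _
  have i3 : IntervalIntegrable S volume T₀ T₁ := by
    have e : S = ∑ ρ ∈ Z, fun t : ℝ ↦
        if |t - ρ.im| ≤ √η then (zeroMult f ρ : ℝ) * (η / 8) else 0 := by
      funext t
      rw [Finset.sum_apply]
    rw [e]
    exact IntervalIntegrable.sum Z fun ρ _ ↦ intervalIntegrable_ite_abs_sub_le _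
  have hint : ∫ t in T₀..T₁, S t ≤ ∫ t in T₀..T₁, ((2 * π)⁻¹ *
      (∫ θ in (0 : ℝ)..2 * π, 2 * Q (t + r * sin θ) θ) +
        4 * ‖P (3 + t * Complex.I)‖ ^ 2 + 6 * E ^ 2) :=
    intervalIntegral.integral_mono_on hT i3 ((i1.add i2).add intervalIntegrable_const) hpt
  have hL : ∫ t in T₀..T₁, S t = (∑ ρ ∈ Z, (zeroMult f ρ : ℝ)) * (η * √η / 4) := by
    rw [hS]
    rw [intervalIntegral.integral_finsetSum fun ρ _ ↦ intervalIntegrable_ite_abs_sub_le _, sum_mul]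
    refine sum_congr rfl fun ρ hρ ↦ ?_
    obtain ⟨_, _, h3, h4⟩ := hZ ρ hρ
    rw [intervalIntegral_ite_abs_sub_le (sqrt_nonneg _) (by linarith) (by linarith)]
    ring
  rw [hL] at hint
  refine hint.trans ?_
  rw [intervalIntegral.integral_add (i1.add i2) intervalIntegrable_const,
    intervalIntegral.integral_add i1 i2, intervalIntegral.integral_const_mul,
    intervalIntegral.integral_const_mul, intervalIntegral.integral_const, smul_eq_mul]
  have hsub : ∀ (g : ℝ → ℝ), Continuous g → (∀ v, 0 ≤ g v) → ∀ a : ℝ, |a| ≤ 3 →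
      ∫ t in T₀..T₁, g (t + a) ≤ ∫ v in (T₀ - 3)..(T₁ + 3), g v := by
    intro g hg hg0 a ha
    rw [abs_le] at ha
    rw [intervalIntegral.integral_comp_add_right]
    exact intervalIntegral.integral_mono_interval (by linarith) (by linarith) (by linarith)
      (Filter.Eventually.of_forall hg0) (hg.intervalIntegrable _ _)
  have hswap : ∫ t in T₀..T₁, ∫ θ in (0 : ℝ)..2 * π, 2 * Q (t + r * sin θ) θ =
      ∫ θ in (0 : ℝ)..2 * π, ∫ t in T₀..T₁, 2 * Q (t + r * sin θ) θ := by
    refine intervalIntegral_intervalIntegral_swap ?_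
    have hc : Continuous (Function.uncurry fun t θ ↦ 2 * Q (t + r * sin θ) θ) :=
      continuous_const.mul hQs
    have hK : IsCompact (Set.uIcc T₀ T₁ ×ˢ Set.uIcc (0 : ℝ) (2 * π)) :=
      isCompact_uIcc.prod isCompact_uIcc
    exact (hc.continuousOn.integrableOn_compact hK).mono_set
      (Set.prod_mono Set.uIoc_subset_uIcc Set.uIoc_subset_uIcc)
  have h1 : ∫ t in T₀..T₁, ∫ θ in (0 : ℝ)..2 * π, 2 * Q (t + r * sin θ) θ ≤
      ∫ θ in (0 : ℝ)..2 * π, ∫ v in (T₀ - 3)..(T₁ + 3), 2 * Q v θ := by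
    rw [hswap]
    have c1 : Continuous fun θ : ℝ ↦ ∫ t in T₀..T₁, 2 * Q (t + r * sin θ) θ :=
      intervalIntegral.continuous_parametric_intervalIntegral_of_continuous'
        (f := fun θ t ↦ 2 * Q (t + r * sin θ) θ)
        hQs2 _ _
    have c2 : Continuous fun θ : ℝ ↦ ∫ v in (T₀ - 3)..(T₁ + 3), 2 * Q v θ :=
      intervalIntegral.continuous_parametric_intervalIntegral_of_continuous'
        (f := fun θ v ↦ 2 * Q v θ) hQc2 _ _
    refine intervalIntegral.integral_mono_on hpi.le (c1.intervalIntegrable _ _)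
      (c2.intervalIntegrable _ _) fun θ _ ↦ ?_
    have c3 : Continuous fun v : ℝ ↦ 2 * Q v θ := by simp only [hQ]; fun_prop
    have c4 : ∀ v, 0 ≤ 2 * Q v θ := fun v ↦ mul_nonneg zero_le_two (sq_nonneg _)
    refine hsub (fun v ↦ 2 * Q v θ) c3 c4 (r * sin θ) ?_
    rw [abs_mul, abs_of_pos hr0]
    nlinarith [abs_sin_le_one θ]
  have h2 := hsub (fun v ↦ ‖P (3 + v * Complex.I)‖ ^ 2) hP3 (fun v ↦ by positivity) 0 (by simp)
  simp only [add_zero] at h2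
  have h3 := mul_le_mul_of_nonneg_left h1 (inv_nonneg.2 hpi.le)
  simp only [hQ] at h3 ⊢
  push_cast at h3 h2 ⊢
  linarith

end

end

section
open Finset ArithmeticFunction
open scoped ArithmeticFunction.Moebius

/-- Coefficients of the smoothed Möbius mollifier with break points `y < Y`. -/
noncomputable def mollCoef (y Y : ℝ) (d : ℕ) : ℝ :=
  (bvWeight Y d - bvWeight y d) / Real.log (Y / y)

noncomputable def mollSum (y Y : ℝ) (n : ℕ) : ℝ := ∑ d ∈ n.divisors, mollCoef y Y d

variable {y Y : ℝ}

theorem mollCoef_of_le (hy : 0 < y) (hyY : y < Y) {d : ℕ} (hd0 : 0 < d) (hd : (d : ℝ) ≤ y) :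
    mollCoef y Y d = μ d := by
  have hd0' : (0 : ℝ) < d := by exact_mod_cast hd0
  have hl : 0 < Real.log (Y / y) := Real.log_pos ((one_lt_div hy).2 hyY)
  rw [mollCoef, bvWeight, bvWeight, if_pos hd, if_pos (hd.trans hyY.le), ← mul_sub,
    Real.log_div (by linarith) hd0'.ne', Real.log_div hy.ne' hd0'.ne',
    div_eq_iff hl.ne', Real.log_div (by linarith) hy.ne']
  ring

theorem mollCoef_eq_zero (hyY : y < Y) {d : ℕ} (hd : Y < d) : mollCoef y Y d = 0 := by
  rw [mollCoef, bvWeight, bvWeight, if_neg (not_le.2 hd), if_neg (by linarith)]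
  simp

theorem abs_mollCoef_le_one (hy : 0 < y) (hyY : y < Y) {d : ℕ} (hd0 : 0 < d) :
    |mollCoef y Y d| ≤ 1 := by
  have hd0' : (0 : ℝ) < d := by exact_mod_cast hd0
  have hl : 0 < Real.log (Y / y) := Real.log_pos ((one_lt_div hy).2 hyY)
  rcases le_or_gt (d : ℝ) y with h | h
  · rw [mollCoef_of_le hy hyY hd0 h]
    exact abs_moebius_le_one d
  · rcases le_or_gt (d : ℝ) Y with h' | h'
    · rw [mollCoef, bvWeight, bvWeight, if_pos h', if_neg (not_le.2 h), sub_zero, abs_div, abs_mul,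
        abs_of_pos hl, div_le_one hl]
      have h1 : 0 ≤ Real.log (Y / d) := Real.log_nonneg ((one_le_div hd0').2 h')
      have h2 : Real.log (Y / d) ≤ Real.log (Y / y) := Real.log_le_log (div_pos (by linarith) hd0') (div_le_div_of_nonneg_left (by linarith) hy h.le)
      rw [abs_of_nonneg h1]
      nlinarith [abs_moebius_le_one d]
    · rw [mollCoef_eq_zero hyY h']; simp

theorem mollSum_one (hy : 1 ≤ y) (hyY : y < Y) : mollSum y Y 1 = 1 := by
  rw [mollSum, Nat.divisors_one, sum_singleton, mollCoef_of_le (by linarith) hyY one_pos (by simpa)]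
  simp

theorem mollSum_eq_zero (hy : 0 < y) (hyY : y < Y) {n : ℕ} (hn : 1 < n) (hny : (n : ℝ) ≤ y) :
    mollSum y Y n = 0 := by
  have h : mollSum y Y n = ∑ d ∈ n.divisors, (μ d : ℝ) := by
    refine sum_congr rfl fun d hd ↦ mollCoef_of_le hy hyY (Nat.pos_of_mem_divisors hd) ?_
    exact le_trans (by exact_mod_cast Nat.divisor_le hd) hny
  rw [h]
  have := congr_arg (fun f : ArithmeticFunction ℤ ↦ f n) moebius_mul_coe_zeta
  rw [coe_mul_zeta_apply, one_apply_ne hn.ne'] at this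
  exact_mod_cast this

theorem abs_mollSum_le (hy : 0 < y) (hyY : y < Y) (n : ℕ) : |mollSum y Y n| ≤ #n.divisors := by
  refine (abs_sum_le_sum_abs _ _).trans ?_
  rw [card_eq_sum_ones, Nat.cast_sum]
  refine sum_le_sum fun d hd ↦ ?_
  simpa using abs_mollCoef_le_one hy hyY (Nat.pos_of_mem_divisors hd)

theorem mollSum_eq (n : ℕ) : mollSum y Y n = (bvSum Y n - bvSum y n) / Real.log (Y / y) := by
  simp only [mollSum, mollCoef, bvSum, ← sum_sub_distrib, sum_div]

/-- The mollified coefficients are bounded in logarithmic mean square. -/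
theorem sum_mollSum_sq_div_le (hy : 1 ≤ y) (hyY : y < Y) {V : ℝ} (hYV : Y ≤ V)
    (hV : 1 ≤ Real.log V) :
    ∑ n ∈ Icc 1 ⌊V⌋₊, mollSum y Y n ^ 2 / n ≤
      7776000 * (Real.log V / Real.log (Y / y)) ^ 2 := by
  set L := Real.log V with hL
  have hV0 : 0 < V := by linarith
  have hl : 0 < Real.log (Y / y) := Real.log_pos ((one_lt_div (by linarith)).2 hyY)
  have hLy : Real.log y ≤ L := Real.log_le_log (by linarith) (by linarith)
  have hLY : Real.log Y ≤ L := Real.log_le_log (by linarith) hYV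
  have hδ : 0 < 1 / L := by positivity
  have key : ∀ w : ℝ, 1 ≤ w → Real.log w ≤ L →
      ∑ n ∈ Icc 1 ⌊V⌋₊, bvSum w n ^ 2 * (n : ℝ) ^ (-(1 + 1 / L)) ≤ 648000 * L ^ 2 := by
    intro w hw hwL
    refine (sum_bvSum_sq_mul_rpow_le hδ hw (by rw [one_div_mul_eq_div, div_le_one (by linarith)]
                                               exact hwL) _).trans ?_
    rw [one_div_one_div]
    nlinarith
  have hpt : ∀ n ∈ Icc 1 ⌊V⌋₊, mollSum y Y n ^ 2 / n ≤ 2 * Real.exp 1 / Real.log (Y / y) ^ 2 *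
      (bvSum Y n ^ 2 * (n : ℝ) ^ (-(1 + 1 / L)) + bvSum y n ^ 2 * (n : ℝ) ^ (-(1 + 1 / L))) := by
    intro n hn
    rw [mem_Icc] at hn
    have hn0 : (0 : ℝ) < n := by exact_mod_cast hn.1
    have hnV : (n : ℝ) ≤ V := (Nat.le_floor_iff hV0.le).1 hn.2
    have h1 : (n : ℝ)⁻¹ ≤ Real.exp 1 * (n : ℝ) ^ (-(1 + 1 / L)) := by
      rw [neg_add, Real.rpow_add hn0, Real.rpow_neg_one, mul_left_comm]
      refine le_mul_of_one_le_right (by positivity) ?_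
      rw [Real.rpow_def_of_pos hn0, ← Real.exp_add]
      refine Real.one_le_exp ?_
      have : Real.log n / L ≤ 1 := (div_le_one (by linarith)).2 (Real.log_le_log hn0 hnV)
      have e : 1 + Real.log n * -(1 / L) = 1 - Real.log n / L := by ring
      rw [e]; linarith
    rw [mollSum_eq, ← add_mul, div_pow, div_eq_mul_inv]
    have h2 : (bvSum Y n - bvSum y n) ^ 2 ≤ 2 * (bvSum Y n ^ 2 + bvSum y n ^ 2) := by
      nlinarith [sq_nonneg (bvSum Y n + bvSum y n)]
    calc _ ≤ 2 * (bvSum Y n ^ 2 + bvSum y n ^ 2) / Real.log (Y / y) ^ 2 *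
          (Real.exp 1 * (n : ℝ) ^ (-(1 + 1 / L))) := by gcongr
      _ = _ := by ring
  refine (sum_le_sum hpt).trans ?_
  rw [← mul_sum, sum_add_distrib]
  have h3 := add_le_add (key Y (by linarith) hLY) (key y hy hLy)
  have he : Real.exp 1 ≤ 3 := Real.exp_one_lt_d9.le.trans (by norm_num)
  calc _ ≤ 2 * 3 / Real.log (Y / y) ^ 2 * (648000 * L ^ 2 + 648000 * L ^ 2) := by gcongr
    _ = _ := by rw [div_pow]; ring

end

section
open Finset

variable {q : ℕ}

/-- The Dirichlet polynomial used as a mollifier for `L(s, χ)`. -/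
noncomputable def mollD (χ : DirichletCharacter ℂ q) (y Y : ℝ) (R : ℕ) (w : ℕ → ℝ) (s : ℂ) : ℂ :=
  ∑ p ∈ Icc 1 ⌊Y⌋₊ ×ˢ Icc 1 R, (((mollCoef y Y p.1 * w p.2 : ℝ) : ℂ) *
    χ ((p.1.lcm p.2 : ℕ) : ZMod q)) * ((p.1.lcm p.2 : ℕ) : ℂ) ^ (-s)

/-- The range of summation of `mollP`. -/
noncomputable def mollRange (y V : ℝ) : Finset ℕ := {n ∈ Icc 1 ⌊V⌋₊ | y < n}

/-- The truncated Dirichlet series of `L(s, χ)` times its mollifier, without the leading term. -/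
noncomputable def mollP (χ : DirichletCharacter ℂ q) (y Y V : ℝ) (w : ℕ → ℝ) (s : ℂ) : ℂ :=
  ∑ n ∈ mollRange y V, ((mollSum y Y n * ∑ d ∈ n.divisors, w d : ℝ) : ℂ) * (n : ℂ) ^ (-s) *
    χ (n : ZMod q)

variable {χ : DirichletCharacter ℂ q} {y Y : ℝ} {R : ℕ} {w : ℕ → ℝ}

theorem sum_divisors_eq_sum_Icc {n N : ℕ} (hn : n ≠ 0) {v : ℕ → ℝ} (hv : ∀ d, N < d → v d = 0) :
    ∑ d ∈ n.divisors, v d = ∑ d ∈ Icc 1 N, if d ∣ n then v d else 0 := by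
  rw [← sum_filter]
  symm
  refine sum_subset_zero_on_sdiff ?_ ?_ fun _ _ ↦ rfl
  · intro d hd
    rw [mem_filter] at hd
    exact Nat.mem_divisors.2 ⟨hd.2, hn⟩
  · intro d hd
    rw [mem_sdiff, mem_filter, mem_Icc, Nat.mem_divisors] at hd
    refine hv d (not_le.1 fun h ↦ hd.2 ⟨⟨Nat.pos_of_dvd_of_pos hd.1.1 (Nat.pos_of_ne_zero hn), h⟩, hd.1.1⟩)

theorem dilate_moll (hyY : y < Y) (hw : ∀ d, R < d → w d = 0) {n : ℕ} (hn : n ≠ 0) :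
    dilate (Icc 1 ⌊Y⌋₊ ×ˢ Icc 1 R) (fun p ↦ ((mollCoef y Y p.1 * w p.2 : ℝ) : ℂ) *
      χ ((p.1.lcm p.2 : ℕ) : ZMod q)) (fun p ↦ p.1.lcm p.2) (fun n ↦ χ (n : ZMod q)) n =
      ((mollSum y Y n * ∑ d ∈ n.divisors, w d : ℝ) : ℂ) * χ (n : ZMod q) := by
  rw [mollSum, sum_divisors_eq_sum_Icc (N := ⌊Y⌋₊) hn fun d hd ↦
    mollCoef_eq_zero hyY ((Nat.floor_lt' (by omega)).1 hd), sum_divisors_eq_sum_Icc hn hw,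
    sum_mul_sum, ← sum_product', dilate, Complex.ofReal_sum, sum_mul]
  refine sum_congr rfl fun p _ ↦ ?_
  by_cases h1 : p.1 ∣ n <;> by_cases h2 : p.2 ∣ n
  · obtain ⟨m, hm⟩ := Nat.lcm_dvd h1 h2
    rw [if_pos h1, if_pos h2, if_pos (Nat.lcm_dvd h1 h2), mul_assoc, ← map_mul, ← Nat.cast_mul,
      Nat.mul_div_cancel' (Nat.lcm_dvd h1 h2)]
  · rw [if_neg h2, if_neg fun h ↦ h2 ((Nat.dvd_lcm_right _ _).trans h)]; simp
  · rw [if_neg h1, if_neg fun h ↦ h1 ((Nat.dvd_lcm_left _ _).trans h)]; simp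
  · rw [if_neg h1, if_neg fun h ↦ h1 ((Nat.dvd_lcm_left _ _).trans h)]; simp

theorem sum_moll_eq (hy : 1 ≤ y) (hyY : y < Y) {V : ℝ} (hV : 1 ≤ V) (hw1 : w 1 = 1)
    (hw : ∀ d, R < d → w d = 0) (s : ℂ) :
    ∑ n ∈ Icc 1 ⌊V⌋₊, dilate (Icc 1 ⌊Y⌋₊ ×ˢ Icc 1 R) (fun p ↦ ((mollCoef y Y p.1 * w p.2 : ℝ) : ℂ) *
      χ ((p.1.lcm p.2 : ℕ) : ZMod q)) (fun p ↦ p.1.lcm p.2) (fun n ↦ χ (n : ZMod q)) n *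
      (n : ℂ) ^ (-s) = 1 + mollP χ y Y V w s := by
  have h1 : (1 : ℕ) ∈ Icc 1 ⌊V⌋₊ := by
    rw [mem_Icc]; exact ⟨le_rfl, Nat.le_floor (by simpa using hV)⟩
  rw [← add_sum_erase _ _ h1, dilate_moll hyY hw one_ne_zero, mollSum_one hy hyY]
  congr 1
  · simp [hw1]
  · rw [mollP]
    symm
    refine sum_subset_zero_on_sdiff ?_ ?_ ?_
    · intro n hn
      rw [mollRange, mem_filter] at hn
      refine mem_erase.2 ⟨?_, hn.1⟩
      rintro rfl
      rw [Nat.cast_one] at hn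
      linarith [hn.2]
    · intro n hn
      rw [mem_sdiff, mem_erase, mollRange, mem_filter, not_and] at hn
      have hn1 : 1 ≤ n := (mem_Icc.1 hn.1.2).1
      rw [dilate_moll hyY hw (by omega), mollSum_eq_zero (by linarith) hyY
        (lt_of_le_of_ne hn1 (Ne.symm hn.1.1)) (not_lt.1 (hn.2 hn.1.2))]
      simp
    · intro n hn
      rw [mollRange, mem_filter, mem_Icc] at hn
      rw [dilate_moll hyY hw (by omega)]
      ring

theorem norm_one_sub_mul_mollD_add_le {f g : ℂ → ℂ} {κ : ℂ} {K V : ℝ} (hy : 1 ≤ y) (hyY : y < Y)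
    (hV : 1 ≤ V) (hw1 : w 1 = 1) (hw : ∀ d, R < d → w d = 0) (hw2 : ∀ d, |w d| ≤ 1) (hK : 0 ≤ K)
    (hF : ∀ u : ℝ, 0 < u → ‖∑ n ∈ Icc 1 ⌊u⌋₊, χ (n : ZMod q) - κ * u‖ ≤ K)
    (hg : DifferentiableOn ℂ g {s | 0 < s.re})
    (hgL : ∀ s : ℂ, 1 < s.re → g s = (s - 1) * LSeries (fun n ↦ χ (n : ZMod q)) s) {s : ℂ}
    (hs : 0 < s.re) (hs1 : s ≠ 1) (hgf : g s = (s - 1) * f s) :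
    ‖1 - f s * mollD χ y Y R w s + mollP χ y Y V w s‖ ≤
      ‖κ‖ * (R * (1 + Real.log Y)) * V ^ (1 - s.re) / ‖s - 1‖ + K * (Y * R) * V ^ (-s.re) * (1 + ‖s‖ / s.re) := by
  have hs1' : 0 < ‖s - 1‖ := norm_pos_iff.2 (sub_ne_zero.2 hs1)
  set I := Icc 1 ⌊Y⌋₊ ×ˢ Icc 1 R
  set β : ℕ × ℕ → ℂ := fun p ↦ ((mollCoef y Y p.1 * w p.2 : ℝ) : ℂ) *
      χ ((p.1.lcm p.2 : ℕ) : ZMod q) with hβ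
  have hk : ∀ i ∈ I, 0 < i.1.lcm i.2 := by
    intro i hi
    rw [mem_product, mem_Icc, mem_Icc] at hi
    exact Nat.lcm_pos hi.1.1 hi.2.1
  have hβ1 : ∀ i ∈ I, ‖β i‖ ≤ 1 := by
    intro i hi
    rw [mem_product, mem_Icc, mem_Icc] at hi
    simp only [hβ]
    rw [norm_mul, Complex.norm_real, Real.norm_eq_abs, abs_mul]
    have h1 := abs_mollCoef_le_one (by linarith) hyY (Nat.lt_of_succ_le hi.1.1)
    have h2 := hw2 i.2
    have h3 := χ.norm_le_one ((i.1.lcm i.2 : ℕ) : ZMod q)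
    exact mul_le_one₀ (mul_le_one₀ h1 (abs_nonneg _) h2) (norm_nonneg _) h3
  have hI : (#I : ℝ) ≤ Y * R := by
    rw [card_product, Nat.card_Icc, Nat.card_Icc, Nat.cast_mul]
    simp only [Nat.add_sub_cancel]
    exact mul_le_mul_of_nonneg_right (Nat.floor_le (by linarith)) (Nat.cast_nonneg _)
  have hsum : ∑ i ∈ I, ‖β i‖ ≤ Y * R := by
    refine (sum_le_card_nsmul _ _ 1 hβ1).trans ?_
    simpa using hI
  have hsum2 : ‖∑ i ∈ I, β i / ((i.1.lcm i.2 : ℕ) : ℂ)‖ ≤ R * (1 + Real.log Y) := by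
    have h : ∀ i ∈ I, ‖β i / ((i.1.lcm i.2 : ℕ) : ℂ)‖ ≤ (i.1 : ℝ)⁻¹ * 1 := by
      intro i hi
      rw [norm_div, Complex.norm_natCast, mul_one, ← one_div]
      have hi' := hi
      rw [mem_product, mem_Icc, mem_Icc] at hi'
      exact div_le_div₀ zero_le_one (hβ1 i hi) (by exact_mod_cast hi'.1.1)
        (by exact_mod_cast Nat.le_of_dvd (hk i hi) (Nat.dvd_lcm_left _ _))
    refine (norm_sum_le_of_le _ h).trans ?_
    have e : ∑ i ∈ I, (i.1 : ℝ)⁻¹ * 1 = ∑ a ∈ Icc 1 ⌊Y⌋₊, ∑ _b ∈ Icc 1 R, (a : ℝ)⁻¹ * 1 :=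
      sum_product _ _ _
    rw [e]
    simp only [sum_const, Nat.card_Icc, Nat.add_sub_cancel, nsmul_eq_mul, mul_one, ← mul_sum]
    have hY : 0 < ⌊Y⌋₊ := Nat.floor_pos.2 (by linarith)
    refine mul_le_mul_of_nonneg_left ((sum_inv_le_one_add_log _).trans ?_) (Nat.cast_nonneg _)
    have := Real.log_le_log (by exact_mod_cast hY) (Nat.floor_le (by linarith : 0 ≤ Y))
    linarith
  have key := norm_partialSum_dilate_sub_le (B := K) (θ := 0) (N := V) I β hk
    (f := fun n ↦ χ (n : ZMod q)) (κ := κ) (fun u hu ↦ by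
      rw [Real.rpow_zero, mul_one]; exact hF u hu) one_pos
    (fun s hs ↦ χ.LSeriesSummable_of_one_lt_re hs) hg hgL hV hs
  rw [sum_moll_eq hy hyY hV hw1 hw] at key
  have hD : ∑ i ∈ I, β i * ((i.1.lcm i.2 : ℕ) : ℂ) ^ (-s) = mollD χ y Y R w s := rfl
  rw [hD, hgf] at key
  have e1 : ∑ i ∈ I, ‖β i‖ * ((i.1.lcm i.2 : ℕ) : ℝ) ^ (-(0 : ℝ)) = ∑ i ∈ I, ‖β i‖ := by simp
  rw [e1, zero_sub, sub_zero] at key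
  have e2 : (s - 1) * (1 - f s * mollD χ y Y R w s + mollP χ y Y V w s) =
      ((s - 1) * (1 + mollP χ y Y V w s) + (κ * ∑ i ∈ I, β i / ((i.1.lcm i.2 : ℕ) : ℂ)) * (V : ℂ) ^ (1 - s) -
        (s - 1) * f s * mollD χ y Y R w s) -
      (κ * ∑ i ∈ I, β i / ((i.1.lcm i.2 : ℕ) : ℂ)) * (V : ℂ) ^ (1 - s) := by ring
  have hVp : 0 < V := by linarith
  have e3 : ‖(κ * ∑ i ∈ I, β i / ((i.1.lcm i.2 : ℕ) : ℂ)) * (V : ℂ) ^ (1 - s)‖ ≤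
      ‖κ‖ * (R * (1 + Real.log Y)) * V ^ (1 - s.re) := by
    rw [norm_mul, norm_mul, Complex.norm_cpow_eq_rpow_re_of_pos hVp, Complex.sub_re, Complex.one_re]
    gcongr
  have e4 : ‖s - 1‖ * (K * (∑ i ∈ I, ‖β i‖) * V ^ (-s.re) * (1 + ‖s‖ / s.re)) ≤
      ‖s - 1‖ * (K * (Y * R) * V ^ (-s.re) * (1 + ‖s‖ / s.re)) := by
    have : 0 ≤ 1 + ‖s‖ / s.re := by positivity
    gcongr
  have h5 : ‖s - 1‖ * ‖1 - f s * mollD χ y Y R w s + mollP χ y Y V w s‖ ≤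
      ‖s - 1‖ * (K * (Y * R) * V ^ (-s.re) * (1 + ‖s‖ / s.re)) + ‖κ‖ * (R * (1 + Real.log Y)) * V ^ (1 - s.re) := by
    rw [← norm_mul, e2]
    exact (norm_sub_le _ _).trans (add_le_add (key.trans e4) e3)
  have h6 : ‖1 - f s * mollD χ y Y R w s + mollP χ y Y V w s‖ ≤
      (‖s - 1‖ * (K * (Y * R) * V ^ (-s.re) * (1 + ‖s‖ / s.re)) + ‖κ‖ * (R * (1 + Real.log Y)) * V ^ (1 - s.re)) /
        ‖s - 1‖ := by
    rw [le_div_iff₀ hs1', mul_comm]; exact h5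
  refine h6.trans (le_of_eq ?_)
  field_simp
  ring

theorem differentiable_mollD (χ : DirichletCharacter ℂ q) (y Y : ℝ) (R : ℕ) (w : ℕ → ℝ) :
    Differentiable ℂ (mollD χ y Y R w) := by
  unfold mollD
  refine Differentiable.fun_sum fun p hp ↦ ?_
  rw [mem_product, mem_Icc, mem_Icc] at hp
  have h : ((p.1.lcm p.2 : ℕ) : ℂ) ≠ 0 :=
    Nat.cast_ne_zero.2 (Nat.lcm_pos hp.1.1 hp.2.1).ne'
  exact (differentiable_neg.const_cpow (Or.inl h)).const_mul _

theorem continuous_mollP (χ : DirichletCharacter ℂ q) (y Y V : ℝ) (w : ℕ → ℝ) :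
    Continuous (mollP χ y Y V w) := by
  unfold mollP
  refine continuous_finsetSum _ fun n hn ↦ ?_
  rw [mollRange, mem_filter, mem_Icc] at hn
  have h : (n : ℂ) ≠ 0 := Nat.cast_ne_zero.2 (by omega)
  exact (continuous_const.mul (continuous_neg.const_cpow (Or.inl h))).mul continuous_const

end

section
open Finset

variable {q : ℕ}

theorem mem_mollRange {y V : ℝ} {n : ℕ} (hV : 0 ≤ V) (hn : n ∈ mollRange y V) :
    0 < n ∧ y < n ∧ (n : ℝ) ≤ V := by
  rw [mollRange, mem_filter, mem_Icc] at hn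
  exact ⟨hn.1.1, hn.2, (Nat.le_floor_iff hV).1 hn.1.2⟩

theorem sum_integral_mollP_le [NeZero q] {R : ℕ} {w : ℕ → ℝ} (hR : 1 ≤ R) (hw : IsSelbergWeight q R w)
    {y Y V T δ a b : ℝ} (hy : 1 ≤ y) (hyY : y < Y) (hYV : Y ≤ V) (hV : 1 ≤ Real.log V) (hT : 1 ≤ T)
    (hδ : (q.totient / q : ℝ) * (selbergSum (coprimeSieve q R) R)⁻¹ ≤ δ)
    (hδ2 : T * q.totient * R ^ 2 ≤ δ * y) (ha : 0 ≤ a) (hb : 0 ≤ b) :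
    ∑ χ : DirichletCharacter ℂ q, ∫ t in (-T)..T,
      ‖mollP χ y Y V w (((1 - a + b : ℝ) : ℂ) + t * Complex.I)‖ ^ 2 ≤
    4 * Real.exp 14 * √Real.pi * δ * 7776000 * (Real.log V / Real.log (Y / y)) ^ 2 *
      (V ^ (2 * a) * y ^ (-(2 * b))) := by
  have hV0 : 0 < V := by linarith
  have hδ0 : 0 ≤ δ := by
    have : 0 ≤ δ * y := le_trans (by positivity) hδ2
    exact nonneg_of_mul_nonneg_left this (by linarith)
  have key := sum_char_integral_selberg_le hR hw (mollRange y V)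
    (fun n hn ↦ (mem_mollRange hV0.le hn).1) (fun n ↦ mollSum y Y n) (1 - a + b) hT
  have hterm : ∀ n ∈ mollRange y V, mollSum y Y n ^ 2 * (n : ℝ) ^ (-(2 * (1 - a + b))) *
      (n * ((q.totient : ℝ) / q) * (selbergSum (coprimeSieve q R) R)⁻¹ + T * q.totient * R ^ 2) ≤
      mollSum y Y n ^ 2 / n * (2 * δ * (V ^ (2 * a) * y ^ (-(2 * b)))) := by
    intro n hn
    obtain ⟨h0, h1, h2⟩ := mem_mollRange hV0.le hn
    have h0' : (0 : ℝ) < n := by exact_mod_cast h0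
    have e1 : n * ((q.totient : ℝ) / q) * (selbergSum (coprimeSieve q R) R)⁻¹ + T * q.totient * R ^ 2 ≤
        n * (2 * δ) := by
      have : δ * y ≤ δ * n := mul_le_mul_of_nonneg_left h1.le hδ0
      have h3 := mul_le_mul_of_nonneg_left hδ h0'.le
      rw [mul_assoc]; linarith
    have e2 : (n : ℝ) ^ (-(2 * (1 - a + b))) = (n : ℝ)⁻¹ * (n : ℝ)⁻¹ * ((n : ℝ) ^ (2 * a) * (n : ℝ) ^ (-(2 * b))) := by
      rw [← Real.rpow_neg_one, ← Real.rpow_add h0', ← Real.rpow_add h0', ← Real.rpow_add h0']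
      congr 1; ring
    have e3 : (n : ℝ) ^ (2 * a) * (n : ℝ) ^ (-(2 * b)) ≤ V ^ (2 * a) * y ^ (-(2 * b)) := by
      have i1 : (n : ℝ) ^ (2 * a) ≤ V ^ (2 * a) := Real.rpow_le_rpow h0'.le h2 (by linarith)
      have i2 : (n : ℝ) ^ (-(2 * b)) ≤ y ^ (-(2 * b)) :=
        Real.rpow_le_rpow_of_nonpos (by linarith) h1.le (by linarith)
      exact mul_le_mul i1 i2 (by positivity) (by positivity)
    calc _ ≤ mollSum y Y n ^ 2 * ((n : ℝ)⁻¹ * (n : ℝ)⁻¹ * ((n : ℝ) ^ (2 * a) * (n : ℝ) ^ (-(2 * b)))) * (n * (2 * δ)) := by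
          rw [e2]; exact mul_le_mul_of_nonneg_left e1 (by positivity)
      _ = mollSum y Y n ^ 2 / n * (2 * δ) * ((n : ℝ) ^ (2 * a) * (n : ℝ) ^ (-(2 * b))) := by
          field_simp
      _ ≤ mollSum y Y n ^ 2 / n * (2 * δ) * (V ^ (2 * a) * y ^ (-(2 * b))) :=
          mul_le_mul_of_nonneg_left e3 (by positivity)
      _ = _ := by ring
  have hsum : ∑ n ∈ mollRange y V, mollSum y Y n ^ 2 / (n : ℝ) ≤
      7776000 * (Real.log V / Real.log (Y / y)) ^ 2 := by
    refine le_trans (sum_le_sum_of_subset_of_nonneg (filter_subset _ _) fun _ _ _ ↦ by positivity)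
      (sum_mollSum_sq_div_le hy hyY hYV hV)
  have hc : (0 : ℝ) ≤ 2 * Real.exp 14 * √Real.pi := by positivity
  have hd : 0 ≤ 2 * δ * (V ^ (2 * a) * y ^ (-(2 * b))) := by positivity
  refine key.trans ((mul_le_mul_of_nonneg_left (sum_le_sum hterm) hc).trans ?_)
  rw [← sum_mul]
  refine (mul_le_mul_of_nonneg_left (mul_le_mul_of_nonneg_right hsum hd) hc).trans (le_of_eq ?_)
  ring

theorem two_mul_sq_div_le_one_add_cos {θ : ℝ} (h0 : 0 ≤ θ) (h1 : θ ≤ 2 * Real.pi) :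
    2 / Real.pi ^ 2 * (θ - Real.pi) ^ 2 ≤ 1 + Real.cos θ := by
  have h := Real.cos_le_one_sub_mul_cos_sq (x := θ - Real.pi) (abs_le.2 ⟨by linarith, by linarith⟩)
  rw [Real.cos_sub_pi] at h
  linarith

theorem integral_rpow_one_add_cos_le {y r : ℝ} (hy : 1 < y) (hr : 2 ≤ r) :
    ∫ θ in (0 : ℝ)..2 * Real.pi, y ^ (-(2 * (r * (1 + Real.cos θ)))) ≤ 2 / √(Real.log y) := by
  have hl : 0 < Real.log y := Real.log_pos hy
  have hpi := Real.pi_pos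
  set c : ℝ := 8 * Real.log y / Real.pi ^ 2 with hc
  have hc0 : 0 < c := by positivity
  have h1 : ∀ θ ∈ Set.Icc (0 : ℝ) (2 * Real.pi), y ^ (-(2 * (r * (1 + Real.cos θ)))) ≤
      Real.exp (-c * (θ - Real.pi) ^ 2) := by
    intro θ hθ
    rw [Real.rpow_def_of_pos (by linarith), Real.exp_le_exp]
    have := two_mul_sq_div_le_one_add_cos hθ.1 hθ.2
    have h2 : 2 * (2 / Real.pi ^ 2 * (θ - Real.pi) ^ 2) ≤ r * (1 + Real.cos θ) :=
      mul_le_mul hr this (by positivity) (by linarith)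
    have h3 : c * (θ - Real.pi) ^ 2 = Real.log y * (2 * (2 * (2 / Real.pi ^ 2 * (θ - Real.pi) ^ 2))) := by
      rw [hc]; field_simp; ring
    nlinarith [mul_le_mul_of_nonneg_left h2 hl.le]
  have hint : MeasureTheory.Integrable (fun θ : ℝ ↦ Real.exp (-c * (θ - Real.pi) ^ 2)) :=
    (integrable_exp_neg_mul_sq hc0).comp_sub_right Real.pi
  have h2pi : (0 : ℝ) ≤ 2 * Real.pi := by positivity
  calc _ ≤ ∫ θ in (0 : ℝ)..2 * Real.pi, Real.exp (-c * (θ - Real.pi) ^ 2) := by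
        refine intervalIntegral.integral_mono_on h2pi (Continuous.intervalIntegrable ?_ _ _)
          hint.intervalIntegrable h1
        have : (fun θ : ℝ ↦ y ^ (-(2 * (r * (1 + Real.cos θ))))) =
            fun θ ↦ Real.exp (Real.log y * (-(2 * (r * (1 + Real.cos θ))))) := by
          funext θ; rw [Real.rpow_def_of_pos (by linarith)]
        rw [this]; fun_prop
    _ ≤ ∫ θ, Real.exp (-c * (θ - Real.pi) ^ 2) := by
        rw [intervalIntegral.integral_of_le h2pi]
        exact MeasureTheory.setIntegral_le_integral hint (Filter.Eventually.of_forall fun _ ↦ (Real.exp_pos _).le)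
    _ = ∫ θ, Real.exp (-c * θ ^ 2) :=
        MeasureTheory.integral_sub_right_eq_self (fun θ ↦ Real.exp (-c * θ ^ 2)) Real.pi
    _ = √(Real.pi / c) := integral_gaussian c
    _ ≤ √(2 ^ 2 / Real.log y) := by
        apply Real.sqrt_le_sqrt
        rw [hc, div_div_eq_mul_div, div_le_div_iff₀ (by positivity) hl]
        have : Real.pi ^ 3 ≤ 32 := by
          have := pow_le_pow_left₀ hpi.le Real.pi_lt_d2.le 3
          norm_num at this; linarith
        nlinarith
    _ = 2 / √(Real.log y) := by
        rw [Real.sqrt_div (by norm_num), Real.sqrt_sq (by norm_num)]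

theorem norm_mollP_three_le {w : ℕ → ℝ} (hw2 : ∀ d, |w d| ≤ 1) (χ : DirichletCharacter ℂ q)
    {y Y : ℝ} (V t : ℝ) (hy : 1 ≤ y) (hyY : y < Y) :
    ‖mollP χ y Y V w (((3 : ℝ) : ℂ) + t * Complex.I)‖ ≤ 8 / y := by
  have hterm : ∀ n ∈ mollRange y V, ‖((mollSum y Y n * ∑ d ∈ n.divisors, w d : ℝ) : ℂ) *
      (n : ℂ) ^ (-(((3 : ℝ) : ℂ) + t * Complex.I)) * χ (n : ZMod q)‖ ≤ 4 * ((n : ℝ) ^ 2)⁻¹ := by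
    intro n hn
    rw [mollRange, mem_filter, mem_Icc] at hn
    have h0 : 0 < n := hn.1.1
    have h0' : (0 : ℝ) < n := by exact_mod_cast h0
    have hd := card_divisors_le_two_mul_sqrt n
    have h1 : |mollSum y Y n| ≤ 2 * √n := (abs_mollSum_le (by linarith) hyY n).trans hd
    have h2 : |∑ d ∈ n.divisors, w d| ≤ 2 * √n := by
      refine ((abs_sum_le_sum_abs _ _).trans (sum_le_card_nsmul _ _ 1 fun d _ ↦ hw2 d)).trans ?_
      simpa using hd
    rw [norm_mul, norm_mul, Complex.norm_real, Real.norm_eq_abs, abs_mul,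
      Complex.norm_natCast_cpow_of_pos h0]
    have h3 : (n : ℝ) ^ ((-(((3 : ℝ) : ℂ) + t * Complex.I)).re) = ((n : ℝ) ^ 3)⁻¹ := by
      have : (-(((3 : ℝ) : ℂ) + t * Complex.I)).re = -((3 : ℕ) : ℝ) := by simp
      rw [this, Real.rpow_neg h0'.le, Real.rpow_natCast]
    rw [h3]
    calc _ ≤ 2 * √n * (2 * √n) * ((n : ℝ) ^ 3)⁻¹ * 1 := by
          gcongr
          exact χ.norm_le_one _
      _ = 4 * (√n * √n) * ((n : ℝ) ^ 3)⁻¹ := by ring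
      _ = _ := by
          rw [Real.mul_self_sqrt h0'.le]; field_simp
  rw [mollP]
  refine (norm_sum_le_of_le _ hterm).trans ?_
  rw [← mul_sum]
  have hsub : mollRange y V ⊆ Ioo ⌊y⌋₊ (⌊V⌋₊ + 1) := by
    intro n hn
    rw [mollRange, mem_filter, mem_Icc] at hn
    rw [mem_Ioo]
    exact ⟨(Nat.floor_lt (by linarith)).2 hn.2, by omega⟩
  have h1 := sum_Ioo_inv_sq_le (α := ℝ) ⌊y⌋₊ (⌊V⌋₊ + 1)
  have h2 : ∑ n ∈ mollRange y V, ((n : ℝ) ^ 2)⁻¹ ≤ 2 / y :=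
    (sum_le_sum_of_subset_of_nonneg hsub fun _ _ _ ↦ by positivity).trans
      (h1.trans (div_le_div_of_nonneg_left (by norm_num) (by linarith) (Nat.lt_floor_add_one y).le))
  calc _ ≤ 4 * (2 / y) := by linarith
    _ = 8 / y := by ring

end

section
open Finset

variable {q : ℕ}

theorem card_dirichletCharacter_le [NeZero q] (Ξ : Finset (DirichletCharacter ℂ q)) : (#Ξ : ℝ) ≤ q := by
  have h1 : #Ξ ≤ Fintype.card (DirichletCharacter ℂ q) := card_le_univ Ξ
  rw [← Nat.card_eq_fintype_card, DirichletCharacter.card_eq_totient_of_hasEnoughRootsOfUnity ℂ q] at h1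
  exact_mod_cast h1.trans (Nat.totient_le q)

theorem sum_zeroMult_mul_le [NeZero q] {R : ℕ} {w : ℕ → ℝ} (hR : 1 ≤ R) (hw : IsSelbergWeight q R w)
    {y Y V T δ η σ T₀ T₁ E : ℝ} (hy : 1 < y) (hyY : y < Y) (hYV : Y ≤ V) (hV : 1 ≤ Real.log V)
    (hT : 1 ≤ T) (hδ : (q.totient / q : ℝ) * (selbergSum (coprimeSieve q R) R)⁻¹ ≤ δ)
    (hδ2 : T * q.totient * R ^ 2 ≤ δ * y) (hη : 0 < η) (hη1 : η ≤ 1) (hσ : 1 / 2 ≤ σ - η)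
    (hσ1 : σ ≤ 1) (hTT : T₀ ≤ T₁) (hT0 : -T ≤ T₀ - 3) (hT1 : T₁ + 3 ≤ T)
    (Ξ : Finset (DirichletCharacter ℂ q))
    (hf : ∀ χ ∈ Ξ, ∀ s : ℂ, σ - η ≤ s.re → T₀ - 3 ≤ s.im → s.im ≤ T₁ + 3 →
      AnalyticAt ℂ χ.LFunction s)
    (hE : ∀ χ ∈ Ξ, ∀ s : ℂ, σ - η ≤ s.re → s.re ≤ 6 → T₀ - 3 ≤ s.im → s.im ≤ T₁ + 3 →
      ‖1 - χ.LFunction s * mollD χ y Y R w s + mollP χ y Y V w s‖ ≤ E)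
    (hsmall : 8 / y + E ≤ 1 / 2) (Z : DirichletCharacter ℂ q → Finset ℂ)
    (hZ : ∀ χ ∈ Ξ, ∀ ρ ∈ Z χ, σ ≤ ρ.re ∧ ρ.re ≤ 1 ∧ T₀ + √η ≤ ρ.im ∧ ρ.im ≤ T₁ - √η) :
    (∑ χ ∈ Ξ, ∑ ρ ∈ Z χ, (zeroMult χ.LFunction ρ : ℝ)) * (η * √η / 4) ≤
      4 * Real.exp 14 * √Real.pi * δ * 7776000 * (Real.log V / Real.log (Y / y)) ^ 2 *
        V ^ (2 * (1 - σ + η)) / √(Real.log y) + 8 * T * q * (8 / y) ^ 2 + 12 * q * T * E ^ 2 := by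
  have hV0 : 0 < V := by linarith
  have hδ0 : 0 ≤ δ := by
    have : 0 ≤ δ * y := le_trans (by positivity) hδ2
    exact nonneg_of_mul_nonneg_left this (by linarith)
  set B : ℝ := 4 * Real.exp 14 * √Real.pi * δ * 7776000 * (Real.log V / Real.log (Y / y)) ^ 2 with hB
  have hB0 : 0 ≤ B := by positivity
  set r : ℝ := 3 - σ + η with hr
  have h1 : ∀ χ ∈ Ξ, (∑ ρ ∈ Z χ, (zeroMult χ.LFunction ρ : ℝ)) * (η * √η / 4) ≤
      (2 * Real.pi)⁻¹ * (∫ θ in (0 : ℝ)..2 * Real.pi, ∫ v in (T₀ - 3)..(T₁ + 3),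
        2 * ‖mollP χ y Y V w (((3 + r * Real.cos θ : ℝ) : ℂ) + (v : ℂ) * Complex.I)‖ ^ 2) +
      (4 * (2 * T * (8 / y) ^ 2) + 6 * E ^ 2 * (2 * T)) := by
    intro χ hχ
    have h := sum_zeroMult_le_integral hη hη1 hσ hσ1 hTT (hf χ hχ) (differentiable_mollD χ y Y R w)
      (continuous_mollP χ y Y V w) (hE χ hχ) (fun t _ _ ↦ (add_le_add_left
        (norm_mollP_three_le hw.abs_le_one χ V t hy.le hyY) E).trans hsmall) (Z χ) (hZ χ hχ)
    refine h.trans ?_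
    rw [add_assoc]
    refine add_le_add (le_refl _) (add_le_add ?_ ?_)
    · refine mul_le_mul_of_nonneg_left ?_ (by norm_num)
      have hc : Continuous fun v : ℝ ↦ ‖mollP χ y Y V w (((3 : ℝ) : ℂ) + (v : ℂ) * Complex.I)‖ ^ 2 := by
        have := continuous_mollP χ y Y V w
        fun_prop
      calc _ ≤ ∫ v in (T₀ - 3)..(T₁ + 3), (8 / y) ^ 2 := by
            refine intervalIntegral.integral_mono_on (by linarith) (hc.intervalIntegrable _ _)
              (by simp) fun v _ ↦ ?_
            exact pow_le_pow_left₀ (norm_nonneg _) (norm_mollP_three_le hw.abs_le_one χ V v hy.le hyY) 2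
        _ = (T₁ + 3 - (T₀ - 3)) * (8 / y) ^ 2 := by simp
        _ ≤ _ := mul_le_mul_of_nonneg_right (by linarith) (by positivity)
    · exact mul_le_mul_of_nonneg_left (by linarith) (by positivity)
  have hcont : ∀ χ : DirichletCharacter ℂ q, Continuous fun θ : ℝ ↦ ∫ v in (-T)..T,
      2 * ‖mollP χ y Y V w (((3 + r * Real.cos θ : ℝ) : ℂ) + (v : ℂ) * Complex.I)‖ ^ 2 := by
    intro χ
    refine intervalIntegral.continuous_parametric_intervalIntegral_of_continuous' ?_ _ _
    have := continuous_mollP χ y Y V w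
    simp only [Function.uncurry_def]
    fun_prop
  have hcont' : ∀ χ : DirichletCharacter ℂ q, Continuous fun θ : ℝ ↦ ∫ v in (T₀ - 3)..(T₁ + 3),
      2 * ‖mollP χ y Y V w (((3 + r * Real.cos θ : ℝ) : ℂ) + (v : ℂ) * Complex.I)‖ ^ 2 := by
    intro χ
    refine intervalIntegral.continuous_parametric_intervalIntegral_of_continuous' ?_ _ _
    have := continuous_mollP χ y Y V w
    simp only [Function.uncurry_def]
    fun_prop
  have hpi2 : (0 : ℝ) ≤ 2 * Real.pi := by positivity
  have hcv : ∀ (χ : DirichletCharacter ℂ q) (θ : ℝ), Continuous fun v : ℝ ↦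
      2 * ‖mollP χ y Y V w (((3 + r * Real.cos θ : ℝ) : ℂ) + (v : ℂ) * Complex.I)‖ ^ 2 := by
    intro χ θ
    have := continuous_mollP χ y Y V w
    fun_prop
  have h2 : ∀ θ : ℝ, ∑ χ ∈ Ξ, ∫ v in (T₀ - 3)..(T₁ + 3),
      2 * ‖mollP χ y Y V w (((3 + r * Real.cos θ : ℝ) : ℂ) + (v : ℂ) * Complex.I)‖ ^ 2 ≤
      2 * (B * (V ^ (2 * (1 - σ + η)) * y ^ (-(2 * (r * (1 + Real.cos θ)))))) := by
    intro θ
    have hb : 0 ≤ r * (1 + Real.cos θ) :=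
      mul_nonneg (by rw [hr]; linarith) (by linarith [Real.neg_one_le_cos θ])
    have hm := sum_integral_mollP_le hR hw hy.le hyY hYV hV hT hδ hδ2 (a := 1 - σ + η)
      (by linarith) hb
    calc _ ≤ ∑ χ ∈ Ξ, ∫ v in (-T)..T,
          2 * ‖mollP χ y Y V w (((3 + r * Real.cos θ : ℝ) : ℂ) + (v : ℂ) * Complex.I)‖ ^ 2 := by
          refine sum_le_sum fun χ _ ↦ ?_
          exact intervalIntegral.integral_mono_interval hT0 (by linarith) hT1
            (Filter.Eventually.of_forall fun v ↦ by positivity) ((hcv χ θ).intervalIntegrable _ _)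
      _ ≤ ∑ χ, ∫ v in (-T)..T,
          2 * ‖mollP χ y Y V w (((3 + r * Real.cos θ : ℝ) : ℂ) + (v : ℂ) * Complex.I)‖ ^ 2 := by
          refine sum_le_sum_of_subset_of_nonneg (subset_univ _) fun χ _ _ ↦ ?_
          exact intervalIntegral.integral_nonneg (by linarith) fun v _ ↦ by positivity
      _ = 2 * ∑ χ, ∫ v in (-T)..T,
          ‖mollP χ y Y V w (((3 + r * Real.cos θ : ℝ) : ℂ) + (v : ℂ) * Complex.I)‖ ^ 2 := by
          rw [mul_sum]
          exact sum_congr rfl fun χ _ ↦ intervalIntegral.integral_const_mul _ _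
      _ ≤ _ := by
          refine mul_le_mul_of_nonneg_left ?_ (by norm_num)
          have e : 3 + r * Real.cos θ = 1 - (1 - σ + η) + r * (1 + Real.cos θ) := by rw [hr]; ring
          rw [e]
          exact hm
  rw [sum_mul]
  refine (sum_le_sum h1).trans ?_
  rw [sum_add_distrib, ← mul_sum, sum_const, nsmul_eq_mul, add_assoc]
  refine add_le_add ?_ ?_
  · rw [← intervalIntegral.integral_finsetSum fun χ _ ↦ (hcont' χ).intervalIntegrable _ _]
    have hypow : Continuous fun θ : ℝ ↦ y ^ (-(2 * (r * (1 + Real.cos θ)))) := by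
      have : (fun θ : ℝ ↦ y ^ (-(2 * (r * (1 + Real.cos θ))))) =
          fun θ ↦ Real.exp (Real.log y * (-(2 * (r * (1 + Real.cos θ))))) := by
        funext θ; rw [Real.rpow_def_of_pos (by linarith)]
      rw [this]; fun_prop
    have h3 : ∫ θ in (0 : ℝ)..2 * Real.pi, ∑ χ ∈ Ξ, ∫ v in (T₀ - 3)..(T₁ + 3),
        2 * ‖mollP χ y Y V w (((3 + r * Real.cos θ : ℝ) : ℂ) + (v : ℂ) * Complex.I)‖ ^ 2 ≤
        2 * (B * (V ^ (2 * (1 - σ + η)) * (2 / √(Real.log y)))) := by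
      refine (intervalIntegral.integral_mono_on hpi2 ((continuous_finsetSum _ fun χ _ ↦
        hcont' χ).intervalIntegrable _ _) (Continuous.intervalIntegrable (by fun_prop) _ _)
        fun θ _ ↦ h2 θ).trans ?_
      simp only [intervalIntegral.integral_const_mul]
      have := integral_rpow_one_add_cos_le hy (r := r) (by rw [hr]; linarith)
      gcongr
    have hX : 0 ≤ B * V ^ (2 * (1 - σ + η)) / √(Real.log y) := by positivity
    refine (mul_le_mul_of_nonneg_left h3 (by positivity)).trans ?_
    have hpi : 2 / Real.pi ≤ 1 := (div_le_one Real.pi_pos).2 (by linarith [Real.pi_gt_three])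
    calc _ = 2 / Real.pi * (B * V ^ (2 * (1 - σ + η)) / √(Real.log y)) := by
          field_simp
      _ ≤ 1 * (B * V ^ (2 * (1 - σ + η)) / √(Real.log y)) := mul_le_mul_of_nonneg_right hpi hX
      _ = _ := one_mul _
  · refine (mul_le_mul_of_nonneg_right (card_dirichletCharacter_le Ξ) (by positivity)).trans (le_of_eq ?_)
    ring

end

section
open Finset

variable {q : ℕ}

theorem exists_forall_le_rpow {κ : ℝ} (hκ : 0 < κ) (A : ℝ) :
    ∃ M₀ : ℝ, 1 < M₀ ∧ ∀ M : ℝ, M₀ ≤ M → A ≤ M ^ κ ∧ 1 + Real.log M ≤ M ^ κ := by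
  have h1 : ∀ᶠ M : ℝ in Filter.atTop, A ≤ M ^ κ := (tendsto_rpow_atTop hκ).eventually_ge_atTop A
  have h2 : ∀ᶠ M : ℝ in Filter.atTop, 2 ≤ M ^ κ := (tendsto_rpow_atTop hκ).eventually_ge_atTop 2
  have h3 := (isLittleO_log_rpow_atTop hκ).bound (show (0 : ℝ) < 1 / 2 by norm_num)
  obtain ⟨M₀, hM⟩ := Filter.eventually_atTop.1 (h1.and (h2.and (h3.and (Filter.eventually_ge_atTop 1))))
  refine ⟨max M₀ 2, lt_of_lt_of_le one_lt_two (le_max_right _ _), fun M h ↦ ?_⟩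
  obtain ⟨a, b, c, d⟩ := hM M ((le_max_left _ _).trans h)
  refine ⟨a, ?_⟩
  rw [Real.norm_of_nonneg (Real.log_nonneg d), Real.norm_of_nonneg (by positivity)] at c
  linarith

theorem mul_div_sq_le_inv_pow {M X : ℝ} (hM : 1 ≤ M) (hX : 1 ≤ X) :
    40 * M * (8 / (M * X ^ 5)) ^ 2 ≤ 2560 * (X ^ 8)⁻¹ := by
  have e : 40 * M * (8 / (M * X ^ 5)) ^ 2 = 2560 * (X ^ 8)⁻¹ * (M * X ^ 2)⁻¹ := by
    field_simp; norm_num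
  rw [e]
  refine mul_le_of_le_one_right (by positivity) (inv_le_one_of_one_le₀ ?_)
  have : 1 ≤ X ^ 2 := one_le_pow₀ hX
  nlinarith

set_option maxHeartbeats 1600000 in
theorem sum_zeroMult_le_of_mollifier {κ v : ℝ} (hκ : 0 < κ) (hκ1 : κ ≤ 1 / 10) (hv : 1 / 2 ≤ v) :
    ∃ C : ℝ, 0 < C ∧ ∃ M₀ : ℝ, 1 < M₀ ∧ ∀ (q : ℕ) [NeZero q] (T : ℝ), 1 ≤ T → M₀ ≤ q * T →
      ∀ w : ℕ → ℝ, IsSelbergWeight q ⌊(q * T) ^ κ⌋₊ w → ∀ σ T₀ T₁ : ℝ,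
      1 / 2 ≤ σ - (Real.log (q * T))⁻¹ → σ ≤ 1 → T₀ ≤ T₁ → -(5 * T) ≤ T₀ - 3 → T₁ + 3 ≤ 5 * T →
      ∀ Ξ : Finset (DirichletCharacter ℂ q),
      (∀ χ ∈ Ξ, ∀ s : ℂ, σ - (Real.log (q * T))⁻¹ ≤ s.re → T₀ - 3 ≤ s.im → s.im ≤ T₁ + 3 →
        AnalyticAt ℂ χ.LFunction s) →
      (∀ χ ∈ Ξ, ∀ s : ℂ, σ - (Real.log (q * T))⁻¹ ≤ s.re → s.re ≤ 6 → T₀ - 3 ≤ s.im →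
        s.im ≤ T₁ + 3 →
        ‖1 - χ.LFunction s * mollD χ ((q * T) ^ (1 + 5 * κ)) ((q * T) ^ (1 + 6 * κ))
          ⌊(q * T) ^ κ⌋₊ w s + mollP χ ((q * T) ^ (1 + 5 * κ)) ((q * T) ^ (1 + 6 * κ))
          (((q : ℝ) ^ 4 * T ^ 5) ^ v) w s‖ ≤ 64 * (q * T) ^ (-(1 / 2 + 4 * κ))) →
      ∀ Z : DirichletCharacter ℂ q → Finset ℂ,
      (∀ χ ∈ Ξ, ∀ ρ ∈ Z χ, σ ≤ ρ.re ∧ ρ.re ≤ 1 ∧ T₀ + 1 ≤ ρ.im ∧ ρ.im ≤ T₁ - 1) →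
      ∑ χ ∈ Ξ, ∑ ρ ∈ Z χ, (zeroMult χ.LFunction ρ : ℝ) ≤
        C * (((q : ℝ) ^ 4 * T ^ 5) ^ v) ^ (2 * (1 - σ)) := by
  set C1 : ℝ := 4 * Real.exp 14 * √Real.pi * (2 / κ) * 7776000 * (5 * v / κ) ^ 2 * Real.exp (10 * v)
    with hC1
  clear_value C1
  obtain ⟨M₀, hM₀, hlarge⟩ := exists_forall_le_rpow hκ 100
  have hC1p : 0 < C1 := by
    have : 0 < v := by linarith
    rw [hC1]
    positivity
  refine ⟨4 * (C1 + 1), by positivity, M₀, hM₀, ?_⟩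
  intro q _ T hT hM w hw σ T₀ T₁ hσ hσ1 hTT hT0 hT1 Ξ hf hE Z hZ
  obtain ⟨hX, hXl⟩ := hlarge _ hM
  have hq1 : (1 : ℝ) ≤ q := by exact_mod_cast NeZero.one_le
  set M : ℝ := q * T with hMdef
  have hM1 : 1 < M := by linarith
  have hMp : 0 < M := by linarith
  set X : ℝ := M ^ κ with hXdef
  set ℓ : ℝ := Real.log M with hℓ
  have hXp : 0 < X := by linarith
  have hXM : X ^ 10 ≤ M := by
    rw [hXdef, ← Real.rpow_mul_natCast hMp.le]
    calc M ^ (κ * (10 : ℕ)) ≤ M ^ (1 : ℝ) :=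
          Real.rpow_le_rpow_of_exponent_le hM1.le (by push_cast; linarith)
      _ = M := Real.rpow_one M
  have hX10 : (100 : ℝ) ^ 10 ≤ X ^ 10 := pow_le_pow_left₀ (by norm_num) hX 10
  have hMbig : (2 : ℝ) ^ 20 ≤ M := by norm_num at hX10 ⊢; linarith
  have hℓ10 : 10 ≤ ℓ := by
    have h := Real.log_le_log (by norm_num) hMbig
    rw [Real.log_pow] at h
    have := Real.log_two_gt_d9
    push_cast at h
    linarith
  have hℓp : 0 < ℓ := by linarith
  set R : ℕ := ⌊X⌋₊ with hRdef
  set V : ℝ := ((q : ℝ) ^ 4 * T ^ 5) ^ v with hVdef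
  set y : ℝ := M ^ (1 + 5 * κ) with hydef
  set Y : ℝ := M ^ (1 + 6 * κ) with hYdef
  clear_value Y y V R ℓ X M
  have hR1 : 1 ≤ R := by rw [hRdef]; exact Nat.le_floor (by push_cast; linarith)
  have hRX : (R : ℝ) ≤ X := by rw [hRdef]; exact Nat.floor_le hXp.le
  have hRX2 : X / 2 ≤ R := by
    have := Nat.lt_floor_add_one X
    rw [hRdef]; linarith
  have hy1 : 1 < y := by rw [hydef]; exact Real.one_lt_rpow hM1 (by linarith)
  have hyY : y < Y := by rw [hydef, hYdef]; exact Real.rpow_lt_rpow_of_exponent_lt hM1 (by linarith)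
  have hbase : M ^ 4 ≤ (q : ℝ) ^ 4 * T ^ 5 := by
    rw [hMdef, mul_pow]
    exact mul_le_mul_of_nonneg_left (pow_le_pow_right₀ hT (by norm_num)) (by positivity)
  have hbase2 : (q : ℝ) ^ 4 * T ^ 5 ≤ M ^ 5 := by
    rw [hMdef, mul_pow]
    exact mul_le_mul_of_nonneg_right (pow_le_pow_right₀ hq1 (by norm_num)) (by positivity)
  have hbp : 0 < (q : ℝ) ^ 4 * T ^ 5 := lt_of_lt_of_le (by positivity) hbase
  have hM4 : (1 : ℝ) ≤ M ^ 4 := one_le_pow₀ hM1.le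
  have hYV : Y ≤ V := by
    calc Y ≤ M ^ (4 * v) := by rw [hYdef]; exact Real.rpow_le_rpow_of_exponent_le hM1.le (by linarith)
      _ = (M ^ 4) ^ v := by rw [Real.rpow_mul hMp.le]; norm_cast
      _ ≤ V := by rw [hVdef]; exact Real.rpow_le_rpow (by positivity) hbase (by linarith)
  have hVp : 0 < V := by linarith
  have hV1 : 1 ≤ V := by linarith
  have hlogV : Real.log V ≤ 5 * v * ℓ := by
    rw [hVdef, Real.log_rpow hbp]
    have := Real.log_le_log hbp hbase2
    rw [Real.log_pow, ← hℓ] at this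
    push_cast at this
    linarith [mul_le_mul_of_nonneg_left this (by linarith : 0 ≤ v)]
  have hlogV1 : 1 ≤ Real.log V := by
    have h1 := Real.log_le_log (by linarith) hYV
    rw [hYdef, Real.log_rpow hMp, ← hℓ] at h1
    linarith [mul_pos hκ hℓp]
  have hlogYy : Real.log (Y / y) = κ * ℓ := by
    rw [hYdef, hydef, ← Real.rpow_sub hMp, Real.log_rpow hMp, hℓ]
    ring
  set δ : ℝ := 2 / (κ * ℓ) with hδdef
  clear_value δ
  have hδ0 : 0 < δ := by rw [hδdef]; positivity
  have hlogR : κ * ℓ / 2 ≤ Real.log R := by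
    have h1 : Real.log (X ^ (1 / 2 : ℝ)) ≤ Real.log R := by
      refine Real.log_le_log (by positivity) (le_trans ?_ hRX2)
      rw [← Real.sqrt_eq_rpow, Real.sqrt_le_left (by linarith)]
      linarith [mul_le_mul_of_nonneg_left hX hXp.le]
    rw [Real.log_rpow hXp, hXdef, Real.log_rpow hMp, ← hℓ] at h1
    linarith
  have hlogRp : 0 < Real.log R := lt_of_lt_of_le (by positivity) hlogR
  have hδ : (q.totient / q : ℝ) * (selbergSum (coprimeSieve q R) R)⁻¹ ≤ δ := by
    have h1 := totient_div_mul_log_le_selbergSum (NeZero.ne q) R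
    have hφ : (0 : ℝ) < q.totient / q := by
      have : 0 < q.totient := Nat.totient_pos.2 (NeZero.pos q)
      positivity
    have hS : 0 < selbergSum (coprimeSieve q R) R := lt_of_lt_of_le (by positivity) h1
    rw [← div_eq_mul_inv, div_le_iff₀ hS]
    calc (q.totient : ℝ) / q = (2 / (κ * ℓ)) * (q.totient / q * (κ * ℓ / 2)) := by field_simp
      _ ≤ δ * (q.totient / q * Real.log R) := by rw [← hδdef]; gcongr
      _ ≤ δ * selbergSum (coprimeSieve q R) R := by gcongr
  have hyX : y = M * X ^ 5 := by
    rw [hydef, hXdef, ← Real.rpow_mul_natCast hMp.le, Real.rpow_add hMp, Real.rpow_one]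
    push_cast; ring_nf
  have hδ2 : 5 * T * q.totient * R ^ 2 ≤ δ * y := by
    have hφ : (q.totient : ℝ) ≤ q := by exact_mod_cast Nat.totient_le q
    have h1 : 5 * T * q.totient * R ^ 2 ≤ 5 * M * X ^ 2 := by
      calc 5 * T * q.totient * R ^ 2 ≤ 5 * T * q * X ^ 2 := by gcongr
        _ = _ := by rw [hMdef]; ring
    refine h1.trans ?_
    rw [hδdef, hyX, div_mul_eq_mul_div, le_div_iff₀ (by positivity)]
    have h2 : κ * ℓ ≤ X := by linarith [mul_le_mul_of_nonneg_right hκ1 hℓp.le]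
    calc 5 * M * X ^ 2 * (κ * ℓ) ≤ 5 * M * X ^ 2 * X := by gcongr
      _ = M * X ^ 3 * 5 := by ring
      _ ≤ M * X ^ 3 * (2 * X ^ 2) := by
          gcongr
          linarith [mul_le_mul_of_nonneg_left hX hXp.le]
      _ = _ := by ring
  have hMX : M ^ (-(1 / 2 + 4 * κ)) ≤ (X ^ 4)⁻¹ := by
    rw [Real.rpow_neg hMp.le]
    apply inv_anti₀ (by positivity)
    rw [hXdef, ← Real.rpow_mul_natCast hMp.le]
    exact Real.rpow_le_rpow_of_exponent_le hM1.le (by push_cast; linarith)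
  have hMX2 : (M ^ (-(1 / 2 + 4 * κ))) ^ 2 = (M * X ^ 8)⁻¹ := by
    rw [hXdef, ← Real.rpow_mul_natCast hMp.le, ← Real.rpow_mul_natCast hMp.le, ← Real.rpow_one_add' hMp.le
      (by push_cast; linarith), ← Real.rpow_neg hMp.le]
    congr 1; push_cast; ring
  have hsmall : 8 / y + 64 * M ^ (-(1 / 2 + 4 * κ)) ≤ 1 / 2 := by
    have h1 : 8 / y ≤ 1 / 4 := by
      rw [div_le_div_iff₀ (by linarith) (by norm_num)]
      have : M ≤ y := by
        calc M = M ^ (1 : ℝ) := (Real.rpow_one M).symm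
          _ ≤ y := by rw [hydef]; exact Real.rpow_le_rpow_of_exponent_le hM1.le (by linarith)
      norm_num at hMbig; linarith
    have h2 : 64 * (X ^ 4)⁻¹ ≤ 1 / 4 := by
      rw [← div_eq_mul_inv, div_le_div_iff₀ (by positivity) (by norm_num)]
      have := pow_le_pow_left₀ (by norm_num) hX 4
      norm_num at this; linarith
    linarith
  have hη1 : ℓ⁻¹ ≤ 1 := inv_le_one_of_one_le₀ (by linarith)
  have hsη : √(ℓ⁻¹) ≤ 1 := Real.sqrt_le_one.2 hη1
  have key := sum_zeroMult_mul_le hR1 hw hy1 hyY hYV hlogV1 (T := 5 * T) (by linarith) hδ hδ2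
    (inv_pos.2 hℓp) hη1 hσ hσ1 hTT hT0 hT1 Ξ hf hE hsmall Z fun χ hχ ρ hρ ↦ by
      obtain ⟨a, b, c, d⟩ := hZ χ hχ ρ hρ
      exact ⟨a, b, by linarith, by linarith⟩
  generalize ∑ χ ∈ Ξ, ∑ ρ ∈ Z χ, (zeroMult χ.LFunction ρ : ℝ) = N at key ⊢
  set H : ℝ := V ^ (2 * (1 - σ)) with hH
  have hH1 : 1 ≤ H := by rw [hH]; exact Real.one_le_rpow hV1 (by linarith)
  clear_value H
  have hsℓ : 0 < √ℓ := Real.sqrt_pos.2 hℓp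
  have t1 : 4 * Real.exp 14 * √Real.pi * δ * 7776000 * (Real.log V / Real.log (Y / y)) ^ 2 *
        V ^ (2 * (1 - σ + ℓ⁻¹)) / √(Real.log y) ≤ C1 * H * (ℓ * √ℓ)⁻¹ := by
    have e1 : V ^ (2 * (1 - σ + ℓ⁻¹)) ≤ H * Real.exp (10 * v) := by
      rw [mul_add, Real.rpow_add hVp, ← hH]
      refine mul_le_mul_of_nonneg_left ?_ (by positivity)
      rw [Real.rpow_def_of_pos hVp, Real.exp_le_exp]
      calc Real.log V * (2 * ℓ⁻¹) ≤ 5 * v * ℓ * (2 * ℓ⁻¹) := by gcongr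
        _ = 10 * v := by field_simp; ring
    have e2 : √ℓ ≤ √(Real.log y) := by
      apply Real.sqrt_le_sqrt
      rw [hydef, Real.log_rpow hMp, ← hℓ]
      linarith [mul_pos hκ hℓp]
    have e3 : (Real.log V / Real.log (Y / y)) ^ 2 ≤ (5 * v / κ) ^ 2 := by
      rw [hlogYy]
      refine pow_le_pow_left₀ (div_nonneg (by linarith) (by positivity)) ?_ 2
      rw [div_le_div_iff₀ (by positivity) hκ]
      linarith [mul_le_mul_of_nonneg_right hlogV hκ.le]
    calc _ ≤ 4 * Real.exp 14 * √Real.pi * δ * 7776000 * (5 * v / κ) ^ 2 * (H * Real.exp (10 * v)) / √ℓ := by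
          gcongr
      _ = C1 * H * (ℓ * √ℓ)⁻¹ := by
          rw [hC1, hδdef]; field_simp
  have hℓX : ℓ * √ℓ ≤ X ^ 2 := by
    have h1 : √ℓ ≤ ℓ := by
      rw [Real.sqrt_le_left hℓp.le]
      linarith [mul_le_mul_of_nonneg_left hℓ10 hℓp.le]
    rw [pow_two]
    exact mul_le_mul (by linarith) (by linarith) hsℓ.le hXp.le
  have t2 : 8 * (5 * T) * q * (8 / y) ^ 2 + 12 * q * (5 * T) * (64 * M ^ (-(1 / 2 + 4 * κ))) ^ 2 ≤
      (ℓ * √ℓ)⁻¹ := by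
    have e1 : 8 * (5 * T) * q * (8 / y) ^ 2 ≤ 2560 * (X ^ 8)⁻¹ := by
      have h8 : 8 * (5 * T) * q = 40 * M := by rw [hMdef]; ring
      rw [hyX, h8]
      exact mul_div_sq_le_inv_pow hM1.le (by linarith)
    have e2 : 12 * q * (5 * T) * (64 * M ^ (-(1 / 2 + 4 * κ))) ^ 2 = 245760 * (X ^ 8)⁻¹ := by
      rw [mul_pow, hMX2]
      have : 12 * q * (5 * T) = 60 * M := by rw [hMdef]; ring
      rw [this]; field_simp; norm_num
    rw [e2]
    have e3 : (X ^ 2)⁻¹ ≤ (ℓ * √ℓ)⁻¹ := inv_anti₀ (by positivity) hℓX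
    refine le_trans (add_le_add e1 le_rfl) (le_trans ?_ e3)
    rw [← add_mul, ← div_eq_mul_inv, div_le_iff₀ (by positivity)]
    have : (X ^ 2)⁻¹ * X ^ 8 = X ^ 6 := by field_simp
    rw [this]
    have := pow_le_pow_left₀ (by norm_num) hX 6
    norm_num at this ⊢; linarith
  have hfin : N * (ℓ⁻¹ * √(ℓ⁻¹) / 4) ≤ (C1 + 1) * H * (ℓ * √ℓ)⁻¹ := by
    have h3 : (ℓ * √ℓ)⁻¹ ≤ H * (ℓ * √ℓ)⁻¹ := le_mul_of_one_le_left (by positivity) hH1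
    rw [add_assoc] at key
    calc _ ≤ C1 * H * (ℓ * √ℓ)⁻¹ + H * (ℓ * √ℓ)⁻¹ := key.trans (add_le_add t1 (t2.trans h3))
      _ = _ := by ring
  rw [Real.sqrt_inv] at hfin
  have h4 : N * (ℓ⁻¹ * (√ℓ)⁻¹ / 4) = N / 4 * (ℓ * √ℓ)⁻¹ := by rw [mul_inv]; ring
  rw [h4] at hfin
  have h5 := le_of_mul_le_mul_right hfin (by positivity)
  linarith

end

section
open Finset

variable {q : ℕ}

theorem rpow_main_error_le {κ v σ₀ Q T : ℝ} (hκ : 0 < κ) (hQ : 1 ≤ Q) (hT : 1 ≤ T)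
    (hv : 1 + 6 * κ ≤ 2 * v * σ₀) :
    √Q * T * (Q * T) ^ (1 + 8 * κ) * ((Q ^ 4 * T ^ 5) ^ v) ^ (-σ₀) ≤ (Q * T) ^ (-(1 / 2 + 4 * κ)) := by
  have hM : 1 ≤ Q * T := one_le_mul_of_one_le_of_one_le hQ hT
  set M := Q * T with hMdef
  have hMp : 0 < M := by linarith
  have hTp : 0 < T := by linarith
  have hb : Q ^ 4 * T ^ 5 = M ^ 4 * T := by rw [hMdef]; ring
  have hb1 : 1 ≤ M ^ 4 * T := one_le_mul_of_one_le_of_one_le (one_le_pow₀ hM) hT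
  have h1 : ((Q ^ 4 * T ^ 5) ^ v) ^ (-σ₀) ≤ M ^ (-(2 + 12 * κ)) * T ^ (-(1 / 2 : ℝ)) := by
    rw [hb, ← Real.rpow_mul (by linarith)]
    calc (M ^ 4 * T) ^ (v * -σ₀) ≤ (M ^ 4 * T) ^ (-(1 / 2 + 3 * κ)) :=
          Real.rpow_le_rpow_of_exponent_le hb1 (by linarith)
      _ = M ^ (-(2 + 12 * κ)) * T ^ (-(1 / 2 + 3 * κ)) := by
          rw [Real.mul_rpow (by positivity) hTp.le, ← Real.rpow_natCast_mul hMp.le]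
          congr 2; push_cast; ring
      _ ≤ _ := mul_le_mul_of_nonneg_left
          (Real.rpow_le_rpow_of_exponent_le hT (by linarith)) (by positivity)
  have h2 : √Q * T = M ^ (1 / 2 : ℝ) * T ^ (1 / 2 : ℝ) := by
    rw [hMdef, Real.mul_rpow (by linarith) hTp.le, ← Real.sqrt_eq_rpow, ← Real.sqrt_eq_rpow, mul_assoc,
      Real.mul_self_sqrt hTp.le]
  calc _ ≤ √Q * T * M ^ (1 + 8 * κ) * (M ^ (-(2 + 12 * κ)) * T ^ (-(1 / 2 : ℝ))) :=
        mul_le_mul_of_nonneg_left h1 (by positivity)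
    _ = (M ^ (1 / 2 : ℝ) * M ^ (1 + 8 * κ) * M ^ (-(2 + 12 * κ))) * (T ^ (1 / 2 : ℝ) * T ^ (-(1 / 2 : ℝ))) := by
        rw [h2]; ring
    _ = M ^ (-(1 / 2 + 4 * κ)) := by
        rw [← Real.rpow_add hMp, ← Real.rpow_add hMp, ← Real.rpow_add hTp]
        have e : (1 / 2 : ℝ) + -(1 / 2) = 0 := by norm_num
        rw [e, Real.rpow_zero, mul_one]
        congr 1; ring

theorem main_error_le {κ v σ₀ Q T K : ℝ} (hκ : 0 < κ) (hQ : 1 ≤ Q) (hT : 1 ≤ T)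
    (hv : 1 + 6 * κ ≤ 2 * v * σ₀) (hv0 : 0 ≤ v) (hσ₀ : 3 / 4 ≤ σ₀) (hK : K ≤ 2 * √Q * (Q * T) ^ κ) {s : ℂ}
    (hs : σ₀ ≤ s.re) (hs6 : s.re ≤ 6) (him : |s.im| ≤ 5 * T) :
    K * ((Q * T) ^ (1 + 6 * κ) * ⌊(Q * T) ^ κ⌋₊) * ((Q ^ 4 * T ^ 5) ^ v) ^ (-s.re) * (1 + ‖s‖ / s.re) ≤
      32 * (Q * T) ^ (-(1 / 2 + 4 * κ)) := by
  have hM : 1 ≤ Q * T := one_le_mul_of_one_le_of_one_le hQ hT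
  have hMp : 0 < Q * T := by linarith
  have hsn : ‖s‖ ≤ 11 * T := by
    refine (Complex.norm_le_abs_re_add_abs_im s).trans ?_
    rw [abs_of_nonneg (by linarith)]
    linarith
  have h1 : 1 + ‖s‖ / s.re ≤ 16 * T := by
    have : ‖s‖ / s.re ≤ 15 * T := by
      rw [div_le_iff₀ (by linarith)]
      nlinarith
    linarith
  have hV1 : 1 ≤ (Q ^ 4 * T ^ 5) ^ v :=
    Real.one_le_rpow (one_le_mul_of_one_le_of_one_le (one_le_pow₀ hQ) (one_le_pow₀ hT)) hv0
  have h2 : ((Q ^ 4 * T ^ 5) ^ v) ^ (-s.re) ≤ ((Q ^ 4 * T ^ 5) ^ v) ^ (-σ₀) :=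
    Real.rpow_le_rpow_of_exponent_le hV1 (by linarith)
  have hR : (⌊(Q * T) ^ κ⌋₊ : ℝ) ≤ (Q * T) ^ κ := Nat.floor_le (by positivity)
  have h3 : 0 ≤ 1 + ‖s‖ / s.re := by
    have : 0 < s.re := by linarith
    positivity
  have hVp : 0 < (Q ^ 4 * T ^ 5) ^ v := by linarith
  calc _ ≤ (2 * √Q * (Q * T) ^ κ) * ((Q * T) ^ (1 + 6 * κ) * (Q * T) ^ κ) *
        ((Q ^ 4 * T ^ 5) ^ v) ^ (-σ₀) * (16 * T) := by
        gcongr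
    _ = 32 * (√Q * T * ((Q * T) ^ κ * (Q * T) ^ (1 + 6 * κ) * (Q * T) ^ κ) *
        ((Q ^ 4 * T ^ 5) ^ v) ^ (-σ₀)) := by ring
    _ = 32 * (√Q * T * (Q * T) ^ (1 + 8 * κ) * ((Q ^ 4 * T ^ 5) ^ v) ^ (-σ₀)) := by
        rw [← Real.rpow_add hMp, ← Real.rpow_add hMp]
        ring_nf
    _ ≤ _ := mul_le_mul_of_nonneg_left (rpow_main_error_le hκ hQ hT hv) (by norm_num)

/-- Log-free zero density estimate for the nonprincipal characters modulo `q`. -/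
theorem sum_zeroMult_nonprincipal_le {κ v σ₀ : ℝ} (hκ : 0 < κ) (hκ1 : κ ≤ 1 / 10)
    (hσ₀ : 3 / 4 ≤ σ₀) (hv0 : 1 / 2 ≤ v) (hv : 1 + 6 * κ ≤ 2 * v * σ₀) :
    ∃ C : ℝ, 0 < C ∧ ∃ M₀ : ℝ, 1 < M₀ ∧ ∀ (q : ℕ) [NeZero q] (T : ℝ), 1 ≤ T → M₀ ≤ q * T →
      ∀ σ : ℝ, σ₀ ≤ σ - (Real.log (q * T))⁻¹ → σ ≤ 1 →
      ∀ Z : DirichletCharacter ℂ q → Finset ℂ,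
      (∀ χ, χ ≠ 1 → ∀ ρ ∈ Z χ, σ ≤ ρ.re ∧ ρ.re ≤ 1 ∧ |ρ.im| ≤ T) →
      ∑ χ ∈ univ.erase (1 : DirichletCharacter ℂ q), ∑ ρ ∈ Z χ, (zeroMult χ.LFunction ρ : ℝ) ≤
        C * (((q : ℝ) ^ 4 * T ^ 5) ^ v) ^ (2 * (1 - σ)) := by
  obtain ⟨C, hC, M₁, hM₁, H⟩ := sum_zeroMult_le_of_mollifier hκ hκ1 hv0
  obtain ⟨M₂, hM₂, hlarge⟩ := exists_forall_le_rpow hκ 1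
  refine ⟨C, hC, max M₁ M₂, lt_max_of_lt_left hM₁, ?_⟩
  intro q _ T hT hM σ hσ hσ1 Z hZ
  obtain ⟨hX, hXl⟩ := hlarge _ ((le_max_right _ _).trans hM)
  have hq1 : (1 : ℝ) ≤ q := by exact_mod_cast NeZero.one_le
  have hM1 : 1 < q * T := lt_of_lt_of_le hM₂ ((le_max_right _ _).trans hM)
  obtain ⟨w, hw⟩ := exists_isSelbergWeight q (R := ⌊((q : ℝ) * T) ^ κ⌋₊)
    (Nat.le_floor (by push_cast; exact hX))
  refine H q T hT ((le_max_left _ _).trans hM) w hw σ (-T - 1) (T + 1) (by linarith) hσ1 (by linarith)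
    (by linarith) (by linarith) _ ?_ ?_ Z ?_
  · intro χ hχ s _ _ _
    exact (DirichletCharacter.differentiable_LFunction (ne_of_mem_erase hχ)).analyticAt s
  · intro χ hχ s hs hs6 hi1 hi2
    have hχ1 := ne_of_mem_erase hχ
    have hd := DirichletCharacter.differentiable_LFunction hχ1
    have hYV : ∀ a : ℝ, 0 ≤ a → (1 : ℝ) ≤ (q * T) ^ a := fun a ha ↦ Real.one_le_rpow hM1.le ha
    have key : ∀ s : ℂ, s ≠ 1 → σ₀ ≤ s.re → s.re ≤ 6 → |s.im| ≤ 5 * T →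
        ‖1 - χ.LFunction s * mollD χ ((q * T) ^ (1 + 5 * κ)) ((q * T) ^ (1 + 6 * κ))
          ⌊((q : ℝ) * T) ^ κ⌋₊ w s + mollP χ ((q * T) ^ (1 + 5 * κ)) ((q * T) ^ (1 + 6 * κ))
          (((q : ℝ) ^ 4 * T ^ 5) ^ v) w s‖ ≤ 64 * (q * T) ^ (-(1 / 2 + 4 * κ)) := by
      intro s hs1 hs hs6 him
      have h := norm_one_sub_mul_mollD_add_le (χ := χ) (κ := 0) (K := 2 * √q * (1 + Real.log q))
        (f := χ.LFunction) (g := fun s ↦ (s - 1) * χ.LFunction s) (w := w) (R := ⌊((q : ℝ) * T) ^ κ⌋₊)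
        (y := (q * T) ^ (1 + 5 * κ)) (Y := (q * T) ^ (1 + 6 * κ)) (V := ((q : ℝ) ^ 4 * T ^ 5) ^ v)
        (hYV _ (by linarith)) (Real.rpow_lt_rpow_of_exponent_lt hM1 (by linarith))
        (Real.one_le_rpow (one_le_mul_of_one_le_of_one_le (one_le_pow₀ hq1) (one_le_pow₀ hT)) (by linarith))
        hw.one (fun d hd ↦ by_contra fun h0 ↦ absurd (hw.le d h0) (not_le.2 hd)) hw.abs_le_one
        (mul_nonneg (by positivity) (by linarith [Real.log_nonneg hq1]))
        (fun u _ ↦ by rw [zero_mul, sub_zero]; exact norm_sum_char_le hχ1 _)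
        (by fun_prop) (fun s hs ↦ by rw [χ.LFunction_eq_LSeries hs]) (by linarith) hs1 rfl
      refine h.trans ?_
      rw [norm_zero, zero_mul, zero_mul, zero_div, zero_add]
      refine (main_error_le hκ hq1 hT hv (by linarith) hσ₀ ?_ hs hs6
        him).trans ?_
      · refine mul_le_mul_of_nonneg_left (le_trans ?_ hXl) (by positivity)
        have : Real.log q ≤ Real.log (q * T) :=
          Real.log_le_log (by linarith) (le_mul_of_one_le_right (by linarith) hT)
        linarith
      · have : 0 < (q * T) ^ (-(1 / 2 + 4 * κ)) := Real.rpow_pos_of_pos (by linarith) _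
        linarith
    have hs' : σ₀ ≤ s.re := by linarith
    have hi : |s.im| ≤ 5 * T := abs_le.2 ⟨by linarith, by linarith⟩
    rcases eq_or_ne s 1 with rfl | hs1
    · have hc : Continuous fun t : ℝ ↦ ‖1 - χ.LFunction (1 + t) *
          mollD χ ((q * T) ^ (1 + 5 * κ)) ((q * T) ^ (1 + 6 * κ)) ⌊((q : ℝ) * T) ^ κ⌋₊ w (1 + t) +
          mollP χ ((q * T) ^ (1 + 5 * κ)) ((q * T) ^ (1 + 6 * κ)) (((q : ℝ) ^ 4 * T ^ 5) ^ v) w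
            (1 + t)‖ := by
        have h1 := hd.continuous
        have h2 := (differentiable_mollD χ ((q * T) ^ (1 + 5 * κ)) ((q * T) ^ (1 + 6 * κ))
          ⌊((q : ℝ) * T) ^ κ⌋₊ w).continuous
        have h3 := continuous_mollP χ ((q * T) ^ (1 + 5 * κ)) ((q * T) ^ (1 + 6 * κ))
          (((q : ℝ) ^ 4 * T ^ 5) ^ v) w
        fun_prop
      have ht := (hc.tendsto 0).mono_left (nhdsWithin_le_nhds (s := Set.Ioi 0))
      simp only [Complex.ofReal_zero, add_zero] at ht
      refine le_of_tendsto ht ?_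
      filter_upwards [Ioo_mem_nhdsGT (zero_lt_one' ℝ)] with t ht
      refine key _ ?_ ?_ ?_ ?_
      · simp [ht.1.ne']
      · simp at hs' ⊢; linarith [ht.1]
      · simp; linarith [ht.2]
      · simp; linarith
    · exact key s hs1 hs' hs6 hi
  · intro χ hχ ρ hρ
    obtain ⟨a, b, c⟩ := hZ χ (ne_of_mem_erase hχ) ρ hρ
    rw [abs_le] at c
    exact ⟨a, b, by linarith, by linarith⟩

end

section
open Finset

theorem pole_error_le {κ v σ₀ T : ℝ} (hκ : 0 < κ) (hκ1 : κ ≤ 1 / 10) (hT : 1 ≤ T) (hv0 : 0 ≤ v)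
    (hv : 6 * κ + 5 * v * (1 - σ₀) ≤ 1 / 2) (hl : 1 + Real.log T ≤ T ^ κ) {s : ℂ} (hs : σ₀ ≤ s.re)
    (him : T / 2 ≤ ‖s - 1‖) :
    (⌊T ^ κ⌋₊ * (1 + Real.log (T ^ (1 + 6 * κ)))) * ((T ^ 5) ^ v) ^ (1 - s.re) / ‖s - 1‖ ≤
      32 * T ^ (-(1 / 2 + 4 * κ)) := by
  have hTp : 0 < T := by linarith
  have hlog := Real.log_nonneg hT
  have h1 : (⌊T ^ κ⌋₊ : ℝ) ≤ T ^ κ := Nat.floor_le (by positivity)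
  have h2 : 1 + Real.log (T ^ (1 + 6 * κ)) ≤ 2 * T ^ κ := by
    rw [Real.log_rpow hTp]
    have := mul_le_mul_of_nonneg_right (show 1 + 6 * κ ≤ 2 by linarith) hlog
    linarith
  have h3 : ((T ^ 5) ^ v) ^ (1 - s.re) ≤ T ^ (5 * v * (1 - σ₀)) := by
    rw [← Real.rpow_natCast_mul hTp.le, ← Real.rpow_mul hTp.le]
    refine Real.rpow_le_rpow_of_exponent_le hT ?_
    push_cast
    exact mul_le_mul_of_nonneg_left (by linarith) (by linarith)
  have h4 : 0 < ‖s - 1‖ := by linarith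
  rw [div_le_iff₀ h4]
  calc _ ≤ (T ^ κ * (2 * T ^ κ)) * T ^ (5 * v * (1 - σ₀)) := by
        have h5 : 0 ≤ 1 + Real.log (T ^ (1 + 6 * κ)) := by
          have := Real.log_nonneg (Real.one_le_rpow hT (show 0 ≤ 1 + 6 * κ by linarith))
          linarith
        gcongr
    _ = 2 * T ^ (2 * κ + 5 * v * (1 - σ₀)) := by
        rw [Real.rpow_add hTp, two_mul κ, Real.rpow_add hTp]; ring
    _ ≤ 2 * T ^ (-(1 / 2 + 4 * κ) + 1) := by
        refine mul_le_mul_of_nonneg_left (Real.rpow_le_rpow_of_exponent_le hT (by linarith)) (by norm_num)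
    _ = T ^ (-(1 / 2 + 4 * κ)) * (2 * T) := by rw [Real.rpow_add hTp, Real.rpow_one]; ring
    _ ≤ T ^ (-(1 / 2 + 4 * κ)) * (4 * ‖s - 1‖) :=
        mul_le_mul_of_nonneg_left (by linarith) (by positivity)
    _ ≤ _ := by
        have : 0 ≤ T ^ (-(1 / 2 + 4 * κ)) * ‖s - 1‖ := by positivity
        linarith

theorem sum_zeroMult_riemannZeta_window_le {κ v σ₀ : ℝ} (hκ : 0 < κ) (hκ1 : κ ≤ 1 / 10)
    (hσ₀ : 3 / 4 ≤ σ₀) (hv0 : 1 / 2 ≤ v) (hv : 1 + 6 * κ ≤ 2 * v * σ₀)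
    (hv2 : 6 * κ + 5 * v * (1 - σ₀) ≤ 1 / 2) :
    ∃ C : ℝ, 0 < C ∧ ∃ M₀ : ℝ, 1 < M₀ ∧ ∀ T : ℝ, M₀ ≤ T → ∀ T₀ T₁ : ℝ, T₀ ≤ T₁ →
      -(5 * T) ≤ T₀ - 3 → T₁ + 3 ≤ 5 * T → (∀ y, T₀ - 3 ≤ y → y ≤ T₁ + 3 → T / 2 ≤ |y|) →
      ∀ σ : ℝ, σ₀ ≤ σ - (Real.log T)⁻¹ → σ ≤ 1 → ∀ Z : Finset ℂ,
      (∀ ρ ∈ Z, σ ≤ ρ.re ∧ ρ.re ≤ 1 ∧ T₀ + 1 ≤ ρ.im ∧ ρ.im ≤ T₁ - 1) →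
      ∑ ρ ∈ Z, (zeroMult riemannZeta ρ : ℝ) ≤ C * T ^ (10 * v * (1 - σ)) := by
  obtain ⟨C, hC, M₁, hM₁, H⟩ := sum_zeroMult_le_of_mollifier hκ hκ1 hv0
  obtain ⟨M₂, hM₂, hlarge⟩ := exists_forall_le_rpow hκ 1
  refine ⟨C, hC, max M₁ M₂, lt_max_of_lt_left hM₁, ?_⟩
  intro T hM T₀ T₁ hTT hT0 hT1 him σ hσ hσ1 Z hZ
  have hM1 : 1 < T := lt_of_lt_of_le hM₂ ((le_max_right _ _).trans hM)
  have hTp : 0 < T := by linarith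
  obtain ⟨hX, hXl⟩ := hlarge _ ((le_max_right _ _).trans hM)
  obtain ⟨w, hw⟩ := exists_isSelbergWeight 1 (R := ⌊T ^ κ⌋₊) (Nat.le_floor (by push_cast; exact hX))
  have H := H 1 T hM1.le
  simp only [Nat.cast_one, one_mul, one_pow] at H
  have hL : (1 : DirichletCharacter ℂ 1).LFunction = riemannZeta := DirichletCharacter.LFunction_modOne_eq
  have h0 : ∀ s : ℂ, T₀ - 3 ≤ s.im → s.im ≤ T₁ + 3 → T / 2 ≤ ‖s - 1‖ := fun s h1 h2 ↦ by
    have := (him _ h1 h2).trans (Complex.abs_im_le_norm (s - 1) |>.trans' (by simp))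
    exact this
  have hne : ∀ s : ℂ, T₀ - 3 ≤ s.im → s.im ≤ T₁ + 3 → s ≠ 1 := fun s h1 h2 h ↦ by
    have := h0 s h1 h2
    rw [h, sub_self, norm_zero] at this
    linarith
  have := H ((le_max_left _ _).trans hM) w hw σ T₀ T₁ (by linarith) hσ1 hTT hT0 hT1 {1} ?_ ?_
    (fun _ ↦ Z) (fun _ _ ↦ hZ)
  · rw [sum_singleton, hL] at this
    refine this.trans (le_of_eq ?_)
    rw [← Real.rpow_natCast_mul hTp.le, ← Real.rpow_mul hTp.le]
    congr 2; push_cast; ring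
  · intro χ hχ s _ h1 h2
    rw [mem_singleton.1 hχ, hL]
    refine DifferentiableOn.analyticAt (s := {1}ᶜ) (fun z hz ↦
      (differentiableAt_riemannZeta hz).differentiableWithinAt) (isOpen_compl_singleton.mem_nhds (hne s h1 h2))
  · intro χ hχ s hs hs6 hi1 hi2
    rw [mem_singleton.1 hχ]
    have hs1 := hne s hi1 hi2
    have hone : ∀ n : ℕ, (1 : DirichletCharacter ℂ 1) (n : ZMod 1) = 1 := fun n ↦ by
      rw [MulChar.one_apply]; exact isUnit_of_subsingleton _
    have hYV : ∀ a : ℝ, 0 ≤ a → (1 : ℝ) ≤ T ^ a := fun a ha ↦ Real.one_le_rpow hM1.le ha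
    have h := norm_one_sub_mul_mollD_add_le (χ := (1 : DirichletCharacter ℂ 1)) (κ := 1) (K := 1)
      (f := (1 : DirichletCharacter ℂ 1).LFunction) (g := DirichletCharacter.LFunctionTrivChar₁ 1)
      (w := w) (R := ⌊T ^ κ⌋₊)
      (y := T ^ (1 + 5 * κ)) (Y := T ^ (1 + 6 * κ)) (V := (T ^ 5) ^ v)
      (hYV _ (by linarith)) (Real.rpow_lt_rpow_of_exponent_lt hM1 (by linarith))
      (Real.one_le_rpow (one_le_pow₀ hM1.le) (by linarith))
      hw.one (fun d hd ↦ by_contra fun h0 ↦ absurd (hw.le d h0) (not_le.2 hd)) hw.abs_le_one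
      zero_le_one
      (fun u hu ↦ by
        simp only [hone, sum_const, Nat.card_Icc, Nat.add_sub_cancel, nsmul_eq_mul, mul_one, one_mul]
        rw [← Complex.ofReal_natCast, ← Complex.ofReal_sub, Complex.norm_real, Real.norm_eq_abs, abs_le]
        exact ⟨by linarith [Nat.lt_floor_add_one u], by linarith [Nat.floor_le hu.le]⟩)
      (DirichletCharacter.differentiable_LFunctionTrivChar₁ 1).differentiableOn
      (fun s hs ↦ by
        have : s ≠ 1 := fun h ↦ by simp [h] at hs
        rw [DirichletCharacter.LFunctionTrivChar₁, Function.update_of_ne this,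
          DirichletCharacter.LFunctionTrivChar, DirichletCharacter.LFunction_eq_LSeries _ hs]) (by linarith) hs1
      (by rw [DirichletCharacter.LFunctionTrivChar₁, Function.update_of_ne hs1])
    refine h.trans ?_
    have e1 := pole_error_le hκ hκ1 hM1.le (by linarith) hv2 hXl (s := s) (by linarith) (h0 s hi1 hi2)
    have e2 := main_error_le (Q := 1) (T := T) (K := 1) hκ le_rfl hM1.le hv (by linarith) hσ₀
      (by rw [Real.sqrt_one, one_mul]; linarith) (s := s) (by linarith) hs6
      (abs_le.2 ⟨by linarith, by linarith⟩)
    simp only [one_mul, one_pow] at e2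
    rw [norm_one, one_mul, one_mul]
    linarith

/-- Log-free zero density estimate for the Riemann zeta function in dyadic ranges. -/
theorem sum_zeroMult_riemannZeta_le {κ v σ₀ : ℝ} (hκ : 0 < κ) (hκ1 : κ ≤ 1 / 10)
    (hσ₀ : 3 / 4 ≤ σ₀) (hv0 : 1 / 2 ≤ v) (hv : 1 + 6 * κ ≤ 2 * v * σ₀)
    (hv2 : 6 * κ + 5 * v * (1 - σ₀) ≤ 1 / 2) :
    ∃ C : ℝ, 0 < C ∧ ∃ M₀ : ℝ, 1 < M₀ ∧ ∀ T : ℝ, M₀ ≤ T →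
      ∀ σ : ℝ, σ₀ ≤ σ - (Real.log T)⁻¹ → σ ≤ 1 → ∀ Z : Finset ℂ,
      (∀ ρ ∈ Z, σ ≤ ρ.re ∧ ρ.re ≤ 1 ∧ T ≤ |ρ.im| ∧ |ρ.im| ≤ 2 * T) →
      ∑ ρ ∈ Z, (zeroMult riemannZeta ρ : ℝ) ≤ C * T ^ (10 * v * (1 - σ)) := by
  obtain ⟨C, hC, M₁, hM₁, H⟩ := sum_zeroMult_riemannZeta_window_le hκ hκ1 hσ₀ hv0 hv hv2
  refine ⟨2 * C, by linarith, max M₁ 8, lt_max_of_lt_left hM₁, ?_⟩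
  intro T hM σ hσ hσ1 Z hZ
  have hT8 : 8 ≤ T := (le_max_right _ _).trans hM
  rw [← sum_filter_add_sum_filter_not Z (fun ρ ↦ 0 ≤ ρ.im)]
  have h1 := H T ((le_max_left _ _).trans hM) (T - 1) (2 * T + 1) (by linarith) (by linarith)
    (by linarith) (fun y h1 _ ↦ by rw [abs_of_nonneg (by linarith)]; linarith) σ hσ hσ1
    (Z.filter fun ρ ↦ 0 ≤ ρ.im) (fun ρ hρ ↦ by
      rw [mem_filter] at hρ
      obtain ⟨a, b, c, d⟩ := hZ ρ hρ.1
      rw [abs_of_nonneg hρ.2] at c d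
      exact ⟨a, b, by linarith, by linarith⟩)
  have h2 := H T ((le_max_left _ _).trans hM) (-(2 * T) - 1) (-T + 1) (by linarith) (by linarith)
    (by linarith) (fun y _ h1 ↦ by rw [abs_of_nonpos (by linarith)]; linarith) σ hσ hσ1
    (Z.filter fun ρ ↦ ¬ 0 ≤ ρ.im) (fun ρ hρ ↦ by
      rw [mem_filter] at hρ
      obtain ⟨a, b, c, d⟩ := hZ ρ hρ.1
      rw [abs_of_neg (not_le.1 hρ.2)] at c d
      exact ⟨a, b, by linarith, by linarith⟩)
  linarith

end

section
open Finset
open scoped ArithmeticFunction.zeta ArithmeticFunction.Moebius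

variable {q : ℕ}

/-- The real part of a Dirichlet character, as an arithmetic function. -/
noncomputable def reChar (χ : DirichletCharacter ℂ q) : ArithmeticFunction ℝ :=
  ⟨fun n ↦ if n = 0 then 0 else (χ n).re, by simp⟩

/-- The convolution `1 * χ` for a real character. -/
noncomputable def zetaRe (χ : DirichletCharacter ℂ q) : ArithmeticFunction ℝ :=
  (ζ : ArithmeticFunction ℝ) * reChar χ

variable {χ : DirichletCharacter ℂ q}

theorem sq_eq_one_values (hχ : χ ^ 2 = 1) (n : ZMod q) : χ n = 0 ∨ χ n = 1 ∨ χ n = -1 := by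
  by_cases hn : IsUnit n
  · right
    have h : (χ ^ 2) n = 1 := by rw [hχ, MulChar.one_apply hn]
    rw [MulChar.pow_apply' _ two_ne_zero] at h
    have h2 : (χ n - 1) * (χ n + 1) = 0 := by linear_combination h
    rcases mul_eq_zero.1 h2 with h3 | h3
    · exact Or.inl (sub_eq_zero.1 h3)
    · exact Or.inr (eq_neg_of_add_eq_zero_left h3)
  · exact Or.inl (χ.map_nonunit hn)

theorem reChar_apply {n : ℕ} (hn : n ≠ 0) : reChar χ n = (χ n).re := if_neg hn

theorem ofReal_reChar (hχ : χ ^ 2 = 1) {n : ℕ} (hn : n ≠ 0) : (reChar χ n : ℂ) = χ n := by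
  rw [reChar_apply hn]
  rcases sq_eq_one_values hχ (n : ZMod q) with h | h | h <;> simp [h]

theorem reChar_values (hχ : χ ^ 2 = 1) (n : ℕ) :
    reChar χ n = 0 ∨ reChar χ n = 1 ∨ reChar χ n = -1 := by
  rcases eq_or_ne n 0 with rfl | hn
  · simp
  rw [reChar_apply hn]
  rcases sq_eq_one_values hχ (n : ZMod q) with h | h | h <;> simp [h]

theorem reChar_mul (hχ : χ ^ 2 = 1) (m n : ℕ) : reChar χ (m * n) = reChar χ m * reChar χ n := by
  rcases eq_or_ne m 0 with rfl | hm
  · simp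
  rcases eq_or_ne n 0 with rfl | hn
  · simp
  have : ((reChar χ (m * n) : ℝ) : ℂ) = (reChar χ m * reChar χ n : ℝ) := by
    rw [Complex.ofReal_mul, ofReal_reChar hχ hm, ofReal_reChar hχ hn,
      ofReal_reChar hχ (mul_ne_zero hm hn), Nat.cast_mul, map_mul]
  exact_mod_cast this

theorem reChar_one : reChar χ 1 = 1 := by
  rw [reChar_apply one_ne_zero]; simp

theorem reChar_pow (hχ : χ ^ 2 = 1) (n k : ℕ) : reChar χ (n ^ k) = reChar χ n ^ k := by
  induction k with
  | zero => simp [reChar_one]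
  | succ k ih => rw [pow_succ, reChar_mul hχ, ih, pow_succ]

theorem reChar_isMultiplicative (hχ : χ ^ 2 = 1) : (reChar χ).IsMultiplicative :=
  ⟨reChar_one, fun _ ↦ reChar_mul hχ _ _⟩

theorem zetaRe_apply (n : ℕ) : zetaRe χ n = ∑ d ∈ n.divisors, reChar χ d :=
  ArithmeticFunction.coe_zeta_mul_apply

theorem zetaRe_isMultiplicative (hχ : χ ^ 2 = 1) : (zetaRe χ).IsMultiplicative :=
  ArithmeticFunction.isMultiplicative_zeta.natCast.mul (reChar_isMultiplicative hχ)

theorem zetaRe_one (hχ : χ ^ 2 = 1) : zetaRe χ 1 = 1 := (zetaRe_isMultiplicative hχ).1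

theorem zetaRe_prime_pow (hχ : χ ^ 2 = 1) {p : ℕ} (hp : p.Prime) (k : ℕ) :
    zetaRe χ (p ^ k) = ∑ i ∈ range (k + 1), reChar χ p ^ i := by
  rw [zetaRe_apply, Nat.divisors_prime_pow hp, sum_map]
  exact sum_congr rfl fun i _ ↦ reChar_pow hχ _ _

theorem zetaRe_prime (hχ : χ ^ 2 = 1) {p : ℕ} (hp : p.Prime) : zetaRe χ p = 1 + reChar χ p := by
  have := zetaRe_prime_pow hχ hp 1
  rw [pow_one] at this
  rw [this, sum_range_succ, sum_range_one, pow_zero, pow_one]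

theorem zetaRe_prime_pow_nonneg (hχ : χ ^ 2 = 1) {p : ℕ} (hp : p.Prime) (k : ℕ) :
    0 ≤ zetaRe χ (p ^ k) := by
  rw [zetaRe_prime_pow hχ hp]
  rcases reChar_values hχ p with h | h | h
  · rw [h]; exact sum_nonneg fun i _ ↦ by positivity
  · rw [h]; exact sum_nonneg fun i _ ↦ by positivity
  · rw [h, neg_one_geom_sum]; split_ifs <;> norm_num

theorem zetaRe_nonneg (hχ : χ ^ 2 = 1) (n : ℕ) : 0 ≤ zetaRe χ n := by
  rcases eq_or_ne n 0 with rfl | hn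
  · simp
  rw [(zetaRe_isMultiplicative hχ).multiplicative_factorization _ hn]
  exact prod_nonneg fun p hp ↦
    zetaRe_prime_pow_nonneg hχ (Nat.prime_of_mem_primeFactors hp) _

theorem zetaRe_prime_mul (hχ : χ ^ 2 = 1) {p : ℕ} (hp : p.Prime) {m : ℕ} (hm : m ≠ 0) :
    zetaRe χ (p * m) = zetaRe χ p * zetaRe χ m -
      if p ∣ m then reChar χ p * zetaRe χ (m / p) else 0 := by
  obtain ⟨k, m', hm', rfl⟩ := Nat.exists_eq_pow_mul_and_not_dvd hm p hp.ne_one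
  have hmul {a b : ℕ} (h : a.Coprime b) : zetaRe χ (a * b) = zetaRe χ a * zetaRe χ b :=
    (zetaRe_isMultiplicative hχ).2 h
  have hco : ∀ j, (p ^ j).Coprime m' := fun j ↦ Nat.Coprime.pow_left _ ((hp.coprime_iff_not_dvd).2 hm')
  rw [← mul_assoc, ← pow_succ', hmul (hco _), hmul (hco _)]
  cases k with
  | zero => simp [hm', zetaRe_one hχ]
  | succ j =>
    rw [if_pos (Dvd.dvd.mul_right (dvd_pow_self p (by omega)) _), pow_succ' p j, mul_assoc,
      Nat.mul_div_cancel_left _ hp.pos, hmul (hco _), ← pow_succ', zetaRe_prime_pow hχ hp,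
      zetaRe_prime_pow hχ hp, zetaRe_prime_pow hχ hp, zetaRe_prime hχ hp, sum_range_succ _ (j + 1 + 1),
      sum_range_succ _ (j + 1)]
    ring

theorem sum_divisors_prime_mul {M : Type*} [AddCommMonoid M] {p D : ℕ} (hp : p.Prime) (hpD : ¬ p ∣ D) (f : ℕ → M) :
    ∑ e ∈ (p * D).divisors, f e = ∑ e ∈ D.divisors, f e + ∑ e ∈ D.divisors, f (p * e) := by
  have hco : p.Coprime D := (hp.coprime_iff_not_dvd).2 hpD
  rw [Nat.divisors_mul, mul_def, sum_image hco.mul_injOn_divisors, sum_product, Nat.Prime.divisors hp,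
    sum_pair hp.one_lt.ne]
  simp

/-- Hecke relation for `1 * χ`. -/
theorem zetaRe_squarefree_mul (hχ : χ ^ 2 = 1) {D : ℕ} (hD : Squarefree D) {m : ℕ} (hm : m ≠ 0) :
    zetaRe χ (D * m) = ∑ e ∈ D.divisors,
      if e ∣ m then (μ e : ℝ) * reChar χ e * zetaRe χ (D / e) * zetaRe χ (m / e) else 0 := by
  induction D using induction_on_primes generalizing m with
  | zero => exact absurd hD not_squarefree_zero
  | one => simp [reChar_one, zetaRe_one hχ]
  | prime_mul p D hp ih =>
    have hD' : Squarefree D := hD.squarefree_of_dvd (dvd_mul_left _ _)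
    have hco : p.Coprime D := Nat.coprime_of_squarefree_mul hD
    have hpD : ¬ p ∣ D := (hp.coprime_iff_not_dvd).1 hco
    rw [mul_comm p D, mul_assoc, ih hD' (mul_ne_zero hp.ne_zero hm), mul_comm D p,
      sum_divisors_prime_mul hp hpD, ← sum_add_distrib]
    refine sum_congr rfl fun e he ↦ ?_
    have heD := Nat.dvd_of_mem_divisors he
    have he0 : e ≠ 0 := (Nat.pos_of_mem_divisors he).ne'
    have hpe : p.Coprime e := hco.coprime_dvd_right heD
    have h1 : e ∣ p * m ↔ e ∣ m := Nat.Coprime.dvd_mul_left hpe.symm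
    have h3 : p * D / e = p * (D / e) := Nat.mul_div_assoc _ heD
    have h4 : zetaRe χ (p * (D / e)) = zetaRe χ p * zetaRe χ (D / e) :=
      (zetaRe_isMultiplicative hχ).2 (hco.coprime_dvd_right (Nat.div_dvd_of_dvd heD))
    have h5 : (μ (p * e) : ℝ) = -(μ e : ℝ) := by
      rw [ArithmeticFunction.isMultiplicative_moebius.2 hpe, ArithmeticFunction.moebius_apply_prime hp]
      push_cast; ring
    by_cases hem : e ∣ m
    · obtain ⟨r, rfl⟩ := hem
      have hr : r ≠ 0 := fun h ↦ hm (by simp [h])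
      have h6 : p * (e * r) / e = p * r := by
        rw [mul_left_comm, Nat.mul_div_cancel_left _ (Nat.pos_of_ne_zero he0)]
      have h7 : p * e ∣ e * r ↔ p ∣ r := by
        rw [mul_comm p e]; exact mul_dvd_mul_iff_left he0
      have h8 : e * r / (p * e) = r / p := by
        rw [mul_comm p e, ← Nat.div_div_eq_div_mul, Nat.mul_div_cancel_left _ (Nat.pos_of_ne_zero he0)]
      have h9 : p * D / (p * e) = D / e := Nat.mul_div_mul_left _ _ hp.pos
      rw [if_pos (h1.2 (dvd_mul_right _ _)), if_pos (dvd_mul_right _ _), h6, h3, h4, h5, h8, h9,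
        Nat.mul_div_cancel_left _ (Nat.pos_of_ne_zero he0), zetaRe_prime_mul hχ hp hr, reChar_mul hχ]
      by_cases hpr : p ∣ r
      · rw [if_pos hpr, if_pos (h7.2 hpr)]; ring
      · rw [if_neg hpr, if_neg (fun h ↦ hpr (h7.1 h))]; ring
    · rw [if_neg (fun h ↦ hem (h1.1 h)), if_neg hem, if_neg (fun h ↦ hem (dvd_of_mul_left_dvd h)), add_zero]

theorem ite_dvd_zetaRe (hχ : χ ^ 2 = 1) {D : ℕ} (hD : Squarefree D) {n : ℕ} (hn : n ≠ 0) :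
    (if D ∣ n then zetaRe χ n else 0) = ∑ e ∈ D.divisors,
      if D * e ∣ n then (μ e : ℝ) * reChar χ e * zetaRe χ (D / e) * zetaRe χ (n / (D * e)) else 0 := by
  split_ifs with h
  · obtain ⟨m, rfl⟩ := h
    have hD0 := hD.ne_zero
    rw [zetaRe_squarefree_mul hχ hD (right_ne_zero_of_mul hn)]
    refine sum_congr rfl fun e he ↦ ?_
    rw [Nat.mul_div_mul_left _ _ (Nat.pos_of_ne_zero hD0)]
    simp only [mul_dvd_mul_iff_left hD0]
  · symm
    refine sum_eq_zero fun e _ ↦ if_neg fun h' ↦ h (dvd_of_mul_right_dvd h')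

end

section
open Finset
open scoped ArithmeticFunction.zeta ArithmeticFunction.Moebius

theorem pow_card_primeFactors_le {A ε : ℝ} (hA : 1 ≤ A) (hε : 0 < ε) :
    ∃ C : ℝ, 1 ≤ C ∧ ∀ n : ℕ, n ≠ 0 → A ^ n.primeFactors.card ≤ C * (n : ℝ) ^ ε := by
  set P : ℕ := ⌈A ^ ε⁻¹⌉₊ with hP
  have hA0 : 0 < A := by linarith
  refine ⟨A ^ (P + 1), one_le_pow₀ hA, fun n hn ↦ ?_⟩
  have h1 : ∀ p ∈ n.primeFactors, A ≤ (if p ≤ P then A else 1) * (p : ℝ) ^ ε := by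
    intro p hp
    have hp1 : (1 : ℝ) ≤ p := by exact_mod_cast (Nat.prime_of_mem_primeFactors hp).one_le
    split_ifs with h
    · exact le_mul_of_one_le_right hA0.le (Real.one_le_rpow hp1 hε.le)
    · rw [one_mul]
      have h2 : A ^ ε⁻¹ ≤ p := (Nat.le_ceil _).trans (by exact_mod_cast (not_le.1 h).le)
      calc A = (A ^ ε⁻¹) ^ ε := by rw [← Real.rpow_mul hA0.le, inv_mul_cancel₀ hε.ne', Real.rpow_one]
        _ ≤ _ := Real.rpow_le_rpow (by positivity) h2 hε.le
  calc A ^ n.primeFactors.card = ∏ p ∈ n.primeFactors, A := by rw [prod_const]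
    _ ≤ ∏ p ∈ n.primeFactors, (if p ≤ P then A else 1) * (p : ℝ) ^ ε :=
        prod_le_prod (fun _ _ ↦ hA0.le) h1
    _ = (∏ p ∈ n.primeFactors, if p ≤ P then A else 1) * ∏ p ∈ n.primeFactors, (p : ℝ) ^ ε :=
        prod_mul_distrib
    _ ≤ A ^ (P + 1) * (n : ℝ) ^ ε := by
        gcongr
        · rw [prod_ite, prod_const, prod_const_one, mul_one]
          refine pow_le_pow_right₀ hA ?_
          calc _ ≤ (range (P + 1)).card := card_le_card fun p hp ↦ by
                rw [mem_filter] at hp; exact mem_range.2 (by omega)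
            _ = _ := card_range _
        · rw [Real.finsetProd_rpow _ _ (fun i _ ↦ by positivity)]
          refine Real.rpow_le_rpow (by positivity) ?_ hε.le
          rw [← Nat.cast_prod]
          exact_mod_cast Nat.le_of_dvd (Nat.pos_of_ne_zero hn) (Nat.prod_primeFactors_dvd n)

variable {q : ℕ} {χ : DirichletCharacter ℂ q}

theorem zetaRe_le (hχ : χ ^ 2 = 1) (n : ℕ) : zetaRe χ n ≤ n.divisors.card := by
  rw [zetaRe_apply, card_eq_sum_ones, Nat.cast_sum]
  refine sum_le_sum fun d _ ↦ ?_
  rcases reChar_values hχ d with h | h | h <;> rw [h] <;> norm_num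

/-- Sieve density for the numbers weighted by `1 * χ`. -/
noncomputable def exceptNu (χ : DirichletCharacter ℂ q) : ArithmeticFunction ℝ :=
  ArithmeticFunction.pmul invArith
    ((ArithmeticFunction.pmul (ArithmeticFunction.pmul (μ : ArithmeticFunction ℝ) (reChar χ)) invArith) *
      zetaRe χ)

theorem exceptNu_isMultiplicative (hχ : χ ^ 2 = 1) : (exceptNu χ).IsMultiplicative :=
  invArith_mult.pmul (((ArithmeticFunction.isMultiplicative_moebius.intCast.pmul
    (reChar_isMultiplicative hχ)).pmul invArith_mult).mul (zetaRe_isMultiplicative hχ))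

theorem exceptNu_apply (D : ℕ) : exceptNu χ D =
    ∑ e ∈ D.divisors, (μ e : ℝ) * reChar χ e * zetaRe χ (D / e) * ((D * e : ℕ) : ℝ)⁻¹ := by
  rw [exceptNu, ArithmeticFunction.pmul_apply, ArithmeticFunction.mul_apply,
    Nat.sum_divisorsAntidiagonal (fun a b ↦ (ArithmeticFunction.pmul (ArithmeticFunction.pmul
      (μ : ArithmeticFunction ℝ) (reChar χ)) invArith) a * zetaRe χ b), mul_sum]
  refine sum_congr rfl fun e _ ↦ ?_
  simp only [ArithmeticFunction.pmul_apply, invArith_apply, ArithmeticFunction.intCoe_apply]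
  push_cast
  rw [mul_inv]
  ring

theorem exceptNu_prime (hχ : χ ^ 2 = 1) {p : ℕ} (hp : p.Prime) :
    exceptNu χ p = 1 - (1 - (p : ℝ)⁻¹) * (1 - reChar χ p * (p : ℝ)⁻¹) := by
  rw [exceptNu_apply, hp.divisors, sum_pair hp.one_lt.ne, Nat.div_one, Nat.div_self hp.pos,
    ArithmeticFunction.moebius_apply_prime hp, zetaRe_prime hχ hp, zetaRe_one hχ]
  simp [reChar_one]
  ring

theorem exceptNu_prime_mem (hχ : χ ^ 2 = 1) {p : ℕ} (hp : p.Prime) :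
    0 < exceptNu χ p ∧ exceptNu χ p < 1 := by
  have h1 : (p : ℝ)⁻¹ < 1 := inv_lt_one_of_one_lt₀ (by exact_mod_cast hp.one_lt)
  have h0 : 0 < (p : ℝ)⁻¹ := inv_pos.2 (by exact_mod_cast hp.pos)
  rw [exceptNu_prime hχ hp]
  rcases reChar_values hχ p with h | h | h <;> rw [h] <;> constructor <;> nlinarith

theorem sum_zetaRe_prime_pow_le (hχ : χ ^ 2 = 1) {p : ℕ} (hp : p.Prime) (K : ℕ) :
    ∑ k ∈ Icc 1 K, zetaRe χ (p ^ k) * ((p ^ k : ℕ) : ℝ)⁻¹ ≤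
      exceptNu χ p * (1 - exceptNu χ p)⁻¹ := by
  obtain ⟨hn0, hn1⟩ := exceptNu_prime_mem hχ hp
  have h1 : (p : ℝ)⁻¹ < 1 := inv_lt_one_of_one_lt₀ (by exact_mod_cast hp.one_lt)
  have h0 : 0 < (p : ℝ)⁻¹ := inv_pos.2 (by exact_mod_cast hp.pos)
  set x := (p : ℝ)⁻¹ with hx
  set r := reChar χ p with hr
  have hsucc : ∀ k, zetaRe χ (p ^ (k + 1)) = 1 + r * zetaRe χ (p ^ k) := fun k ↦ by
    rw [zetaRe_prime_pow hχ hp, zetaRe_prime_pow hχ hp, sum_range_succ', mul_sum]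
    simp only [pow_succ', pow_zero]
    ring
  have key : (1 - exceptNu χ p) * ∑ k ∈ range (K + 1), zetaRe χ (p ^ k) * x ^ k =
      1 - (zetaRe χ (p ^ (K + 1)) - r * zetaRe χ (p ^ K) * x) * x ^ (K + 1) := by
    rw [exceptNu_prime hχ hp]
    induction K with
    | zero =>
      simp only [pow_zero, zetaRe_one hχ, zero_add, sum_range_one, mul_one, pow_one, hx, hr,
        zetaRe_prime hχ hp]
      ring
    | succ K ih =>
      rw [sum_range_succ, mul_add, ih, hsucc (K + 1), hsucc K]
      ring
  have htail : 0 ≤ (zetaRe χ (p ^ (K + 1)) - r * zetaRe χ (p ^ K) * x) * x ^ (K + 1) := by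
    refine mul_nonneg ?_ (by positivity)
    have ha := zetaRe_prime_pow_nonneg hχ hp K
    have hb := zetaRe_prime_pow_nonneg hχ hp (K + 1)
    rcases reChar_values hχ p with h | h | h
    · rw [hr, h]; linarith
    · rw [hsucc, hr, h]; nlinarith
    · rw [hr, h]; nlinarith
  have hle : ∑ k ∈ range (K + 1), zetaRe χ (p ^ k) * x ^ k ≤ (1 - exceptNu χ p)⁻¹ := by
    rw [le_inv_comm₀ ?_ (by linarith), ← one_div, le_div_iff₀ ?_] <;> first | linarith | skip
    all_goals
      rw [sum_range_succ']
      simp only [pow_zero, zetaRe_one hχ, mul_one]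
      have : 0 ≤ ∑ k ∈ range K, zetaRe χ (p ^ (k + 1)) * x ^ (k + 1) :=
        sum_nonneg fun k _ ↦ mul_nonneg (zetaRe_prime_pow_nonneg hχ hp _) (by positivity)
      linarith
  have e : ∑ k ∈ Icc 1 K, zetaRe χ (p ^ k) * ((p ^ k : ℕ) : ℝ)⁻¹ =
      ∑ k ∈ range (K + 1), zetaRe χ (p ^ k) * x ^ k - 1 := by
    rw [range_eq_Ico, sum_eq_sum_Ico_succ_bot (by omega : 0 < K + 1)]
    simp only [pow_zero, zetaRe_one hχ, mul_one, add_sub_cancel_left, hx, inv_pow, Nat.cast_pow]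
    rfl
  rw [e]
  have : exceptNu χ p * (1 - exceptNu χ p)⁻¹ = (1 - exceptNu χ p)⁻¹ - 1 := by
    have : (1 - exceptNu χ p) ≠ 0 := by linarith
    field_simp
    ring
  linarith

/-- Sieve of density `exceptNu χ` by all primes up to `R`. -/
noncomputable def exceptSieve (χ : DirichletCharacter ℂ q) (hχ : χ ^ 2 = 1) (R : ℕ) :
    BoundingSieve where
  support := ∅
  prodPrimes := (coprimeSieve 1 R).prodPrimes
  prodPrimes_squarefree := (coprimeSieve 1 R).prodPrimes_squarefree
  weights := 0
  weights_nonneg := fun _ ↦ le_rfl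
  totalMass := 0
  nu := exceptNu χ
  nu_mult := exceptNu_isMultiplicative hχ
  nu_pos_of_prime := fun _ hp _ ↦ (exceptNu_prime_mem hχ hp).1
  nu_lt_one_of_prime := fun _ hp _ ↦ (exceptNu_prime_mem hχ hp).2

theorem sum_zetaRe_div_le_selbergSum (hχ : χ ^ 2 = 1) (R : ℕ) :
    ∑ n ∈ Icc 1 R, zetaRe χ n * (n : ℝ)⁻¹ ≤ selbergSum (exceptSieve χ hχ R) R := by
  have := sum_le_prod_mul_selbergSum (exceptSieve χ hχ R) R ∅ (fun _ ↦ 1)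
    (b := ArithmeticFunction.pmul (zetaRe χ) invArith)
    ((zetaRe_isMultiplicative hχ).pmul invArith_mult)
    (fun n ↦ by
      rw [ArithmeticFunction.pmul_apply, invArith_apply]
      exact mul_nonneg (zetaRe_nonneg hχ n) (by positivity))
    (fun p hp hpR _ ↦ by
      refine (dvd_coprimeSieve_prodPrimes (q := 1) hp).2 ⟨hpR, ?_⟩
      exact hp.one_lt.not_ge ∘ Nat.le_of_dvd one_pos)
    (by simp) (fun p hp _ K ↦ by
      simp only [ArithmeticFunction.pmul_apply, invArith_apply]
      exact sum_zetaRe_prime_pow_le hχ hp K) (by simp)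
  simpa only [prod_empty, one_mul, ArithmeticFunction.pmul_apply, invArith_apply] using this

end

section
open Finset
open scoped ArithmeticFunction.zeta ArithmeticFunction.Moebius

/-- Squarefree integers in `[1, R]`. -/
noncomputable def sqfRange (R : ℕ) : Finset ℕ := (Icc 1 R).filter Squarefree

/-- The square of a truncated sieve sum. -/
noncomputable def sieveSq (R : ℕ) (w : ℕ → ℝ) (n : ℕ) : ℝ :=
  (∑ d ∈ sqfRange R, if d ∣ n then w d else 0) ^ 2

/-- Index set for the Dirichlet polynomial attached to `sieveSq`. -/
noncomputable def sieveIdx (R : ℕ) : Finset (Σ _ : ℕ × ℕ, ℕ) :=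
  (sqfRange R ×ˢ sqfRange R).sigma fun p ↦ (p.1.lcm p.2).divisors

/-- Moduli of the Dirichlet polynomial attached to `sieveSq`. -/
def sieveMod (i : Σ _ : ℕ × ℕ, ℕ) : ℕ := i.1.1.lcm i.1.2 * i.2

variable {q N : ℕ} {χ : DirichletCharacter ℂ q} {R : ℕ} {w : ℕ → ℝ}

/-- Coefficients of the Dirichlet polynomial attached to `sieveSq`. -/
noncomputable def sieveCoef (χ : DirichletCharacter ℂ q) (ψ : DirichletCharacter ℂ N) (w : ℕ → ℝ)
    (i : Σ _ : ℕ × ℕ, ℕ) : ℂ :=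
  ((w i.1.1 * w i.1.2 * ((μ i.2 : ℝ) * reChar χ i.2 * zetaRe χ (i.1.1.lcm i.1.2 / i.2)) : ℝ) : ℂ) *
    ψ (sieveMod i)

theorem squarefree_lcm {a b : ℕ} (ha : Squarefree a) (hb : Squarefree b) : Squarefree (a.lcm b) := by
  rw [Nat.squarefree_iff_factorization_le_one (Nat.lcm_ne_zero ha.ne_zero hb.ne_zero)]
  intro p
  rw [Nat.factorization_lcm ha.ne_zero hb.ne_zero]
  exact sup_le ((Nat.squarefree_iff_factorization_le_one ha.ne_zero).1 ha p)
    ((Nat.squarefree_iff_factorization_le_one hb.ne_zero).1 hb p)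

theorem mem_sqfRange {d : ℕ} : d ∈ sqfRange R ↔ (1 ≤ d ∧ d ≤ R) ∧ Squarefree d := by
  rw [sqfRange, mem_filter, mem_Icc]

theorem sieveMod_pos {i : Σ _ : ℕ × ℕ, ℕ} (hi : i ∈ sieveIdx R) : 0 < sieveMod i := by
  rw [sieveIdx, mem_sigma, mem_product, mem_sqfRange, mem_sqfRange] at hi
  exact Nat.mul_pos (Nat.lcm_pos hi.1.1.1.1 hi.1.2.1.1) (Nat.pos_of_mem_divisors hi.2)

theorem dilate_sieve (hχ : χ ^ 2 = 1) (ψ : DirichletCharacter ℂ N) {n : ℕ} (hn : n ≠ 0) :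
    dilate (sieveIdx R) (sieveCoef χ ψ w) sieveMod (fun m ↦ (zetaRe χ m : ℂ) * ψ m) n =
      ((sieveSq R w n * zetaRe χ n : ℝ) : ℂ) * ψ n := by
  have h1 : sieveSq R w n * zetaRe χ n = ∑ p ∈ sqfRange R ×ˢ sqfRange R, w p.1 * w p.2 *
      (if p.1.lcm p.2 ∣ n then zetaRe χ n else 0) := by
    rw [sieveSq, sq, sum_mul_sum, ← sum_product', sum_mul]
    refine sum_congr rfl fun p _ ↦ ?_
    simp only [Nat.lcm_dvd_iff]
    split_ifs <;> simp_all
  rw [h1, Complex.ofReal_sum, sum_mul, dilate, sieveIdx, sum_sigma]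
  refine sum_congr rfl fun p hp ↦ ?_
  rw [mem_product, mem_sqfRange, mem_sqfRange] at hp
  have hL := squarefree_lcm hp.1.2 hp.2.2
  rw [ite_dvd_zetaRe hχ hL hn, mul_sum, Complex.ofReal_sum, sum_mul]
  refine sum_congr rfl fun e _ ↦ ?_
  have hM : sieveMod ⟨p, e⟩ = p.1.lcm p.2 * e := rfl
  rw [← hM]
  simp only [sieveCoef]
  generalize sieveMod ⟨p, e⟩ = M
  by_cases h : M ∣ n
  · rw [if_pos h, if_pos h]
    obtain ⟨m, rfl⟩ := h
    rw [Nat.mul_div_cancel_left _ (Nat.pos_of_ne_zero (left_ne_zero_of_mul hn))]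
    rw [Nat.cast_mul _ m, map_mul]
    push_cast
    ring
  · rw [if_neg h, if_neg h]
    simp

theorem sum_sieveCoef_div (ψ : DirichletCharacter ℂ 1) :
    ∑ i ∈ sieveIdx R, sieveCoef χ ψ w i / sieveMod i =
      ((∑ d ∈ sqfRange R, ∑ e ∈ sqfRange R, w d * w e * exceptNu χ (d.lcm e) : ℝ) : ℂ) := by
  rw [← sum_product', sieveIdx, sum_sigma, Complex.ofReal_sum]
  refine sum_congr rfl fun p _ ↦ ?_
  rw [exceptNu_apply, mul_sum, Complex.ofReal_sum]
  refine sum_congr rfl fun e _ ↦ ?_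
  have hψ : ψ ((sieveMod ⟨p, e⟩ : ℕ) : ZMod 1) = 1 := by
    rw [Subsingleton.elim ((sieveMod ⟨p, e⟩ : ℕ) : ZMod 1) 1, map_one]
  rw [sieveCoef, hψ, sieveMod]
  push_cast
  rw [div_eq_mul_inv]
  ring

theorem card_divisors_le_of_squarefree {n : ℕ} (hn : Squarefree n) :
    n.divisors.card ≤ 2 ^ n.primeFactors.card := by
  rw [Nat.card_divisors hn.ne_zero]
  refine prod_le_pow_card _ _ _ fun p _ ↦ ?_
  have := (Nat.squarefree_iff_factorization_le_one hn.ne_zero).1 hn p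
  omega

theorem sum_inv_sqrt_le (X : ℕ) :
    ∑ m ∈ Icc 1 X, (m : ℝ) ^ (-(1 / 2 : ℝ)) ≤ 2 * (X : ℝ) ^ (1 / 2 : ℝ) := by
  induction X with
  | zero => simp
  | succ n ih =>
    rw [sum_Icc_succ_top (by omega)]
    have hn : (0 : ℝ) < (n + 1 : ℕ) := by positivity
    rw [Real.rpow_neg hn.le, ← Real.sqrt_eq_rpow, ← one_div]
    rw [← Real.sqrt_eq_rpow] at ih
    have h1 := Real.sq_sqrt (Nat.cast_nonneg (α := ℝ) n)
    have h2 := Real.sq_sqrt hn.le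
    have h3 := Real.sqrt_nonneg (n : ℝ)
    have h4 := Real.sqrt_pos.2 hn
    push_cast at h2 h4 ⊢
    have h5 : 1 / √((n : ℝ) + 1) ≤ 2 * √((n : ℝ) + 1) - 2 * √(n : ℝ) := by
      rw [div_le_iff₀ h4]
      nlinarith [sq_nonneg (√((n : ℝ) + 1) - √(n : ℝ))]
    linarith

theorem sum_lcm_rpow_le (R : ℕ) :
    ∑ d ∈ sqfRange R, ∑ e ∈ sqfRange R, ((d.lcm e : ℕ) : ℝ) ^ (-(1 / 2 : ℝ)) ≤
      4 * R * (1 + Real.log R) := by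
  have hpt : ∀ d ∈ sqfRange R, ∀ e ∈ sqfRange R, ((d.lcm e : ℕ) : ℝ) ^ (-(1 / 2 : ℝ)) ≤
      ∑ g ∈ Icc 1 R, (g : ℝ) ^ (1 / 2 : ℝ) * ((if g ∣ d then (d : ℝ) ^ (-(1 / 2 : ℝ)) else 0) *
        (if g ∣ e then (e : ℝ) ^ (-(1 / 2 : ℝ)) else 0)) := by
    intro d hd e he
    rw [mem_sqfRange] at hd he
    have hg : d.gcd e ∈ Icc 1 R := mem_Icc.2 ⟨Nat.gcd_pos_of_pos_left _ hd.1.1,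
      (Nat.gcd_le_left _ hd.1.1).trans hd.1.2⟩
    refine le_trans (le_of_eq ?_) (single_le_sum (fun g _ ↦ ?_) hg)
    · simp only [Nat.gcd_dvd_left, Nat.gcd_dvd_right, if_true]
      have hgp : (0 : ℝ) < d.gcd e := by exact_mod_cast (mem_Icc.1 hg).1
      have hd0 : (0 : ℝ) < d := by exact_mod_cast hd.1.1
      have he0 : (0 : ℝ) < e := by exact_mod_cast he.1.1
      have hl : (0 : ℝ) < d.lcm e := by exact_mod_cast Nat.lcm_pos hd.1.1 he.1.1
      rw [← Real.mul_rpow hd0.le he0.le, ← Nat.cast_mul d e, ← Nat.gcd_mul_lcm, Nat.cast_mul,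
        Real.mul_rpow hgp.le hl.le, ← mul_assoc, ← Real.rpow_add hgp]
      norm_num
    · refine mul_nonneg (by positivity) (mul_nonneg ?_ ?_) <;> split_ifs <;> positivity
  have hin : ∀ g ∈ Icc 1 R, ∑ d ∈ sqfRange R, (if g ∣ d then (d : ℝ) ^ (-(1 / 2 : ℝ)) else 0) ≤
      2 * (R : ℝ) ^ (1 / 2 : ℝ) * (g : ℝ)⁻¹ := by
    intro g hg
    have hg1 := (mem_Icc.1 hg).1
    have hg0 : (0 : ℝ) < g := by exact_mod_cast hg1
    calc _ ≤ ∑ d ∈ Icc 1 R, (if g ∣ d then (d : ℝ) ^ (-(1 / 2 : ℝ)) else 0) :=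
          sum_le_sum_of_subset_of_nonneg (filter_subset _ _) fun _ _ _ ↦ by
            split_ifs <;> positivity
      _ = ∑ m ∈ Icc 1 (R / g), ((g * m : ℕ) : ℝ) ^ (-(1 / 2 : ℝ)) := by
          rw [← sum_filter]
          symm
          refine sum_bij (fun m _ ↦ g * m) ?_ ?_ ?_ fun _ _ ↦ rfl
          · intro m hm
            rw [mem_Icc] at hm
            rw [mem_filter, mem_Icc]
            exact ⟨⟨Nat.mul_pos hg1 hm.1, (Nat.mul_le_mul_left g hm.2).trans (Nat.mul_div_le _ _)⟩,
              dvd_mul_right _ _⟩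
          · intro a _ b _ h
            exact Nat.eq_of_mul_eq_mul_left hg1 h
          · intro n hn
            rw [mem_filter, mem_Icc] at hn
            obtain ⟨m, rfl⟩ := hn.2
            exact ⟨m, mem_Icc.2 ⟨Nat.pos_of_mul_pos_left hn.1.1, (Nat.le_div_iff_mul_le hg1).2 (by
              rw [mul_comm]; exact hn.1.2)⟩, rfl⟩
      _ = (g : ℝ) ^ (-(1 / 2 : ℝ)) * ∑ m ∈ Icc 1 (R / g), (m : ℝ) ^ (-(1 / 2 : ℝ)) := by
          rw [mul_sum]
          refine sum_congr rfl fun m _ ↦ ?_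
          rw [Nat.cast_mul, Real.mul_rpow hg0.le (by positivity)]
      _ ≤ (g : ℝ) ^ (-(1 / 2 : ℝ)) * (2 * ((R / g : ℝ)) ^ (1 / 2 : ℝ)) := by
          refine mul_le_mul_of_nonneg_left ?_ (by positivity)
          refine (sum_inv_sqrt_le _).trans (mul_le_mul_of_nonneg_left ?_ zero_le_two)
          exact Real.rpow_le_rpow (by positivity) Nat.cast_div_le (by norm_num)
      _ = 2 * (R : ℝ) ^ (1 / 2 : ℝ) * (g : ℝ)⁻¹ := by
          rw [Real.div_rpow (by positivity) hg0.le, div_eq_mul_inv ((R : ℝ) ^ (1 / 2 : ℝ)), ← Real.rpow_neg hg0.le]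
          have : (g : ℝ)⁻¹ = (g : ℝ) ^ (-(1 / 2 : ℝ)) * (g : ℝ) ^ (-(1 / 2 : ℝ)) := by
            rw [← Real.rpow_add hg0]; norm_num [Real.rpow_neg_one]
          rw [this]; ring
  calc _ ≤ ∑ d ∈ sqfRange R, ∑ e ∈ sqfRange R, ∑ g ∈ Icc 1 R, (g : ℝ) ^ (1 / 2 : ℝ) *
        ((if g ∣ d then (d : ℝ) ^ (-(1 / 2 : ℝ)) else 0) *
        (if g ∣ e then (e : ℝ) ^ (-(1 / 2 : ℝ)) else 0)) :=
        sum_le_sum fun d hd ↦ sum_le_sum fun e he ↦ hpt d hd e he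
    _ = ∑ g ∈ Icc 1 R, (g : ℝ) ^ (1 / 2 : ℝ) *
        (∑ d ∈ sqfRange R, (if g ∣ d then (d : ℝ) ^ (-(1 / 2 : ℝ)) else 0)) ^ 2 := by
        rw [← sum_product', sum_comm]
        refine sum_congr rfl fun g _ ↦ ?_
        rw [← mul_sum, sq, sum_mul_sum, sum_product]
    _ ≤ ∑ g ∈ Icc 1 R, 4 * R * (g : ℝ)⁻¹ := by
        refine sum_le_sum fun g hg ↦ ?_
        have hg1 : (1 : ℝ) ≤ g := by exact_mod_cast (mem_Icc.1 hg).1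
        have hg0 : (0 : ℝ) < g := by linarith
        have hnn : 0 ≤ ∑ d ∈ sqfRange R, (if g ∣ d then (d : ℝ) ^ (-(1 / 2 : ℝ)) else 0) :=
          sum_nonneg fun _ _ ↦ by split_ifs <;> positivity
        have hR : ((R : ℝ) ^ (1 / 2 : ℝ)) ^ 2 = R := by
          rw [← Real.rpow_natCast, ← Real.rpow_mul (by positivity)]; norm_num
        have hg2 : (g : ℝ) ^ (1 / 2 : ℝ) ≤ g := by
          conv_rhs => rw [← Real.rpow_one (g : ℝ)]
          exact Real.rpow_le_rpow_of_exponent_le hg1 (by norm_num)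
        calc _ ≤ (g : ℝ) * (2 * (R : ℝ) ^ (1 / 2 : ℝ) * (g : ℝ)⁻¹) ^ 2 :=
              mul_le_mul hg2 (pow_le_pow_left₀ hnn (hin g hg) 2) (by positivity) (by positivity)
          _ = 4 * ((R : ℝ) ^ (1 / 2 : ℝ)) ^ 2 * (g : ℝ)⁻¹ := by field_simp; ring
          _ = _ := by rw [hR]
    _ = 4 * R * ∑ g ∈ Icc 1 R, (g : ℝ)⁻¹ := by rw [mul_sum]
    _ ≤ _ := mul_le_mul_of_nonneg_left (sum_inv_le_one_add_log R) (by positivity)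

theorem exists_sum_norm_sieveCoef_le {ε : ℝ} (hε : 0 < ε) : ∃ C : ℝ, 1 ≤ C ∧
    ∀ {q N : ℕ} {χ : DirichletCharacter ℂ q} (_ : χ ^ 2 = 1) (ψ : DirichletCharacter ℂ N) (R : ℕ)
      (_ : 1 ≤ R) (w : ℕ → ℝ) (_ : ∀ d, |w d| ≤ 1),
      ∑ i ∈ sieveIdx R, ‖sieveCoef χ ψ w i‖ * (sieveMod i : ℝ) ^ (-(1 / 2 : ℝ)) ≤
        C * (R : ℝ) ^ (1 + ε) := by
  obtain ⟨C, hC1, hC⟩ := pow_card_primeFactors_le (A := 4) (ε := ε / 4) (by norm_num) (by linarith)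
  refine ⟨C * 4 * (1 + 2 / ε), ?_, fun {q N χ} hχ ψ R hR w hw ↦ ?_⟩
  · have : 0 < 2 / ε := by positivity
    nlinarith
  have hR1 : (1 : ℝ) ≤ R := by exact_mod_cast hR
  have hR0 : (0 : ℝ) < R := by linarith
  have hpt : ∀ p ∈ sqfRange R ×ˢ sqfRange R, ∀ e ∈ (p.1.lcm p.2).divisors,
      ‖sieveCoef χ ψ w ⟨p, e⟩‖ * (sieveMod ⟨p, e⟩ : ℝ) ^ (-(1 / 2 : ℝ)) ≤
        2 ^ (p.1.lcm p.2).primeFactors.card * ((p.1.lcm p.2 : ℕ) : ℝ) ^ (-(1 / 2 : ℝ)) := by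
    intro p hp e he
    rw [mem_product, mem_sqfRange, mem_sqfRange] at hp
    have hL := squarefree_lcm hp.1.2 hp.2.2
    have hL0 : (0 : ℝ) < (p.1.lcm p.2 : ℕ) := by exact_mod_cast Nat.pos_of_ne_zero hL.ne_zero
    have he1 : (1 : ℝ) ≤ e := by exact_mod_cast Nat.pos_of_mem_divisors he
    refine mul_le_mul ?_ ?_ (by positivity) (by positivity)
    · rw [sieveCoef, norm_mul, Complex.norm_real, Real.norm_eq_abs, abs_mul, abs_mul, abs_mul,
        abs_mul, abs_of_nonneg (zetaRe_nonneg hχ _)]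
      have h1 : |reChar χ e| ≤ 1 := by
        rcases reChar_values hχ e with h | h | h <;> rw [h] <;> norm_num
      have h2 : |(μ e : ℝ)| ≤ 1 := by
        exact_mod_cast ArithmeticFunction.abs_moebius_le_one
      have h3 : zetaRe χ (p.1.lcm p.2 / e) ≤ 2 ^ (p.1.lcm p.2).primeFactors.card := by
        refine (zetaRe_le hχ _).trans ?_
        have h4 := card_le_card (Nat.divisors_subset_of_dvd hL.ne_zero
          (Nat.div_dvd_of_dvd (Nat.dvd_of_mem_divisors he)))
        exact_mod_cast h4.trans (card_divisors_le_of_squarefree hL)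
      have h5 : ‖ψ ((sieveMod ⟨p, e⟩ : ℕ) : ZMod N)‖ ≤ 1 := ψ.norm_le_one _
      have h6 : |w p.1| * |w p.2| ≤ 1 := mul_le_one₀ (hw _) (abs_nonneg _) (hw _)
      have h7 : |(μ e : ℝ)| * |reChar χ e| ≤ 1 := mul_le_one₀ h2 (abs_nonneg _) h1
      have hz := zetaRe_nonneg hχ (p.1.lcm p.2 / e)
      calc _ ≤ |w p.1| * |w p.2| * (|(μ e : ℝ)| * |reChar χ e| * zetaRe χ (p.1.lcm p.2 / e)) :=
            mul_le_of_le_one_right (by positivity) h5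
        _ ≤ |(μ e : ℝ)| * |reChar χ e| * zetaRe χ (p.1.lcm p.2 / e) :=
            mul_le_of_le_one_left (by positivity) h6
        _ ≤ zetaRe χ (p.1.lcm p.2 / e) := mul_le_of_le_one_left hz h7
        _ ≤ _ := h3
    · refine Real.rpow_le_rpow_of_nonpos hL0 ?_ (by norm_num)
      rw [sieveMod, Nat.cast_mul]
      exact le_mul_of_one_le_right hL0.le he1
  rw [sieveIdx, sum_sigma]
  calc _ ≤ ∑ p ∈ sqfRange R ×ˢ sqfRange R, C * (R : ℝ) ^ (ε / 2) *
        ((p.1.lcm p.2 : ℕ) : ℝ) ^ (-(1 / 2 : ℝ)) := by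
        refine sum_le_sum fun p hp ↦ (sum_le_sum (hpt p hp)).trans ?_
        rw [mem_product, mem_sqfRange, mem_sqfRange] at hp
        have hL := squarefree_lcm hp.1.2 hp.2.2
        rw [sum_const, nsmul_eq_mul, ← mul_assoc]
        refine mul_le_mul_of_nonneg_right ?_ (by positivity)
        have h1 : ((p.1.lcm p.2).divisors.card : ℝ) ≤ 2 ^ (p.1.lcm p.2).primeFactors.card := by
          exact_mod_cast card_divisors_le_of_squarefree hL
        have h2 : ((p.1.lcm p.2 : ℕ) : ℝ) ≤ (R : ℝ) ^ (2 : ℝ) := by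
          rw [Real.rpow_two, sq]
          exact_mod_cast (Nat.le_of_dvd (Nat.mul_pos hp.1.1.1 hp.2.1.1)
            (Nat.lcm_dvd_mul _ _)).trans (Nat.mul_le_mul hp.1.1.2 hp.2.1.2)
        calc _ ≤ (2 : ℝ) ^ (p.1.lcm p.2).primeFactors.card * 2 ^ (p.1.lcm p.2).primeFactors.card :=
              mul_le_mul_of_nonneg_right h1 (by positivity)
          _ = 4 ^ (p.1.lcm p.2).primeFactors.card := by rw [← mul_pow]; norm_num
          _ ≤ C * ((p.1.lcm p.2 : ℕ) : ℝ) ^ (ε / 4) := hC _ hL.ne_zero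
          _ ≤ C * ((R : ℝ) ^ (2 : ℝ)) ^ (ε / 4) := mul_le_mul_of_nonneg_left
              (Real.rpow_le_rpow (by positivity) h2 (by linarith)) (by linarith)
          _ = _ := by rw [← Real.rpow_mul hR0.le]; congr 2; ring
    _ = C * (R : ℝ) ^ (ε / 2) * ∑ d ∈ sqfRange R, ∑ e ∈ sqfRange R,
        ((d.lcm e : ℕ) : ℝ) ^ (-(1 / 2 : ℝ)) := by rw [← mul_sum, sum_product]
    _ ≤ C * (R : ℝ) ^ (ε / 2) * (4 * R * ((1 + 2 / ε) * (R : ℝ) ^ (ε / 2))) := by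
        refine mul_le_mul_of_nonneg_left ((sum_lcm_rpow_le R).trans ?_) (by positivity)
        refine mul_le_mul_of_nonneg_left ?_ (by positivity)
        have h1 := Real.log_le_rpow_div hR0.le (show 0 < ε / 2 by linarith)
        have h2 := Real.one_le_rpow hR1 (show 0 ≤ ε / 2 by linarith)
        have h3 : (R : ℝ) ^ (ε / 2) / (ε / 2) = 2 / ε * (R : ℝ) ^ (ε / 2) := by
          field_simp
        rw [h3] at h1
        linarith
    _ = C * 4 * (1 + 2 / ε) * (R : ℝ) ^ (1 + ε) := by
        have : (R : ℝ) ^ (1 + ε) = R * ((R : ℝ) ^ (ε / 2) * (R : ℝ) ^ (ε / 2)) := by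
          rw [← Real.rpow_add hR0, Real.rpow_add hR0, Real.rpow_one]; congr 2; ring
        rw [this]; ring

theorem exists_except_weights (hχ : χ ^ 2 = 1) (hR : 1 ≤ R) : ∃ w : ℕ → ℝ, ∃ S : ℝ,
    w 1 = 1 ∧ (∀ d, |w d| ≤ 1) ∧ 1 ≤ S ∧ ∑ n ∈ Icc 1 R, zetaRe χ n * (n : ℝ)⁻¹ ≤ S ∧
      ∑ d ∈ sqfRange R, ∑ e ∈ sqfRange R, w d * w e * exceptNu χ (d.lcm e) = S⁻¹ := by
  obtain ⟨w, h1, hw, hs, hsum⟩ := exists_selberg_weights (exceptSieve χ hχ R) hR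
  refine ⟨w, selbergSum (exceptSieve χ hχ R) R, h1, hw, selbergSum_ge_one _ hR,
    sum_zetaRe_div_le_selbergSum hχ R, ?_⟩
  rw [← hsum]
  have hP := (exceptSieve χ hχ R).prodPrimes_squarefree
  have hmem : ∀ d, w d ≠ 0 → (d ∈ sqfRange R ∧ d ∈ (exceptSieve χ hχ R).prodPrimes.divisors) := by
    intro d hd
    obtain ⟨h, h'⟩ := hs d hd
    exact ⟨mem_sqfRange.2 ⟨⟨Nat.pos_of_ne_zero (ne_zero_of_dvd_ne_zero hP.ne_zero h), h'⟩,
      hP.squarefree_of_dvd h⟩, Nat.mem_divisors.2 ⟨h, hP.ne_zero⟩⟩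
  have hsw : ∀ F : ℕ → ℝ, (∀ d, w d = 0 → F d = 0) →
      ∑ d ∈ sqfRange R, F d = ∑ d ∈ (exceptSieve χ hχ R).prodPrimes.divisors, F d := by
    intro F hF
    rw [← sum_filter_add_sum_filter_not (sqfRange R) (fun d ↦ w d ≠ 0),
      ← sum_filter_add_sum_filter_not (exceptSieve χ hχ R).prodPrimes.divisors (fun d ↦ w d ≠ 0)]
    congr 1
    · refine sum_congr (ext fun d ↦ ?_) fun _ _ ↦ rfl
      simp only [mem_filter]
      exact ⟨fun h ↦ ⟨(hmem d h.2).2, h.2⟩, fun h ↦ ⟨(hmem d h.2).1, h.2⟩⟩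
    · rw [sum_eq_zero, sum_eq_zero]
      all_goals
        intro d hd
        exact hF d (not_not.1 (mem_filter.1 hd).2)
  rw [hsw _ fun d hd ↦ by simp [hd]]
  refine sum_congr rfl fun d _ ↦ ?_
  rw [hsw _ fun e he ↦ by simp [he]]
  rfl

end

section
open Finset
open scoped ArithmeticFunction.zeta ArithmeticFunction.Moebius

theorem sum_Icc_mul_eq_hyperbola (f g : ArithmeticFunction ℂ) (U Z : ℕ) :
    ∑ n ∈ Icc 1 U, (f * g) n = ∑ d ∈ Icc 1 Z, f d * ∑ m ∈ Icc 1 (U / d), g m +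
      ∑ e ∈ Icc 1 (U / (Z + 1)), g e *
        (∑ d ∈ Icc 1 (U / e), f d - ∑ d ∈ Icc 1 Z, f d) := by
  have h0 : ∑ n ∈ Icc 1 U, (f * g) n = ∑ d ∈ Icc 1 U, f d * ∑ m ∈ Icc 1 (U / d), g m :=
    ArithmeticFunction.sum_Ioc_mul_eq_sum_sum f g U
  have h1 : ∑ d ∈ Icc 1 U, f d * ∑ m ∈ Icc 1 (U / d), g m =
      ∑ d ∈ Icc 1 (max U Z), f d * ∑ m ∈ Icc 1 (U / d), g m := by
    refine sum_subset (Icc_subset_Icc_right (le_max_left _ _)) fun d hd hd' ↦ ?_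
    rw [mem_Icc] at hd hd'
    rw [Nat.div_eq_of_lt (by omega)]
    simp
  have hsplit : ∀ (F : ℕ → ℂ) {a b : ℕ}, a ≤ b →
      ∑ d ∈ Icc 1 b, F d = ∑ d ∈ Icc 1 a, F d + ∑ d ∈ Ioc a b, F d := fun F a b hab ↦ by
    exact (sum_Ioc_consecutive F (Nat.zero_le a) hab).symm
  rw [h0, h1, hsplit _ (le_max_right U Z)]
  congr 1
  have h2 : ∀ e ∈ Icc 1 (U / (Z + 1)), ∑ d ∈ Icc 1 (U / e), f d - ∑ d ∈ Icc 1 Z, f d =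
      ∑ d ∈ Ioc Z (U / e), f d := by
    intro e he
    rw [mem_Icc] at he
    rw [hsplit f (a := Z) (b := U / e), add_sub_cancel_left]
    rw [Nat.le_div_iff_mul_le he.1]
    have := (Nat.le_div_iff_mul_le (Nat.succ_pos Z)).1 he.2
    nlinarith
  rw [sum_congr (g := fun e ↦ g e * ∑ d ∈ Ioc Z (U / e), f d) (s₁ := Icc 1 (U / (Z + 1))) rfl
    fun e he ↦ by rw [h2 e he]]
  simp only [mul_sum]
  rw [sum_comm' (s' := fun e ↦ Ioc Z (U / e)) (t' := Icc 1 (U / (Z + 1)))]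
  · exact sum_congr rfl fun e _ ↦ sum_congr rfl fun d _ ↦ mul_comm _ _
  · intro d e
    simp only [mem_Ioc, mem_Icc]
    constructor
    · rintro ⟨⟨h1, h2⟩, h3, h4⟩
      have h5 := (Nat.le_div_iff_mul_le (by omega)).1 h4
      refine ⟨⟨h1, (Nat.le_div_iff_mul_le (by omega)).2 (by rwa [mul_comm])⟩, h3,
        (Nat.le_div_iff_mul_le (by omega)).2 ?_⟩
      nlinarith
    · rintro ⟨⟨h1, h2⟩, h3, h4⟩
      have h5 := (Nat.le_div_iff_mul_le (by omega)).1 h2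
      refine ⟨⟨h1, ?_⟩, h3, (Nat.le_div_iff_mul_le (by omega)).2 (by rwa [mul_comm])⟩
      exact le_max_of_le_left (by nlinarith)

theorem norm_sum_mul_sub_le {f g : ArithmeticFunction ℂ} {κ l : ℂ} {K₁ K₂ : ℝ}
    (hf1 : ∀ n, ‖f n‖ ≤ 1) (hg1 : ∀ n, ‖g n‖ ≤ 1) (hκ : ‖κ‖ ≤ 1) (hK₁ : 0 < K₁) (hK₂ : 0 < K₂)
    (hg : ∀ u : ℝ, 0 < u → ‖∑ n ∈ Icc 1 ⌊u⌋₊, g n - κ * u‖ ≤ K₁)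
    (hf : ∀ M : ℕ, ‖∑ n ∈ Icc 1 M, f n‖ ≤ K₂)
    (hl : ∀ u : ℝ, 0 < u → ‖∑ n ∈ Icc 1 ⌊u⌋₊, f n / n - l‖ ≤ 3 * K₂ / u) {u : ℝ} (hu : 0 < u) :
    ‖∑ n ∈ Icc 1 ⌊u⌋₊, (f * g) n - κ * l * u‖ ≤ 6 * √(K₁ * K₂) * u ^ (1 / 2 : ℝ) := by
  set z := √(u * K₂ / K₁) with hz
  have hz0 : 0 < z := Real.sqrt_pos.2 (by positivity)
  rw [sum_Icc_mul_eq_hyperbola f g ⌊u⌋₊ ⌊z⌋₊]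
  have e1 : ∑ d ∈ Icc 1 ⌊z⌋₊, f d * ∑ m ∈ Icc 1 (⌊u⌋₊ / d), g m =
      ∑ d ∈ Icc 1 ⌊z⌋₊, f d * (∑ m ∈ Icc 1 ⌊u / d⌋₊, g m - κ * ((u / d : ℝ) : ℂ)) +
        κ * u * ∑ d ∈ Icc 1 ⌊z⌋₊, f d / d := by
    rw [mul_sum, ← sum_add_distrib]
    refine sum_congr rfl fun d _ ↦ ?_
    rw [Nat.floor_div_natCast]
    push_cast
    ring
  have b1 : ‖∑ d ∈ Icc 1 ⌊z⌋₊, f d * (∑ m ∈ Icc 1 ⌊u / d⌋₊, g m - κ * ((u / d : ℝ) : ℂ))‖ ≤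
      z * K₁ := by
    refine (norm_sum_le _ _).trans ((sum_le_card_nsmul _ _ K₁ fun d hd ↦ ?_).trans ?_)
    · rw [norm_mul]
      have hd0 : (0 : ℝ) < d := by exact_mod_cast (mem_Icc.1 hd).1
      exact (mul_le_of_le_one_left (norm_nonneg _) (hf1 d)).trans (hg _ (by positivity))
    · rw [Nat.card_Icc, Nat.add_sub_cancel, nsmul_eq_mul]
      exact mul_le_mul_of_nonneg_right (Nat.floor_le hz0.le) hK₁.le
  have b2 : ‖∑ e ∈ Icc 1 (⌊u⌋₊ / (⌊z⌋₊ + 1)), g e *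
        (∑ d ∈ Icc 1 (⌊u⌋₊ / e), f d - ∑ d ∈ Icc 1 ⌊z⌋₊, f d)‖ ≤ u / z * (2 * K₂) := by
    refine (norm_sum_le _ _).trans ((sum_le_card_nsmul _ _ (2 * K₂) fun d hd ↦ ?_).trans ?_)
    · rw [norm_mul]
      refine (mul_le_of_le_one_left (norm_nonneg _) (hg1 d)).trans ((norm_sub_le _ _).trans ?_)
      linarith [hf (⌊u⌋₊ / d), hf ⌊z⌋₊]
    · rw [Nat.card_Icc, Nat.add_sub_cancel, nsmul_eq_mul]
      refine mul_le_mul_of_nonneg_right ?_ (by positivity)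
      refine Nat.cast_div_le.trans ?_
      have := Nat.lt_floor_add_one z
      push_cast
      exact div_le_div₀ hu.le (Nat.floor_le hu.le) hz0 this.le
  have b3 : ‖κ * u * (∑ d ∈ Icc 1 ⌊z⌋₊, f d / d - l)‖ ≤ u * (3 * K₂ / z) := by
    rw [norm_mul, norm_mul, Complex.norm_real, Real.norm_eq_abs, abs_of_pos hu]
    exact mul_le_mul (mul_le_of_le_one_left hu.le hκ) (hl z hz0) (norm_nonneg _) hu.le
  rw [e1]
  have hz2 : z ^ 2 = u * K₂ / K₁ := Real.sq_sqrt (by positivity)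
  have k1 : z * K₁ = √(K₁ * K₂) * u ^ (1 / 2 : ℝ) := by
    rw [← Real.sqrt_eq_rpow, ← Real.sqrt_mul (by positivity), hz,
      show u * K₂ / K₁ = K₁ * K₂ * u / K₁ ^ 2 by field_simp, Real.sqrt_div' _ (by positivity),
      Real.sqrt_sq hK₁.le]
    field_simp
  have k2 : u / z * K₂ = z * K₁ := by
    rw [div_mul_eq_mul_div, div_eq_iff hz0.ne']
    have : z * K₁ * z = z ^ 2 * K₁ := by ring
    rw [this, hz2]
    field_simp
  calc _ = ‖(∑ d ∈ Icc 1 ⌊z⌋₊, f d * (∑ m ∈ Icc 1 ⌊u / d⌋₊, g m - κ * ((u / d : ℝ) : ℂ))) +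
        (∑ e ∈ Icc 1 (⌊u⌋₊ / (⌊z⌋₊ + 1)), g e *
        (∑ d ∈ Icc 1 (⌊u⌋₊ / e), f d - ∑ d ∈ Icc 1 ⌊z⌋₊, f d)) +
        κ * u * (∑ d ∈ Icc 1 ⌊z⌋₊, f d / d - l)‖ := by congr 1; ring
    _ ≤ z * K₁ + u / z * (2 * K₂) + u * (3 * K₂ / z) := norm_add₃_le.trans (by linarith)
    _ = z * K₁ + 5 * (u / z * K₂) := by ring
    _ = _ := by rw [k2, k1]; ring

/-- A Dirichlet character as an arithmetic function. -/
noncomputable def charAF {N : ℕ} (χ : DirichletCharacter ℂ N) : ArithmeticFunction ℂ :=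
  ⟨fun n ↦ if n = 0 then 0 else χ n, by simp⟩

theorem charAF_apply {N : ℕ} (χ : DirichletCharacter ℂ N) {n : ℕ} (hn : n ≠ 0) :
    charAF χ n = χ n := if_neg hn

theorem norm_charAF_le {N : ℕ} (χ : DirichletCharacter ℂ N) (n : ℕ) : ‖charAF χ n‖ ≤ 1 := by
  rcases eq_or_ne n 0 with rfl | hn
  · simp
  · rw [charAF_apply χ hn]; exact χ.norm_le_one _

variable {N : ℕ} [NeZero N] {χ : DirichletCharacter ℂ N}

theorem norm_sum_charAF_le (hχ : χ ≠ 1) (M : ℕ) :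
    ‖∑ n ∈ Icc 1 M, charAF χ n‖ ≤ 2 * √N * (1 + Real.log N) := by
  rw [sum_congr rfl fun n hn ↦ charAF_apply χ (by have := (mem_Icc.1 hn).1; omega)]
  exact norm_sum_char_le hχ M

theorem norm_sum_charAF_div_sub_le (hχ : χ ≠ 1) {u : ℝ} (hu : 0 < u) :
    ‖∑ n ∈ Icc 1 ⌊u⌋₊, charAF χ n / n - χ.LFunction 1‖ ≤
      3 * (2 * √N * (1 + Real.log N)) / u := by
  set K := 2 * √N * (1 + Real.log N) with hK
  have hN1 : (1 : ℝ) ≤ N := by exact_mod_cast NeZero.one_le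
  have hK1 : 1 ≤ K := by
    have h1 := Real.one_le_sqrt.2 hN1
    have h2 := Real.log_nonneg hN1
    nlinarith
  have main : ∀ v : ℝ, 1 ≤ v → ‖∑ n ∈ Icc 1 ⌊v⌋₊, charAF χ n / n - χ.LFunction 1‖ ≤
      2 * K / v := by
    intro v hv
    have hv0 : 0 < v := by linarith
    have hs : ∀ σ : ℝ, 1 < σ → ‖∑ n ∈ Icc 1 ⌊v⌋₊, charAF χ n * (n : ℂ) ^ (-(σ : ℂ)) -
        χ.LFunction σ‖ ≤ 2 * K * v ^ (-σ) := by
      intro σ hσ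
      have hre : (1 : ℝ) < (σ : ℂ).re := by simpa using hσ
      have hsumm : ∀ s : ℂ, 1 < s.re → LSeriesSummable (fun n ↦ charAF χ n) s := fun s hs ↦ by
        refine (LSeriesSummable_congr s fun {n} hn ↦ ?_).1
          (ZMod.LSeriesSummable_of_one_lt_re (χ : ZMod N → ℂ) hs)
        exact (charAF_apply χ hn).symm
      have h := norm_partialSum_sub_le (c := fun n ↦ charAF χ n) (κ := 0) (B := K) (θ := 0)
        (g := fun s ↦ (s - 1) * χ.LFunction s)
        (fun u _ ↦ by simpa using norm_sum_charAF_le hχ ⌊u⌋₊) zero_lt_one hsumm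
        (((differentiable_id.sub_const 1).mul
          (DirichletCharacter.differentiable_LFunction hχ)).differentiableOn)
        (fun s hs ↦ by
          rw [DirichletCharacter.LFunction_eq_LSeries _ hs]
          congr 1
          exact LSeries_congr (fun {n} hn ↦ (charAF_apply χ hn).symm) s) hv
        (s := σ) (by linarith)
      rw [zero_mul, add_zero, ← mul_sub, norm_mul] at h
      have hne : (0 : ℝ) < ‖(σ : ℂ) - 1‖ := by
        rw [norm_pos_iff, sub_ne_zero]
        exact_mod_cast hσ.ne'
      have h' := le_of_mul_le_mul_left h hne
      refine h'.trans (le_of_eq ?_)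
      rw [Complex.norm_real, Real.norm_eq_abs, abs_of_pos (by linarith), Complex.ofReal_re,
        zero_sub, sub_zero, div_self (by linarith)]
      ring
    have hlim : Filter.Tendsto (fun σ : ℝ ↦ ‖∑ n ∈ Icc 1 ⌊v⌋₊, charAF χ n * (n : ℂ) ^ (-(σ : ℂ)) -
        χ.LFunction σ‖) (nhdsWithin 1 (Set.Ioi 1)) (nhds
          ‖∑ n ∈ Icc 1 ⌊v⌋₊, charAF χ n * (n : ℂ) ^ (-((1 : ℝ) : ℂ)) - χ.LFunction (1 : ℝ)‖) := by
      refine (Continuous.tendsto ?_ 1).mono_left nhdsWithin_le_nhds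
      refine ((continuous_finsetSum _ fun n hn ↦ ?_).sub
        ((DirichletCharacter.differentiable_LFunction hχ).continuous.comp
          Complex.continuous_ofReal)).norm
      have : (n : ℂ) ≠ 0 := by
        have := (mem_Icc.1 hn).1
        exact_mod_cast (by omega : n ≠ 0)
      exact continuous_const.mul ((Complex.continuous_ofReal.neg).const_cpow (Or.inl this))
    have hlim2 : Filter.Tendsto (fun σ : ℝ ↦ 2 * K * v ^ (-σ)) (nhdsWithin 1 (Set.Ioi 1))
        (nhds (2 * K * v ^ (-(1 : ℝ)))) := by
      refine (Continuous.tendsto ?_ 1).mono_left nhdsWithin_le_nhds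
      exact continuous_const.mul (Continuous.rpow continuous_const continuous_neg fun _ ↦ Or.inl hv0.ne')
    have := le_of_tendsto_of_tendsto hlim hlim2
      (Filter.eventually_of_mem self_mem_nhdsWithin fun σ hσ ↦ hs σ hσ)
    rw [Real.rpow_neg_one] at this
    simpa [Complex.cpow_neg_one, div_eq_mul_inv] using this
  rcases le_or_gt 1 u with h | h
  · exact (main u h).trans (by gcongr; norm_num)
  · have h1 := main 1 le_rfl
    rw [Nat.floor_eq_zero.2 h]
    simp only [Nat.floor_one, Icc_self, sum_singleton, Nat.cast_one, div_one, zero_lt_one,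
      Icc_eq_empty_of_lt, sum_empty, zero_sub, norm_neg] at h1 ⊢
    have h2 := norm_charAF_le χ 1
    have h3 : ‖χ.LFunction 1‖ ≤ 3 * K := by
      have := norm_sub_norm_le (χ.LFunction 1) (charAF χ 1)
      rw [norm_sub_rev] at this
      linarith
    refine h3.trans ?_
    rw [le_div_iff₀ hu]
    nlinarith

end

section
open Finset
open scoped ArithmeticFunction.zeta ArithmeticFunction.Moebius

theorem charAF_mul_charAF {q M N : ℕ} {χ : DirichletCharacter ℂ q} (hχ : χ ^ 2 = 1)
    (ψ : DirichletCharacter ℂ N) (φ : DirichletCharacter ℂ M) (hφ : ∀ n : ℕ, n ≠ 0 → φ n = χ n * ψ n) {n : ℕ} (hn : n ≠ 0) :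
    (charAF φ * charAF ψ) n = (zetaRe χ n : ℂ) * ψ n := by
  rw [ArithmeticFunction.mul_apply, Nat.sum_divisorsAntidiagonal (fun a b ↦ charAF φ a * charAF ψ b),
    zetaRe_apply, Complex.ofReal_sum, sum_mul]
  refine sum_congr rfl fun d hd ↦ ?_
  obtain ⟨e, rfl⟩ := Nat.dvd_of_mem_divisors hd
  have hd0 := left_ne_zero_of_mul hn
  have he0 := right_ne_zero_of_mul hn
  rw [Nat.mul_div_cancel_left _ (Nat.pos_of_ne_zero hd0), charAF_apply _ hd0, charAF_apply _ he0,
    hφ _ hd0, ofReal_reChar hχ hd0, Nat.cast_mul, map_mul]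
  ring

theorem LSeriesSummable_charAF {N : ℕ} [NeZero N] (ψ : DirichletCharacter ℂ N) {s : ℂ}
    (hs : 1 < s.re) : LSeriesSummable (fun n ↦ charAF ψ n) s :=
  (LSeriesSummable_congr s fun {_} hn ↦ (charAF_apply ψ hn).symm).1
    (ZMod.LSeriesSummable_of_one_lt_re (ψ : ZMod N → ℂ) hs)

theorem LSeries_charAF {N : ℕ} [NeZero N] (ψ : DirichletCharacter ℂ N) {s : ℂ}
    (hs : 1 < s.re) : LSeries (fun n ↦ charAF ψ n) s = ψ.LFunction s := by
  rw [DirichletCharacter.LFunction_eq_LSeries _ hs]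
  exact LSeries_congr (fun {n} hn ↦ charAF_apply ψ hn) s

/-- The Pólya–Vinogradov bound. -/
noncomputable def pvBound (q : ℕ) : ℝ := 2 * √q * (1 + Real.log q)

theorem one_le_pvBound {q : ℕ} [NeZero q] : 1 ≤ pvBound q := by
  have hq1 : (1 : ℝ) ≤ q := by exact_mod_cast NeZero.one_le
  have h1 := Real.one_le_sqrt.2 hq1
  have h2 := Real.log_nonneg hq1
  rw [pvBound]
  nlinarith

theorem norm_sieveSum_sub_le_aux {q M N : ℕ} [NeZero M] [NeZero N] {χ : DirichletCharacter ℂ q}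
    {R : ℕ} {w : ℕ → ℝ} {ψ : DirichletCharacter ℂ N} {φ : DirichletCharacter ℂ M}
    (hχ : χ ^ 2 = 1) (hφ : ∀ n : ℕ, n ≠ 0 → φ n = χ n * ψ n)
    {κ : ℂ} {B : ℝ} {g : ℂ → ℂ}
    (hF : ∀ u : ℝ, 0 < u → ‖∑ n ∈ Icc 1 ⌊u⌋₊, (charAF φ * charAF ψ) n - κ * u‖ ≤
      B * u ^ (1 / 2 : ℝ))
    (hg : Differentiable ℂ g)
    (hgL : ∀ s : ℂ, 1 < s.re → g s = (s - 1) * (φ.LFunction s * ψ.LFunction s))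
    {V : ℝ} (hV : 1 ≤ V) {s : ℂ} (hs : 1 / 2 < s.re) :
    ‖(s - 1) * ∑ n ∈ Icc 1 ⌊V⌋₊, ((sieveSq R w n * zetaRe χ n : ℝ) : ℂ) * ψ n * (n : ℂ) ^ (-s) +
        (κ * ∑ i ∈ sieveIdx R, sieveCoef χ ψ w i / sieveMod i) * (V : ℂ) ^ (1 - s) -
        g s * ∑ i ∈ sieveIdx R, sieveCoef χ ψ w i * (sieveMod i : ℂ) ^ (-s)‖ ≤
      ‖s - 1‖ * ((B * ∑ i ∈ sieveIdx R, ‖sieveCoef χ ψ w i‖ * (sieveMod i : ℝ) ^ (-(1 / 2 : ℝ))) *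
        V ^ (1 / 2 - s.re) * (1 + ‖s‖ / (s.re - 1 / 2))) := by
  have hcong : ∀ n : ℕ, n ≠ 0 → (charAF φ * charAF ψ) n = (zetaRe χ n : ℂ) * ψ n := fun n hn ↦
    charAF_mul_charAF hχ ψ φ hφ hn
  have hsumm : ∀ s : ℂ, 1 < s.re → LSeriesSummable (fun n ↦ (zetaRe χ n : ℂ) * ψ n) s := fun s hs ↦
    (LSeriesSummable_congr s fun {n} hn ↦ hcong n hn).1
      (ArithmeticFunction.LSeriesSummable_mul (LSeriesSummable_charAF φ hs)
        (LSeriesSummable_charAF ψ hs))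
  have h := norm_partialSum_dilate_sub_le (sieveIdx R) (sieveCoef χ ψ w) (k := sieveMod)
    (fun i hi ↦ sieveMod_pos hi) (f := fun n ↦ (zetaRe χ n : ℂ) * ψ n) (κ := κ) (B := B)
    (θ := 1 / 2) (fun u hu ↦ by
      rw [sum_congr rfl fun n hn ↦ (hcong n (by have := (mem_Icc.1 hn).1; omega)).symm]
      exact hF u hu) (by norm_num) hsumm (g := g) hg.differentiableOn (fun s hs ↦ by
      rw [hgL s hs, ← LSeries_charAF φ hs, ← LSeries_charAF ψ hs,
        ← ArithmeticFunction.LSeries_mul' (LSeriesSummable_charAF φ hs) (LSeriesSummable_charAF ψ hs)]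
      congr 1
      exact LSeries_congr (fun {n} hn ↦ hcong n hn) s) hV hs
  have e : ∀ n ∈ Icc 1 ⌊V⌋₊, ((sieveSq R w n * zetaRe χ n : ℝ) : ℂ) * ψ n * (n : ℂ) ^ (-s) =
      dilate (sieveIdx R) (sieveCoef χ ψ w) sieveMod (fun n ↦ (zetaRe χ n : ℂ) * ψ n) n *
        (n : ℂ) ^ (-s) := fun n hn ↦ by
    rw [dilate_sieve hχ ψ (by have := (mem_Icc.1 hn).1; omega)]
  rw [sum_congr rfl e]
  exact h

variable {q : ℕ} [NeZero q] {χ : DirichletCharacter ℂ q}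

theorem norm_sieveSum_sub_le (hχ : χ ^ 2 = 1) (hχ1 : χ ≠ 1) (R : ℕ) (w : ℕ → ℝ) {V : ℝ}
    (hV : 1 ≤ V) {s : ℂ} (hs : 1 / 2 < s.re) :
    ‖(s - 1) * ∑ n ∈ Icc 1 ⌊V⌋₊, ((sieveSq R w n * zetaRe χ n : ℝ) : ℂ) * (n : ℂ) ^ (-s) +
        (χ.LFunction 1 * ((∑ d ∈ sqfRange R, ∑ e ∈ sqfRange R,
          w d * w e * exceptNu χ (d.lcm e) : ℝ) : ℂ)) * (V : ℂ) ^ (1 - s) -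
        DirichletCharacter.LFunctionTrivChar₁ 1 s * χ.LFunction s *
          ∑ i ∈ sieveIdx R, sieveCoef χ (1 : DirichletCharacter ℂ 1) w i * (sieveMod i : ℂ) ^ (-s)‖ ≤
      ‖s - 1‖ * ((6 * √(pvBound q) * ∑ i ∈ sieveIdx R, ‖sieveCoef χ (1 : DirichletCharacter ℂ 1) w i‖ *
        (sieveMod i : ℝ) ^ (-(1 / 2 : ℝ))) * V ^ (1 / 2 - s.re) * (1 + ‖s‖ / (s.re - 1 / 2))) := by
  have hK := one_le_pvBound (q := q)
  have hone : ∀ n : ℕ, (1 : DirichletCharacter ℂ 1) (n : ZMod 1) = 1 := fun n ↦ by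
    rw [Subsingleton.elim ((n : ℕ) : ZMod 1) 1, map_one]
  have h := norm_sieveSum_sub_le_aux (χ := χ) (R := R) (w := w) (ψ := (1 : DirichletCharacter ℂ 1))
    (φ := χ) hχ (fun n _ ↦ by rw [hone, mul_one]) (κ := χ.LFunction 1) (B := 6 * √(pvBound q))
    (g := fun s ↦ DirichletCharacter.LFunctionTrivChar₁ 1 s * χ.LFunction s)
    (fun u hu ↦ by
      have := norm_sum_mul_sub_le (f := charAF χ) (g := charAF (1 : DirichletCharacter ℂ 1)) (κ := 1)
        (l := χ.LFunction 1) (K₁ := 1) (K₂ := pvBound q) (norm_charAF_le _)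
        (norm_charAF_le _) (by simp) one_pos (by linarith)
        (fun u hu ↦ by
          rw [sum_congr rfl fun n hn ↦ (charAF_apply (1 : DirichletCharacter ℂ 1)
            (by have := (mem_Icc.1 hn).1; omega)).trans (hone n), sum_const, Nat.card_Icc,
            Nat.add_sub_cancel, nsmul_eq_mul, mul_one, one_mul, ← Complex.ofReal_natCast,
            ← Complex.ofReal_sub, Complex.norm_real, Real.norm_eq_abs, abs_le]
          have h1 := Nat.floor_le hu.le
          have h2 := Nat.lt_floor_add_one u
          constructor <;> linarith)
        (norm_sum_charAF_le hχ1) (fun u hu ↦ norm_sum_charAF_div_sub_le hχ1 hu) hu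
      rwa [one_mul, one_mul] at this)
    ((DirichletCharacter.differentiable_LFunctionTrivChar₁ 1).mul
      (DirichletCharacter.differentiable_LFunction hχ1)) (fun s hs ↦ by
      have : s ≠ 1 := by rintro rfl; simp at hs
      rw [DirichletCharacter.LFunctionTrivChar₁, Function.update_of_ne this,
        DirichletCharacter.LFunctionTrivChar]
      ring) hV hs
  simp only [hone, mul_one] at h
  rw [sum_sieveCoef_div] at h
  exact h

theorem norm_sieveSum_twist_le (hχ : χ ^ 2 = 1) (R : ℕ) (w : ℕ → ℝ)
    {ψ : DirichletCharacter ℂ q} (hψ : ψ ≠ 1) (hψχ : ψ ≠ χ) {V : ℝ}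
    (hV : 1 ≤ V) {s : ℂ} (hs : 1 / 2 < s.re) (h0 : ψ.LFunction s = 0) :
    ‖∑ n ∈ Icc 1 ⌊V⌋₊, ((sieveSq R w n * zetaRe χ n : ℝ) : ℂ) * ψ n * (n : ℂ) ^ (-s)‖ ≤
      (6 * pvBound q * ∑ i ∈ sieveIdx R, ‖sieveCoef χ ψ w i‖ *
        (sieveMod i : ℝ) ^ (-(1 / 2 : ℝ))) * V ^ (1 / 2 - s.re) * (1 + ‖s‖ / (s.re - 1 / 2)) := by
  have hφ1 : χ * ψ ≠ 1 := fun h ↦ hψχ (by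
    have : χ * (χ * ψ) = χ := by rw [h, mul_one]
    rwa [← mul_assoc, ← sq, hχ, one_mul] at this)
  have hs1 : s ≠ 1 := by
    rintro rfl
    exact DirichletCharacter.LFunction_apply_one_ne_zero hψ h0
  have hK := one_le_pvBound (q := q)
  have h := norm_sieveSum_sub_le_aux (χ := χ) (R := R) (w := w) (ψ := ψ) (φ := χ * ψ) hχ
    (fun n _ ↦ by rw [MulChar.mul_apply]) (κ := 0) (B := 6 * pvBound q)
    (g := fun s ↦ (s - 1) * ((χ * ψ).LFunction s * ψ.LFunction s))
    (fun u hu ↦ by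
      have := norm_sum_mul_sub_le (f := charAF (χ * ψ)) (g := charAF ψ) (κ := 0)
        (l := (χ * ψ).LFunction 1) (K₁ := pvBound q) (K₂ := pvBound q) (norm_charAF_le _)
        (norm_charAF_le _) (by simp) (by linarith) (by linarith)
        (fun u _ ↦ by simpa [pvBound] using norm_sum_charAF_le hψ ⌊u⌋₊)
        (norm_sum_charAF_le hφ1) (fun u hu ↦ norm_sum_charAF_div_sub_le hφ1 hu) hu
      rwa [zero_mul, Real.sqrt_mul_self (by linarith)] at this)
    ((differentiable_id.sub_const 1).mul ((DirichletCharacter.differentiable_LFunction hφ1).mul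
      (DirichletCharacter.differentiable_LFunction hψ))) (fun _ _ ↦ rfl) hV hs
  rw [h0, mul_zero, mul_zero, zero_mul, zero_mul, zero_mul, add_zero, sub_zero, norm_mul] at h
  exact le_of_mul_le_mul_left h (norm_pos_iff.2 (sub_ne_zero.2 hs1))

end

section
open Finset
open scoped ArithmeticFunction.zeta ArithmeticFunction.Moebius

theorem norm_LFunction_one_mul_sub_le {q : ℕ} [NeZero q] {χ : DirichletCharacter ℂ q}
    (hχ : χ ^ 2 = 1) (hχ1 : χ ≠ 1) {u V B : ℝ} (hu : 0 < u) (hu1 : u ≤ 1 / 10)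
    (h0 : χ.LFunction ((1 - u : ℝ) : ℂ) = 0) (R : ℕ) (w : ℕ → ℝ) (hV : 1 ≤ V)
    (hB : ∑ i ∈ sieveIdx R, ‖sieveCoef χ (1 : DirichletCharacter ℂ 1) w i‖ *
        (sieveMod i : ℝ) ^ (-(1 / 2 : ℝ)) ≤ B) :
    ‖χ.LFunction 1 * ((∑ d ∈ sqfRange R, ∑ e ∈ sqfRange R,
          w d * w e * exceptNu χ (d.lcm e) : ℝ) : ℂ) * ((V ^ u : ℝ) : ℂ) -
        ((u * ∑ n ∈ Icc 1 ⌊V⌋₊, sieveSq R w n * zetaRe χ n * (n : ℝ) ^ (-(1 - u)) : ℝ) : ℂ)‖ ≤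
      u * (24 * √(pvBound q) * B * V ^ (-(1 / 2) + u)) := by
  have hV0 : 0 < V := by linarith
  have hs : (1 / 2 : ℝ) < ((1 - u : ℝ) : ℂ).re := by rw [Complex.ofReal_re]; linarith
  have h := norm_sieveSum_sub_le hχ hχ1 R w hV hs
  rw [h0, mul_zero, zero_mul, sub_zero] at h
  have e1 : ((1 - u : ℝ) : ℂ) - 1 = ((-u : ℝ) : ℂ) := by push_cast; ring
  have e2 : (V : ℂ) ^ (1 - ((1 - u : ℝ) : ℂ)) = ((V ^ u : ℝ) : ℂ) := by
    rw [Complex.ofReal_cpow hV0.le]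
    congr 1
    push_cast
    ring
  have e3 : ∑ n ∈ Icc 1 ⌊V⌋₊, ((sieveSq R w n * zetaRe χ n : ℝ) : ℂ) *
      (n : ℂ) ^ (-((1 - u : ℝ) : ℂ)) =
      ((∑ n ∈ Icc 1 ⌊V⌋₊, sieveSq R w n * zetaRe χ n * (n : ℝ) ^ (-(1 - u)) : ℝ) : ℂ) := by
    rw [Complex.ofReal_sum]
    refine sum_congr rfl fun n _ ↦ ?_
    rw [Complex.ofReal_mul (_ * _), Complex.ofReal_cpow (Nat.cast_nonneg n)]
    push_cast
    rfl
  rw [e1, e2, e3, Complex.norm_real, Complex.norm_real, Real.norm_eq_abs, Real.norm_eq_abs, abs_neg,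
    abs_of_pos hu, abs_of_pos (by linarith : 0 < 1 - u), Complex.ofReal_re] at h
  set A := ∑ n ∈ Icc 1 ⌊V⌋₊, sieveSq R w n * zetaRe χ n * (n : ℝ) ^ (-(1 - u))
  set Q := ∑ d ∈ sqfRange R, ∑ e ∈ sqfRange R, w d * w e * exceptNu χ (d.lcm e)
  clear_value A Q
  have e4 : χ.LFunction 1 * (Q : ℂ) * ((V ^ u : ℝ) : ℂ) - ((u * A : ℝ) : ℂ) =
      ((-u : ℝ) : ℂ) * A + χ.LFunction 1 * (Q : ℂ) * ((V ^ u : ℝ) : ℂ) := by push_cast; ring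
  rw [e4]
  refine h.trans (mul_le_mul_of_nonneg_left ?_ hu.le)
  have e5 : (1 / 2 - (1 - u) : ℝ) = -(1 / 2) + u := by ring
  have h5 : 1 + (1 - u) / (1 - u - 1 / 2) ≤ 4 := by
    have : (1 - u) / (1 - u - 1 / 2) ≤ 3 := by
      rw [div_le_iff₀ (by linarith)]; linarith
    linarith
  rw [e5]
  have hB0 : 0 ≤ B := le_trans (sum_nonneg fun i _ ↦ by positivity) hB
  calc _ ≤ 6 * √(pvBound q) * B * V ^ (-(1 / 2) + u) * 4 := by
        refine mul_le_mul (mul_le_mul_of_nonneg_right (mul_le_mul_of_nonneg_left hB (by positivity))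
          (by positivity)) h5 ?_ (by positivity)
        have : 0 ≤ (1 - u) / (1 - u - 1 / 2) := div_nonneg (by linarith) (by linarith)
        linarith
    _ = _ := by ring

theorem sieveSq_one (n : ℕ) : sieveSq 1 (fun _ ↦ 1) n = 1 := by
  have : sqfRange 1 = {1} := by
    ext d
    rw [mem_sqfRange, mem_singleton]
    exact ⟨fun h ↦ by omega, fun h ↦ by subst h; exact ⟨⟨le_rfl, le_rfl⟩, squarefree_one⟩⟩
  rw [sieveSq, this, sum_singleton]
  simp only [one_dvd, if_true, one_pow]

theorem sum_exceptNu_one {q : ℕ} {χ : DirichletCharacter ℂ q} (hχ : χ ^ 2 = 1) :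
    ∑ d ∈ sqfRange 1, ∑ e ∈ sqfRange 1, (fun _ ↦ (1 : ℝ)) d * (fun _ ↦ (1 : ℝ)) e *
      exceptNu χ (d.lcm e) = 1 := by
  have : sqfRange 1 = {1} := by
    ext d
    rw [mem_sqfRange, mem_singleton]
    exact ⟨fun h ↦ by omega, fun h ↦ by subst h; exact ⟨⟨le_rfl, le_rfl⟩, squarefree_one⟩⟩
  rw [this]
  simp [(exceptNu_isMultiplicative hχ).1]

theorem sieveSq_apply_one {R : ℕ} (hR : 1 ≤ R) {w : ℕ → ℝ} (hw : w 1 = 1) : sieveSq R w 1 = 1 := by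
  have h1 : 1 ∈ sqfRange R := mem_sqfRange.2 ⟨⟨le_rfl, hR⟩, squarefree_one⟩
  rw [sieveSq, sum_eq_single_of_mem 1 h1]
  · simp [hw]
  · intro d _ hd
    simp only [Nat.dvd_one, hd, if_false]

theorem pvBound_le {q : ℕ} {κ : ℝ} (h2 : 2 ≤ (q : ℝ) ^ κ)
    (hl : 1 + Real.log q ≤ (q : ℝ) ^ κ) (hq : 1 ≤ (q : ℝ)) : pvBound q ≤ (q : ℝ) ^ (1 / 2 + 2 * κ) := by
  have hq0 : (0 : ℝ) < q := by linarith
  have e : (q : ℝ) ^ (1 / 2 + 2 * κ) = (q : ℝ) ^ κ * √q * (q : ℝ) ^ κ := by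
    rw [Real.sqrt_eq_rpow, ← Real.rpow_add hq0, ← Real.rpow_add hq0]; congr 1; ring
  rw [e, pvBound]
  refine mul_le_mul (mul_le_mul_of_nonneg_right h2 (Real.sqrt_nonneg _)) hl ?_ (by positivity)
  linarith [Real.log_nonneg hq]

set_option maxHeartbeats 1600000 in
/-- A sieve majorant on which a character with an exceptional zero is almost supported at `1`. -/
theorem exists_sieve_of_exceptional {ε : ℝ} (hε : 0 < ε) (hε1 : ε ≤ 1 / 100) :
    ∃ q₀ : ℝ, 1 < q₀ ∧ ∀ (q : ℕ) [NeZero q], q₀ ≤ q → ∀ χ : DirichletCharacter ℂ q, χ ^ 2 = 1 →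
      χ ≠ 1 → ∀ lam : ℝ, 0 < lam → lam ≤ 1 / 20 →
      χ.LFunction ((1 - lam / Real.log q : ℝ) : ℂ) = 0 →
      ∃ (R : ℕ) (w : ℕ → ℝ), 1 ≤ R ∧ w 1 = 1 ∧
        (∀ (N : ℕ) (ψ : DirichletCharacter ℂ N), ∑ i ∈ sieveIdx R, ‖sieveCoef χ ψ w i‖ *
          (sieveMod i : ℝ) ^ (-(1 / 2 : ℝ)) ≤ (q : ℝ) ^ (1 / 2 + 4 * ε)) ∧
        ‖χ.LFunction 1 * ((∑ d ∈ sqfRange R, ∑ e ∈ sqfRange R,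
          w d * w e * exceptNu χ (d.lcm e) : ℝ) : ℂ)‖ ≤ 2 * lam / Real.log q ∧
        ∀ V : ℝ, (q : ℝ) ^ (2 : ℝ) ≤ V → V ≤ (q : ℝ) ^ (10 : ℝ) →
          ∑ n ∈ Icc 2 ⌊V⌋₊, sieveSq R w n * zetaRe χ n * (n : ℝ) ^ (-(1 - lam / Real.log q)) ≤
            20 * lam + (q : ℝ) ^ (-(ε / 5)) := by
  obtain ⟨C, hC1, hC⟩ := exists_sum_norm_sieveCoef_le hε
  obtain ⟨M₀, hM₀, hM⟩ := exists_forall_le_rpow (κ := ε / 20) (by linarith) (100 * C)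
  refine ⟨max M₀ 3, lt_max_of_lt_left hM₀, fun q _ hq χ hχ hχ1 lam hl hl1 h0 ↦ ?_⟩
  obtain ⟨hA, hlog⟩ := hM q ((le_max_left _ _).trans hq)
  have hq3 : (3 : ℝ) ≤ q := (le_max_right _ _).trans hq
  set M : ℝ := (q : ℝ) with hMdef
  set κ := ε / 20 with hκ
  have hM1 : (1 : ℝ) ≤ M := by linarith
  have hM0 : 0 < M := by linarith
  have hL : 1 ≤ Real.log M := by
    rw [← Real.log_exp 1]
    exact Real.log_le_log (Real.exp_pos 1) (Real.exp_one_lt_d9.le.trans (by linarith))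
  have hpow : ∀ {a b : ℝ}, a ≤ b → M ^ a ≤ M ^ b := fun h ↦ Real.rpow_le_rpow_of_exponent_le hM1 h
  have hp0 : ∀ a : ℝ, 0 < M ^ a := fun a ↦ Real.rpow_pos_of_pos hM0 a
  set u := lam / Real.log M with hu
  have hu0 : 0 < u := by positivity
  have hul : u ≤ lam := div_le_self hl.le hL
  have hMu : M ^ u = Real.exp lam := by
    rw [Real.rpow_def_of_pos hM0, hu, mul_div_cancel₀ _ (by linarith)]
  set R := ⌈M ^ (1 / 2 + ε)⌉₊ with hR
  have hR1 : M ^ (1 / 2 + ε) ≤ R := Nat.le_ceil _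
  have hone : (1 : ℝ) ≤ M ^ (1 / 2 + ε) := Real.one_le_rpow hM1 (by linarith)
  have hRn : 1 ≤ R := by exact_mod_cast hone.trans hR1
  have h100 : 100 ≤ M ^ κ := by nlinarith
  have hR2 : (R : ℝ) ≤ M ^ (1 / 2 + 2 * ε) := by
    have h1 : (R : ℝ) < M ^ (1 / 2 + ε) + 1 := Nat.ceil_lt_add_one (by linarith)
    calc (R : ℝ) ≤ M ^ κ * M ^ (1 / 2 + ε) := by nlinarith
      _ = M ^ (κ + (1 / 2 + ε)) := (Real.rpow_add hM0 _ _).symm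
      _ ≤ _ := hpow (by linarith)
  have hR0 : (0 : ℝ) < R := by exact_mod_cast hRn
  have hRM : (R : ℝ) ≤ M := by
    refine hR2.trans ?_
    conv_rhs => rw [← Real.rpow_one M]
    exact hpow (by linarith)
  obtain ⟨w, S, hw1, hw, hS1, hSs, hSS⟩ := exists_except_weights hχ hRn
  have hpv : √(pvBound q) ≤ M ^ (1 / 4 + κ) := by
    rw [Real.sqrt_le_left (by positivity), ← Real.rpow_natCast, ← Real.rpow_mul hM0.le]
    refine (pvBound_le (κ := κ) (by linarith) hlog hM1).trans (hpow ?_)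
    push_cast; linarith
  have hcoef : ∀ (N : ℕ) (ψ : DirichletCharacter ℂ N), ∑ i ∈ sieveIdx R, ‖sieveCoef χ ψ w i‖ *
      (sieveMod i : ℝ) ^ (-(1 / 2 : ℝ)) ≤ M ^ (1 / 2 + 4 * ε) := fun N ψ ↦ by
    refine (hC hχ ψ R hRn w hw).trans ?_
    calc C * (R : ℝ) ^ (1 + ε) ≤ M ^ κ * (M ^ (1 / 2 + 2 * ε)) ^ (1 + ε) :=
          mul_le_mul (by linarith) (Real.rpow_le_rpow hR0.le hR2 (by linarith)) (by positivity)
            (by positivity)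
      _ = M ^ (κ + (1 / 2 + 2 * ε) * (1 + ε)) := by
          rw [← Real.rpow_mul hM0.le, ← Real.rpow_add hM0]
      _ ≤ _ := hpow (by rw [hκ]; nlinarith)
  set E := M ^ (-(ε / 4)) with hE
  have hE0 : 0 < E := hp0 _
  have hE1 : E ≤ 1 := Real.rpow_le_one_of_one_le_of_nonpos hM1 (by linarith)
  have hexp3 : M ^ u ≤ 3 := by
    rw [hMu]
    exact (Real.exp_le_exp.2 (by linarith)).trans (Real.exp_one_lt_d9.le.trans (by norm_num))
  -- the plain sum up to `R`
  have hplain := norm_LFunction_one_mul_sub_le hχ hχ1 hu0 (by linarith) h0 1 (fun _ ↦ 1)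
    (V := R) (by exact_mod_cast hRn) (hC hχ (1 : DirichletCharacter ℂ 1) 1 le_rfl (fun _ ↦ 1)
      (fun _ ↦ by simp))
  rw [sum_exceptNu_one hχ, Complex.ofReal_one, mul_one, Nat.floor_natCast, Nat.cast_one,
    Real.one_rpow, mul_one] at hplain
  simp only [sieveSq_one, one_mul] at hplain
  have hE1' : 24 * √(pvBound q) * C * (R : ℝ) ^ (-(1 / 2) + u) ≤ E := by
    have h1 : (R : ℝ) ^ (-(1 / 2) + u) ≤ M ^ (-(1 / 4) - ε / 2) * 3 := by
      rw [Real.rpow_add hR0]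
      refine mul_le_mul ?_ ((Real.rpow_le_rpow hR0.le hRM hu0.le).trans hexp3) (by positivity)
        (by positivity)
      refine (Real.rpow_le_rpow_of_nonpos (hp0 _) hR1 (by norm_num)).trans (le_of_eq ?_)
      rw [← Real.rpow_mul hM0.le]; congr 1; ring
    calc _ ≤ 24 * M ^ (1 / 4 + κ) * C * (M ^ (-(1 / 4) - ε / 2) * 3) := by gcongr
      _ = 72 * C * (M ^ (1 / 4 + κ) * M ^ (-(1 / 4) - ε / 2)) := by ring
      _ ≤ M ^ κ * (M ^ (1 / 4 + κ) * M ^ (-(1 / 4) - ε / 2)) := by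
          refine mul_le_mul_of_nonneg_right (by linarith) (by positivity)
      _ = M ^ (κ + (1 / 4 + κ + (-(1 / 4) - ε / 2))) := by
          rw [← Real.rpow_add hM0, ← Real.rpow_add hM0]
      _ ≤ _ := hpow (by rw [hκ]; linarith)
  set A := ∑ n ∈ Icc 1 R, zetaRe χ n * (n : ℝ) ^ (-(1 - u)) with hAdef
  have hRu : 1 ≤ (R : ℝ) ^ u := Real.one_le_rpow (by exact_mod_cast hRn) hu0.le
  have hAS : A ≤ (R : ℝ) ^ u * S := by
    refine le_trans ?_ (mul_le_mul_of_nonneg_left hSs (by positivity))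
    rw [hAdef, mul_sum]
    refine sum_le_sum fun n hn ↦ ?_
    have hn0 : (0 : ℝ) < n := by exact_mod_cast (mem_Icc.1 hn).1
    have hnR : (n : ℝ) ≤ R := by exact_mod_cast (mem_Icc.1 hn).2
    rw [show -(1 - u) = -1 + u by ring, Real.rpow_add hn0, Real.rpow_neg_one]
    have h1 := Real.rpow_le_rpow hn0.le hnR hu0.le
    have h2 := zetaRe_nonneg hχ n
    calc _ = zetaRe χ n * (n : ℝ)⁻¹ * (n : ℝ) ^ u := by ring
      _ ≤ zetaRe χ n * (n : ℝ)⁻¹ * (R : ℝ) ^ u := mul_le_mul_of_nonneg_left h1 (by positivity)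
      _ = _ := by ring
  have hA0 : 0 ≤ A := sum_nonneg fun n _ ↦ mul_nonneg (zetaRe_nonneg hχ n) (by positivity)
  have hLone : ‖χ.LFunction 1‖ ≤ u * (S + E) := by
    have h1 : ‖χ.LFunction 1‖ * (R : ℝ) ^ u ≤ u * A + u * E := by
      have h2 := norm_le_norm_add_norm_sub ((u * A : ℝ) : ℂ) (χ.LFunction 1 * (((R : ℝ) ^ u : ℝ) : ℂ))
      rw [norm_sub_rev, norm_mul, Complex.norm_real, Complex.norm_real, Real.norm_eq_abs,
        Real.norm_eq_abs, abs_of_nonneg (by positivity), abs_of_nonneg (by positivity)] at h2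
      exact h2.trans (add_le_add_right (hplain.trans (mul_le_mul_of_nonneg_left hE1' hu0.le)) _)
    have h3 : ‖χ.LFunction 1‖ * (R : ℝ) ^ u ≤ u * (S + E) * (R : ℝ) ^ u := by
      refine h1.trans ?_
      have h4 : u * A ≤ u * ((R : ℝ) ^ u * S) := mul_le_mul_of_nonneg_left hAS hu0.le
      have h5 : u * E ≤ u * E * (R : ℝ) ^ u := le_mul_of_one_le_right (by positivity) hRu
      linarith
    exact le_of_mul_le_mul_right h3 (by linarith)
  have hmain : ‖χ.LFunction 1 * ((S⁻¹ : ℝ) : ℂ)‖ ≤ u * (1 + E) := by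
    rw [norm_mul, Complex.norm_real, Real.norm_eq_abs, abs_of_pos (by positivity),
      ← div_eq_mul_inv, div_le_iff₀ (by linarith)]
    refine hLone.trans ?_
    rw [mul_assoc]
    refine mul_le_mul_of_nonneg_left ?_ hu0.le
    nlinarith
  refine ⟨R, w, hRn, hw1, hcoef, ?_, fun V hV hV10 ↦ ?_⟩
  · rw [hSS]
    refine hmain.trans ?_
    rw [mul_div_assoc, ← hu]
    nlinarith
  have hV1 : 1 ≤ V := (Real.one_le_rpow hM1 (by norm_num)).trans hV
  have hV0 : 0 < V := by linarith
  have hsieve := norm_LFunction_one_mul_sub_le hχ hχ1 hu0 (by linarith) h0 R w hV1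
    (hcoef 1 (1 : DirichletCharacter ℂ 1))
  rw [hSS] at hsieve
  have hVu : V ^ u ≤ 1 + 20 * lam := by
    calc V ^ u ≤ (M ^ (10 : ℝ)) ^ u := Real.rpow_le_rpow hV0.le hV10 hu0.le
      _ = (M ^ u) ^ (10 : ℝ) := by rw [← Real.rpow_mul hM0.le, ← Real.rpow_mul hM0.le, mul_comm]
      _ = Real.exp (10 * lam) := by rw [hMu, ← Real.exp_mul, mul_comm]
      _ ≤ 1 / (1 - 10 * lam) := Real.exp_bound_div_one_sub_of_interval (by linarith) (by linarith)
      _ ≤ _ := by rw [div_le_iff₀ (by linarith)]; nlinarith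
  have hE2 : 24 * √(pvBound q) * M ^ (1 / 2 + 4 * ε) * V ^ (-(1 / 2) + u) ≤ E := by
    have h1 : V ^ (-(1 / 2) + u) ≤ M ^ (-(1 : ℝ)) * 2 := by
      rw [Real.rpow_add hV0]
      refine mul_le_mul ?_ (hVu.trans (by linarith)) (by positivity) (by positivity)
      refine (Real.rpow_le_rpow_of_nonpos (hp0 _) hV (by norm_num)).trans (le_of_eq ?_)
      rw [← Real.rpow_mul hM0.le]; norm_num
    calc _ ≤ 24 * M ^ (1 / 4 + κ) * M ^ (1 / 2 + 4 * ε) * (M ^ (-(1 : ℝ)) * 2) := by gcongr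
      _ = 48 * (M ^ (1 / 4 + κ) * M ^ (1 / 2 + 4 * ε) * M ^ (-(1 : ℝ))) := by ring
      _ ≤ M ^ κ * (M ^ (1 / 4 + κ) * M ^ (1 / 2 + 4 * ε) * M ^ (-(1 : ℝ))) := by
          refine mul_le_mul_of_nonneg_right (by linarith) (by positivity)
      _ = M ^ (κ + (1 / 4 + κ + (1 / 2 + 4 * ε) + -1)) := by
          rw [← Real.rpow_add hM0, ← Real.rpow_add hM0, ← Real.rpow_add hM0]
      _ ≤ _ := hpow (by rw [hκ]; linarith)
  set W := ∑ n ∈ Icc 1 ⌊V⌋₊, sieveSq R w n * zetaRe χ n * (n : ℝ) ^ (-(1 - u)) with hW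
  have hVf : 1 ≤ ⌊V⌋₊ := Nat.le_floor (by simpa using hV1)
  have hsplit : W = 1 + ∑ n ∈ Icc 2 ⌊V⌋₊, sieveSq R w n * zetaRe χ n * (n : ℝ) ^ (-(1 - u)) := by
    rw [hW, ← add_sum_Ioc_eq_sum_Icc hVf, sieveSq_apply_one hRn hw1, zetaRe_one hχ, Nat.cast_one,
      Real.one_rpow, mul_one, mul_one]
    rfl
  have hW0 : 0 ≤ W := sum_nonneg fun n _ ↦
    mul_nonneg (mul_nonneg (sq_nonneg _) (zetaRe_nonneg hχ n)) (by positivity)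
  have hWle : u * W ≤ u * ((1 + E) * V ^ u + E) := by
    have h2 := norm_le_norm_add_norm_sub (χ.LFunction 1 * ((S⁻¹ : ℝ) : ℂ) * ((V ^ u : ℝ) : ℂ))
      ((u * W : ℝ) : ℂ)
    rw [norm_mul _ ((V ^ u : ℝ) : ℂ), Complex.norm_real, Complex.norm_real, Real.norm_eq_abs,
      Real.norm_eq_abs, abs_of_nonneg (by positivity), abs_of_nonneg (by positivity)] at h2
    refine h2.trans ?_
    have h3 := mul_le_mul_of_nonneg_right hmain (show 0 ≤ V ^ u by positivity)
    have h4 := hsieve.trans (mul_le_mul_of_nonneg_left hE2 hu0.le)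
    linarith
  have hW2 := le_of_mul_le_mul_left hWle hu0
  have h3E : 4 * E ≤ M ^ (-(ε / 5)) := by
    calc 4 * E ≤ M ^ κ * M ^ (-(ε / 4)) := mul_le_mul_of_nonneg_right (by linarith) hE0.le
      _ = M ^ (κ + -(ε / 4)) := (Real.rpow_add hM0 _ _).symm
      _ ≤ _ := hpow (by rw [hκ]; linarith)
  have h6 : (1 + E) * V ^ u ≤ 1 + 20 * lam + 2 * E := by nlinarith
  linarith

end

section
open Finset DirichletCharacter

theorem prod_eulerFactor_ne_zero {M N : ℕ} (χ : DirichletCharacter ℂ M) {s : ℂ} (h0 : 0 < s.re) :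
    ∏ p ∈ N.primeFactors, (1 - χ p * (p : ℂ) ^ (-s)) ≠ 0 := by
  refine prod_ne_zero_iff.2 fun p hp ↦ ?_
  have hp2 := (Nat.prime_of_mem_primeFactors hp).two_le
  intro h
  have h1 : ‖χ p * (p : ℂ) ^ (-s)‖ = 1 := by rw [← sub_eq_zero.1 h, norm_one]
  rw [norm_mul, Complex.norm_natCast_cpow_of_pos (by omega), Complex.neg_re] at h1
  have h2 : (p : ℝ) ^ (-s.re) < 1 :=
    Real.rpow_lt_one_of_one_lt_of_neg (by exact_mod_cast hp2) (by linarith)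
  nlinarith [χ.norm_le_one p, norm_nonneg (χ p), Real.rpow_nonneg (Nat.cast_nonneg (α := ℝ) p) (-s.re)]

theorem LFunction_changeLevel_eq_zero_iff {M N : ℕ} [NeZero M] [NeZero N] (hMN : M ∣ N)
    (χ : DirichletCharacter ℂ M) {s : ℂ} (hs : s ≠ 1) (h0 : 0 < s.re) :
    (changeLevel hMN χ).LFunction s = 0 ↔ χ.LFunction s = 0 := by
  rw [LFunction_changeLevel hMN χ (.inr hs), mul_eq_zero,
    or_iff_left (prod_eulerFactor_ne_zero χ h0)]

/-- A weighted sum almost supported at `1` stays away from zero. -/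
theorem one_le_norm_sum_add {c : ℕ → ℝ} {a : ℕ → ℂ} (hc : ∀ n, 0 ≤ c n) (hc1 : c 1 = 1)
    (ha : ∀ n, ‖a n‖ ≤ 1) (ha1 : a 1 = 1) {V b D : ℝ} (hV : 1 ≤ V) (hb : b ≤ 1) {s : ℂ}
    (hs : s.re ≤ 1) (hD : ∑ n ∈ Icc 2 ⌊V⌋₊, c n * (n : ℝ) ^ (-b) ≤ D) :
    1 ≤ ‖∑ n ∈ Icc 1 ⌊V⌋₊, (c n : ℂ) * a n * (n : ℂ) ^ (-s)‖ + D * V ^ (1 - s.re) := by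
  have hVf : 1 ≤ ⌊V⌋₊ := Nat.le_floor (by simpa using hV)
  have e : Ioc 1 ⌊V⌋₊ = Icc 2 ⌊V⌋₊ := rfl
  rw [← add_sum_Ioc_eq_sum_Icc hVf, hc1, ha1, Nat.cast_one, Complex.one_cpow, Complex.ofReal_one,
    one_mul, one_mul, e]
  set t := ∑ n ∈ Icc 2 ⌊V⌋₊, (c n : ℂ) * a n * (n : ℂ) ^ (-s)
  have ht : ‖t‖ ≤ D * V ^ (1 - s.re) := by
    refine le_trans ?_ (mul_le_mul_of_nonneg_right hD (by positivity))
    rw [sum_mul]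
    refine norm_sum_le_of_le _ fun n hn ↦ ?_
    have hn1 : 2 ≤ n := (mem_Icc.1 hn).1
    have hn0 : (1 : ℝ) ≤ n := by exact_mod_cast (by omega : 1 ≤ n)
    have hnV : (n : ℝ) ≤ V := (Nat.le_floor_iff (by linarith)).1 (mem_Icc.1 hn).2
    rw [norm_mul, norm_mul, Complex.norm_natCast_cpow_of_pos (by omega), Complex.norm_real,
      Real.norm_eq_abs, abs_of_nonneg (hc n), Complex.neg_re]
    have h1 : (n : ℝ) ^ (-s.re) ≤ (n : ℝ) ^ (-b) * V ^ (1 - s.re) := by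
      calc (n : ℝ) ^ (-s.re) = (n : ℝ) ^ (-1 : ℝ) * (n : ℝ) ^ (1 - s.re) := by
            rw [← Real.rpow_add (by linarith)]; congr 1; ring
        _ ≤ _ := mul_le_mul (Real.rpow_le_rpow_of_exponent_le hn0 (by linarith))
            (Real.rpow_le_rpow (by linarith) hnV (by linarith)) (by positivity) (by positivity)
    have h2 : 0 ≤ (n : ℝ) ^ (-s.re) := by positivity
    calc c n * ‖a n‖ * (n : ℝ) ^ (-s.re) ≤ c n * 1 * (n : ℝ) ^ (-s.re) :=
          mul_le_mul_of_nonneg_right (mul_le_mul_of_nonneg_left (ha n) (hc n)) h2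
      _ = c n * (n : ℝ) ^ (-s.re) := by ring
      _ ≤ c n * ((n : ℝ) ^ (-b) * V ^ (1 - s.re)) := mul_le_mul_of_nonneg_left h1 (hc n)
      _ = _ := by ring
  have := norm_le_norm_add_norm_sub (1 + t) 1
  rw [show 1 + t - 1 = t by ring, norm_one] at this
  linarith

theorem LFunction_mul_trivChar_eq_zero {q : ℕ} [NeZero q] {χ ψ : DirichletCharacter ℂ q}
    (h : ψ = 1 ∨ ψ = χ) {s : ℂ} (hs : s ≠ 1) (h0 : 0 < s.re) (hz : ψ.LFunction s = 0) :
    LFunctionTrivChar₁ 1 s * χ.LFunction s = 0 := by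
  rcases h with rfl | rfl
  · rw [← changeLevel_one q.one_dvd, LFunction_changeLevel_eq_zero_iff _ _ hs h0] at hz
    rw [LFunctionTrivChar₁, Function.update_of_ne hs, LFunctionTrivChar, hz, mul_zero, zero_mul]
  · rw [hz, mul_zero]

set_option maxHeartbeats 1000000 in
/-- The Deuring–Heilbronn phenomenon, in log-free form. -/
theorem deuring_heilbronn {ε c₀ : ℝ} (hε : 0 < ε) (hε1 : ε ≤ 1 / 100) (hc₀ : 0 < c₀) :
    ∃ C : ℝ, 1 ≤ C ∧ ∃ q₀ : ℝ, 1 < q₀ ∧ ∀ (q : ℕ) [NeZero q], q₀ ≤ q →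
      ∀ χ : DirichletCharacter ℂ q, χ ^ 2 = 1 → χ ≠ 1 → ∀ lam : ℝ, 0 < lam → lam ≤ 1 / 20 →
      χ.LFunction ((1 - lam / Real.log q : ℝ) : ℂ) = 0 →
      ∀ (ψ : DirichletCharacter ℂ q) (ρ : ℂ), ψ.LFunction ρ = 0 → 1 - ε ≤ ρ.re → ρ.re ≤ 1 →
      |ρ.im| ≤ (q : ℝ) ^ (2 : ℝ) → (ψ ≠ 1 ∧ ψ ≠ χ ∨ c₀ / Real.log q ≤ ‖ρ - 1‖) →
      1 ≤ C * (lam + (q : ℝ) ^ (-(ε / 5))) *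
        ((q : ℝ) ^ (2 + 20 * ε) * (2 + |ρ.im|) ^ (3 : ℝ)) ^ (1 - ρ.re) := by
  obtain ⟨q₁, hq₁, hS⟩ := exists_sieve_of_exceptional hε hε1
  obtain ⟨M₀, hM₀, hM⟩ := exists_forall_le_rpow (κ := ε / 2) (by linarith) 72
  refine ⟨2 * (20 + 2 / c₀ + 1), ?_, max (max q₁ M₀) 3, lt_max_of_lt_right (by norm_num),
    fun q _ hq χ hχ hχ1 lam hl hl1 h0 ψ ρ hz hρ hρ1 hρt hcase ↦ ?_⟩
  · have : 0 < 2 / c₀ := by positivity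
    linarith
  obtain ⟨R, w, hR, hw1, hcoef, hκ, hV⟩ :=
    hS q ((le_max_left _ _).trans ((le_max_left _ _).trans hq)) χ hχ hχ1 lam hl hl1 h0
  obtain ⟨hA, hlog⟩ := hM q ((le_max_right _ _).trans ((le_max_left _ _).trans hq))
  have hq3 : (3 : ℝ) ≤ q := (le_max_right _ _).trans hq
  have hpv := pvBound_le (by linarith) hlog (by linarith)
  have hpv1 := one_le_pvBound (q := q)
  have hL : 0 < Real.log q := Real.log_pos (by linarith)
  set M : ℝ := (q : ℝ)
  have hM0 : 0 < M := by linarith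
  have hM1 : 1 ≤ M := by linarith
  have hpow : ∀ {a b : ℝ}, a ≤ b → M ^ a ≤ M ^ b := fun h ↦ Real.rpow_le_rpow_of_exponent_le hM1 h
  set t := 2 + |ρ.im| with ht
  have ht2 : 2 ≤ t := by linarith [abs_nonneg ρ.im]
  set V := M ^ (2 + 20 * ε) * t ^ (3 : ℝ) with hVdef
  have ht1 : 1 ≤ t ^ (3 : ℝ) := Real.one_le_rpow (by linarith) (by norm_num)
  have hV2 : M ^ (2 : ℝ) ≤ V := by
    refine (hpow (by linarith : (2 : ℝ) ≤ 2 + 20 * ε)).trans ?_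
    exact le_mul_of_one_le_right (by positivity) ht1
  have hV1 : 1 ≤ V := (Real.one_le_rpow hM1 (by norm_num)).trans hV2
  have hV10 : V ≤ M ^ (10 : ℝ) := by
    have h1 : t ≤ M ^ (2.5 : ℝ) := by
      have h2 : M ^ (2.5 : ℝ) = M ^ (2 : ℝ) * M ^ (1 / 2 : ℝ) := by
        rw [← Real.rpow_add hM0]; norm_num
      have h3 : 1.7 ≤ M ^ (1 / 2 : ℝ) := by
        rw [← Real.sqrt_eq_rpow]; exact Real.le_sqrt_of_sq_le (by norm_num; linarith)
      have h4 : 9 ≤ M ^ (2 : ℝ) := by rw [Real.rpow_two]; nlinarith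
      have h5 := mul_le_mul_of_nonneg_left h3 (show 0 ≤ M ^ (2 : ℝ) by linarith)
      linarith
    calc V ≤ M ^ (2 + 20 * ε) * (M ^ (2.5 : ℝ)) ^ (3 : ℝ) :=
          mul_le_mul_of_nonneg_left (Real.rpow_le_rpow (by linarith) h1 (by norm_num))
            (by positivity)
      _ = M ^ (2 + 20 * ε + 2.5 * 3) := by rw [← Real.rpow_mul hM0.le, ← Real.rpow_add hM0]
      _ ≤ _ := hpow (by linarith)
  have hD := hV V hV2 hV10
  have hErr : 6 * pvBound q * M ^ (1 / 2 + 4 * ε) * V ^ (1 / 2 - ρ.re) *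
      (1 + ‖ρ‖ / (ρ.re - 1 / 2)) ≤ 1 / 4 := by
    have h1 : 1 + ‖ρ‖ / (ρ.re - 1 / 2) ≤ 3 * t := by
      have h2 : ‖ρ‖ ≤ 1 + |ρ.im| := (Complex.norm_le_abs_re_add_abs_im ρ).trans (by
        rw [abs_of_nonneg (by linarith)]; linarith)
      have h3 : ‖ρ‖ / (ρ.re - 1 / 2) ≤ 3 * (1 + |ρ.im|) := by
        rw [div_le_iff₀ (by linarith)]
        nlinarith [norm_nonneg ρ, abs_nonneg ρ.im]
      linarith
    have h2 : V ^ (1 / 2 - ρ.re) ≤ M ^ (-(1 + 8 * ε - 20 * ε ^ 2)) * t ^ (-1 : ℝ) := by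
      calc V ^ (1 / 2 - ρ.re) ≤ V ^ (-(1 / 2) + ε) :=
            Real.rpow_le_rpow_of_exponent_le hV1 (by linarith)
        _ = M ^ (-(1 + 8 * ε - 20 * ε ^ 2)) * t ^ (3 * (-(1 / 2) + ε)) := by
            rw [hVdef, Real.mul_rpow (by positivity) (by positivity), ← Real.rpow_mul hM0.le,
              ← Real.rpow_mul (by linarith)]
            congr 2; ring
        _ ≤ _ := mul_le_mul_of_nonneg_left
            (Real.rpow_le_rpow_of_exponent_le (by linarith) (by linarith)) (by positivity)
    have hn : 0 ≤ ‖ρ‖ / (ρ.re - 1 / 2) := div_nonneg (norm_nonneg _) (by linarith)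
    calc _ ≤ 6 * M ^ (1 / 2 + 2 * (ε / 2)) * M ^ (1 / 2 + 4 * ε) *
          (M ^ (-(1 + 8 * ε - 20 * ε ^ 2)) * t ^ (-1 : ℝ)) * (3 * t) := by
          refine mul_le_mul (mul_le_mul (mul_le_mul_of_nonneg_right
            (mul_le_mul_of_nonneg_left hpv (by norm_num)) (by positivity)) h2
            (by positivity) (by positivity)) h1 (by linarith) (by positivity)
      _ = 18 * (M ^ (1 / 2 + 2 * (ε / 2)) * M ^ (1 / 2 + 4 * ε) *
          M ^ (-(1 + 8 * ε - 20 * ε ^ 2))) := by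
          rw [Real.rpow_neg_one]
          have : t ≠ 0 := by linarith
          field_simp
          norm_num
      _ = 18 * M ^ (1 / 2 + 2 * (ε / 2) + (1 / 2 + 4 * ε) + -(1 + 8 * ε - 20 * ε ^ 2)) := by
          rw [← Real.rpow_add hM0, ← Real.rpow_add hM0]
      _ ≤ 18 * M ^ (-(ε / 2)) := mul_le_mul_of_nonneg_left (hpow (by nlinarith)) (by norm_num)
      _ ≤ 1 / 4 := by
          rw [Real.rpow_neg hM0.le, ← div_eq_mul_inv, div_le_iff₀ (by positivity)]
          linarith
  have hc : ∀ n, 0 ≤ sieveSq R w n * zetaRe χ n := fun n ↦ mul_nonneg (sq_nonneg _) (zetaRe_nonneg hχ n)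
  have hc1 : sieveSq R w 1 * zetaRe χ 1 = 1 := by rw [sieveSq_apply_one hR hw1, zetaRe_one hχ, one_mul]
  have hb : 1 - lam / Real.log M ≤ 1 := by linarith [div_pos hl hL]
  have hs : 1 / 2 < ρ.re := by linarith
  have hVp : 0 < V ^ (1 - ρ.re) := by positivity
  have hE0 : 0 < M ^ (-(ε / 5)) := by positivity
  have hfac : 0 ≤ V ^ (1 / 2 - ρ.re) * (1 + ‖ρ‖ / (ρ.re - 1 / 2)) :=
    mul_nonneg (by positivity) (add_nonneg zero_le_one (div_nonneg (norm_nonneg _) (by linarith)))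
  clear_value V t
  by_cases hA : ψ ≠ 1 ∧ ψ ≠ χ
  · have h1 := one_le_norm_sum_add hc hc1 (fun n ↦ ψ.norm_le_one n) (by simp) hV1 hb hρ1 hD
    have h2 := norm_sieveSum_twist_le hχ R w hA.1 hA.2 hV1 hs hz
    have h3 : (6 * pvBound q * ∑ i ∈ sieveIdx R, ‖sieveCoef χ ψ w i‖ *
        (sieveMod i : ℝ) ^ (-(1 / 2 : ℝ))) * V ^ (1 / 2 - ρ.re) * (1 + ‖ρ‖ / (ρ.re - 1 / 2)) ≤ 1 / 4 := by
      refine le_trans ?_ hErr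
      rw [mul_assoc _ (V ^ _), mul_assoc _ (V ^ _)]
      exact mul_le_mul_of_nonneg_right
        (mul_le_mul_of_nonneg_left (hcoef q ψ) (by linarith)) hfac
    have h4 : (20 * lam + M ^ (-(ε / 5))) * V ^ (1 - ρ.re) ≤
        (20 + 2 / c₀ + 1) * (lam + M ^ (-(ε / 5))) * V ^ (1 - ρ.re) := by
      refine mul_le_mul_of_nonneg_right ?_ hVp.le
      have : 0 < 2 / c₀ := by positivity
      nlinarith
    linarith
  · have hρn : c₀ / Real.log M ≤ ‖ρ - 1‖ := hcase.resolve_left hA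
    have hρ0 : 0 < ‖ρ - 1‖ := (div_pos hc₀ hL).trans_le hρn
    have hne : ρ ≠ 1 := fun h ↦ by simp [h] at hρ0
    have h1 := one_le_norm_sum_add hc hc1 (a := fun _ ↦ 1) (fun n ↦ by simp) rfl hV1 hb hρ1 hD
    have h2 := norm_sieveSum_sub_le hχ hχ1 R w hV1 hs
    simp only [mul_one] at h1
    rw [LFunction_mul_trivChar_eq_zero (by tauto) hne (by linarith) hz, zero_mul, sub_zero] at h2
    set S := ∑ n ∈ Icc 1 ⌊V⌋₊, ((sieveSq R w n * zetaRe χ n : ℝ) : ℂ) * (n : ℂ) ^ (-ρ)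
    have h3 : (6 * √(pvBound q) * ∑ i ∈ sieveIdx R, ‖sieveCoef χ (1 : DirichletCharacter ℂ 1) w i‖ *
        (sieveMod i : ℝ) ^ (-(1 / 2 : ℝ))) * V ^ (1 / 2 - ρ.re) * (1 + ‖ρ‖ / (ρ.re - 1 / 2)) ≤ 1 / 4 := by
      refine le_trans ?_ hErr
      rw [mul_assoc _ (V ^ _), mul_assoc _ (V ^ _)]
      refine mul_le_mul_of_nonneg_right (mul_le_mul ?_ (hcoef 1 _) (sum_nonneg fun i _ ↦ by positivity)
        (by linarith)) hfac
      have : √(pvBound q) ≤ pvBound q := Real.sqrt_le_iff.2 ⟨by linarith, by nlinarith⟩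
      linarith
    have h4 := mul_le_mul_of_nonneg_left h3 hρ0.le
    set K := χ.LFunction 1 * ((∑ d ∈ sqfRange R, ∑ e ∈ sqfRange R,
          w d * w e * exceptNu χ (d.lcm e) : ℝ) : ℂ)
    have h5 : ‖ρ - 1‖ * ‖S‖ ≤ ‖ρ - 1‖ * (1 / 4) + 2 * lam / Real.log M * V ^ (1 - ρ.re) := by
      have h6 := norm_le_norm_add_norm_sub (-(K * (V : ℂ) ^ (1 - ρ))) ((ρ - 1) * S)
      rw [norm_neg, ← norm_neg (_ - _), neg_sub, sub_neg_eq_add, norm_mul, norm_mul,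
        Complex.norm_cpow_eq_rpow_re_of_pos (by linarith), Complex.sub_re, Complex.one_re] at h6
      have h7 := mul_le_mul_of_nonneg_right hκ hVp.le
      linarith
    have h8 : 2 * lam / Real.log M ≤ ‖ρ - 1‖ * (2 / c₀ * lam) := by
      calc 2 * lam / Real.log M = c₀ / Real.log M * (2 / c₀ * lam) := by field_simp
        _ ≤ _ := mul_le_mul_of_nonneg_right hρn (by positivity)
    have h9 : ‖S‖ ≤ 1 / 4 + 2 / c₀ * lam * V ^ (1 - ρ.re) := by
      refine le_of_mul_le_mul_left ?_ hρ0
      have := mul_le_mul_of_nonneg_right h8 hVp.le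
      linarith
    have h10 : (20 * lam + M ^ (-(ε / 5))) * V ^ (1 - ρ.re) + 2 / c₀ * lam * V ^ (1 - ρ.re) ≤
        (20 + 2 / c₀ + 1) * (lam + M ^ (-(ε / 5))) * V ^ (1 - ρ.re) := by
      rw [← add_mul]
      refine mul_le_mul_of_nonneg_right ?_ hVp.le
      have : 0 < 2 / c₀ := by positivity
      nlinarith
    linarith

end

section
open Finset Metric

theorem norm_deriv_div_le {f : ℂ → ℂ} {c : ℂ} {R M : ℝ} (hR : 0 < R) (hM : 0 < M)
    (hf : Differentiable ℂ f) (hb : ∀ z ∈ ball c R, ‖f z‖ ≤ Real.exp M * ‖f c‖)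
    (h0 : ∀ z ∈ ball c R, f z ≠ 0) : ‖deriv f c / f c‖ ≤ 4 * M / R := by
  have hfd : Differentiable ℂ (deriv f) := hf.contDiff.differentiable_deriv_two
  obtain ⟨h, hh⟩ := DifferentiableOn.isExactOn_ball (c := c) (r := R)
    (f := fun z ↦ deriv f z / f z) (hfd.differentiableOn.div hf.differentiableOn h0)
  have hcR : c ∈ ball c R := mem_ball_self hR
  have hc0 := h0 c hcR
  have key : ∀ z ∈ ball c R, f z = f c * Complex.exp (h z - h c) := by
    intro z hz
    have hd : ∀ w ∈ ball c R, HasDerivAt (fun w ↦ f w * Complex.exp (-h w)) 0 w := fun w hw ↦ by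
      have := (hf w).hasDerivAt.mul (hh w hw).neg.cexp
      refine this.congr_deriv ?_
      have := h0 w hw
      field_simp
      ring
    have := isOpen_ball.is_const_of_deriv_eq_zero (convex_ball c R).isPreconnected
      (fun w hw ↦ (hd w hw).differentiableAt.differentiableWithinAt) (fun w hw ↦ (hd w hw).deriv) hz hcR
    rw [sub_eq_add_neg, add_comm, Complex.exp_add, ← mul_assoc, ← this, mul_assoc, ← Complex.exp_add,
      neg_add_cancel, Complex.exp_zero, mul_one]
  have hshift : ∀ z ∈ ball (0 : ℂ) R, c + z ∈ ball c R := fun z hz ↦ by simpa using hz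
  have hbc : ∀ z ∈ ball (0 : ℂ) R, ‖h (c + z) - h c‖ ≤ 2 * M * ‖z‖ / (R - ‖z‖) := fun z hz ↦ by
    refine Complex.borelCaratheodory_zero (f := fun z ↦ h (c + z) - h c) hM (fun z hz ↦ ?_)
      (fun z hz ↦ ?_) hR hz (by simp)
    · exact (((hh _ (hshift z hz)).comp_const_add c z).differentiableAt.sub_const _).differentiableWithinAt
    · have h1 := hb _ (hshift z hz)
      rw [key _ (hshift z hz), norm_mul, Complex.norm_exp, mul_comm] at h1
      exact Real.exp_le_exp.1 (le_of_mul_le_mul_right h1 (norm_pos_iff.2 hc0))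
  have hd : HasDerivAt (fun z ↦ h (c + z) - h c) (deriv f c / f c) 0 :=
    (HasDerivAt.comp_const_add c 0 (by simpa using hh c hcR)).sub_const _
  rw [← hd.deriv]
  have := Complex.norm_deriv_le_of_forall_mem_sphere_norm_le (c := (0 : ℂ)) (R := R / 2) (C := 2 * M)
    (f := fun z ↦ h (c + z) - h c) (by positivity)
    (DifferentiableOn.diffContOnCl_ball (U := ball 0 R) (fun z hz ↦
      (((hh _ (hshift z hz)).comp_const_add c z).differentiableAt.sub_const _).differentiableWithinAt)
      (closedBall_subset_ball (by linarith))) (fun z hz ↦ by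
        rw [mem_sphere_zero_iff_norm] at hz
        refine (hbc z (by rw [mem_ball_zero_iff, hz]; linarith)).trans (le_of_eq ?_)
        rw [hz]; field_simp; ring)
  exact this.trans (le_of_eq (by field_simp; ring))

/-- Landau's lemma on the logarithmic derivative at a point to the right of all zeros. -/
theorem neg_re_deriv_div_le {c : ℂ} {r : ℝ} (hr : 0 < r) (n : ℕ) : ∀ {f : ℂ → ℂ} {M : ℝ},
    Differentiable ℂ f → f c ≠ 0 → (∀ z ∈ closedBall c r, ‖f z‖ ≤ Real.exp M * ‖f c‖) →
    (∀ z, f z = 0 → z.re < c.re) → M < n * Real.log 2 → ∀ S : Finset ℂ,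
    (∀ z ∈ S, f z = 0 ∧ z ∈ closedBall c (r / 3)) →
    -(deriv f c / f c).re ≤ 12 * (M + 1) / r - ∑ z ∈ S, ((c - z)⁻¹).re := by
  induction n with
  | zero =>
    intro f M hf hc hb hz hM
    have h1 := hb c (mem_closedBall_self hr.le)
    have h2 : Real.exp M < 1 := Real.exp_lt_one_iff.2 (by simpa using hM)
    nlinarith [norm_pos_iff.2 hc]
  | succ n ih =>
    intro f M hf hc hb hz hM S hS
    have hM0 : 0 ≤ M := by
      by_contra! h
      have h1 := hb c (mem_closedBall_self hr.le)
      nlinarith [norm_pos_iff.2 hc, Real.exp_lt_one_iff.2 h]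
    by_cases hex : ∃ a, f a = 0 ∧ a ∈ closedBall c (r / 3)
    · obtain ⟨a, ha, haB, haS⟩ : ∃ a, f a = 0 ∧ a ∈ closedBall c (r / 3) ∧ (S = ∅ ∨ a ∈ S) := by
        rcases S.eq_empty_or_nonempty with h | ⟨a, h⟩
        · obtain ⟨a, ha⟩ := hex
          exact ⟨a, ha.1, ha.2, .inl h⟩
        · exact ⟨a, (hS a h).1, (hS a h).2, .inr h⟩
      set g := dslope f a with hg
      have hfg : ∀ z, f z = (z - a) * g z := fun z ↦ by
        have := sub_smul_dslope f a z
        rw [ha, sub_zero, smul_eq_mul] at this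
        exact this.symm
      have hgd : Differentiable ℂ g := by
        rw [← differentiableOn_univ] at hf ⊢
        exact (Complex.differentiableOn_dslope Filter.univ_mem).2 hf
      have hca : 0 < (c - a).re := by rw [Complex.sub_re]; linarith [hz a ha]
      have hca0 : c - a ≠ 0 := fun h ↦ by simp [h] at hca
      have hgc : g c ≠ 0 := fun h ↦ hc (by rw [hfg, h, mul_zero])
      have had : ‖c - a‖ ≤ r / 3 := by rwa [mem_closedBall, dist_comm, dist_eq_norm] at haB
      have hgb : ∀ z ∈ closedBall c r, ‖g z‖ ≤ Real.exp (M - Real.log 2) * ‖g c‖ := by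
        intro z hz
        rw [← closure_ball c hr.ne'] at hz
        refine Complex.norm_le_of_forall_mem_frontier_norm_le isBounded_ball hgd.diffContOnCl
          (fun w hw ↦ ?_) hz
        rw [frontier_ball c hr.ne', mem_sphere, dist_eq_norm] at hw
        have h1 := hb w (by rw [mem_closedBall, dist_eq_norm, hw])
        rw [hfg w, hfg c, norm_mul, norm_mul] at h1
        have h2 : 2 * r / 3 ≤ ‖w - a‖ := by
          have := norm_sub_norm_le (w - c) (a - c)
          rw [show w - c - (a - c) = w - a by ring, norm_sub_rev a c] at this
          linarith
        rw [Real.exp_sub, Real.exp_log two_pos]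
        have h3 := mul_le_mul_of_nonneg_right h2 (norm_nonneg (g w))
        have h4 : Real.exp M * (‖c - a‖ * ‖g c‖) ≤ Real.exp M * (r / 3 * ‖g c‖) := by gcongr
        refine le_of_mul_le_mul_left ?_ (show 0 < 2 * r / 3 by positivity)
        linarith
      have hIH := ih hgd hgc hgb (fun z h ↦ hz z (by rw [hfg, h, mul_zero]))
        (by push_cast at hM; linarith) (S.erase a) (fun z hzS ↦ by
          obtain ⟨h1, h2⟩ := hS z (mem_of_mem_erase hzS)
          rw [hfg, mul_eq_zero, sub_eq_zero] at h1
          exact ⟨h1.resolve_left (ne_of_mem_erase hzS), h2⟩)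
      have hder : deriv f c / f c = (c - a)⁻¹ + deriv g c / g c := by
        have h1 : HasDerivAt (fun z ↦ (z - a) * g z) (1 * g c + (c - a) * deriv g c) c :=
          ((hasDerivAt_id c).sub_const a).mul (hgd c).hasDerivAt
        rw [show f = fun z ↦ (z - a) * g z from funext hfg, h1.deriv]
        field_simp
      have hinv : 0 ≤ ((c - a)⁻¹).re := by
        rw [Complex.inv_re]; exact div_nonneg hca.le (Complex.normSq_nonneg _)
      have hsum : ∑ z ∈ S, ((c - z)⁻¹).re ≤ ((c - a)⁻¹).re + ∑ z ∈ S.erase a, ((c - z)⁻¹).re := by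
        rcases haS with rfl | h
        · simpa using hinv
        · exact (add_sum_erase S (fun z ↦ ((c - z)⁻¹).re) h).ge
      rw [hder, Complex.add_re]
      have : 12 * (M - Real.log 2 + 1) / r ≤ 12 * (M + 1) / r := by
        gcongr; linarith [Real.log_pos one_lt_two]
      linarith
    · have hS0 : S = ∅ := eq_empty_of_forall_notMem fun z h ↦ hex ⟨z, hS z h⟩
      subst hS0
      have hsub : ball c (r / 3) ⊆ closedBall c r :=
        ball_subset_closedBall.trans (closedBall_subset_closedBall (by linarith))
      have := norm_deriv_div_le (M := M + 1) (show 0 < r / 3 by positivity) (by linarith) hf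
        (fun z hz ↦ (hb z (hsub hz)).trans (by gcongr; linarith))
        (fun z hz h ↦ hex ⟨z, h, ball_subset_closedBall hz⟩)
      rw [sum_empty, sub_zero]
      have h2 := neg_le_of_abs_le (Complex.abs_re_le_norm (deriv f c / f c))
      rw [show 4 * (M + 1) / (r / 3) = 12 * (M + 1) / r by field_simp; ring] at this
      linarith

end

section
open scoped LSeries.notation ArithmeticFunction.vonMangoldt ArithmeticFunction.Moebius
open Finset Metric DirichletCharacter

variable {q : ℕ} [NeZero q] {χ : DirichletCharacter ℂ q}

/-- The entire function `(s - 1) L(s, χ)`, with `ζ` in place of `L(s, χ)` for principal `χ`. -/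
noncomputable def regL (χ : DirichletCharacter ℂ q) (s : ℂ) : ℂ :=
  if χ = 1 then LFunctionTrivChar₁ 1 s else (s - 1) * χ.LFunction s

theorem regL_one_apply {s : ℂ} (hs : s ≠ 1) : regL (1 : DirichletCharacter ℂ q) s =
    (s - 1) * riemannZeta s := by
  rw [regL, if_pos rfl, LFunctionTrivChar₁, Function.update_of_ne hs, LFunctionTrivChar,
    LFunction_modOne_eq]

theorem regL_apply (hχ : χ ≠ 1) (s : ℂ) : regL χ s = (s - 1) * χ.LFunction s := if_neg hχ

theorem differentiable_regL (χ : DirichletCharacter ℂ q) : Differentiable ℂ (regL χ) := by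
  by_cases h : χ = 1
  · rw [show regL χ = LFunctionTrivChar₁ 1 from funext fun s ↦ if_pos h]
    exact differentiable_LFunctionTrivChar₁ 1
  · rw [show regL χ = fun s ↦ (s - 1) * χ.LFunction s from funext (regL_apply h)]
    exact (differentiable_id.sub_const 1).mul (differentiable_LFunction h)

theorem norm_regL_le (χ : DirichletCharacter ℂ q) {s : ℂ} (hs : 0 < s.re) :
    ‖regL χ s‖ ≤ 1 + ‖s - 1‖ * (1 + pvBound q * (1 + ‖s‖ / s.re)) := by
  have hK := one_le_pvBound (q := q)
  suffices ∃ κ : ℂ, ‖κ‖ ≤ 1 ∧ ‖(s - 1) * 1 + κ - regL χ s‖ ≤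
      ‖s - 1‖ * (pvBound q * (1 + ‖s‖ / s.re)) by
    obtain ⟨κ, h1, h2⟩ := this
    have h3 := norm_le_norm_add_norm_sub ((s - 1) * 1 + κ) (regL χ s)
    have h4 := norm_add_le ((s - 1) * 1) κ
    rw [mul_one] at h2 h3 h4
    linarith
  have key : ∀ {N : ℕ} [NeZero N] (ψ : DirichletCharacter ℂ N) (κ : ℂ),
      (∀ u : ℝ, 1 ≤ u → ‖∑ n ∈ Icc 1 ⌊u⌋₊, charAF ψ n - κ * u‖ ≤ pvBound q) →
      (∀ s : ℂ, 1 < s.re → regL χ s = (s - 1) * ψ.LFunction s) →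
      ‖(s - 1) * 1 + κ - regL χ s‖ ≤ ‖s - 1‖ * (pvBound q * (1 + ‖s‖ / s.re)) := by
    intro N _ ψ κ h1 h2
    have := norm_partialSum_sub_le (c := fun n ↦ charAF ψ n) (κ := κ) (B := pvBound q) (θ := 0)
      (N := 1) (fun u hu ↦ by simpa using h1 u hu) one_pos (fun _ ↦ LSeriesSummable_charAF ψ)
      (differentiable_regL χ).differentiableOn
      (fun s hs ↦ by rw [h2 s hs, LSeries_charAF ψ hs]) le_rfl hs
    simpa [charAF_apply] using this
  by_cases h : χ = 1
  · subst h
    refine ⟨1, norm_one.le, key (1 : DirichletCharacter ℂ 1) 1 (fun u hu ↦ ?_) fun s hs ↦ ?_⟩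
    · rw [sum_congr rfl fun n hn ↦ (charAF_apply (1 : DirichletCharacter ℂ 1)
        (by have := (mem_Icc.1 hn).1; omega)).trans
          (by rw [Subsingleton.elim ((n : ℕ) : ZMod 1) 1, map_one] : _ = (1 : ℂ)), sum_const,
        Nat.card_Icc, Nat.add_sub_cancel, nsmul_eq_mul, mul_one, one_mul,
        ← Complex.ofReal_natCast, ← Complex.ofReal_sub, Complex.norm_real, Real.norm_eq_abs]
      exact (abs_le.2 ⟨by linarith [Nat.lt_floor_add_one u], by
        linarith [Nat.floor_le (by linarith : 0 ≤ u)]⟩).trans hK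
    · rw [regL_one_apply (by rintro rfl; simp at hs), LFunction_modOne_eq]
  · exact ⟨0, by simp, key χ 0 (fun u _ ↦ by simpa [pvBound] using norm_sum_charAF_le h ⌊u⌋₊)
      fun s _ ↦ regL_apply h s⟩

theorem norm_LSeries_le {f : ℕ → ℂ} (hf : ∀ n, ‖f n‖ ≤ 1) {s : ℂ} (hs : 1 < s.re)
    (hs2 : s.re ≤ 2) : (s.re - 1) * ‖LSeries f s‖ ≤ 6 := by
  have hσ : 1 < ((s.re : ℝ) : ℂ).re := by simpa
  have hsum := (LSeriesSummable_one_iff.2 hσ).norm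
  have h1 : ∀ n, ‖LSeries.term f s n‖ ≤ ‖LSeries.term 1 (s.re : ℂ) n‖ := fun n ↦ by
    rcases eq_or_ne n 0 with rfl | hn
    · simp
    · rw [LSeries.norm_term_eq, LSeries.norm_term_eq, if_neg hn, if_neg hn, Complex.ofReal_re]
      simpa using div_le_div_of_nonneg_right (hf n) (by positivity)
  have h2 : ‖LSeries f s‖ ≤ ‖riemannZeta (s.re : ℂ)‖ := by
    refine (tsum_of_norm_bounded hsum.hasSum h1).trans (le_of_eq ?_)
    rw [← LSeries_one_eq_riemannZeta hσ, LSeries]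
    have : ∀ n, LSeries.term 1 (s.re : ℂ) n = ((‖LSeries.term 1 (s.re : ℂ) n‖ : ℝ) : ℂ) := fun n ↦ by
      rcases eq_or_ne n 0 with rfl | hn
      · simp
      · rw [LSeries.norm_term_eq, if_neg hn, LSeries.term_of_ne_zero hn]
        simp [Complex.ofReal_cpow]
    rw [tsum_congr this, ← Complex.ofReal_tsum, Complex.norm_real, Real.norm_of_nonneg
      (tsum_nonneg fun _ ↦ norm_nonneg _)]
  have h3 := norm_regL_le (1 : DirichletCharacter ℂ 1) (s := (s.re : ℂ)) (by linarith)
  rw [regL_one_apply (by intro h; rw [h] at hσ; simp at hσ), norm_mul, ← Complex.ofReal_one,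
    ← Complex.ofReal_sub, Complex.norm_real, Complex.norm_real, Complex.ofReal_re,
    Real.norm_of_nonneg (by linarith), Real.norm_of_nonneg (by linarith),
    div_self (by linarith : s.re ≠ 0)] at h3
  have h4 : pvBound 1 = 2 := by simp [pvBound]
  rw [h4] at h3
  have := mul_le_mul_of_nonneg_left h2 (by linarith : 0 ≤ s.re - 1)
  linarith

theorem le_norm_regL (χ : DirichletCharacter ℂ q) {s : ℂ} (hs : 1 < s.re) (hs2 : s.re ≤ 2) :
    (s.re - 1) * ‖s - 1‖ ≤ 6 * ‖regL χ s‖ := by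
  have key : ∀ {N : ℕ} [NeZero N] (ψ : DirichletCharacter ℂ N),
      s.re - 1 ≤ 6 * ‖ψ.LFunction s‖ := by
    intro N _ ψ
    have h1 := LSeries.mul_mu_eq_one ψ hs
    rw [← LFunction_eq_LSeries ψ hs] at h1
    have h2 := norm_LSeries_le (f := (fun n : ℕ ↦ ψ n) * fun n : ℕ ↦ ((μ n : ℤ) : ℂ)) (fun n ↦ by
      rw [Pi.mul_apply, norm_mul]
      refine mul_le_one₀ (ψ.norm_le_one _) (norm_nonneg _) ?_
      rw [Complex.norm_intCast]
      exact_mod_cast ArithmeticFunction.abs_moebius_le_one) hs hs2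
    have h3 := congr_arg norm h1
    rw [norm_mul, norm_one] at h3
    have := mul_le_mul_of_nonneg_right h2 (norm_nonneg (ψ.LFunction s))
    calc s.re - 1 = (s.re - 1) * (‖ψ.LFunction s‖ * ‖LSeries _ s‖) := by rw [h3, mul_one]
      _ ≤ _ := by linarith
  have hs1 : s ≠ 1 := by rintro rfl; simp at hs
  have hn := norm_nonneg (s - 1)
  by_cases h : χ = 1
  · subst h
    have := mul_le_mul_of_nonneg_right (key (1 : DirichletCharacter ℂ 1)) hn
    rw [regL_one_apply hs1, norm_mul]
    rw [LFunction_modOne_eq] at this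
    linarith
  · rw [regL_apply h, norm_mul]
    linarith [mul_le_mul_of_nonneg_right (key χ) hn]

end

section
open scoped LSeries.notation ArithmeticFunction.vonMangoldt
open Finset Metric DirichletCharacter

variable {q : ℕ} [NeZero q] {χ : DirichletCharacter ℂ q}

theorem re_LSeries_vonMangoldt_le {N : ℕ} [NeZero N] (ψ : DirichletCharacter ℂ N)
    (h : ∀ s : ℂ, 1 < s.re → regL χ s = (s - 1) * ψ.LFunction s) {b M : ℝ} (hb : 0 < b)
    (hb1 : b ≤ 1 / 2) (hM : 42 * pvBound q ≤ b ^ 2 * Real.exp M) (S : Finset ℂ)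
    (hS : ∀ z ∈ S, regL χ z = 0 ∧ ‖z - (1 + b : ℝ)‖ ≤ 1 / 6) :
    (L (fun n ↦ ψ n * (Λ n : ℂ)) (1 + b : ℝ)).re ≤
      1 / b + 24 * (M + 1) - ∑ z ∈ S, (((1 + b : ℝ) - z)⁻¹).re := by
  set c : ℂ := ((1 + b : ℝ) : ℂ) with hc
  have hK := one_le_pvBound (q := q)
  have hcr : c.re = 1 + b := Complex.ofReal_re _
  have hc1 : 1 < c.re := by linarith
  have hcb : c - 1 = b := by rw [hc]; push_cast; ring
  have hlow := le_norm_regL χ hc1 (by linarith)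
  rw [hcb, Complex.norm_real, Real.norm_of_nonneg hb.le, hcr] at hlow
  have hcn : 0 < ‖regL χ c‖ := by nlinarith
  obtain ⟨n, hn⟩ := exists_nat_gt (M / Real.log 2)
  rw [div_lt_iff₀ (Real.log_pos one_lt_two)] at hn
  have hz : ∀ z, regL χ z = 0 → z.re < c.re := by
    intro z hz
    by_contra! hre
    have h1 : 1 < z.re := by linarith
    rw [h z h1, mul_eq_zero, sub_eq_zero] at hz
    rcases hz with rfl | hz
    · simp at h1
    · exact LFunction_ne_zero_of_one_le_re ψ (.inr (by rintro rfl; simp at h1)) h1.le hz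
  have hbd : ∀ z ∈ closedBall c (1 / 2), ‖regL χ z‖ ≤ Real.exp M * ‖regL χ c‖ := by
    intro z hz
    rw [mem_closedBall, dist_eq_norm] at hz
    have h1 := (abs_le.1 ((Complex.abs_re_le_norm _).trans hz)).1
    rw [Complex.sub_re, hcr] at h1
    have h2 : ‖z - 1‖ ≤ 1 := by
      have := norm_add_le (z - c) (c - 1)
      rw [sub_add_sub_cancel, hcb, Complex.norm_real, Real.norm_of_nonneg hb.le] at this
      linarith
    have h3 : ‖z‖ ≤ 2 := by
      have := norm_add_le (z - 1) 1
      rw [sub_add_cancel, norm_one] at this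
      linarith
    have h4 : ‖z‖ / z.re ≤ 4 := by rw [div_le_iff₀ (by linarith)]; linarith
    have h5 : 1 + pvBound q * (1 + ‖z‖ / z.re) ≤ 6 * pvBound q := by nlinarith
    calc ‖regL χ z‖ ≤ 1 + ‖z - 1‖ * (1 + pvBound q * (1 + ‖z‖ / z.re)) :=
          norm_regL_le χ (by linarith)
      _ ≤ 1 + 1 * (6 * pvBound q) := by
          have : 0 ≤ ‖z‖ / z.re := div_nonneg (norm_nonneg _) (by linarith)
          gcongr
      _ ≤ (b ^ 2 * Real.exp M) / 6 := by linarith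
      _ = Real.exp M * ((1 + b - 1) * b / 6) := by ring
      _ ≤ _ := mul_le_mul_of_nonneg_left (by linarith) (Real.exp_pos M).le
  have key := neg_re_deriv_div_le (by norm_num : (0 : ℝ) < 1 / 2) n (differentiable_regL χ)
    (norm_pos_iff.1 hcn) hbd hz hn S fun z hz ↦ ⟨(hS z hz).1, by
      rw [mem_closedBall, dist_eq_norm]; exact (hS z hz).2.trans (by norm_num)⟩
  have hc0 : c - 1 ≠ 0 := by rw [hcb]; exact_mod_cast hb.ne'
  have hL0 : ψ.LFunction c ≠ 0 := fun h0 ↦ hcn.ne' (by rw [h c hc1, h0, mul_zero, norm_zero])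
  have hder : deriv (regL χ) c / regL χ c = (c - 1)⁻¹ + deriv ψ.LFunction c / ψ.LFunction c := by
    have h1 : HasDerivAt (fun s ↦ (s - 1) * ψ.LFunction s)
        (1 * ψ.LFunction c + (c - 1) * deriv ψ.LFunction c) c :=
      ((hasDerivAt_id c).sub_const 1).mul
        (differentiableAt_LFunction ψ c (.inl (sub_ne_zero.1 hc0))).hasDerivAt
    have h2 : regL χ =ᶠ[nhds c] fun s ↦ (s - 1) * ψ.LFunction s :=
      Filter.eventuallyEq_of_mem ((isOpen_lt continuous_const Complex.continuous_re).mem_nhds hc1) h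
    rw [h2.deriv_eq, h1.deriv, h c hc1]
    field_simp
  have hΛ : L (fun n ↦ ψ n * (Λ n : ℂ)) c = -deriv ψ.LFunction c / ψ.LFunction c := by
    rw [LFunction_eq_LSeries ψ hc1, deriv_LFunction_eq_deriv_LSeries ψ hc1]
    exact LSeries_twist_vonMangoldt_eq ψ hc1
  rw [hder, Complex.add_re, hcb, ← Complex.ofReal_inv, Complex.ofReal_re] at key
  rw [hΛ, neg_div, Complex.neg_re, one_div]
  linarith

theorem hasSum_re_LSeries_vonMangoldt {N : ℕ} [NeZero N] (ψ : DirichletCharacter ℂ N) {σ : ℝ}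
    (hσ : 1 < σ) : HasSum (fun n : ℕ ↦ (ψ n).re * (Λ n * (n : ℝ) ^ (-σ)))
      (L (fun n ↦ ψ n * (Λ n : ℂ)) σ).re := by
  convert! (LSeriesSummable_twist_vonMangoldt ψ
    (s := (σ : ℂ)) (by simpa)).hasSum.mapL Complex.reCLM using 2 with n
  rcases eq_or_ne n 0 with rfl | hn
  · simp
  rw [LSeries.term_of_ne_zero hn, div_eq_mul_inv, ← Complex.cpow_neg, ← Complex.ofReal_neg,
    ← Complex.ofReal_natCast, ← Complex.ofReal_cpow (Nat.cast_nonneg n), Pi.mul_apply, mul_assoc,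
    ← Complex.ofReal_mul]
  exact (Complex.re_mul_ofReal _ _).symm

/-- A real zero close to `1` belongs to a real character and is the only zero close to `1`. -/
theorem exceptional_zero : ∃ q₀ : ℝ, 1 < q₀ ∧ ∀ (q : ℕ) [NeZero q], q₀ ≤ q →
    ∀ χ : DirichletCharacter ℂ q, χ ≠ 1 → ∀ lam : ℝ, 0 < lam → lam ≤ 1 / 20000 →
    χ.LFunction ((1 - lam / Real.log q : ℝ) : ℂ) = 0 →
    χ ^ 2 = 1 ∧ ∀ ρ, χ.LFunction ρ = 0 → ‖ρ - 1‖ < 1 / 20000 / Real.log q →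
      ρ = ((1 - lam / Real.log q : ℝ) : ℂ) := by
  obtain ⟨q₀, hq₀, hlarge⟩ := exists_forall_le_rpow (κ := 1) one_pos 336000000
  refine ⟨max q₀ 3, lt_max_of_lt_left hq₀, fun q _ hq χ hχ lam hl hl1 h0 ↦ ?_⟩
  obtain ⟨hA, hlog⟩ := hlarge q ((le_max_left _ _).trans hq)
  rw [Real.rpow_one] at hA hlog
  set ℓ := Real.log q with hℓ
  have hℓ1 : 1 ≤ ℓ := by
    rw [hℓ, Real.le_log_iff_exp_le (by linarith)]
    linarith [Real.exp_one_lt_d9]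
  set b := 1 / 2000 / ℓ with hb
  have hb0 : 0 < b := by positivity
  have hb1 : b ≤ 1 / 2000 := div_le_self (by norm_num) hℓ1
  have hbℓ : b * ℓ = 1 / 2000 := div_mul_cancel₀ _ (by linarith)
  have hM : 42 * pvBound q ≤ b ^ 2 * Real.exp (5 * ℓ) := by
    have h1 : Real.exp (5 * ℓ) = (q : ℝ) ^ 5 := by
      rw [mul_comm, hℓ, ← Real.rpow_def_of_pos (by linarith)]; norm_cast
    have h2 : √(q : ℝ) ≤ q := Real.sqrt_le_iff.2 ⟨by linarith, by nlinarith⟩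
    have h3 : ℓ ^ 2 * pvBound q ≤ q ^ 2 * (2 * q * q) := by
      rw [pvBound]; gcongr; linarith
    have h4 : b ^ 2 = 1 / 4000000 / ℓ ^ 2 := by rw [hb]; ring
    rw [h1, h4, div_mul_eq_mul_div, le_div_iff₀ (by positivity)]
    have h5 : 0 ≤ (q : ℝ) ^ 4 := by positivity
    nlinarith
  clear_value ℓ
  have hΛ1 := re_LSeries_vonMangoldt_le (χ := (1 : DirichletCharacter ℂ q))
    (1 : DirichletCharacter ℂ 1) (fun s hs ↦ by
      rw [regL_one_apply (by rintro rfl; simp at hs), LFunction_modOne_eq]) hb0 (by linarith) hM ∅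
    (by simp)
  rw [sum_empty, sub_zero] at hΛ1
  have hΛ : ∀ ψ : DirichletCharacter ℂ q, ψ ≠ 1 → ∀ S : Finset ℂ, (∀ z ∈ S, ψ.LFunction z = 0 ∧
      ‖z - 1‖ ≤ 1 / 10) → (L (fun n ↦ ψ n * (Λ n : ℂ)) (1 + b : ℝ)).re ≤
      24 * (5 * ℓ + 1) - ∑ z ∈ S, (((1 + b : ℝ) - z)⁻¹).re := by
    intro ψ hψ S hS
    have h1 : (1 : ℂ) ∉ S := fun h ↦ LFunction_apply_one_ne_zero hψ (hS 1 h).1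
    have := re_LSeries_vonMangoldt_le ψ (fun s _ ↦ regL_apply hψ s) hb0 (by linarith) hM
      (insert 1 S) fun z hz ↦ ?_
    · rw [sum_insert h1, show (((1 + b : ℝ) : ℂ) - 1)⁻¹ = ((1 / b : ℝ) : ℂ) by
        push_cast; rw [add_sub_cancel_left, one_div], Complex.ofReal_re] at this
      linarith
    · have h3 : ∀ z : ℂ, ‖z - 1‖ ≤ 1 / 10 → ‖z - (1 + b : ℝ)‖ ≤ 1 / 6 := fun z hz ↦ by
        have := norm_sub_le (z - 1) b
        rw [Complex.norm_real, Real.norm_of_nonneg hb0.le] at this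
        push_cast
        rw [← sub_sub]
        linarith
      rw [regL_apply hψ]
      rcases mem_insert.1 hz with rfl | hz
      · exact ⟨by simp, h3 1 (by simp)⟩
      · exact ⟨by rw [(hS z hz).1, mul_zero], h3 z (hS z hz).2⟩
  set β : ℂ := ((1 - lam / ℓ : ℝ) : ℂ) with hβ
  have hlℓ : lam / ℓ ≤ b / 10 := by
    rw [div_le_iff₀ (by linarith)]; linarith
  have hlℓ0 : 0 < lam / ℓ := by positivity
  have hβn : ‖β - 1‖ ≤ 1 / 10 := by
    rw [hβ, Complex.ofReal_sub, Complex.ofReal_one, sub_sub_cancel_left, norm_neg,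
      Complex.norm_real, Real.norm_of_nonneg hlℓ0.le]
    linarith
  have hβi : 1800 * ℓ ≤ (((1 + b : ℝ) - β)⁻¹).re := by
    have h1 : ℓ * (lam / ℓ) = lam := mul_div_cancel₀ _ (by linarith)
    rw [hβ, ← Complex.ofReal_sub, ← Complex.ofReal_inv, Complex.ofReal_re, ← one_div,
      le_div_iff₀ (by linarith)]
    linarith
  have hb2 : 24 * (5 * ℓ + 1) ≤ 144 * ℓ := by linarith
  have hbi : 1 / b = 2000 * ℓ := by rw [hb]; field_simp
  have hσ : 1 < 1 + b := by linarith
  have hone : ∀ n : ℕ, ((1 : DirichletCharacter ℂ 1) n) = 1 := fun n ↦ by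
    rw [Subsingleton.elim ((n : ℕ) : ZMod 1) 1, map_one]
  have hs1 := hasSum_re_LSeries_vonMangoldt (1 : DirichletCharacter ℂ 1) hσ
  have hsχ := hasSum_re_LSeries_vonMangoldt χ hσ
  have hw : ∀ n : ℕ, 0 ≤ Λ n * (n : ℝ) ^ (-(1 + b)) := fun n ↦
    mul_nonneg ArithmeticFunction.vonMangoldt_nonneg (by positivity)
  refine ⟨?_, fun ρ hρ hρn ↦ ?_⟩
  · by_contra hχ2
    have hA := hΛ χ hχ {β} (by rintro z hz; rw [mem_singleton.1 hz]; exact ⟨h0, hβn⟩)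
    have hB := hΛ (χ ^ 2) hχ2 ∅ (by simp)
    have := (((hs1.mul_left 3).add (hsχ.mul_left 4)).add
      (hasSum_re_LSeries_vonMangoldt (χ ^ 2) hσ)).nonneg fun n ↦ ?_
    · rw [sum_singleton] at hA
      rw [sum_empty] at hB
      rw [hbi] at hΛ1
      linarith
    · have h1 : 0 ≤ 3 + 4 * (χ n).re + ((χ ^ 2) n).re := by
        by_cases hu : IsUnit (n : ZMod q)
        · have h2 : ‖χ n‖ ^ 2 = 1 := by rw [show χ n = χ hu.unit from rfl, DirichletCharacter.unit_norm_eq_one, one_pow]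
          rw [Complex.sq_norm, Complex.normSq_apply] at h2
          rw [MulChar.pow_apply' χ two_ne_zero, sq, Complex.mul_re]
          nlinarith [sq_nonneg ((χ n).re + 1)]
        · simp [MulChar.map_nonunit _ hu]
      rw [hone, Complex.one_re]
      linarith [mul_nonneg h1 (hw n)]
  · by_contra hne
    have hA := hΛ χ hχ {β, ρ} (by
      have h1 : 1 / 20000 / ℓ ≤ 1 / 10 := (div_le_self (by norm_num) hℓ1).trans (by norm_num)
      rintro z hz
      rcases mem_insert.1 hz with rfl | hz
      · exact ⟨h0, hβn⟩
      · rw [mem_singleton.1 hz]; exact ⟨hρ, hρn.le.trans h1⟩)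
    have := (hs1.add hsχ).nonneg fun n ↦ ?_
    · rw [sum_pair (Ne.symm hne)] at hA
      rw [hbi] at hΛ1
      have : 1400 * ℓ ≤ (((1 + b : ℝ) - ρ)⁻¹).re := by
        rw [show 1 / 20000 / ℓ = b / 10 by rw [hb]; ring] at hρn
        set w := ((1 + b : ℝ) : ℂ) - ρ with hw
        have h2 : ‖w - b‖ < b / 10 := by
          rwa [hw, show ((1 + b : ℝ) : ℂ) - ρ - b = -(ρ - 1) by push_cast; ring, norm_neg]
        have h3 := (abs_lt.1 ((Complex.abs_re_le_norm _).trans_lt h2)).1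
        rw [Complex.sub_re, Complex.ofReal_re] at h3
        have h4 := norm_add_le (w - b) b
        rw [sub_add_cancel, Complex.norm_real, Real.norm_of_nonneg hb0.le] at h4
        have h5 : ‖w‖ ^ 2 ≤ (1.1 * b) ^ 2 := by gcongr; linarith
        have h6 : 0 < ‖w‖ ^ 2 := by
          have : w ≠ 0 := by rintro h; rw [h, Complex.zero_re] at h3; linarith
          positivity
        rw [Complex.inv_re, ← Complex.sq_norm, le_div_iff₀ h6]
        have h7 := mul_le_mul_of_nonneg_left h5 (by linarith : 0 ≤ 1400 * ℓ)
        have h8 : 1400 * ℓ * (1.1 * b) ^ 2 = 1694 * (b * ℓ) * b := by ring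
        rw [h8, hbℓ] at h7
        linarith
      linarith
    · have h1 : -1 ≤ (χ n).re :=
        (abs_le.1 ((Complex.abs_re_le_norm _).trans (χ.norm_le_one n))).1
      rw [hone, Complex.one_re, ← add_mul]
      exact mul_nonneg (by linarith) (hw n)

end

section
open Finset Metric DirichletCharacter

/-- **Siegel's theorem**, for zeros close to `1`. -/
theorem siegel {ε : ℝ} (hε : 0 < ε) : ∃ q₀ : ℝ, 1 < q₀ ∧ ∀ (q : ℕ) [NeZero q], q₀ ≤ q →
    ∀ χ : DirichletCharacter ℂ q, χ ^ 2 = 1 → χ ≠ 1 → ∀ lam : ℝ, 0 < lam → lam ≤ 1 / 40 →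
      χ.LFunction ((1 - lam / Real.log q : ℝ) : ℂ) = 0 → (q : ℝ) ^ (-ε) ≤ lam := by
  obtain ⟨C, hC, q₁, hq₁, hDH⟩ := deuring_heilbronn (ε := 1 / 100) (by norm_num) le_rfl one_pos
  set m := min ε (1 / 500) / 10 with hm
  have hm0 : 0 < m := by positivity
  have hmε : 10 * m ≤ ε := by rw [hm]; linarith [min_le_left ε (1 / 500)]
  have hm1 : 10 * m ≤ 1 / 500 := by rw [hm]; linarith [min_le_right ε (1 / 500)]
  obtain ⟨M₀, hM₀, hM⟩ := exists_forall_le_rpow hm0 (32 * C)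
  by_cases hex : ∃ (r : ℕ) (_ : NeZero r) (χ' : DirichletCharacter ℂ r) (β : ℝ),
      χ' ^ 2 = 1 ∧ χ' ≠ 1 ∧ 1 - m ≤ β ∧ β < 1 ∧ χ'.LFunction β = 0
  · obtain ⟨r, _, χ', β, -, hχ'1, hβ, hβ1, hβ0⟩ := hex
    obtain ⟨δ, hδ, hδ0⟩ := Metric.eventually_nhds_iff.1
      ((differentiable_LFunction hχ'1).continuous.continuousAt.eventually_ne
        (LFunction_apply_one_ne_zero hχ'1))
    obtain ⟨M₁, hM₁, hM'⟩ := exists_forall_le_rpow hε (1 / δ)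
    refine ⟨max (max q₁ M₀) (max (max M₁ r) 3), lt_max_of_lt_left (lt_max_of_lt_left hq₁),
      fun q _ hq χ hχ hχ1 lam hl hl1 h0 ↦ ?_⟩
    simp only [max_le_iff] at hq
    obtain ⟨⟨hqq, hqM⟩, ⟨hqM₁, hqr⟩, hq3⟩ := hq
    set Q : ℝ := (q : ℝ) with hQ
    have hQ0 : 0 < Q := by linarith
    have hL : 1 ≤ Real.log Q := by
      rw [Real.le_log_iff_exp_le hQ0]; linarith [Real.exp_one_lt_d9]
    have hr1 : (1 : ℝ) ≤ r := by exact_mod_cast NeZero.one_le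
    have hN : ((q * r : ℕ) : ℝ) = Q * r := by push_cast; rfl
    have hNQ : Q * r ≤ Q ^ (2 : ℝ) := by rw [Real.rpow_two, sq]; gcongr
    have hQN : Q ≤ Q * r := le_mul_of_one_le_right hQ0.le hr1
    have hlN : 1 ≤ Real.log (Q * r) := hL.trans (Real.log_le_log hQ0 hQN)
    set lam' := lam * Real.log (Q * r) / Real.log Q with hlam'
    have hl2 : lam' ≤ 2 * lam := by
      have := Real.log_le_log (by linarith) hNQ
      rw [Real.log_rpow hQ0] at this
      rw [hlam', div_le_iff₀ (by linarith)]
      nlinarith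
    have he : lam' / Real.log (Q * r) = lam / Real.log Q := by
      rw [hlam']; field_simp
    have hb1 : lam / Real.log Q ≤ 1 / 40 := (div_le_self hl.le hL).trans hl1
    have hb0 : 0 < lam / Real.log Q := by positivity
    have hne : ((1 - lam / Real.log Q : ℝ) : ℂ) ≠ 1 := by
      rw [Ne, Complex.ofReal_eq_one]; linarith
    set ψ := changeLevel (dvd_mul_right q r) χ with hψ
    have hψ1 : ψ ≠ 1 := by rwa [hψ, Ne, changeLevel_eq_one_iff]
    have hψ0 : ψ.LFunction ((1 - lam / Real.log Q : ℝ) : ℂ) = 0 :=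
      (LFunction_changeLevel_eq_zero_iff _ χ hne (by rw [Complex.ofReal_re]; linarith)).2 h0
    by_cases hψψ : changeLevel (dvd_mul_left r q) χ' = ψ
    · rw [← hψψ, LFunction_changeLevel_eq_zero_iff _ χ' hne
        (by rw [Complex.ofReal_re]; linarith)] at hψ0
      have h1 : δ ≤ lam / Real.log Q := by
        by_contra! h
        refine hδ0 (y := ((1 - lam / Real.log Q : ℝ) : ℂ)) ?_ hψ0
        rwa [dist_eq_norm, Complex.ofReal_sub, Complex.ofReal_one, sub_sub_cancel_left, norm_neg,
          Complex.norm_real, Real.norm_of_nonneg hb0.le]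
      rw [Real.rpow_neg hQ0.le]
      have h2 := inv_anti₀ (by positivity) (hM' Q hqM₁).1
      rw [one_div, inv_inv] at h2
      exact h2.trans (h1.trans (div_le_self hl.le hL))
    · have h := hDH (q * r) (hN ▸ hqq.trans hQN) ψ (by rw [hψ, ← map_pow, hχ, map_one]) hψ1 lam'
        (by positivity) (by linarith) (by rw [hN, he]; exact hψ0) (changeLevel (dvd_mul_left r q) χ') β
        ((LFunction_changeLevel_eq_zero_iff _ χ' (by rw [Ne, Complex.ofReal_eq_one]; linarith)
          (by rw [Complex.ofReal_re]; linarith)).2 hβ0) (by rw [Complex.ofReal_re]; linarith)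
        (by rw [Complex.ofReal_re]; linarith) (by rw [Complex.ofReal_im, abs_zero]; positivity)
        (.inl ⟨by rwa [Ne, changeLevel_eq_one_iff], hψψ⟩)
      rw [Complex.ofReal_im, abs_zero, add_zero, Complex.ofReal_re, hN] at h
      have h1 : ((Q * r) ^ (2 + 20 * (1 / 100) : ℝ) * (2 : ℝ) ^ (3 : ℝ)) ^ (1 - β) ≤
          8 * Q ^ (5 * m) := by
        have h2 : 1 ≤ (Q * r) ^ (2 + 20 * (1 / 100) : ℝ) := Real.one_le_rpow (by linarith) (by norm_num)
        have h3 : (2 : ℝ) ^ (3 : ℝ) = 8 := by norm_num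
        rw [h3, Real.mul_rpow (by linarith) (by norm_num), mul_comm]
        refine mul_le_mul (Real.rpow_le_self_of_one_le (by norm_num) (by linarith)) ?_
          (by positivity) (by norm_num)
        calc ((Q * r) ^ (2 + 20 * (1 / 100) : ℝ)) ^ (1 - β) ≤
            ((Q ^ (2 : ℝ)) ^ (2 + 20 * (1 / 100) : ℝ)) ^ (1 - β) := by gcongr
          _ = Q ^ (2 * (2 + 20 * (1 / 100)) * (1 - β)) := by
            rw [← Real.rpow_mul hQ0.le, ← Real.rpow_mul hQ0.le]
          _ ≤ _ := Real.rpow_le_rpow_of_exponent_le (by linarith) (by linarith)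
      have h2 : (Q * r) ^ (-(1 / 100 / 5) : ℝ) ≤ Q ^ (-(10 * m)) :=
        (Real.rpow_le_rpow_of_nonpos hQ0 hQN (by norm_num)).trans
          (Real.rpow_le_rpow_of_exponent_le (by linarith) (by linarith))
      have h3 : 1 ≤ C * (2 * lam + Q ^ (-(10 * m))) * (8 * Q ^ (5 * m)) :=
        h.trans (by gcongr)
      have e1 : Q ^ (-(10 * m)) * Q ^ (5 * m) = Q ^ (-(5 * m)) := by
        rw [← Real.rpow_add hQ0]; congr 1; ring
      have h4 : 32 * C * Q ^ (-(5 * m)) ≤ 1 := by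
        have := mul_le_mul_of_nonneg_right (hM Q hqM).1 (by positivity : 0 ≤ Q ^ (-(5 * m)))
        rw [← Real.rpow_add hQ0] at this
        exact this.trans (Real.rpow_le_one_of_one_le_of_nonpos (by linarith) (by linarith))
      have h5 : 1 ≤ 32 * C * lam * Q ^ (5 * m) := by
        have : C * (2 * lam + Q ^ (-(10 * m))) * (8 * Q ^ (5 * m)) =
          16 * C * lam * Q ^ (5 * m) + 8 * C * (Q ^ (-(10 * m)) * Q ^ (5 * m)) := by ring
        rw [this, e1] at h3
        linarith
      have h6 : 1 ≤ lam * Q ^ ε := by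
        calc 1 ≤ 32 * C * lam * Q ^ (5 * m) := h5
          _ = lam * (32 * C * Q ^ (5 * m)) := by ring
          _ ≤ lam * (Q ^ m * Q ^ (5 * m)) := by gcongr; exact (hM Q hqM).1
          _ ≤ lam * Q ^ ε := by
            rw [← Real.rpow_add hQ0]
            gcongr
            · linarith
            · linarith
      rw [Real.rpow_neg hQ0.le, inv_le_iff_one_le_mul₀ (by positivity)]
      exact h6
  · obtain ⟨M₁, hM₁, hM'⟩ := exists_forall_le_rpow hε (1 / m)
    refine ⟨max M₁ 3, lt_max_of_lt_left hM₁, fun q _ hq χ hχ hχ1 lam hl hl1 h0 ↦ ?_⟩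
    rw [max_le_iff] at hq
    have hL : 1 ≤ Real.log q := by
      rw [Real.le_log_iff_exp_le (by linarith)]; linarith [Real.exp_one_lt_d9]
    have h1 : m ≤ lam / Real.log q := by
      by_contra! h
      exact hex ⟨q, ‹_›, χ, _, hχ, hχ1, by linarith, by
        linarith [show 0 < lam / Real.log q by positivity], h0⟩
    rw [Real.rpow_neg (by positivity)]
    have h2 := inv_anti₀ (by positivity) (hM' q hq.1).1
    rw [one_div, inv_inv] at h2
    exact h2.trans (h1.trans (div_le_self hl.le hL))

end

section
open Finset

/-- The trivial character has no zero in a fixed punctured neighbourhood of `1`. -/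
theorem exists_le_norm_sub_one_of_trivial : ∃ δ : ℝ, 0 < δ ∧ ∀ (q : ℕ) [NeZero q] (ρ : ℂ),
    (1 : DirichletCharacter ℂ q).LFunction ρ = 0 → 0 < ρ.re → ρ.re < 1 → δ ≤ ‖ρ - 1‖ := by
  have hc := ((differentiable_regL (1 : DirichletCharacter ℂ 1)).continuous.continuousAt
    (x := 1)).eventually_ne (y := 0) (by simp [regL])
  obtain ⟨δ, hδ, h⟩ := Metric.eventually_nhds_iff.mp hc
  refine ⟨δ, hδ, fun q _ ρ hz h0 h1 ↦ ?_⟩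
  have hs : ρ ≠ 1 := by rintro rfl; simp at h1
  by_contra! hlt
  refine h (by rwa [dist_eq_norm]) ?_
  rw [← DirichletCharacter.changeLevel_one (one_dvd q),
    LFunction_changeLevel_eq_zero_iff (one_dvd q) 1 hs h0] at hz
  rw [regL_one_apply hs, ← DirichletCharacter.LFunction_modOne_eq (χ := 1), hz, mul_zero]

/-- Consequences of a Siegel zero: a lower bound for `lam`, isolation of the point `1` from all
other zeros, and repulsion of all other zeros from the line `Re s = 1`. -/
theorem siegel_zero_consequences : ∃ η : ℝ, 0 < η ∧ ∃ C : ℝ, 1 ≤ C ∧ ∃ q₀ : ℝ, 1 < q₀ ∧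
    ∀ (q : ℕ) [NeZero q], q₀ ≤ q → ∀ (χ : DirichletCharacter ℂ q) (lam : ℝ), 0 < lam → lam ≤ η →
      χ.LFunction ((1 - lam / Real.log q : ℝ) : ℂ) = 0 →
      (q : ℝ) ^ (-(1 / 10000) : ℝ) ≤ lam ∧
      ∀ (ψ : DirichletCharacter ℂ q) (ρ : ℂ), ψ.LFunction ρ = 0 → 0 < ρ.re → ρ.re < 1 →
        ¬(ψ = χ ∧ ρ = ((1 - lam / Real.log q : ℝ) : ℂ)) →
        1 / 20000 / Real.log q ≤ ‖ρ - 1‖ ∧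
        (1 - 1 / 500 ≤ ρ.re → |ρ.im| ≤ (q : ℝ) ^ (2 : ℝ) →
          1 ≤ C * lam * ((q : ℝ) ^ (2.04 : ℝ) * (2 + |ρ.im|) ^ (3 : ℝ)) ^ (1 - ρ.re)) := by
  obtain ⟨δ, hδ, hδz⟩ := exists_le_norm_sub_one_of_trivial
  obtain ⟨C, hC, q₁, hq₁, hDH⟩ :=
    deuring_heilbronn (ε := 1 / 500) (c₀ := 1 / 20000) (by norm_num) (by norm_num) (by norm_num)
  obtain ⟨q₂, hq₂, hE⟩ := exceptional_zero
  obtain ⟨q₃, hq₃, hS⟩ := siegel (ε := 1 / 10000) (by norm_num)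
  refine ⟨min (1 / 20000) (min (δ / 2) (1 / (200 * C))), by positivity, 2 * C, by linarith,
    max (max q₁ q₂) (max q₃ (max (Real.exp 1) (Real.exp (1 / δ)))), by simp [hq₁], ?_⟩
  intro q _ hq χ lam hl hlη hz
  simp only [max_le_iff, le_min_iff] at hq hlη
  obtain ⟨⟨hq1, hq2⟩, hq3, hq4, hq5⟩ := hq
  obtain ⟨hl1, hl2, hl3⟩ := hlη
  have hQ : (1 : ℝ) < q := by linarith
  have hQ0 : (0 : ℝ) < q := by linarith
  have hL1 : 1 ≤ Real.log q := (Real.le_log_iff_exp_le hQ0).mpr hq4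
  have hL0 : 0 < Real.log q := by linarith
  have hLδ : 1 / δ ≤ Real.log q := (Real.le_log_iff_exp_le hQ0).mpr hq5
  have hll : lam / Real.log q ≤ lam := div_le_self hl.le hL1
  have hll0 : 0 < lam / Real.log q := by positivity
  have hχ : χ ≠ 1 := by
    rintro rfl
    have := hδz q _ hz (by rw [Complex.ofReal_re]; linarith) (by rw [Complex.ofReal_re]; linarith)
    rw [← Complex.ofReal_one, ← Complex.ofReal_sub, Complex.norm_real, Real.norm_eq_abs,
      show (1 - lam / Real.log q - 1 : ℝ) = -(lam / Real.log q) by ring, abs_neg,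
      abs_of_pos hll0] at this
    linarith
  obtain ⟨hχ2, hEχ⟩ := hE q hq2 χ hχ lam hl hl1 hz
  have hSl := hS q hq3 χ hχ2 hχ lam hl (by linarith) hz
  have hexp : (q : ℝ) ^ (-(1 / 500 / 5) : ℝ) ≤ lam :=
    (Real.rpow_le_rpow_of_exponent_le hQ.le (by norm_num)).trans hSl
  have hDHl : ∀ (ψ : DirichletCharacter ℂ q) (ρ : ℂ), ψ.LFunction ρ = 0 → 1 - 1 / 500 ≤ ρ.re →
      ρ.re ≤ 1 → |ρ.im| ≤ (q : ℝ) ^ (2 : ℝ) →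
      (ψ ≠ 1 ∧ ψ ≠ χ ∨ 1 / 20000 / Real.log q ≤ ‖ρ - 1‖) →
      1 ≤ 2 * C * lam * ((q : ℝ) ^ (2.04 : ℝ) * (2 + |ρ.im|) ^ (3 : ℝ)) ^ (1 - ρ.re) := by
    intro ψ ρ h1 h2 h3 h4 h5
    have h := hDH q hq1 χ hχ2 hχ lam hl (by linarith) hz ψ ρ h1 h2 h3 h4 h5
    rw [show (2 + 20 * (1 / 500) : ℝ) = 2.04 by norm_num] at h
    refine h.trans (mul_le_mul_of_nonneg_right ?_ (by positivity))
    calc C * (lam + (q : ℝ) ^ (-(1 / 500 / 5) : ℝ)) ≤ C * (lam + lam) := by gcongr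
      _ = 2 * C * lam := by ring
  refine ⟨hSl, fun ψ ρ hψ h0 h1 hne ↦ ?_⟩
  suffices hiso : 1 / 20000 / Real.log q ≤ ‖ρ - 1‖ from
    ⟨hiso, fun h2 h3 ↦ hDHl ψ ρ hψ h2 h1.le h3 (Or.inr hiso)⟩
  by_contra! hlt
  have hcL : 1 / 20000 / Real.log q ≤ 1 / 20000 := div_le_self (by norm_num) hL1
  by_cases hψ1 : ψ = 1
  · subst hψ1
    have h2 := hδz q ρ hψ h0 h1
    have h3 : 1 / Real.log q ≤ δ := by rwa [one_div_le hL0 hδ]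
    have h4 : 1 / 20000 / Real.log q = 1 / 20000 * (1 / Real.log q) := by ring
    have h5 : 0 < 1 / Real.log q := by positivity
    linarith
  by_cases hψχ : ψ = χ
  · subst hψχ
    exact hne ⟨rfl, hEχ ρ hψ hlt⟩
  have hre : 1 - ρ.re ≤ 1 / 20000 / Real.log q := by
    have := (Complex.abs_re_le_norm (ρ - 1)).trans hlt.le
    rw [Complex.sub_re, Complex.one_re] at this
    linarith [neg_abs_le (ρ.re - 1)]
  have him : |ρ.im| ≤ 1 := by
    have := (Complex.abs_im_le_norm (ρ - 1)).trans hlt.le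
    rw [Complex.sub_im, Complex.one_im, sub_zero] at this
    linarith
  have h := hDHl ψ ρ hψ (by linarith) h1.le (him.trans (Real.one_le_rpow hQ.le (by norm_num)))
    (Or.inl ⟨hψ1, hψχ⟩)
  have h2 : ((q : ℝ) ^ (2.04 : ℝ) * (2 + |ρ.im|) ^ (3 : ℝ)) ^ (1 - ρ.re) ≤ 3 * 27 := by
    rw [Real.mul_rpow (by positivity) (by positivity), ← Real.rpow_mul hQ0.le]
    have h3 : (q : ℝ) ^ (2.04 * (1 - ρ.re)) ≤ 3 := by
      rw [Real.rpow_def_of_pos hQ0]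
      refine (Real.exp_le_exp.mpr ?_).trans (by linarith [Real.exp_one_lt_d9] : Real.exp 1 ≤ 3)
      have := mul_le_mul_of_nonneg_left hre hL0.le
      rw [mul_div_cancel₀ _ hL0.ne'] at this
      linarith
    have h4 : ((2 + |ρ.im|) ^ (3 : ℝ)) ^ (1 - ρ.re) ≤ 27 := by
      have h5 : (2 + |ρ.im|) ^ (3 : ℝ) ≤ 27 := by
        calc (2 + |ρ.im|) ^ (3 : ℝ) ≤ 3 ^ (3 : ℝ) := by gcongr; linarith
          _ = 27 := by norm_num
      refine (Real.rpow_le_self_of_one_le ?_ (by linarith)).trans h5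
      exact Real.one_le_rpow (by linarith [abs_nonneg ρ.im]) (by norm_num)
    exact mul_le_mul h3 h4 (by positivity) (by norm_num)
  have h3 : C * lam ≤ 1 / 200 := by
    calc C * lam ≤ C * (1 / (200 * C)) := by gcongr
      _ = 1 / 200 := by field_simp
  have h4 := mul_le_mul_of_nonneg_left h2 (show 0 ≤ 2 * C * lam by positivity)
  linarith

end

section
open Finset DirichletCharacter Complex

theorem differentiableAt_gammaFactor {N : ℕ} (χ : DirichletCharacter ℂ N) {s : ℂ} (hs : 0 < s.re) :
    DifferentiableAt ℂ (gammaFactor χ) s ∧ gammaFactor χ s ≠ 0 := by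
  have h : ∀ z : ℂ, 0 < z.re → DifferentiableAt ℂ Gammaℝ z := fun z hz ↦ by
    simpa [Function.comp_def] using
      (differentiable_Gammaℝ_inv z).fun_inv (inv_ne_zero (Gammaℝ_ne_zero_of_re_pos hz))
  have hs1 : 0 < (s + 1).re := by rw [add_re, one_re]; linarith
  rcases χ.even_or_odd with hχ | hχ
  · rw [funext hχ.gammaFactor_def]
    exact ⟨h s hs, Gammaℝ_ne_zero_of_re_pos hs⟩
  · rw [funext hχ.gammaFactor_def]
    exact ⟨DifferentiableAt.comp s (h _ hs1) (by fun_prop : DifferentiableAt ℂ (· + 1) s), Gammaℝ_ne_zero_of_re_pos hs1⟩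

variable {q : ℕ} [NeZero q]

theorem analyticAt_LFunction (χ : DirichletCharacter ℂ q) {s : ℂ} (hs : s ≠ 1) :
    AnalyticAt ℂ χ.LFunction s :=
  (DifferentiableOn.analyticAt (s := {1}ᶜ) (fun z hz ↦
    (χ.differentiableAt_LFunction z (.inl hz)).differentiableWithinAt)
    (isOpen_compl_singleton.mem_nhds hs))

/-- The asymmetric functional equation, up to an analytic factor. -/
theorem analyticOrderAt_one_sub_le (χ : DirichletCharacter ℂ q) {ρ : ℂ} (h0 : 0 < ρ.re)
    (h1 : ρ.re < 1) :
    analyticOrderAt χ⁻¹.LFunction (1 - ρ) ≤ analyticOrderAt χ.LFunction ρ := by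
  have hM := χ.conductor_dvd_level
  have : NeZero χ.conductor := ⟨fun h ↦ NeZero.ne q (by rwa [h, zero_dvd_iff] at hM)⟩
  set ψ := χ.primitiveCharacter with hψ
  have hχ : changeLevel hM ψ = χ := χ.changeLevel_primitiveCharacter
  have hχi : changeLevel hM ψ⁻¹ = χ⁻¹ := by rw [map_inv, hχ]
  let E (φ : DirichletCharacter ℂ χ.conductor) (s : ℂ) :=
    ∏ p ∈ q.primeFactors, (1 - φ p * (p : ℂ) ^ (-s))
  have hE (φ) : Differentiable ℂ (E φ) := by
    refine Differentiable.fun_finsetProd fun p hp ↦ ?_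
    have : NeZero p := ⟨(Nat.prime_of_mem_primeFactors hp).ne_zero⟩
    fun_prop (disch := simp [NeZero.ne])
  let u (s : ℂ) := E ψ s / gammaFactor ψ s * ((χ.conductor : ℂ) ^ (1 - s - 1 / 2) * rootNumber ψ) *
    (gammaFactor ψ⁻¹ (1 - s) / E ψ⁻¹ (1 - s))
  let U : Set ℂ := {s | 0 < s.re ∧ s.re < 1}
  have hU : IsOpen U := (isOpen_lt continuous_const continuous_re).inter
    (isOpen_lt continuous_re continuous_const)
  have hre (s : ℂ) (hs : s ∈ U) : 0 < (1 - s).re := by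
    rw [sub_re, one_re]; linarith [hs.2]
  have hs1 (s : ℂ) (hs : s ∈ U) : s ≠ 1 ∧ 1 - s ≠ 1 ∧ s ≠ 0 ∧ 1 - s ≠ 0 := by
    obtain ⟨h2, h3⟩ := hs
    refine ⟨?_, ?_, ?_, ?_⟩ <;> intro h <;> have := congrArg re h <;>
      simp only [sub_re, one_re, zero_re] at this <;> linarith
  have hu : DifferentiableOn ℂ u U := by
    intro s hs
    obtain ⟨ha, ha0⟩ := differentiableAt_gammaFactor ψ hs.1
    obtain ⟨hb, hb0⟩ := differentiableAt_gammaFactor ψ⁻¹ (hre s hs)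
    have hc : DifferentiableAt ℂ (fun s : ℂ ↦ (χ.conductor : ℂ) ^ (1 - s - 1 / 2)) s := by
      fun_prop (disch := simp [NeZero.ne])
    refine ((((hE ψ s).div ha ha0).mul (hc.mul_const _)).mul
      ((hb.comp s (by fun_prop)).div ((hE ψ⁻¹ _).comp s (by fun_prop))
        (prod_eulerFactor_ne_zero ψ⁻¹ (hre s hs)))).differentiableWithinAt
  have heq : ∀ s ∈ U, χ.LFunction s = u s * χ⁻¹.LFunction (1 - s) := by
    intro s hs
    obtain ⟨h2, h3, h4, h5⟩ := hs1 s hs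
    have ha := (differentiableAt_gammaFactor ψ⁻¹ (hre s hs)).2
    have hb : E ψ⁻¹ (1 - s) ≠ 0 := prod_eulerFactor_ne_zero ψ⁻¹ (hre s hs)
    have h6 := χ.primitiveCharacter_isPrimitive.completedLFunction_one_sub (1 - s)
    rw [sub_sub_cancel, ← hψ] at h6
    rw [← hχi, LFunction_changeLevel hM _ (.inr h3), LFunction_eq_completed_div_gammaFactor _ _ (.inl h5)]
    conv_lhs => rw [← hχ, LFunction_changeLevel hM _ (.inr h2),
      LFunction_eq_completed_div_gammaFactor _ _ (.inl h4), h6]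
    change _ * E ψ s = u s * (_ * E ψ⁻¹ (1 - s))
    simp only [u]
    field_simp
  have hρ : U ∈ nhds ρ := hU.mem_nhds ⟨h0, h1⟩
  have hg : AnalyticAt ℂ χ⁻¹.LFunction (1 - ρ) := analyticAt_LFunction _ (hs1 ρ ⟨h0, h1⟩).2.1
  have hg2 : analyticOrderAt (χ⁻¹.LFunction ∘ (1 - ·)) ρ = analyticOrderAt χ⁻¹.LFunction (1 - ρ) :=
    analyticOrderAt_comp_of_deriv_ne_zero (by fun_prop) (by simp)
  have h8 : χ.LFunction =ᶠ[nhds ρ] u * (χ⁻¹.LFunction ∘ (1 - ·)) :=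
    Filter.eventually_of_mem hρ fun s hs ↦ by simpa using heq s hs
  rw [analyticOrderAt_congr h8, analyticOrderAt_mul (hu.analyticAt hρ)
    (hg.comp_of_eq (by fun_prop) rfl), hg2]
  exact le_add_self

/-- Zeros in the critical strip are symmetric under `(χ, ρ) ↦ (χ⁻¹, 1 - ρ)`. -/
theorem LFunction_one_sub (χ : DirichletCharacter ℂ q) {ρ : ℂ} (h0 : 0 < ρ.re) (h1 : ρ.re < 1) :
    zeroMult χ⁻¹.LFunction (1 - ρ) = zeroMult χ.LFunction ρ ∧
      (χ.LFunction ρ = 0 → χ⁻¹.LFunction (1 - ρ) = 0) := by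
  have hρ : ρ ≠ 1 := by rintro rfl; simp at h1
  have hρ0 : 1 - ρ ≠ 1 := by intro h; rw [sub_eq_self] at h; simp [h] at h0
  have ha := analyticAt_LFunction χ hρ
  have hb := analyticAt_LFunction χ⁻¹ hρ0
  have h := analyticOrderAt_one_sub_le χ⁻¹ (ρ := 1 - ρ) (by rw [sub_re, one_re]; linarith)
    (by rw [sub_re, one_re]; linarith)
  rw [inv_inv, sub_sub_cancel] at h
  have he := le_antisymm (analyticOrderAt_one_sub_le χ h0 h1) h
  refine ⟨by rw [zeroMult_eq ha, zeroMult_eq hb, he], fun hz ↦ ?_⟩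
  rw [← hb.analyticOrderAt_ne_zero, he, ha.analyticOrderAt_ne_zero]
  exact hz

end

section
open Finset DirichletCharacter Metric

theorem zeroMult_congr_mul {f g u : ℂ → ℂ} {z : ℂ} (hf : AnalyticAt ℂ f z) (hu : AnalyticAt ℂ u z)
    (hu0 : u z ≠ 0) (h : g =ᶠ[nhds z] u * f) : zeroMult g z = zeroMult f z := by
  rw [zeroMult_eq hf, zeroMult_eq ((hu.mul hf).congr h.symm), analyticOrderAt_congr h,
    analyticOrderAt_mul hu hf, hu.analyticOrderAt_eq_zero.2 hu0, zero_add]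

variable {q : ℕ} [NeZero q]

theorem zeroMult_LFunction_one {ρ : ℂ} (h0 : 0 < ρ.re) (h1 : ρ ≠ 1) :
    zeroMult (1 : DirichletCharacter ℂ q).LFunction ρ = zeroMult riemannZeta ρ := by
  rw [← LFunction_modOne_eq (χ := 1)]
  refine zeroMult_congr_mul (analyticAt_LFunction _ h1) (u := fun s ↦
    ∏ p ∈ q.primeFactors, (1 - (1 : DirichletCharacter ℂ 1) p * (p : ℂ) ^ (-s)))
    (Differentiable.analyticAt (Differentiable.fun_finsetProd fun p hp ↦ ?_) ρ)
    (prod_eulerFactor_ne_zero _ h0)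
    (Filter.eventually_of_mem (isOpen_compl_singleton.mem_nhds h1) fun s hs ↦ ?_)
  · have : NeZero p := ⟨(Nat.prime_of_mem_primeFactors hp).ne_zero⟩
    fun_prop (disch := simp [NeZero.ne])
  · rw [← changeLevel_one q.one_dvd, LFunction_changeLevel _ _ (.inr hs), mul_comm]
    rfl

theorem zeroMult_regL (χ : DirichletCharacter ℂ q) {ρ : ℂ} (h0 : 0 < ρ.re) (h1 : ρ ≠ 1) :
    zeroMult (regL χ) ρ = zeroMult χ.LFunction ρ := by
  have hu : AnalyticAt ℂ (fun s : ℂ ↦ s - 1) ρ := by fun_prop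
  by_cases hχ : χ = 1
  · subst hχ
    rw [zeroMult_LFunction_one h0 h1, ← LFunction_modOne_eq (χ := 1)]
    refine zeroMult_congr_mul (analyticAt_LFunction _ h1) hu (sub_ne_zero.2 h1)
      (Filter.eventually_of_mem (isOpen_compl_singleton.mem_nhds h1) fun s hs ↦ ?_)
    rw [regL_one_apply hs, LFunction_modOne_eq]
    rfl
  · exact zeroMult_congr_mul (analyticAt_LFunction _ h1) hu (sub_ne_zero.2 h1)
      (.of_forall (regL_apply hχ))

/-- A bound for the number of zeros near a point of the critical strip. -/
theorem sum_zeroMult_local_le (χ : DirichletCharacter ℂ q) (t : ℝ) (Z : Finset ℂ)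
    (hZ : ∀ ρ ∈ Z, 1 / 2 ≤ ρ.re ∧ ρ.re < 1 ∧ |ρ.im - t| ≤ 1 / 2) :
    ∑ ρ ∈ Z, (zeroMult χ.LFunction ρ : ℝ) ≤ 12 * Real.log (12 * (q * (20 + 5 * |t|)) ^ 2) := by
  have hQ : (1 : ℝ) ≤ q := by exact_mod_cast NeZero.one_le
  set c : ℂ := 2 + t * Complex.I with hc
  have hcre : c.re = 2 := by simp [hc]
  have hcim : c.im = t := by simp [hc]
  have hd (z : ℂ) : ‖c - z‖ ^ 2 = (2 - z.re) ^ 2 + (z.im - t) ^ 2 := by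
    rw [Complex.sq_norm, Complex.normSq_apply, Complex.sub_re, Complex.sub_im, hcre, hcim]
    ring
  have hc1 : 1 ≤ ‖c - 1‖ := by
    have := Complex.abs_re_le_norm (c - 1)
    rwa [Complex.sub_re, hcre, Complex.one_re, show (2 - 1 : ℝ) = 1 by norm_num, abs_one] at this
  have hfc : 1 / 6 ≤ ‖regL χ c‖ := by
    have := le_norm_regL χ (s := c) (by rw [hcre]; norm_num) hcre.le
    rw [hcre] at this
    linarith
  have hfc0 : regL χ c ≠ 0 := norm_pos_iff.1 (by linarith)
  have hf : AnalyticOnNhd ℂ (regL χ) (closedBall c (7 / 4)) := fun z _ ↦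
    (differentiable_regL χ).analyticAt z
  have hsub (ρ : ℂ) (hρ : ρ ∈ Z) : ‖c - ρ‖ ^ 2 ≤ 5 / 2 := by
    obtain ⟨h1, h2, h3⟩ := hZ ρ hρ
    rw [hd]
    nlinarith [abs_le.1 h3]
  have hS : ∀ z ∈ Z, z ∈ closedBall c (7 / 4) := fun ρ hρ ↦ by
    rw [mem_closedBall', dist_eq_norm]
    nlinarith [hsub ρ hρ, norm_nonneg (c - ρ)]
  have hJ := sum_zeroMult_mul_log_le (by norm_num) hf hfc0 Z hS
  have hcirc : Real.circleAverage (Real.log ‖regL χ ·‖) c (7 / 4) ≤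
      Real.log (2 * (q * (20 + 5 * |t|)) ^ 2) := by
    refine Real.circleAverage_mono_on_of_le_circle
      (MeromorphicOn.circleIntegrable_log_norm fun s hs ↦
        ((differentiable_regL χ).analyticAt s).meromorphicAt) fun s hs ↦ ?_
    rw [abs_of_pos (by norm_num), mem_sphere, dist_eq_norm] at hs
    rcases eq_or_ne (regL χ s) 0 with h0 | h0
    · simp only [h0, norm_zero, Real.log_zero]
      refine Real.log_nonneg ?_
      have h1 := one_le_pow₀ (n := 2) (one_le_mul_of_one_le_of_one_le hQ
        (show 1 ≤ 20 + 5 * |t| by linarith [abs_nonneg t]))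
      linarith
    refine Real.log_le_log (norm_pos_iff.2 h0) ?_
    have hre : 1 / 4 ≤ s.re := by
      have := (Complex.abs_re_le_norm (s - c)).trans hs.le
      rw [Complex.sub_re, hcre] at this
      linarith [neg_abs_le (s.re - 2)]
    have hcn : ‖c‖ ≤ 2 + |t| := by
      refine (norm_add_le _ _).trans ?_
      simp
    have hs1 : ‖s‖ ≤ 4 + |t| := by
      have := norm_le_norm_add_norm_sub' s c
      linarith
    have hs2 : ‖s - 1‖ ≤ 5 + |t| := (norm_sub_le s 1).trans (by rw [norm_one]; linarith)
    refine (norm_regL_le χ (by linarith)).trans ?_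
    have hp : pvBound q ≤ 2 * q ^ 2 := by
      have h1 : √(q : ℝ) ≤ q := Real.sqrt_le_iff.2 ⟨by linarith, by nlinarith⟩
      have h2 : 1 + Real.log q ≤ q := by linarith [Real.log_le_sub_one_of_pos (show (0 : ℝ) < q by linarith)]
      rw [pvBound]
      nlinarith [mul_le_mul h1 h2 (by linarith [Real.log_nonneg hQ]) (by linarith)]
    have h3 : ‖s‖ / s.re ≤ 4 * (4 + |t|) := by
      rw [div_le_iff₀ (by linarith)]
      nlinarith [abs_nonneg t]
    have hq2 : 1 ≤ (q : ℝ) ^ 2 := one_le_pow₀ hQ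
    have h0t := abs_nonneg t
    have h4 : 1 + pvBound q * (1 + ‖s‖ / s.re) ≤ q ^ 2 * (2 * (20 + 5 * |t|)) := by
      have h5 := mul_le_mul hp (show 1 + ‖s‖ / s.re ≤ 17 + 4 * |t| by linarith)
        (by positivity) (by positivity)
      nlinarith
    have h5 := mul_le_mul hs2 h4 (by
      have := one_le_pvBound (q := q)
      positivity) (by positivity)
    calc 1 + ‖s - 1‖ * (1 + pvBound q * (1 + ‖s‖ / s.re))
        ≤ q ^ 2 * 1 + (5 + |t|) * (q ^ 2 * (2 * (20 + 5 * |t|))) := by linarith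
      _ ≤ q ^ 2 * (20 * (20 + 5 * |t|)) + (5 + |t|) * (q ^ 2 * (2 * (20 + 5 * |t|))) := by
        gcongr
        linarith
      _ ≤ 2 * (q * (20 + 5 * |t|)) ^ 2 := by
        nlinarith [mul_nonneg (sq_nonneg (q : ℝ)) h0t,
          mul_nonneg (sq_nonneg (q : ℝ)) (mul_nonneg h0t h0t)]
  have hm (ρ : ℂ) (hρ : ρ ∈ Z) : (zeroMult χ.LFunction ρ : ℝ) ≤
      12 * (zeroMult (regL χ) ρ * Real.log (7 / 4 / ‖c - ρ‖)) := by
    obtain ⟨h1, h2, h3⟩ := hZ ρ hρ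
    rw [zeroMult_regL χ (by linarith) (by rintro rfl; simp at h2)]
    have hpos : 0 < ‖c - ρ‖ := by
      have := hd ρ
      refine norm_pos_iff.2 fun h ↦ ?_
      rw [h, norm_zero] at this
      nlinarith [sq_nonneg (ρ.im - t)]
    have h4 : 9 / 49 ≤ 2 * Real.log (7 / 4 / ‖c - ρ‖) := by
      rw [← Nat.cast_ofNat (R := ℝ) (n := 2), ← Real.log_pow, div_pow]
      refine le_trans ?_ (Real.one_sub_inv_le_log_of_pos (by positivity))
      rw [inv_div]
      have := hsub ρ hρ
      norm_num
      linarith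
    have h5 : (0 : ℝ) ≤ zeroMult χ.LFunction ρ := Nat.cast_nonneg _
    nlinarith
  have hA : 0 < (q * (20 + 5 * |t|) : ℝ) ^ 2 := by positivity
  have h6 : -Real.log ‖regL χ c‖ ≤ Real.log 6 := by
    rw [← Real.log_inv]
    refine Real.log_le_log (by positivity) ?_
    rw [inv_le_comm₀ (by linarith) (by norm_num)]
    linarith
  refine (sum_le_sum hm).trans ?_
  rw [← mul_sum, show 12 * (q * (20 + 5 * |t|)) ^ 2 = 6 * (2 * (q * (20 + 5 * |t|)) ^ 2) by ring,
    Real.log_mul (by norm_num) (by positivity)]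
  linarith

/-- A crude bound for the number of zeros in the right half of the critical strip. -/
theorem sum_zeroMult_crude_le {κ : ℝ} (hκ : 0 < κ) : ∃ C : ℝ, 0 < C ∧
    ∀ (q : ℕ) [NeZero q] (χ : DirichletCharacter ℂ q) (T : ℝ), 1 ≤ T → ∀ Z : Finset ℂ,
      (∀ ρ ∈ Z, 1 / 2 ≤ ρ.re ∧ ρ.re < 1 ∧ |ρ.im| ≤ T) →
      ∑ ρ ∈ Z, (zeroMult χ.LFunction ρ : ℝ) ≤ C * (q * T) ^ κ * T := by
  refine ⟨7 * (12 * (Real.log 10800 + 2 / κ)), by have := Real.log_pos (show (1 : ℝ) < 10800 by norm_num); positivity,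
    fun q _ χ T hT Z hZ ↦ ?_⟩
  have hQ : (1 : ℝ) ≤ q := by exact_mod_cast NeZero.one_le
  have hqT : 1 ≤ q * T := one_le_mul_of_one_le_of_one_le hQ hT
  set N : ℤ := ⌈T⌉ with hN
  have hN1 := Int.ceil_lt_add_one T
  have hr (ρ : ℂ) (hρ : ρ ∈ Z) : round ρ.im ∈ Icc (-N) N := by
    have h1 := abs_le.1 (hZ ρ hρ).2.2
    have h2 := abs_le.1 (abs_sub_round ρ.im)
    have h3 := Int.le_ceil T
    have h4 : (round ρ.im : ℝ) < ((N + 1 : ℤ) : ℝ) := by push_cast; linarith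
    have h5 : ((-(N + 1) : ℤ) : ℝ) < round ρ.im := by push_cast; linarith
    rw [Int.cast_lt] at h4 h5
    rw [mem_Icc]; omega
  rw [← sum_fiberwise_of_maps_to hr]
  have hb : ∀ k ∈ Icc (-N) N, ∑ ρ ∈ Z with round ρ.im = k, (zeroMult χ.LFunction ρ : ℝ) ≤
      12 * (Real.log 10800 + 2 / κ) * (q * T) ^ κ := by
    intro k hk
    rw [mem_Icc, ← abs_le] at hk
    have hk1 : |(k : ℝ)| ≤ 2 * T := by
      have : ((|k| : ℤ) : ℝ) ≤ N := by exact_mod_cast hk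
      rw [Int.cast_abs] at this
      linarith
    refine (sum_zeroMult_local_le χ k _ fun ρ hρ ↦ ?_).trans ?_
    · rw [mem_filter] at hρ
      obtain ⟨h1, h2, -⟩ := hZ ρ hρ.1
      exact ⟨h1, h2, by rw [← hρ.2]; exact abs_sub_round _⟩
    have h1 : 12 * (q * (20 + 5 * |(k : ℝ)|)) ^ 2 ≤ 10800 * (q * T) ^ 2 := by
      calc 12 * (q * (20 + 5 * |(k : ℝ)|)) ^ 2 ≤ 12 * (q * (30 * T)) ^ 2 := by gcongr; linarith
        _ = _ := by ring
    have h2 := Real.log_le_log (by positivity) h1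
    have h7 : Real.log (10800 * (q * T) ^ 2) = Real.log 10800 + 2 * Real.log (q * T) := by
      rw [Real.log_mul (by norm_num) (by positivity), Real.log_pow]; norm_num
    have h3 := Real.log_le_rpow_div (show 0 ≤ q * T by linarith) hκ
    have h4 : 0 < Real.log 10800 := Real.log_pos (by norm_num)
    have h5 := Real.one_le_rpow hqT hκ.le
    have h6 : 2 / κ * (q * T) ^ κ = 2 * ((q * T) ^ κ / κ) := by ring
    have h8 := mul_le_mul_of_nonneg_left h5 h4.le
    linarith
  refine (sum_le_sum hb).trans ?_
  rw [sum_const, nsmul_eq_mul, Int.card_Icc]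
  have hc : (((N + 1 - -N).toNat : ℕ) : ℝ) ≤ 7 * T := by
    have h0 : 0 ≤ N + 1 - -N := by have := Int.ceil_nonneg (show 0 ≤ T by linarith); omega
    have : (((N + 1 - -N).toNat : ℤ) : ℝ) = ((N + 1 - -N : ℤ) : ℝ) := by rw [Int.toNat_of_nonneg h0]
    push_cast at this
    rw [this]
    linarith
  calc _ ≤ 7 * T * (12 * (Real.log 10800 + 2 / κ) * (q * T) ^ κ) := by gcongr
    _ = _ := by ring

end

section
open Finset

/-- Summation over cells `k ≤ a < k + 1`, `2 ^ j ≤ h < 2 ^ (j + 1)`. -/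
theorem exists_sum_exp_mul_rpow_le {c d θ τ : ℝ} (hcd : c < d) (hθτ : θ < τ) (hd : 0 ≤ d)
    (hτ : 0 ≤ τ) : ∃ K : ℝ, 0 < K ∧ ∀ {ι : Type} (P : Finset ι) (m a h : ι → ℝ) (A : ℝ), 0 ≤ A →
      (∀ p ∈ P, 0 ≤ m p ∧ 0 ≤ a p ∧ 1 ≤ h p) →
      (∀ U V : ℝ, 1 ≤ U → 1 ≤ V → ∀ P' ⊆ P, (∀ p ∈ P', a p ≤ U ∧ V ≤ h p ∧ h p ≤ 2 * V) →
        ∑ p ∈ P', m p ≤ A * (Real.exp (c * U) * V ^ θ)) →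
      ∑ p ∈ P, m p * (Real.exp (-(d * a p)) * h p ^ (-τ)) ≤ K * A := by
  have hr : Real.exp (c - d) < 1 := Real.exp_lt_one_iff.2 (by linarith)
  have hs : (2 : ℝ) ^ (θ - τ) < 1 := Real.rpow_lt_one_of_one_lt_of_neg (by norm_num) (by linarith)
  have hsum : Summable fun i : ℕ × ℕ ↦ Real.exp (c - d) ^ i.1 * ((2 : ℝ) ^ (θ - τ)) ^ i.2 :=
    (summable_geometric_of_lt_one (Real.exp_pos _).le hr).mul_of_nonneg
      (summable_geometric_of_lt_one (by positivity) hs) (fun _ ↦ by positivity)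
      fun _ ↦ by positivity
  refine ⟨Real.exp c * ∑' i : ℕ × ℕ, Real.exp (c - d) ^ i.1 * ((2 : ℝ) ^ (θ - τ)) ^ i.2,
    mul_pos (Real.exp_pos _) (hsum.tsum_pos (fun _ ↦ by positivity) (0, 0) (by simp)),
    fun {ι} P m a h A hA hP hN ↦ ?_⟩
  let f : ι → ℕ × ℕ := fun p ↦ (⌊a p⌋₊, Nat.log 2 ⌊h p⌋₊)
  rw [← sum_fiberwise_of_maps_to (t := P.image f) fun p hp ↦ mem_image_of_mem f hp]
  calc _ ≤ ∑ i ∈ P.image f, A * Real.exp c *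
        (Real.exp (c - d) ^ i.1 * ((2 : ℝ) ^ (θ - τ)) ^ i.2) := sum_le_sum fun i _ ↦ ?_
    _ ≤ _ := by
      rw [← mul_sum, mul_comm A, mul_assoc, mul_assoc, mul_comm A]
      gcongr
      exact hsum.sum_le_tsum _ fun _ _ ↦ by positivity
  have hcell : ∀ p ∈ P.filter (f · = i), i.1 ≤ a p ∧ a p ≤ i.1 + 1 ∧ (2 : ℝ) ^ i.2 ≤ h p ∧
      h p ≤ 2 * 2 ^ i.2 := by
    intro p hp
    obtain ⟨hp', rfl⟩ := mem_filter.1 hp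
    obtain ⟨-, h2, h3⟩ := hP p hp'
    have h4 : ⌊h p⌋₊ ≠ 0 := (Nat.floor_pos.2 h3).ne'
    refine ⟨Nat.floor_le h2, (Nat.lt_floor_add_one _).le, ?_, ?_⟩
    · exact (by exact_mod_cast Nat.pow_log_le_self 2 h4 :
        (2 : ℝ) ^ Nat.log 2 ⌊h p⌋₊ ≤ ⌊h p⌋₊).trans (Nat.floor_le (by linarith))
    · have := Nat.lt_pow_succ_log_self one_lt_two ⌊h p⌋₊
      rw [Nat.floor_lt (by linarith), pow_succ'] at this
      push_cast at this
      exact this.le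
  calc _ ≤ ∑ p ∈ P with f p = i, m p * (Real.exp (-(d * i.1)) * ((2 : ℝ) ^ i.2) ^ (-τ)) := by
        refine sum_le_sum fun p hp ↦ ?_
        obtain ⟨h1, -, h3, -⟩ := hcell p hp
        refine mul_le_mul_of_nonneg_left ?_ (hP p (mem_filter.1 hp).1).1
        exact mul_le_mul (Real.exp_le_exp.2 (neg_le_neg (by gcongr)))
          (Real.rpow_le_rpow_of_nonpos (by positivity) h3 (by linarith))
          (Real.rpow_nonneg (by linarith [(hP p (mem_filter.1 hp).1).2.2]) _) (by positivity)
    _ ≤ A * (Real.exp (c * (i.1 + 1)) * ((2 : ℝ) ^ i.2) ^ θ) *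
        (Real.exp (-(d * i.1)) * ((2 : ℝ) ^ i.2) ^ (-τ)) := by
      rw [← sum_mul]
      gcongr
      exact hN _ _ (by simp) (one_le_pow₀ (by norm_num)) _ (filter_subset _ _)
        fun p hp ↦ (hcell p hp).2
    _ = _ := by
      rw [← Real.exp_nat_mul, ← Real.rpow_natCast ((2 : ℝ) ^ (θ - τ)), ← Real.rpow_mul two_pos.le,
        mul_comm (θ - τ), Real.rpow_mul two_pos.le, Real.rpow_natCast, sub_eq_add_neg θ,
        Real.rpow_add (by positivity), show (i.1 : ℝ) * (c - d) = c * (i.1 + 1) + -(d * i.1) - c by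
          ring, Real.exp_sub, Real.exp_add]
      field_simp

theorem exists_sum_pairs_eq {α β : Type*} (P : Finset (α × β)) (S : Finset α)
    (hS : ∀ p ∈ P, p.1 ∈ S) : ∃ Z : α → Finset β, (∀ χ, ∀ ρ ∈ Z χ, (χ, ρ) ∈ P) ∧
      ∀ f : α × β → ℝ, ∑ p ∈ P, f p = ∑ χ ∈ S, ∑ ρ ∈ Z χ, f (χ, ρ) := by
  refine ⟨fun χ ↦ {p ∈ P | p.1 = χ}.image Prod.snd, fun χ ρ ↦ by simp, fun f ↦ ?_⟩
  refine sum_finset_product P S _ fun p ↦ ⟨fun hp ↦ ⟨hS p hp, by simpa using hp⟩, fun hp ↦ ?_⟩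
  simpa using hp.2

end

section
open Finset

variable {q : ℕ}

theorem sum_pairs_nonprincipal_le {κ v σ₀ δ : ℝ} (hκ : 0 < κ) (hκ1 : κ ≤ 1 / 10)
    (hσ₀ : 3 / 4 ≤ σ₀) (hv0 : 1 / 2 ≤ v) (hv : 1 + 6 * κ ≤ 2 * v * σ₀) (hδ0 : 0 ≤ δ)
    (hδ : σ₀ < 1 - δ) :
    ∃ C : ℝ, 0 < C ∧ ∃ q₀ : ℝ, 1 < q₀ ∧ ∀ (q : ℕ) [NeZero q], q₀ ≤ q → ∀ U V : ℝ, 1 ≤ U → 1 ≤ V →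
      ∀ P : Finset (DirichletCharacter ℂ q × ℂ), (∀ p ∈ P, p.1 ≠ 1 ∧ 1 - δ ≤ p.2.re ∧ p.2.re < 1 ∧
        (1 - p.2.re) * Real.log q ≤ U ∧ |p.2.im| ≤ 2 * V) →
      ∑ p ∈ P, (zeroMult p.1.LFunction p.2 : ℝ) ≤
        C * (Real.exp (8 * v * U) * V ^ (10 * v * δ)) := by
  obtain ⟨C, hC, M₀, hM₀, H⟩ := sum_zeroMult_nonprincipal_le hκ hκ1 hσ₀ hv0 hv
  refine ⟨C * 2 ^ (10 * v * δ), by positivity, max M₀ (Real.exp (1 - δ - σ₀)⁻¹),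
    lt_max_of_lt_left hM₀, fun q _ hq U V hU hV P hP ↦ ?_⟩
  have hqM := (le_max_left _ _).trans hq
  have hq0 : (0 : ℝ) < q := by linarith
  have hL : (1 - δ - σ₀)⁻¹ ≤ Real.log q :=
    (Real.le_log_iff_exp_le hq0).2 ((le_max_right _ _).trans hq)
  have h0 : 0 < 1 - δ - σ₀ := by linarith
  have hL0 : 0 < Real.log q := (inv_pos.2 h0).trans_le hL
  have hq1 : (q : ℝ) ≤ q * (2 * V) := le_mul_of_one_le_right hq0.le (by linarith)
  obtain ⟨Z, hZP, hZ⟩ := exists_sum_pairs_eq P (univ.erase 1) fun p hp ↦ by simpa using (hP p hp).1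
  rw [hZ]
  refine (H q (2 * V) (by linarith) (hqM.trans hq1) (max (1 - U / Real.log q) (1 - δ)) ?_
    (max_le (by linarith [div_nonneg (by linarith : 0 ≤ U) hL0.le]) (by linarith)) _ ?_).trans ?_
  · have h1 : (Real.log (q * (2 * V)))⁻¹ ≤ 1 - δ - σ₀ :=
      inv_le_of_inv_le₀ h0 (hL.trans (Real.log_le_log hq0 hq1))
    linarith [le_max_right (1 - U / Real.log q) (1 - δ)]
  · intro χ _ ρ hρ
    obtain ⟨-, h1, h2, h3, h4⟩ := hP _ (hZP χ ρ hρ)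
    refine ⟨max_le ?_ h1, h2.le, h4⟩
    linarith [(le_div_iff₀ hL0).2 h3]
  · set e := 1 - max (1 - U / Real.log q) (1 - δ) with he
    have he1 : e ≤ δ := by linarith [le_max_right (1 - U / Real.log q) (1 - δ)]
    have he2 : Real.log q * e ≤ U := by
      rw [← le_div_iff₀' hL0]
      linarith [le_max_left (1 - U / Real.log q) (1 - δ)]
    have h1 : (((q : ℝ) ^ 4 * (2 * V) ^ 5) ^ v) ^ (2 * e) =
        (q : ℝ) ^ (8 * v * e) * (2 * V) ^ (10 * v * e) := by
      rw [← Real.rpow_mul (by positivity), Real.mul_rpow (by positivity) (by positivity),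
        ← Real.rpow_natCast, ← Real.rpow_natCast, ← Real.rpow_mul hq0.le,
        ← Real.rpow_mul (by linarith)]
      push_cast
      ring_nf
    have h2 : (q : ℝ) ^ (8 * v * e) ≤ Real.exp (8 * v * U) := by
      rw [Real.rpow_def_of_pos hq0]
      refine Real.exp_le_exp.2 ?_
      nlinarith
    have h3 : (2 * V) ^ (10 * v * e) ≤ 2 ^ (10 * v * δ) * V ^ (10 * v * δ) := by
      rw [← Real.mul_rpow two_pos.le (by linarith)]
      exact Real.rpow_le_rpow_of_exponent_le (by linarith) (by nlinarith)
    calc _ ≤ C * (Real.exp (8 * v * U) * (2 ^ (10 * v * δ) * V ^ (10 * v * δ))) := by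
          rw [h1]
          gcongr
      _ = _ := by ring

theorem sum_pairs_crude_le {κ : ℝ} (hκ : 0 < κ) : ∃ C : ℝ, 0 < C ∧ ∀ (q : ℕ) [NeZero q] (T : ℝ),
    1 ≤ T → ∀ (S : Finset (DirichletCharacter ℂ q)) (P : Finset (DirichletCharacter ℂ q × ℂ)),
      (∀ p ∈ P, p.1 ∈ S ∧ 1 / 2 ≤ p.2.re ∧ p.2.re < 1 ∧ |p.2.im| ≤ T) →
      ∑ p ∈ P, (zeroMult p.1.LFunction p.2 : ℝ) ≤ #S * (C * (q * T) ^ κ * T) := by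
  obtain ⟨C, hC, H⟩ := sum_zeroMult_crude_le hκ
  refine ⟨C, hC, fun q _ T hT S P hP ↦ ?_⟩
  obtain ⟨Z, hZP, hZ⟩ := exists_sum_pairs_eq P S fun p hp ↦ (hP p hp).1
  rw [hZ, ← nsmul_eq_mul]
  exact sum_le_card_nsmul _ _ _ fun χ _ ↦ H q χ T hT _ fun ρ hρ ↦ (hP _ (hZP χ ρ hρ)).2

/-- Zeros in a cell with real part at least `499 / 500`. -/
theorem exists_near_cell_le : ∃ A : ℝ, 0 < A ∧ ∃ q₀ : ℝ, 1 < q₀ ∧ ∀ (q : ℕ) [NeZero q], q₀ ≤ q →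
    ∀ U V : ℝ, 1 ≤ U → 1 ≤ V → ∀ P : Finset (DirichletCharacter ℂ q × ℂ),
      (∀ p ∈ P, 1 - 1 / 500 ≤ p.2.re ∧ p.2.re < 1 ∧ (1 - p.2.re) * Real.log q ≤ U ∧
        V ≤ max 1 |p.2.im| ∧ max 1 |p.2.im| ≤ 2 * V) →
      ∑ p ∈ P, (zeroMult p.1.LFunction p.2 : ℝ) ≤
        A * (Real.exp (4.08 * U) * V ^ (1 / 4 : ℝ)) := by
  obtain ⟨C₁, hC₁, q₀, hq₀, H₁⟩ := sum_pairs_nonprincipal_le (κ := 3 / 2000) (v := 51 / 100)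
    (σ₀ := 99 / 100) (δ := 1 / 500) (by norm_num) (by norm_num) (by norm_num) (by norm_num)
    (by norm_num) (by norm_num) (by norm_num)
  obtain ⟨C₂, hC₂, M₀, hM₀, H₂⟩ := sum_zeroMult_riemannZeta_le (κ := 3 / 2000) (v := 51 / 100)
    (σ₀ := 99 / 100) (by norm_num) (by norm_num) (by norm_num) (by norm_num) (by norm_num)
    (by norm_num)
  obtain ⟨C₃, hC₃, H₃⟩ := sum_zeroMult_crude_le one_pos
  set M := max M₀ (Real.exp 125)
  refine ⟨C₁ + (C₂ + C₃ * (2 * M) * (2 * M)), by positivity, q₀, hq₀,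
    fun q _ hq U V hU hV P hP ↦ ?_⟩
  have hV' : ∀ e : ℝ, e ≤ 1 / 4 → V ^ e ≤ V ^ (1 / 4 : ℝ) := fun e he ↦
    Real.rpow_le_rpow_of_exponent_le hV he
  have hV1 : 1 ≤ V ^ (1 / 4 : ℝ) := Real.one_le_rpow hV (by norm_num)
  have hE : 1 ≤ Real.exp (4.08 * U) := Real.one_le_exp (by linarith)
  rw [← sum_filter_not_add_sum_filter P (·.1 = 1), add_mul]
  refine add_le_add ((H₁ q hq U V hU hV _ fun p hp ↦ ?_).trans ?_) ?_
  · obtain ⟨h1, h2, h3, -, h5⟩ := hP p (mem_filter.1 hp).1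
    exact ⟨(mem_filter.1 hp).2, h1, h2, h3, (le_max_right _ _).trans h5⟩
  · norm_num only
    gcongr ?_ * (?_ * ?_)
    exact Real.rpow_le_rpow_of_exponent_le hV (by norm_num)
  obtain ⟨Z, hZP, hZ⟩ := exists_sum_pairs_eq (P.filter (·.1 = 1)) {1} fun p hp ↦ by
    simpa using (mem_filter.1 hp).2
  rw [hZ, sum_singleton]
  have hmem : ∀ ρ ∈ Z 1, 1 - 1 / 500 ≤ ρ.re ∧ ρ.re < 1 ∧
      V ≤ max 1 |ρ.im| ∧ max 1 |ρ.im| ≤ 2 * V := by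
    intro ρ hρ
    obtain ⟨h1, h2, -, h3⟩ := hP _ (mem_filter.1 (hZP 1 ρ hρ)).1
    exact ⟨h1, h2, h3⟩
  have hz : ∀ (n : ℕ) [NeZero n], ∀ ρ ∈ Z 1,
      zeroMult (1 : DirichletCharacter ℂ n).LFunction ρ = zeroMult riemannZeta ρ := by
    refine fun n _ ρ hρ ↦ zeroMult_LFunction_one (by linarith [(hmem ρ hρ).1]) ?_
    rintro rfl
    exact absurd (hmem 1 hρ).2.1 (by simp)
  rw [sum_congr rfl fun ρ hρ ↦ by rw [hz q ρ hρ]]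
  rcases le_or_gt M V with hMV | hMV
  · have hVM := (le_max_left _ _).trans hMV
    have hV0 : 1 < V := hM₀.trans_le hVM
    refine (H₂ V hVM (1 - 1 / 500) ?_ (by norm_num) _ fun ρ hρ ↦ ?_).trans ?_
    · have : (125 : ℝ) ≤ Real.log V :=
        (Real.le_log_iff_exp_le (by linarith)).2 ((le_max_right _ _).trans hMV)
      have := inv_anti₀ (by norm_num) this
      norm_num at this ⊢
      linarith
    · obtain ⟨h1, h2, h3, h4⟩ := hmem ρ hρ
      exact ⟨h1, h2.le, (le_max_iff.1 h3).resolve_left (by linarith), (le_max_right _ _).trans h4⟩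
    · refine mul_le_mul (le_add_of_nonneg_right (by positivity)) ?_ (by positivity) (by positivity)
      exact (hV' _ (by norm_num)).trans (le_mul_of_one_le_left (by positivity) hE)
  · have := H₃ 1 1 (2 * V) (by linarith) _ fun ρ hρ ↦
      ⟨by linarith [(hmem ρ hρ).1], (hmem ρ hρ).2.1, (le_max_right _ _).trans (hmem ρ hρ).2.2.2⟩
    rw [sum_congr rfl fun ρ hρ ↦ by rw [hz 1 ρ hρ], Nat.cast_one, one_mul, Real.rpow_one] at this
    refine this.trans ?_
    calc _ ≤ C₃ * (2 * M) * (2 * M) * 1 := by rw [mul_one]; gcongr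
      _ ≤ _ := mul_le_mul (le_add_of_nonneg_left hC₂.le) (one_le_mul_of_one_le_of_one_le hE hV1)
        zero_le_one (by positivity)

/-- Zeros in a cell with real part at least `1 / 2`. -/
theorem exists_mid_cell_le : ∃ A : ℝ, 0 < A ∧ ∃ q₀ : ℝ, 1 < q₀ ∧ ∀ (q : ℕ) [NeZero q], q₀ ≤ q →
    ∀ U V : ℝ, 1 ≤ U → 1 ≤ V → ∀ P : Finset (DirichletCharacter ℂ q × ℂ),
      (∀ p ∈ P, 1 / 2 ≤ p.2.re ∧ p.2.re < 1 ∧ (1 - p.2.re) * Real.log q ≤ U ∧ |p.2.im| ≤ 2 * V) →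
      ∑ p ∈ P, (zeroMult p.1.LFunction p.2 : ℝ) ≤
        A * q ^ (1 / 100000 : ℝ) * (Real.exp (6.07 * U) * V ^ (1 + 1 / 100000 : ℝ)) := by
  obtain ⟨C₁, hC₁, q₀, hq₀, H₁⟩ := sum_pairs_nonprincipal_le (κ := 1 / 100000) (v := 3 / 5)
    (σ₀ := 834 / 1000) (δ := 165 / 1000) (by norm_num) (by norm_num) (by norm_num) (by norm_num)
    (by norm_num) (by norm_num) (by norm_num)
  obtain ⟨C₂, hC₂, H₂⟩ := sum_pairs_crude_le (κ := 1 / 100000) (by norm_num)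
  refine ⟨C₁ + C₂ * 4, by positivity, q₀, hq₀, fun q _ hq U V hU hV P hP ↦ ?_⟩
  have hq1 : (1 : ℝ) < q := hq₀.trans_le hq
  have hL := Real.log_pos hq1
  have hqκ : 1 ≤ (q : ℝ) ^ (1 / 100000 : ℝ) := Real.one_le_rpow hq1.le (by norm_num)
  have hE : 1 ≤ Real.exp (6.07 * U) := Real.one_le_exp (by linarith)
  have hcr : C₂ * (q * (2 * V)) ^ (1 / 100000 : ℝ) * (2 * V) ≤
      C₂ * 4 * q ^ (1 / 100000 : ℝ) * V ^ (1 + 1 / 100000 : ℝ) := by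
    have h2 : (2 : ℝ) ^ (1 / 100000 : ℝ) ≤ 2 := by
      simpa using Real.rpow_le_rpow_of_exponent_le one_le_two (by norm_num : (1 / 100000 : ℝ) ≤ 1)
    rw [Real.mul_rpow (by linarith) (by linarith), Real.mul_rpow two_pos.le (by linarith),
      Real.rpow_add (by linarith), Real.rpow_one]
    calc _ = C₂ * q ^ (1 / 100000 : ℝ) * (V * V ^ (1 / 100000 : ℝ)) * 2 *
          2 ^ (1 / 100000 : ℝ) := by ring
      _ ≤ C₂ * q ^ (1 / 100000 : ℝ) * (V * V ^ (1 / 100000 : ℝ)) * 2 * 2 := by gcongr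
      _ = _ := by ring
  rcases le_or_gt (165 / 1000 * Real.log q) U with hUL | hUL
  · have hqE : (q : ℝ) ≤ Real.exp (6.07 * U) := by
      rw [← Real.log_le_iff_le_exp (by linarith)]
      linarith
    refine (H₂ q (2 * V) (by linarith) univ P fun p hp ↦
      ⟨mem_univ _, (hP p hp).1, (hP p hp).2.1, (hP p hp).2.2.2⟩).trans ?_
    calc _ ≤ Real.exp (6.07 * U) *
          (C₂ * 4 * q ^ (1 / 100000 : ℝ) * V ^ (1 + 1 / 100000 : ℝ)) :=
        mul_le_mul ((card_dirichletCharacter_le univ).trans hqE) hcr (by positivity) (by positivity)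
      _ = C₂ * 4 * q ^ (1 / 100000 : ℝ) * (Real.exp (6.07 * U) * V ^ (1 + 1 / 100000 : ℝ)) := by
        ring
      _ ≤ _ := by gcongr; linarith
  · rw [← sum_filter_not_add_sum_filter P (·.1 = 1), add_mul, add_mul]
    refine add_le_add ((H₁ q hq U V hU hV _ fun p hp ↦ ?_).trans ?_)
      ((H₂ q (2 * V) (by linarith) {1} _ fun p hp ↦ ?_).trans ?_)
    · obtain ⟨h1, h2, h3, h4⟩ := hP p (mem_filter.1 hp).1
      refine ⟨(mem_filter.1 hp).2, ?_, h2, h3, h4⟩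
      have := lt_of_mul_lt_mul_right (h3.trans_lt hUL) hL.le
      linarith
    · refine mul_le_mul (le_mul_of_one_le_right hC₁.le hqκ) ?_ (by positivity) (by positivity)
      gcongr ?_ * ?_
      · exact Real.exp_le_exp.2 (by linarith)
      · exact Real.rpow_le_rpow_of_exponent_le hV (by norm_num)
    · obtain ⟨h1, h2, -, h4⟩ := hP p (mem_filter.1 hp).1
      exact ⟨by simpa using (mem_filter.1 hp).2, h1, h2, h4⟩
    · rw [card_singleton, Nat.cast_one, one_mul]
      refine hcr.trans (mul_le_mul_of_nonneg_left ?_ (by positivity))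
      exact le_mul_of_one_le_left (by positivity) hE

end

section
open Finset

variable {q : ℕ}

theorem norm_cpow_div_le {Q x : ℝ} (hQ : 1 < Q) (hx : Q ^ (6.18 : ℝ) ≤ x) {ρ : ℂ}
    (h0 : 1 / 2 ≤ ρ.re) (h1 : ρ.re ≤ 1) : ‖(x : ℂ) ^ ρ / ρ‖ ≤
      2 * x * (Real.exp (-(6.18 * ((1 - ρ.re) * Real.log Q))) * (max 1 |ρ.im|)⁻¹) := by
  have hQ0 : 0 < Q := by linarith
  have hx0 : 0 < x := (by positivity : 0 < Q ^ (6.18 : ℝ)).trans_le hx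
  have hn : max 1 |ρ.im| / 2 ≤ ‖ρ‖ := by
    have h2 := Complex.abs_re_le_norm ρ
    have h3 := Complex.abs_im_le_norm ρ
    rw [abs_of_pos (by linarith)] at h2
    rcases max_cases 1 |ρ.im| with h | h <;> linarith
  have hx1 : x ^ ρ.re ≤ x * Real.exp (-(6.18 * ((1 - ρ.re) * Real.log Q))) := by
    rw [show ρ.re = 1 + -(1 - ρ.re) by ring, Real.rpow_add hx0, Real.rpow_one]
    refine mul_le_mul_of_nonneg_left
      ((Real.rpow_le_rpow_of_nonpos (by positivity) hx (by linarith)).trans_eq ?_) hx0.le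
    rw [← Real.rpow_mul hQ0.le, Real.rpow_def_of_pos hQ0]
    ring_nf
  rw [norm_div, Complex.norm_cpow_eq_rpow_re_of_pos hx0]
  calc _ ≤ x * Real.exp (-(6.18 * ((1 - ρ.re) * Real.log Q))) / (max 1 |ρ.im| / 2) := by gcongr
    _ = _ := by field_simp

theorem sum_near_le : ∃ B : ℝ, 0 < B ∧ ∃ q₀ : ℝ, 1 < q₀ ∧ ∀ (q : ℕ) [NeZero q], q₀ ≤ q →
    ∀ x D : ℝ, (q : ℝ) ^ (6.18 : ℝ) ≤ x → 0 < D → ∀ P : Finset (DirichletCharacter ℂ q × ℂ),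
      (∀ p ∈ P, 1 - 1 / 500 ≤ p.2.re ∧ p.2.re < 1 ∧
        1 ≤ D * ((q : ℝ) ^ (2.04 : ℝ) * (2 + |p.2.im|) ^ (3 : ℝ)) ^ (1 - p.2.re)) →
      ∑ p ∈ P, (zeroMult p.1.LFunction p.2 : ℝ) * ‖(x : ℂ) ^ p.2 / p.2‖ ≤
        B * D ^ (1.01 : ℝ) * x := by
  obtain ⟨A, hA, q₀, hq₀, H⟩ := exists_near_cell_le
  obtain ⟨K, hK, HK⟩ := exists_sum_exp_mul_rpow_le (c := 4.08) (d := 4.1196) (θ := 1 / 4)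
    (τ := 1 / 2) (by norm_num) (by norm_num) (by norm_num) (by norm_num)
  refine ⟨4 * (K * A), by positivity, q₀, hq₀, fun q _ hq x D hx hD P hP ↦ ?_⟩
  have hq1 : (1 : ℝ) < q := hq₀.trans_le hq
  have hq0 : (0 : ℝ) < q := by linarith
  have hL := Real.log_pos hq1
  have hx0 : 0 < x := (by positivity : 0 < (q : ℝ) ^ (6.18 : ℝ)).trans_le hx
  have key := HK P (fun p ↦ (zeroMult p.1.LFunction p.2 : ℝ))
    (fun p ↦ (1 - p.2.re) * Real.log q) (fun p ↦ max 1 |p.2.im|) A hA.le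
    (fun p hp ↦ ⟨by positivity, mul_nonneg (by linarith [(hP p hp).2.1]) hL.le, le_max_left _ _⟩)
    fun U V hU hV P' hP' h ↦ H q hq U V hU hV P' fun p hp ↦
      ⟨(hP p (hP' hp)).1, (hP p (hP' hp)).2.1, h p hp⟩
  calc _ ≤ ∑ p ∈ P, 4 * D ^ (1.01 : ℝ) * x * ((zeroMult p.1.LFunction p.2 : ℝ) *
        (Real.exp (-(4.1196 * ((1 - p.2.re) * Real.log q))) *
          max 1 |p.2.im| ^ (-(1 / 2) : ℝ))) := sum_le_sum fun p hp ↦ ?_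
    _ ≤ 4 * D ^ (1.01 : ℝ) * x * (K * A) := by
      rw [← mul_sum]
      gcongr
    _ = _ := by ring
  obtain ⟨h1, h2, h3⟩ := hP p hp
  refine (mul_le_mul_of_nonneg_left (norm_cpow_div_le hq1 hx (by linarith) h2.le)
    (by positivity)).trans ?_
  set h := max 1 |p.2.im|
  have hh : 1 ≤ h := le_max_left _ _
  have hh0 : 0 < h := by linarith
  set b := 1 - p.2.re with hb
  have hb0 : 0 ≤ b := by linarith
  have hDH : 1 ≤ D ^ (1.01 : ℝ) * (Real.exp (2.0604 * (b * Real.log q)) * (2 * h ^ (1 / 2 : ℝ))) := by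
    have h4 := Real.one_le_rpow h3 (by norm_num : (0 : ℝ) ≤ 1.01)
    rw [Real.mul_rpow hD.le (by positivity), ← Real.rpow_mul (by positivity),
      Real.mul_rpow (by positivity) (by positivity), ← Real.rpow_mul hq0.le,
      ← Real.rpow_mul (by positivity), Real.rpow_def_of_pos hq0] at h4
    refine h4.trans ?_
    gcongr ?_ * (?_ * ?_)
    · exact (congrArg Real.exp (by ring)).le
    · calc (2 + |p.2.im|) ^ (3 * (b * 1.01)) ≤ (3 * h) ^ (3 * (b * 1.01)) := by
            gcongr
            linarith [le_max_right 1 |p.2.im|]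
        _ ≤ (3 * h) ^ (1 / 2 : ℝ) :=
            Real.rpow_le_rpow_of_exponent_le (by linarith) (by linarith)
        _ ≤ _ := by
            rw [Real.mul_rpow (by norm_num) hh0.le]
            gcongr
            rw [← Real.sqrt_eq_rpow, Real.sqrt_le_left (by norm_num)]
            norm_num
  calc _ ≤ (zeroMult p.1.LFunction p.2 : ℝ) * (2 * x * (Real.exp (-(6.18 * (b * Real.log q))) *
        h⁻¹)) * (D ^ (1.01 : ℝ) * (Real.exp (2.0604 * (b * Real.log q)) *
          (2 * h ^ (1 / 2 : ℝ)))) := le_mul_of_one_le_right (by positivity) hDH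
    _ = 4 * D ^ (1.01 : ℝ) * x * ((zeroMult p.1.LFunction p.2 : ℝ) *
        ((Real.exp (-(6.18 * (b * Real.log q))) * Real.exp (2.0604 * (b * Real.log q))) *
          (h ^ (-1 : ℝ) * h ^ (1 / 2 : ℝ)))) := by
      rw [Real.rpow_neg_one]
      ring
    _ = _ := by
      rw [← Real.exp_add, ← Real.rpow_add hh0]
      ring_nf

theorem sum_mid_le : ∃ B : ℝ, 0 < B ∧ ∃ q₀ : ℝ, 1 < q₀ ∧ ∀ (q : ℕ) [NeZero q], q₀ ≤ q →
    ∀ x : ℝ, (q : ℝ) ^ (6.18 : ℝ) ≤ x → ∀ P : Finset (DirichletCharacter ℂ q × ℂ),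
      (∀ p ∈ P, 1 / 2 ≤ p.2.re ∧ p.2.re ≤ 1 - 1 / 500 ∧ |p.2.im| ≤ (q : ℝ) ^ (2 : ℝ)) →
      ∑ p ∈ P, (zeroMult p.1.LFunction p.2 : ℝ) * ‖(x : ℂ) ^ p.2 / p.2‖ ≤
        B * q ^ (-(15 / 100000) : ℝ) * x := by
  obtain ⟨A, hA, q₀, hq₀, H⟩ := exists_mid_cell_le
  obtain ⟨K, hK, HK⟩ := exists_sum_exp_mul_rpow_le (c := 6.07) (d := 6.08) (θ := 1 + 1 / 100000)
    (τ := 1 + 2 / 100000) (by norm_num) (by norm_num) (by norm_num) (by norm_num)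
  refine ⟨2 * (K * A), by positivity, q₀, hq₀, fun q _ hq x hx P hP ↦ ?_⟩
  have hq1 : (1 : ℝ) < q := hq₀.trans_le hq
  have hq0 : (0 : ℝ) < q := by linarith
  have hL := Real.log_pos hq1
  have hx0 : 0 < x := (by positivity : 0 < (q : ℝ) ^ (6.18 : ℝ)).trans_le hx
  have key := HK P (fun p ↦ (zeroMult p.1.LFunction p.2 : ℝ))
    (fun p ↦ (1 - p.2.re) * Real.log q) (fun p ↦ max 1 |p.2.im|) (A * q ^ (1 / 100000 : ℝ))
    (by positivity)
    (fun p hp ↦ ⟨by positivity, mul_nonneg (by linarith [(hP p hp).2.1]) hL.le, le_max_left _ _⟩)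
    fun U V hU hV P' hP' h ↦ H q hq U V hU hV P' fun p hp ↦
      ⟨(hP p (hP' hp)).1, by linarith [(hP p (hP' hp)).2.1], (h p hp).1,
        (le_max_right _ _).trans (h p hp).2.2⟩
  calc _ ≤ ∑ p ∈ P, 2 * q ^ (-(16 / 100000) : ℝ) * x * ((zeroMult p.1.LFunction p.2 : ℝ) *
        (Real.exp (-(6.08 * ((1 - p.2.re) * Real.log q))) *
          max 1 |p.2.im| ^ (-(1 + 2 / 100000) : ℝ))) := sum_le_sum fun p hp ↦ ?_
    _ ≤ 2 * q ^ (-(16 / 100000) : ℝ) * x * (K * (A * q ^ (1 / 100000 : ℝ))) := by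
      rw [← mul_sum]
      gcongr
    _ = 2 * (K * A) * (q ^ (-(16 / 100000) : ℝ) * q ^ (1 / 100000 : ℝ)) * x := by ring
    _ = _ := by
      rw [← Real.rpow_add hq0]
      norm_num
  obtain ⟨h1, h2, h3⟩ := hP p hp
  refine (mul_le_mul_of_nonneg_left (norm_cpow_div_le hq1 hx h1 (by linarith))
    (by positivity)).trans ?_
  set h := max 1 |p.2.im|
  have hh : 1 ≤ h := le_max_left _ _
  have hh0 : 0 < h := by linarith
  have hh2 : h ^ (2 / 100000 : ℝ) ≤ q ^ (4 / 100000 : ℝ) := by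
    calc _ ≤ ((q : ℝ) ^ (2 : ℝ)) ^ (2 / 100000 : ℝ) := by
          gcongr
          exact max_le (Real.one_le_rpow hq1.le (by norm_num)) h3
      _ = _ := by
          rw [← Real.rpow_mul hq0.le]
          norm_num
  have hinv : h⁻¹ ≤ h ^ (-(1 + 2 / 100000) : ℝ) * q ^ (4 / 100000 : ℝ) := by
    calc h⁻¹ = h ^ (-(1 + 2 / 100000) : ℝ) * h ^ (2 / 100000 : ℝ) := by
          rw [← Real.rpow_add hh0, ← Real.rpow_neg_one]
          norm_num
      _ ≤ _ := by gcongr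
  have hexp : Real.exp (-(6.18 * ((1 - p.2.re) * Real.log q))) ≤
      Real.exp (-(6.08 * ((1 - p.2.re) * Real.log q))) * q ^ (-(20 / 100000) : ℝ) := by
    rw [Real.rpow_def_of_pos hq0, ← Real.exp_add, Real.exp_le_exp]
    nlinarith
  calc _ ≤ (zeroMult p.1.LFunction p.2 : ℝ) * (2 * x *
        ((Real.exp (-(6.08 * ((1 - p.2.re) * Real.log q))) * q ^ (-(20 / 100000) : ℝ)) *
          (h ^ (-(1 + 2 / 100000) : ℝ) * q ^ (4 / 100000 : ℝ)))) := by gcongr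
    _ = 2 * (q ^ (-(20 / 100000) : ℝ) * q ^ (4 / 100000 : ℝ)) * x *
        ((zeroMult p.1.LFunction p.2 : ℝ) *
          (Real.exp (-(6.08 * ((1 - p.2.re) * Real.log q))) *
            h ^ (-(1 + 2 / 100000) : ℝ))) := by ring
    _ = _ := by
      rw [← Real.rpow_add hq0]
      norm_num

theorem sum_low_le : ∃ B : ℝ, 0 < B ∧ ∀ (q : ℕ) [NeZero q], 2 ≤ q →
    ∀ x c : ℝ, (q : ℝ) ^ (6.18 : ℝ) ≤ x → 0 < c → ∀ P : Finset (DirichletCharacter ℂ q × ℂ),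
      (∀ p ∈ P, 0 < p.2.re ∧ p.2.re < 1 / 2 ∧ |p.2.im| ≤ (q : ℝ) ^ (2 : ℝ) ∧
        c / Real.log q ≤ ‖p.2‖) →
      ∑ p ∈ P, (zeroMult p.1.LFunction p.2 : ℝ) * ‖(x : ℂ) ^ p.2 / p.2‖ ≤
        B * q ^ (-(5 / 100) : ℝ) / c * x := by
  obtain ⟨C, hC, H⟩ := sum_pairs_crude_le (κ := 1 / 100) (by norm_num)
  refine ⟨C * 100, by positivity, fun q _ hq x c hx hc P hP ↦ ?_⟩
  have hq1 : (1 : ℝ) < q := by exact_mod_cast hq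
  have hq0 : (0 : ℝ) < q := by linarith
  have hL := Real.log_pos hq1
  have hx0 : 0 < x := (by positivity : 0 < (q : ℝ) ^ (6.18 : ℝ)).trans_le hx
  have hx1 : 1 ≤ x := (Real.one_le_rpow hq1.le (by norm_num)).trans hx
  have hcount : ∑ p ∈ P, (zeroMult p.1.LFunction p.2 : ℝ) ≤ C * q ^ (3.03 : ℝ) := by
    have hinj : Set.InjOn (fun p : DirichletCharacter ℂ q × ℂ ↦ (p.1⁻¹, 1 - p.2)) P := by
      rintro ⟨a, b⟩ - ⟨c, d⟩ - h
      simpa using h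
    calc _ = ∑ p ∈ P.image fun p ↦ (p.1⁻¹, 1 - p.2), (zeroMult p.1.LFunction p.2 : ℝ) := by
          rw [sum_image hinj]
          refine sum_congr rfl fun p hp ↦ ?_
          rw [(LFunction_one_sub p.1 (hP p hp).1 (by linarith [(hP p hp).2.1])).1]
      _ ≤ _ := H q (q ^ (2 : ℝ)) (Real.one_le_rpow hq1.le (by norm_num)) univ _ fun p hp ↦ by
          obtain ⟨p, hp', rfl⟩ := mem_image.1 hp
          obtain ⟨h1, h2, h3, -⟩ := hP p hp'
          exact ⟨mem_univ _, by simp; linarith, by simpa using h1, by simpa using h3⟩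
      _ ≤ q * (C * (q * q ^ (2 : ℝ)) ^ (1 / 100 : ℝ) * q ^ (2 : ℝ)) := by
          exact mul_le_mul_of_nonneg_right (card_dirichletCharacter_le univ) (by positivity)
      _ = C * (q ^ (1 : ℝ) * (q ^ (1 : ℝ) * q ^ (2 : ℝ)) ^ (1 / 100 : ℝ) * q ^ (2 : ℝ)) := by
          rw [Real.rpow_one]
          ring
      _ = _ := by
          rw [← Real.rpow_add hq0, ← Real.rpow_mul hq0.le, ← Real.rpow_add hq0,
            ← Real.rpow_add hq0]
          norm_num
  have hxh : x ^ (1 / 2 : ℝ) ≤ x * q ^ (-3.09 : ℝ) := by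
    rw [show (1 / 2 : ℝ) = 1 + -(1 / 2) by norm_num, Real.rpow_add hx0, Real.rpow_one]
    refine mul_le_mul_of_nonneg_left
      ((Real.rpow_le_rpow_of_nonpos (by positivity) hx (by norm_num)).trans_eq ?_) hx0.le
    rw [← Real.rpow_mul hq0.le]
    norm_num
  have hlog : Real.log q ≤ 100 * q ^ (1 / 100 : ℝ) := by
    refine (Real.log_le_rpow_div hq0.le (by norm_num : (0 : ℝ) < 1 / 100)).trans_eq ?_
    ring
  calc _ ≤ ∑ p ∈ P, (zeroMult p.1.LFunction p.2 : ℝ) *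
        (x * q ^ (-3.09 : ℝ) / (c / (100 * q ^ (1 / 100 : ℝ)))) := by
        refine sum_le_sum fun p hp ↦ mul_le_mul_of_nonneg_left ?_ (by positivity)
        obtain ⟨-, h2, -, h4⟩ := hP p hp
        rw [norm_div, Complex.norm_cpow_eq_rpow_re_of_pos hx0]
        refine div_le_div₀ (by positivity)
          ((Real.rpow_le_rpow_of_exponent_le hx1 h2.le).trans hxh) (by positivity) (le_trans ?_ h4)
        gcongr
    _ ≤ C * q ^ (3.03 : ℝ) * (x * q ^ (-3.09 : ℝ) / (c / (100 * q ^ (1 / 100 : ℝ)))) := by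
        rw [← sum_mul]
        gcongr
    _ = C * 100 * (q ^ (3.03 : ℝ) * q ^ (-3.09 : ℝ) * q ^ (1 / 100 : ℝ)) / c * x := by
        field_simp
    _ = _ := by
        rw [← Real.rpow_add hq0, ← Real.rpow_add hq0]
        norm_num

end

section
open Finset Filter

theorem sum_finsum_mem_le {α β : Type*} [Fintype α] (S : α → Set β) (f : α → β → ℝ) (B : ℝ)
    (H : ∀ P : Finset (α × β), (∀ p ∈ P, p.2 ∈ S p.1) → ∑ p ∈ P, f p.1 p.2 ≤ B) :
    ∑ χ, ∑ᶠ ρ ∈ S χ, f χ ρ ≤ B := by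
  have h : ∀ χ, ∃ Z : Finset β, (∀ ρ ∈ Z, ρ ∈ S χ) ∧ ∑ᶠ ρ ∈ S χ, f χ ρ = ∑ ρ ∈ Z, f χ ρ := by
    intro χ
    by_cases hf : (S χ ∩ Function.support (f χ)).Finite
    · exact ⟨hf.toFinset, fun ρ hρ ↦ (hf.mem_toFinset.1 hρ).1,
        finsum_mem_eq_sum _ hf⟩
    · exact ⟨∅, by simp, by rw [finsum_mem_eq_zero_of_infinite hf, sum_empty]⟩
  choose Z hZ hZs using h
  have := H ((univ.sigma Z).map (Equiv.sigmaEquivProd α β).toEmbedding) fun p hp ↦ by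
    obtain ⟨a, ha, rfl⟩ := mem_map.1 hp
    exact hZ _ _ (mem_sigma.1 ha).2
  rw [sum_map, sum_sigma] at this
  simpa [hZs] using this

end

end SiegelSum

open SiegelSum Finset Filter in
/-- **Sum over zeros in the Siegel-zero case**: there is `η > 0` such that for all sufficiently
large `q`, if some `L(s,χ₁)` mod `q` has a real zero `ρ₁ = 1 - λ₁/log q` with `0 < λ₁ ≤ η`, and
`x` is real with `q^{6.18} ≤ x` and `log x ≤ q^{1/3000}`, then, with `T = q(log x)³/λ₁`,
`∑_{χ mod q} ∑_ρ |x^ρ/ρ| ≤ 3λ₁x`, the inner sum over nontrivial zeros `ρ` of `L(s,χ)` with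
`0 < Re ρ < 1`, `|Im ρ| < T`, excluding `ρ₁` for the character `χ₁`, with multiplicity. -/
theorem sum_over_zeros_siegel_case :
    ∃ η : ℝ, 0 < η ∧ ∃ q₀ : ℕ, ∀ (q : ℕ) [NeZero q], q₀ ≤ q →
      ∀ χ₁ : DirichletCharacter ℂ q, ∀ lam₁ : ℝ, 0 < lam₁ → lam₁ ≤ η →
        χ₁.LFunction (((1 : ℝ) - lam₁ / Real.log q : ℝ) : ℂ) = 0 →
        ∀ x : ℝ, (q : ℝ) ^ (6.18 : ℝ) ≤ x → Real.log x ≤ (q : ℝ) ^ ((1 : ℝ) / 3000) →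
          (∑ χ : DirichletCharacter ℂ q,
            ∑ᶠ ρ ∈ {ρ : ℂ | χ.LFunction ρ = 0 ∧ 0 < ρ.re ∧ ρ.re < 1 ∧
                |ρ.im| < (q : ℝ) * (Real.log x) ^ 3 / lam₁ ∧
                ¬(χ = χ₁ ∧ ρ = (((1 : ℝ) - lam₁ / Real.log q : ℝ) : ℂ))},
              (zeroMult χ.LFunction ρ : ℝ) * ‖(x : ℂ) ^ ρ / ρ‖)
          ≤ 3 * lam₁ * x := by
  obtain ⟨η, hη, C, hC, q₁, hq₁, H⟩ := siegel_zero_consequences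
  obtain ⟨B₁, hB₁, q₂, hq₂, H₁⟩ := sum_near_le
  obtain ⟨B₂, hB₂, q₃, hq₃, H₂⟩ := sum_mid_le
  obtain ⟨B₃, hB₃, H₃⟩ := sum_low_le
  have hC0 : 0 < C := by linarith
  obtain ⟨q₀, hq₀⟩ := eventually_atTop.1 (tendsto_natCast_atTop_atTop.eventually
    ((eventually_ge_atTop q₁).and ((eventually_ge_atTop q₂).and ((eventually_ge_atTop q₃).and
      ((eventually_ge_atTop 2).and ((tendsto_rpow_atTop
        (by norm_num : (0 : ℝ) < 5 / 100000)).eventually_ge_atTop (max B₂ (20000 * B₃))))))))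
  refine ⟨min η ((B₁ * C ^ (1.01 : ℝ))⁻¹ ^ (100 : ℝ)), by positivity, q₀,
    fun q _ hq χ₁ lam h0 hlam hz x hx hlog ↦ ?_⟩
  obtain ⟨h1, h2, h3, h4, h5⟩ := hq₀ q hq
  obtain ⟨hl, Hz⟩ := H q h1 χ₁ lam h0 (hlam.trans (min_le_left _ _)) hz
  have hq0 : (0 : ℝ) < q := by linarith
  have hq1 : (1 : ℝ) < q := by linarith
  have hL := Real.log_pos hq1
  have hx0 : 0 < x := (by positivity : 0 < (q : ℝ) ^ (6.18 : ℝ)).trans_le hx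
  have hx1 : 1 ≤ x := (Real.one_le_rpow hq1.le (by norm_num)).trans hx
  have hT : (q : ℝ) * Real.log x ^ 3 / lam ≤ (q : ℝ) ^ (2 : ℝ) := by
    calc _ ≤ (q : ℝ) ^ (1 : ℝ) * ((q : ℝ) ^ ((1 : ℝ) / 3000)) ^ 3 / (q : ℝ) ^ (-(1 / 10000) : ℝ) := by
          rw [Real.rpow_one]
          have := Real.log_nonneg hx1
          gcongr
      _ = (q : ℝ) ^ (1 + 1 / 3000 * 3 - -(1 / 10000) : ℝ) := by
          rw [← Real.rpow_mul_natCast hq0.le, ← Real.rpow_add hq0, ← Real.rpow_sub hq0]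
          norm_num
      _ ≤ _ := Real.rpow_le_rpow_of_exponent_le hq1.le (by norm_num)
  refine sum_finsum_mem_le _ (fun (χ : DirichletCharacter ℂ q) ρ ↦
    (zeroMult χ.LFunction ρ : ℝ) * ‖(x : ℂ) ^ ρ / ρ‖) _
    fun P hP ↦ ?_
  rw [← sum_filter_not_add_sum_filter P (·.2.re < 1 / 2),
    ← sum_filter_not_add_sum_filter (P.filter fun p ↦ ¬p.2.re < 1 / 2) (·.2.re ≤ 1 - 1 / 500)]
  have e1 : B₁ * (C * lam) ^ (1.01 : ℝ) * x ≤ lam * x := by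
    have h6 : lam ^ (0.01 : ℝ) ≤ (B₁ * C ^ (1.01 : ℝ))⁻¹ := by
      have := Real.rpow_le_rpow h0.le (hlam.trans (min_le_right _ _))
        (by norm_num : (0 : ℝ) ≤ 0.01)
      rw [← Real.rpow_mul (by positivity)] at this
      norm_num at this ⊢
      exact this
    rw [Real.mul_rpow hC0.le h0.le, show (1.01 : ℝ) = 0.01 + 1 by norm_num, Real.rpow_add h0,
      Real.rpow_one, ← show (1.01 : ℝ) = 0.01 + 1 by norm_num]
    gcongr
    calc _ = B₁ * C ^ (1.01 : ℝ) * lam ^ (0.01 : ℝ) * lam := by ring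
      _ ≤ B₁ * C ^ (1.01 : ℝ) * (B₁ * C ^ (1.01 : ℝ))⁻¹ * lam := by gcongr
      _ = lam := by rw [mul_inv_cancel₀ (by positivity), one_mul]
  have e2 : B₂ * q ^ (-(15 / 100000) : ℝ) * x ≤ lam * x := by
    refine mul_le_mul_of_nonneg_right (le_trans ?_ hl) hx0.le
    calc _ ≤ (q : ℝ) ^ (5 / 100000 : ℝ) * q ^ (-(15 / 100000) : ℝ) := by
          gcongr
          exact (le_max_left _ _).trans h5
      _ = _ := by
          rw [← Real.rpow_add hq0]
          norm_num
  have e3 : B₃ * q ^ (-(5 / 100) : ℝ) / ((q : ℝ) ^ (-(1 / 10000) : ℝ) / 20000) * x ≤ lam * x := by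
    refine mul_le_mul_of_nonneg_right (le_trans ?_ hl) hx0.le
    calc _ = 20000 * B₃ * (q ^ (-(5 / 100) : ℝ) / (q : ℝ) ^ (-(1 / 10000) : ℝ)) := by
          field_simp
      _ ≤ (q : ℝ) ^ (5 / 100000 : ℝ) * (q ^ (-(5 / 100) : ℝ) / (q : ℝ) ^ (-(1 / 10000) : ℝ)) := by
          gcongr
          exact (le_max_right _ _).trans h5
      _ = (q : ℝ) ^ (5 / 100000 + (-(5 / 100) - -(1 / 10000)) : ℝ) := by
          rw [← Real.rpow_sub hq0, ← Real.rpow_add hq0]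
      _ ≤ _ := Real.rpow_le_rpow_of_exponent_le hq1.le (by norm_num)
  have hc1 : (q : ℝ) ^ (-(1 / 10000) : ℝ) / 20000 ≤ 1 / 20000 := by
    gcongr
    exact Real.rpow_le_one_of_one_le_of_nonpos hq1.le (by norm_num)
  have hc2 : (q : ℝ) ^ (-(1 / 10000) : ℝ) / 20000 ≤ lam :=
    (div_le_self (by positivity) (by norm_num)).trans hl
  have b1 := H₁ q h2 x (C * lam) hx (by positivity)
    {p ∈ {p ∈ P | ¬p.2.re < 1 / 2} | ¬p.2.re ≤ 1 - 1 / 500} fun p hp ↦ by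
      obtain ⟨hp, hp2⟩ := mem_filter.1 hp
      obtain ⟨hp1, hp3, hp4, hp5, hp6⟩ := hP p (mem_filter.1 hp).1
      exact ⟨(not_le.1 hp2).le, hp4, (Hz p.1 p.2 hp1 hp3 hp4 hp6).2 (not_le.1 hp2).le
        (hp5.le.trans hT)⟩
  have b2 := H₂ q h3 x hx {p ∈ {p ∈ P | ¬p.2.re < 1 / 2} | p.2.re ≤ 1 - 1 / 500} fun p hp ↦ by
    obtain ⟨hp, hp2⟩ := mem_filter.1 hp
    obtain ⟨hp, hp3⟩ := mem_filter.1 hp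
    exact ⟨not_lt.1 hp3, hp2, (hP p hp).2.2.2.1.le.trans hT⟩
  have b3 := H₃ q (by exact_mod_cast h4) x ((q : ℝ) ^ (-(1 / 10000) : ℝ) / 20000) hx (by positivity)
    {p ∈ P | p.2.re < 1 / 2} fun p hp ↦ by
      obtain ⟨hp, hp2⟩ := mem_filter.1 hp
      obtain ⟨hp1, hp3, hp4, hp5, hp6⟩ := hP p hp
      refine ⟨hp3, hp2, hp5.le.trans hT, ?_⟩
      rw [← norm_neg, ← sub_sub_cancel_left 1 p.2]
      by_cases he : p.1⁻¹ = χ₁ ∧ 1 - p.2 = ((1 - lam / Real.log q : ℝ) : ℂ)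
      · rw [he.2, ← Complex.ofReal_one, ← Complex.ofReal_sub, Complex.norm_real, Real.norm_eq_abs,
          sub_sub_cancel_left, abs_neg]
        exact (div_le_div_of_nonneg_right hc2 hL.le).trans (le_abs_self _)
      · exact (div_le_div_of_nonneg_right hc1 hL.le).trans (Hz p.1⁻¹ (1 - p.2)
          ((LFunction_one_sub p.1 hp3 hp4).2 hp1) (by simpa using hp4) (by simpa using hp3) he).1
  linarith
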